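/- There are infinitely many natural numbers m whose decimal expansion contains only the digits 0 and 2, such that p_{n+1} − p_n = m for infinitely many n. -/

import Mathlib

/-- `m` is a de Polignac number if `p_{n+1} - p_n = m` for infinitely many `n`. -/
def DePolignac (m : ℕ) : Prop :=
  {n : ℕ | Nat.nth Nat.Prime (n + 1) - Nat.nth Nat.Prime n = m}.Infinite

namespace PG

open Finset

noncomputable def TV {E : Type*} [NormedAddCommGroup E] (g : ℕ → E) : ℝ := ∑' n, ‖g (n+1) - g n‖

section
variable {E : Type*} [NormedAddCommGroup E] [CompleteSpace E]

lemma summable_tv {g : ℕ → E} (hg : Summable fun n => ‖g n‖) :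
    Summable fun n => ‖g (n+1) - g n‖ := by
  refine Summable.of_nonneg_of_le (fun _ => norm_nonneg _) (fun n => norm_sub_le _ _) ?_
  exact ((summable_nat_add_iff 1).2 hg).add hg

lemma tv_nonneg (g : ℕ → E) : 0 ≤ TV g := tsum_nonneg fun _ => norm_nonneg _

lemma norm_sub_le_block (g : ℕ → E) (s q a b : ℕ) (ha : a < q) (hb : b < q) :
    ‖g (s + a) - g (s + b)‖ ≤ ∑ i ∈ range q, ‖g (s + i + 1) - g (s + i)‖ := by
  wlog hab : b ≤ a generalizing a b
  · rw [norm_sub_rev]; exact this b a hb ha (by omega)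
  have h1 : g (s + a) - g (s + b) = ∑ i ∈ Ico b a, (g (s + i + 1) - g (s + i)) := by
    have := Finset.sum_Ico_sub (fun i => g (s + i)) hab
    simpa [add_assoc] using this.symm
  rw [h1]
  refine (norm_sum_le _ _).trans ?_
  refine Finset.sum_le_sum_of_subset_of_nonneg ?_ (fun _ _ _ => norm_nonneg _)
  intro i hi
  simp only [mem_Ico, mem_range] at hi ⊢
  omega

lemma summable_residue {F : ℕ → ℝ} (hF : Summable F) (q : ℕ) [NeZero q] (a : ℕ) :
    Summable fun m : ℕ => F (a + q * m) := by
  have : Function.Injective fun m : ℕ => a + q * m := by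
    intro m n h
    simpa [NeZero.ne q] using h
  exact hF.comp_injective this

lemma tsum_block {F : ℕ → ℝ} (hF : Summable F) (q : ℕ) [NeZero q] :
    ∑' m : ℕ, ∑ i ∈ range q, F (q * m + i) = ∑' n, F n := by
  rw [Nat.sumByResidueClasses hF q]
  rw [Summable.tsum_finsetSum]
  · obtain ⟨q', rfl⟩ : ∃ q', q = q' + 1 := ⟨q - 1, by have := NeZero.pos q; omega⟩
    rw [Finset.sum_range]
    refine Finset.sum_congr rfl fun i _ => ?_
    refine tsum_congr fun m => ?_
    congr 1
    rw [add_comm]; rfl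
  · intro i _
    have := summable_residue hF q i
    simpa [add_comm] using this

lemma residue_diff_le {g : ℕ → E} (hg : Summable fun n => ‖g n‖) (q : ℕ) [NeZero q] (a b : ℕ)
    (ha : a < q) (hb : b < q) :
    ‖∑' m : ℕ, g (a + q * m) - ∑' m : ℕ, g (b + q * m)‖ ≤ TV g := by
  have hs : ∀ a : ℕ, Summable fun m : ℕ => g (a + q * m) := fun a =>
    (summable_residue hg q a).of_norm
  rw [← Summable.tsum_sub (hs a) (hs b)]
  have htv := summable_tv hg
  have hbl : Summable fun m : ℕ => ∑ i ∈ range q, ‖g (q * m + i + 1) - g (q * m + i)‖ := by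
    refine summable_sum fun i _ => ?_
    have := summable_residue htv q i
    simpa [add_comm, add_left_comm, add_assoc] using this
  have hle : ∀ m : ℕ, ‖g (a + q * m) - g (b + q * m)‖ ≤
      ∑ i ∈ range q, ‖g (q * m + i + 1) - g (q * m + i)‖ := fun m => by
    rw [add_comm a, add_comm b]; exact norm_sub_le_block g _ q a b ha hb
  calc _ ≤ ∑' m : ℕ, ‖g (a + q * m) - g (b + q * m)‖ :=
        norm_tsum_le_tsum_norm (Summable.of_nonneg_of_le (fun _ => norm_nonneg _) hle hbl)
    _ ≤ ∑' m : ℕ, ∑ i ∈ range q, ‖g (q * m + i + 1) - g (q * m + i)‖ :=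
        Summable.tsum_le_tsum hle (Summable.of_nonneg_of_le (fun _ => norm_nonneg _) hle hbl) hbl
    _ = TV g := tsum_block htv q
end

/-- Equidistribution in residue classes. -/
lemma ap_real {g : ℕ → ℝ} (hg : Summable fun n => ‖g n‖) (q : ℕ) [NeZero q] (a : ℕ) (ha : a < q) :
    |∑' m : ℕ, g (a + q * m) - (∑' n, g n) / q| ≤ TV g := by
  have hq : (0:ℝ) < q := by exact_mod_cast NeZero.pos q
  rw [Nat.sumByResidueClasses hg.of_norm q]
  have h : ∑' m : ℕ, g (a + q * m) - (∑ j : ZMod q, ∑' m : ℕ, g (j.val + q * m)) / q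
      = (∑ j : ZMod q, (∑' m : ℕ, g (a + q * m) - ∑' m : ℕ, g (j.val + q * m))) / q := by
    rw [Finset.sum_sub_distrib]
    simp only [sum_const, card_univ, ZMod.card, nsmul_eq_mul]
    field_simp
  rw [h, abs_div, abs_of_pos hq, div_le_iff₀ hq]
  refine (Finset.abs_sum_le_sum_abs _ _).trans ?_
  calc _ ≤ ∑ j : ZMod q, TV g := Finset.sum_le_sum fun j _ => by
        have := residue_diff_le hg q a j.val ha (ZMod.val_lt j)
        rwa [Real.norm_eq_abs] at this
    _ = _ := by simp [ZMod.card, mul_comm]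

/-- Sum of a periodic mean zero function against `g`. -/
lemma periodic_sum_le {g : ℕ → ℂ} (hg : Summable fun n => ‖g n‖) (q : ℕ) [NeZero q]
    (f : ZMod q → ℂ) (hf : ∑ a, f a = 0) (hf1 : ∀ a, ‖f a‖ ≤ 1) :
    ‖∑' n : ℕ, f n * g n‖ ≤ q * TV g := by
  have hs : Summable fun n : ℕ => f n * g n := by
    refine Summable.of_norm (Summable.of_nonneg_of_le (fun _ => norm_nonneg _) (fun n => ?_) hg)
    rw [norm_mul]; exact mul_le_of_le_one_left (norm_nonneg _) (hf1 _)
  rw [Nat.sumByResidueClasses hs q]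
  have h1 : ∀ j : ZMod q, ∑' m : ℕ, f ((j.val + q * m : ℕ) : ZMod q) * g (j.val + q * m)
      = f j * ∑' m : ℕ, g (j.val + q * m) := by
    intro j
    rw [← tsum_mul_left]
    refine tsum_congr fun m => ?_
    simp
  have h2 : ∑ j : ZMod q, ∑' m : ℕ, f ((j.val + q * m : ℕ) : ZMod q) * g (j.val + q * m)
      = ∑ j : ZMod q, f j * (∑' m : ℕ, g (j.val + q * m) - ∑' m : ℕ, g (0 + q * m)) := by
    rw [Finset.sum_congr rfl fun j _ => h1 j]
    simp only [mul_sub, Finset.sum_sub_distrib, ← Finset.sum_mul, hf]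
    simp
  rw [h2]
  refine (norm_sum_le _ _).trans ?_
  calc _ ≤ ∑ j : ZMod q, TV g := Finset.sum_le_sum fun j _ => by
        rw [norm_mul]
        refine (mul_le_of_le_one_left (norm_nonneg _) (hf1 _)).trans ?_
        exact residue_diff_le hg q j.val 0 (ZMod.val_lt j) (NeZero.pos q)
    _ = _ := by simp [ZMod.card]

lemma char_sum_le {g : ℕ → ℂ} (hg : Summable fun n => ‖g n‖) (q : ℕ) [NeZero q]
    (χ : DirichletCharacter ℂ q) (hχ : χ ≠ 1) :
    ‖∑' n : ℕ, χ n * g n‖ ≤ q * TV g :=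
  periodic_sum_le hg q χ (MulChar.sum_eq_zero_of_ne_one hχ) (fun a => χ.norm_le_one a)

end PG

namespace PG

open Finset Real

noncomputable def om (y v : ℝ) : ℝ := v ^ (-(1 + 1 / y)) * exp (-(log v - y) ^ 2 / 2)

lemma om_zero {y : ℝ} (hy : 1 ≤ y) : om y 0 = 0 := by
  have : -(1 + 1 / y) ≠ 0 := by have : 0 < 1 / y := by positivity
                                linarith
  simp only [om, Real.zero_rpow this, zero_mul]

lemma om_nonneg {y v : ℝ} (hv : 0 ≤ v) : 0 ≤ om y v := by unfold om; positivity

lemma rpow_neg_c_le {y v : ℝ} (hy : 1 ≤ y) (hv : 1 ≤ v) : v ^ (-(1 + 1 / y)) ≤ v ^ (-1 : ℝ) := by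
  apply Real.rpow_le_rpow_of_exponent_le hv
  have : 0 < 1 / y := by positivity
  linarith

lemma om_le_gen {y v : ℝ} (hy : 1 ≤ y) (hv : 1 ≤ v) (a : ℝ) :
    om y v ≤ exp (a ^ 2 / 2) * (v ^ (a - 1) * exp (-(a * y))) := by
  have hv0 : 0 < v := by linarith
  unfold om
  calc _ ≤ v ^ (-1 : ℝ) * exp (a ^ 2 / 2 + a * (log v - y)) := by
        gcongr
        · have : 0 < 1 / y := by positivity
          linarith
        · nlinarith [sq_nonneg (log v - y + a)]
    _ = _ := by
        rw [show v ^ (a - 1) = v ^ (-1 : ℝ) * exp (a * log v) by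
          rw [show a - 1 = -1 + a by ring, Real.rpow_add hv0, Real.rpow_def_of_pos hv0 a, mul_comm a]]
        rw [show a ^ 2 / 2 + a * (log v - y) = a ^ 2 / 2 + a * log v + -(a * y) by ring,
          Real.exp_add, Real.exp_add]
        ring

lemma exp_half_le : exp (1 / 2 : ℝ) ≤ 2 := by
  have h := Real.exp_one_lt_d9
  have : exp (1 / 2 : ℝ) ^ 2 = exp 1 := by rw [← Real.exp_nat_mul]; norm_num
  nlinarith [Real.exp_pos (1 / 2 : ℝ)]

lemma om_le {y v : ℝ} (hy : 1 ≤ y) (hv : 1 ≤ v) :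
    om y v ≤ 2 * (v ^ (-(3 / 4) : ℝ) * exp (-(y / 4))) := by
  refine (om_le_gen hy hv (1 / 4)).trans ?_
  have h2 : exp ((1 / 4 : ℝ) ^ 2 / 2) ≤ 2 := le_trans (Real.exp_le_exp.2 (by norm_num)) exp_half_le
  have e1 : (1 / 4 : ℝ) - 1 = -(3 / 4) := by norm_num
  have e2 : -(1 / 4 * y) = -(y / 4) := by ring
  rw [e1, e2]
  gcongr

lemma om_le_small {y v : ℝ} (hy : 1 ≤ y) (hv : 1 ≤ v) : om y v ≤ 2 * exp (-y) := by
  refine (om_le_gen hy hv 1).trans ?_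
  have h2 : exp ((1 : ℝ) ^ 2 / 2) ≤ 2 := le_trans (Real.exp_le_exp.2 (by norm_num)) exp_half_le
  simp only [sub_self, Real.rpow_zero, one_mul]
  gcongr

lemma om_le_tail {y v : ℝ} (hy : 1 ≤ y) (hv : 1 ≤ v) :
    om y v ≤ 2 * (v ^ (-2 : ℝ) * exp y) := by
  refine (om_le_gen hy hv (-1)).trans ?_
  have h2 : exp ((-1 : ℝ) ^ 2 / 2) ≤ 2 := le_trans (Real.exp_le_exp.2 (by norm_num)) exp_half_le
  have e1 : (-1 : ℝ) - 1 = -2 := by norm_num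
  rw [e1]
  simp only [neg_mul, one_mul, neg_neg]
  gcongr

noncomputable def omD (y v : ℝ) : ℝ :=
  -(1 + 1 / y + (log v - y)) * (om y v / v)

lemma om_hasDerivAt {y v : ℝ} (hv : 0 < v) : HasDerivAt (om y) (omD y v) v := by
  have h1 : HasDerivAt (fun v : ℝ => v ^ (-(1 + 1 / y))) (-(1 + 1 / y) * v ^ (-(1 + 1 / y) - 1)) v :=
    Real.hasDerivAt_rpow_const (Or.inl hv.ne')
  have h2 : HasDerivAt (fun v : ℝ => exp (-(log v - y) ^ 2 / 2))
      (exp (-(log v - y) ^ 2 / 2) * (-(log v - y) * v⁻¹)) v := by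
    have h3 : HasDerivAt (fun v : ℝ => -(log v - y) ^ 2 / 2) (-(log v - y) * v⁻¹) v := by
      have := ((((Real.hasDerivAt_log hv.ne').sub_const y).pow 2).neg).div_const 2
      refine this.congr_deriv ?_
      simp only [Nat.cast_ofNat]
      norm_num
      ring
    exact h3.exp
  have h := h1.mul h2
  refine h.congr_deriv ?_
  unfold omD om
  rw [Real.rpow_sub_one hv.ne']
  field_simp
  ring

lemma omD_le {y v : ℝ} (hy : 1 ≤ y) (hv : 1 ≤ v) :
    |omD y v| ≤ 4 * (v ^ (-(7 / 4) : ℝ) * exp (-(y / 4))) := by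
  have hv0 : 0 < v := by linarith
  unfold omD om
  set u := log v - y with hu
  have hc : |-(1 + 1 / y + u)| ≤ 2 + |u| := by
    rw [abs_neg]
    have h1 : 1 / y ≤ 1 := by rw [div_le_one (by linarith)]; exact hy
    have h0 : 0 < 1 / y := by positivity
    calc _ ≤ |1 + 1 / y| + |u| := abs_add_le _ _
      _ ≤ _ := by rw [abs_of_pos (by linarith)]; linarith
  have h3 : 2 + |u| ≤ 3 * exp (u ^ 2 / 4) := by
    have h4 := Real.add_one_le_exp (u ^ 2 / 4)
    have h5 : |u| ≤ 1 + u ^ 2 / 4 := by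
      rw [← sq_abs u]; nlinarith [sq_nonneg (|u| / 2 - 1)]
    nlinarith [sq_nonneg u]
  have h6 : exp (1 / 16 : ℝ) ≤ 4 / 3 := by
    have h := Real.exp_one_lt_d9
    have h7 : exp (1 / 16 : ℝ) ^ 16 = exp 1 := by rw [← Real.exp_nat_mul]; norm_num
    by_contra! hcon
    have h8 : (4 / 3 : ℝ) ^ 16 < exp (1 / 16 : ℝ) ^ 16 := by gcongr
    rw [h7] at h8
    norm_num at h8
    have : (3:ℝ) < (4/3)^16 := by norm_num
    norm_num at this
    linarith
  rw [abs_mul, abs_div, abs_mul, Real.abs_exp, abs_of_pos hv0,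
    abs_of_nonneg (Real.rpow_nonneg hv0.le _)]
  calc _ ≤ (3 * exp (u ^ 2 / 4)) * (v ^ (-1 : ℝ) * exp (-u ^ 2 / 2) / v) := by
        gcongr
        · exact hc.trans h3
        · have : 0 < 1 / y := by positivity
          linarith
    _ = 3 * (v ^ (-1 : ℝ) / v) * exp (- u ^ 2 / 4) := by
        rw [show -u ^ 2 / 4 = u ^ 2 / 4 + -u ^ 2 / 2 by ring, Real.exp_add]; ring
    _ ≤ 3 * (v ^ (-1 : ℝ) / v) * (exp (1 / 16) * exp (u / 4)) := by
        rw [← Real.exp_add]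
        gcongr
        nlinarith [sq_nonneg (u / 2 + 1 / 4)]
    _ ≤ 3 * (v ^ (-1 : ℝ) / v) * (4 / 3 * exp (u / 4)) := by gcongr
    _ = _ := by
        have e1 : exp (u / 4) = v ^ (1 / 4 : ℝ) * exp (-(y / 4)) := by
          rw [Real.rpow_def_of_pos hv0, ← Real.exp_add, hu]; congr 1; ring
        have e2 : v ^ (-1 : ℝ) / v = v ^ (-2 : ℝ) := by
          rw [← Real.rpow_sub_one hv0.ne']; norm_num
        rw [e1, e2, show (-(7 / 4) : ℝ) = -2 + 1 / 4 by norm_num, Real.rpow_add hv0]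
        ring

lemma om_sub_le {y v h : ℝ} (hy : 1 ≤ y) (hv : 1 ≤ v) (hh : 0 ≤ h) :
    |om y (v + h) - om y v| ≤ 4 * (v ^ (-(7 / 4) : ℝ) * exp (-(y / 4))) * h := by
  have := (convex_Icc v (v + h)).norm_image_sub_le_of_norm_hasDerivWithin_le (f := om y)
    (f' := omD y) (C := 4 * (v ^ (-(7 / 4) : ℝ) * exp (-(y / 4)))) (x := v) (y := v + h)
    (fun t ht => (om_hasDerivAt (by linarith [ht.1])).hasDerivWithinAt) ?_ (by simp [hh]) (by simp [hh])
  · simpa [abs_of_nonneg hh] using this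
  · intro t ht
    refine (omD_le hy (hv.trans ht.1)).trans ?_
    have : t ^ (-(7 / 4) : ℝ) ≤ v ^ (-(7 / 4) : ℝ) := Real.rpow_le_rpow_of_nonpos (by linarith) ht.1 (by norm_num)
    have h0 := Real.exp_pos (-(y/4))
    nlinarith

lemma om_mul_sub_le {y : ℝ} (hy : 1 ≤ y) (d m : ℕ) (hd : 1 ≤ d) (hm : 1 ≤ m) :
    |om y (d * (m + 1 : ℕ)) - om y (d * m)| ≤ 4 * ((m:ℝ) ^ (-(7 / 4) : ℝ) * exp (-(y / 4))) := by
  have hd' : (1:ℝ) ≤ d := by exact_mod_cast hd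
  have hm' : (1:ℝ) ≤ m := by exact_mod_cast hm
  have h1 : (1:ℝ) ≤ d * m := by nlinarith
  have := om_sub_le hy h1 (h := d) (by linarith)
  rw [show (d:ℝ) * (m + 1 : ℕ) = d * m + d by push_cast; ring]
  refine this.trans ?_
  rw [Real.mul_rpow (by linarith) (by linarith)]
  have h2 : (d:ℝ) ^ (-(7 / 4) : ℝ) * d ≤ 1 := by
    rw [← Real.rpow_add_one (by linarith)]
    exact Real.rpow_le_one_of_one_le_of_nonpos hd' (by norm_num)
  have h3 : 0 ≤ (m:ℝ) ^ (-(7 / 4) : ℝ) * exp (-(y / 4)) := by positivity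
  calc _ = 4 * ((m:ℝ) ^ (-(7 / 4) : ℝ) * exp (-(y / 4))) * ((d:ℝ) ^ (-(7 / 4) : ℝ) * d) := by ring
    _ ≤ 4 * ((m:ℝ) ^ (-(7 / 4) : ℝ) * exp (-(y / 4))) * 1 := by gcongr
    _ = _ := by ring

lemma summable_rpow_neg {a : ℝ} (ha : a < -1) : Summable fun n : ℕ => ((n : ℝ)) ^ a :=
  Real.summable_nat_rpow.2 ha

lemma om_mul_le_tail {y : ℝ} (hy : 1 ≤ y) (d m : ℕ) (hd : 1 ≤ d) (hm : 1 ≤ m) :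
    om y (d * m) ≤ 2 * ((m:ℝ) ^ (-2 : ℝ) * exp y) := by
  have hd' : (1:ℝ) ≤ d := by exact_mod_cast hd
  have hm' : (1:ℝ) ≤ m := by exact_mod_cast hm
  refine (om_le_tail hy (by nlinarith)).trans ?_
  have : ((d:ℝ) * m) ^ (-2 : ℝ) ≤ (m:ℝ) ^ (-2 : ℝ) :=
    Real.rpow_le_rpow_of_nonpos (by linarith) (by nlinarith) (by norm_num)
  gcongr

lemma summable_om_mul {y : ℝ} (hy : 1 ≤ y) (d : ℕ) (hd : 1 ≤ d) :
    Summable fun m : ℕ => om y (d * m) := by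
  have := ((summable_rpow_neg (a := -2) (by norm_num)).mul_right (exp y)).mul_left 2
  refine Summable.of_nonneg_of_le (fun m => om_nonneg (by positivity)) (fun m => ?_) this
  rcases Nat.eq_zero_or_pos m with rfl | hm
  · simp [om_zero hy]
  · exact om_mul_le_tail hy d m hd hm

lemma summable_om {y : ℝ} (hy : 1 ≤ y) : Summable fun m : ℕ => om y m := by
  simpa using summable_om_mul hy 1 le_rfl

lemma log_le_sqrt (m : ℕ) (hm : 1 ≤ m) : log m ≤ 2 * (m : ℝ) ^ (1 / 2 : ℝ) := by
  have := Real.log_le_rpow_div (x := (m:ℝ)) (ε := 1 / 2) (by positivity) (by norm_num)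
  linarith

lemma summable_log_om_mul {y : ℝ} (hy : 1 ≤ y) (d : ℕ) (hd : 1 ≤ d) :
    Summable fun m : ℕ => log m * om y (d * m) := by
  have := ((summable_rpow_neg (a := -(3 / 2)) (by norm_num)).mul_right (exp y)).mul_left 4
  refine Summable.of_nonneg_of_le
    (fun m => mul_nonneg (Real.log_natCast_nonneg m) (om_nonneg (by positivity))) (fun m => ?_) this
  rcases Nat.eq_zero_or_pos m with rfl | hm
  · simp
  · have hm' : (0:ℝ) < m := by exact_mod_cast hm
    calc _ ≤ (2 * (m : ℝ) ^ (1 / 2 : ℝ)) * (2 * ((m:ℝ) ^ (-2 : ℝ) * exp y)) := by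
          have := om_mul_le_tail hy d m hd hm
          have := om_nonneg (y := y) (v := d * m) (by positivity)
          have := log_le_sqrt m hm
          gcongr
      _ = _ := by
          rw [show (-(3 / 2) : ℝ) = 1 / 2 + -2 by norm_num, Real.rpow_add hm']; ring

lemma tv_om_mul : ∃ C > 0, ∀ y : ℝ, 1 ≤ y → ∀ d : ℕ, 1 ≤ d →
    TV (fun m : ℕ => om y (d * m)) ≤ C * exp (-(y / 4)) := by
  set S : ℝ := ∑' n : ℕ, (n : ℝ) ^ (-(7 / 4) : ℝ) with hS
  have hsum := summable_rpow_neg (a := -(7 / 4)) (by norm_num)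
  have hS0 : 0 ≤ S := tsum_nonneg fun _ => by positivity
  refine ⟨2 + 4 * S, by positivity, fun y hy d hd => ?_⟩
  have hd' : (1:ℝ) ≤ d := by exact_mod_cast hd
  unfold TV
  have hb : ∀ m : ℕ, ‖om y (d * (m + 1 : ℕ)) - om y (d * m)‖ ≤
      (if m = 0 then 2 * exp (-(y / 4)) else 0) + 4 * ((m:ℝ) ^ (-(7 / 4) : ℝ) * exp (-(y / 4))) := by
    intro m
    rcases Nat.eq_zero_or_pos m with rfl | hm
    · simp only [Nat.cast_zero, mul_zero, om_zero hy, sub_zero, if_true, zero_add, Nat.cast_one, mul_one]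
      rw [Real.norm_of_nonneg (om_nonneg (by linarith))]
      have h1 := om_le hy hd'
      have h2 : (d:ℝ) ^ (-(3 / 4) : ℝ) ≤ 1 := Real.rpow_le_one_of_one_le_of_nonpos hd' (by norm_num)
      have h3 := Real.exp_pos (-(y / 4))
      have : 0 ≤ 4 * ((0:ℝ) ^ (-(7 / 4) : ℝ) * exp (-(y / 4))) := by positivity
      nlinarith
    · rw [if_neg (by omega), zero_add]
      exact om_mul_sub_le hy d m hd hm
  have hs1 : Summable fun m : ℕ => (if m = 0 then 2 * exp (-(y / 4)) else 0 : ℝ) :=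
    (hasSum_ite_eq 0 _).summable
  have hs2 : Summable fun m : ℕ => 4 * ((m:ℝ) ^ (-(7 / 4) : ℝ) * exp (-(y / 4))) :=
    (hsum.mul_right _).mul_left 4
  calc _ ≤ ∑' m : ℕ, ((if m = 0 then 2 * exp (-(y / 4)) else 0) +
        4 * ((m:ℝ) ^ (-(7 / 4) : ℝ) * exp (-(y / 4)))) :=
        Summable.tsum_le_tsum hb (Summable.of_nonneg_of_le (fun _ => norm_nonneg _) hb (hs1.add hs2))
          (hs1.add hs2)
    _ = _ := by
        rw [hs1.tsum_add hs2, tsum_ite_eq, tsum_mul_left, tsum_mul_right]; ring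

lemma tv_log_om_mul : ∃ C > 0, ∀ y : ℝ, 1 ≤ y → ∀ d : ℕ, 1 ≤ d →
    TV (fun m : ℕ => log m * om y (d * m)) ≤ C * exp (-(y / 4)) := by
  set S : ℝ := ∑' n : ℕ, (n : ℝ) ^ (-(5 / 4) : ℝ) with hS
  have hsum := summable_rpow_neg (a := -(5 / 4)) (by norm_num)
  have hS0 : 0 ≤ S := tsum_nonneg fun _ => by positivity
  refine ⟨1 + 18 * S, by positivity, fun y hy d hd => ?_⟩
  have hd' : (1:ℝ) ≤ d := by exact_mod_cast hd
  unfold TV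
  have hb : ∀ m : ℕ, ‖log (m + 1 : ℕ) * om y (d * (m + 1 : ℕ)) - log m * om y (d * m)‖ ≤
      18 * ((m:ℝ) ^ (-(5 / 4) : ℝ) * exp (-(y / 4))) := by
    intro m
    rcases Nat.eq_zero_or_pos m with rfl | hm
    · simp
    · have hm' : (1:ℝ) ≤ m := by exact_mod_cast hm
      have hm0 : (0:ℝ) < m := by linarith
      have e : log (m + 1 : ℕ) * om y (d * (m + 1 : ℕ)) - log m * om y (d * m)
        = log (m + 1 : ℕ) * (om y (d * (m + 1 : ℕ)) - om y (d * m))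
          + (log (m + 1 : ℕ) - log m) * om y (d * m) := by ring
      have h1 : log (m + 1 : ℕ) ≤ 4 * (m:ℝ) ^ (1 / 2 : ℝ) := by
        refine (log_le_sqrt (m + 1) (by omega)).trans ?_
        have : ((m + 1 : ℕ) : ℝ) ^ (1 / 2 : ℝ) ≤ (4 * m) ^ (1 / 2 : ℝ) := by
          gcongr
          push_cast; linarith
        rw [Real.mul_rpow (by norm_num) (by linarith)] at this
        have h4 : (4:ℝ) ^ (1 / 2 : ℝ) = 2 := by
          rw [show (4:ℝ) = 2 ^ (2:ℝ) by norm_num, ← Real.rpow_mul (by norm_num)]; norm_num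
        rw [h4] at this
        linarith
      have h2 : log (m + 1 : ℕ) - log m ≤ 1 / m := by
        rw [← Real.log_div (by positivity) (by positivity)]
        refine (Real.log_le_sub_one_of_pos (by positivity)).trans ?_
        push_cast
        field_simp
        linarith
      have h20 : 0 ≤ log (m + 1 : ℕ) - log m := by
        have : log m ≤ log (m + 1 : ℕ) := Real.log_le_log (by positivity) (by push_cast; linarith)
        linarith
      have h3 : om y (d * m) ≤ 2 * ((m:ℝ) ^ (-(3 / 4) : ℝ) * exp (-(y / 4))) := by
        refine (om_le hy (by nlinarith)).trans ?_
        have : ((d:ℝ) * m) ^ (-(3 / 4) : ℝ) ≤ (m:ℝ) ^ (-(3 / 4) : ℝ) :=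
          Real.rpow_le_rpow_of_nonpos (by linarith) (by nlinarith) (by norm_num)
        gcongr
      have h30 := om_nonneg (y := y) (v := d * m) (by positivity)
      have h5 := om_mul_sub_le hy d m hd hm
      rw [e]
      refine (norm_add_le _ _).trans ?_
      rw [norm_mul, norm_mul, Real.norm_of_nonneg (Real.log_natCast_nonneg _), Real.norm_of_nonneg h20,
        Real.norm_of_nonneg h30, Real.norm_eq_abs]
      have e1 : (m:ℝ) ^ (1 / 2 : ℝ) * (m:ℝ) ^ (-(7 / 4) : ℝ) = (m:ℝ) ^ (-(5 / 4) : ℝ) := by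
        rw [← Real.rpow_add hm0]; norm_num
      have e2 : 1 / (m:ℝ) * (m:ℝ) ^ (-(3 / 4) : ℝ) ≤ (m:ℝ) ^ (-(5 / 4) : ℝ) := by
        rw [one_div, ← Real.rpow_neg_one, ← Real.rpow_add hm0]
        exact Real.rpow_le_rpow_of_exponent_le hm' (by norm_num)
      calc _ ≤ (4 * (m:ℝ) ^ (1 / 2 : ℝ)) * (4 * ((m:ℝ) ^ (-(7 / 4) : ℝ) * exp (-(y / 4))))
            + 1 / m * (2 * ((m:ℝ) ^ (-(3 / 4) : ℝ) * exp (-(y / 4)))) := by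
            gcongr
        _ = 16 * ((m:ℝ) ^ (1 / 2 : ℝ) * (m:ℝ) ^ (-(7 / 4) : ℝ)) * exp (-(y / 4))
            + 2 * (1 / (m:ℝ) * (m:ℝ) ^ (-(3 / 4) : ℝ)) * exp (-(y / 4)) := by ring
        _ ≤ 16 * ((m:ℝ) ^ (-(5 / 4) : ℝ)) * exp (-(y / 4))
            + 2 * ((m:ℝ) ^ (-(5 / 4) : ℝ)) * exp (-(y / 4)) := by rw [e1]; gcongr
        _ = _ := by ring
  have hs2 : Summable fun m : ℕ => 18 * ((m:ℝ) ^ (-(5 / 4) : ℝ) * exp (-(y / 4))) :=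
    (hsum.mul_right _).mul_left 18
  calc _ ≤ ∑' m : ℕ, 18 * ((m:ℝ) ^ (-(5 / 4) : ℝ) * exp (-(y / 4))) :=
        Summable.tsum_le_tsum hb (Summable.of_nonneg_of_le (fun _ => norm_nonneg _) hb hs2) hs2
    _ = 18 * S * exp (-(y / 4)) := by
        rw [tsum_mul_left, tsum_mul_right]; ring
    _ ≤ _ := by
        have := Real.exp_pos (-(y / 4))
        nlinarith

end PG

namespace PG

open Finset Real MeasureTheory

noncomputable def cy (y : ℝ) : ℝ := 1 + 1 / y

noncomputable def ga (y t : ℝ) : ℂ := Complex.exp (-(t : ℂ) ^ 2 / 2) * Complex.exp (Complex.I * t * y)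

lemma norm_ga (y t : ℝ) : ‖ga y t‖ = exp (-(1 / 2) * t ^ 2) := by
  unfold ga
  rw [norm_mul, Complex.norm_exp, Complex.norm_exp]
  have h1 : (-(t : ℂ) ^ 2 / 2) = ((-(1 / 2) * t ^ 2 : ℝ) : ℂ) := by push_cast; ring
  have h2 : (Complex.I * t * y) = Complex.I * ((t * y : ℝ) : ℂ) := by push_cast; ring
  rw [h1, h2]
  simp [-Complex.ofReal_mul]

lemma cont_ga (y : ℝ) : Continuous (ga y) := by unfold ga; fun_prop

lemma integrable_norm_ga (y : ℝ) : Integrable (fun t => ‖ga y t‖) := by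
  simp_rw [norm_ga]
  exact integrable_exp_neg_mul_sq (by norm_num)

lemma integral_norm_ga (y : ℝ) : ∫ t, ‖ga y t‖ = √(2 * π) := by
  simp_rw [norm_ga]
  rw [integral_gaussian]; congr 1; ring

lemma om_fourier {y : ℝ} {n : ℕ} (hn : 1 ≤ n) :
    ∫ t : ℝ, ga y t * (n : ℂ) ^ (-((cy y : ℂ) + t * Complex.I)) = √(2 * π) * om y n := by
  have hn0 : (n : ℂ) ≠ 0 := by exact_mod_cast (by omega : n ≠ 0)
  have h := fourierIntegral_gaussian (b := 1 / 2) (by norm_num) ((y - log n : ℝ) : ℂ)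
  have e : ∀ t : ℝ, ga y t * (n : ℂ) ^ (-((cy y : ℂ) + t * Complex.I)) =
      ((n : ℝ) ^ (-(cy y)) : ℝ) * (Complex.exp (Complex.I * ((y - log n : ℝ) : ℂ) * t) *
        Complex.exp (-(1 / 2) * (t:ℂ) ^ 2)) := by
    intro t
    rw [neg_add, Complex.cpow_add _ _ hn0, Complex.ofReal_cpow (by positivity),
      Complex.cpow_def_of_ne_zero hn0 (-(t * Complex.I)), ← Complex.natCast_log]
    unfold ga
    push_cast
    rw [mul_left_comm, ← Complex.exp_add, ← Complex.exp_add, ← Complex.exp_add]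
    congr 2
    ring
  simp_rw [e]
  rw [integral_const_mul, h]
  unfold om cy
  have e2 : ((π:ℂ) / (1 / 2)) ^ (1 / 2 : ℂ) = ((√(2 * π) : ℝ) : ℂ) := by
    rw [Real.sqrt_eq_rpow, Complex.ofReal_cpow (by positivity)]
    push_cast; congr 1; ring
  rw [e2]
  have e3 : Complex.exp (-((y - log n : ℝ) : ℂ) ^ 2 / (4 * (1 / 2))) =
      ((exp (-(log n - y) ^ 2 / 2) : ℝ) : ℂ) := by
    push_cast; congr 1; ring
  rw [e3]
  push_cast
  ring

lemma om_sum_eq {y : ℝ} (hy : 1 ≤ y) {a : ℕ → ℂ} (ha : LSeriesSummable a (cy y)) :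
    HasSum (fun n : ℕ => √(2 * π) * (a n * om y n))
      (∫ t : ℝ, ga y t * LSeries a ((cy y : ℂ) + t * Complex.I)) := by
  set F : ℕ → ℝ → ℂ := fun n t => ga y t * LSeries.term a ((cy y : ℂ) + t * Complex.I) n with hF
  have hre : ∀ t : ℝ, ((cy y : ℂ) + t * Complex.I).re = cy y := by intro t; simp
  have hnorm : ∀ n t, ‖F n t‖ = ‖ga y t‖ * ‖LSeries.term a (cy y) n‖ := by
    intro n t
    simp only [hF]
    rw [norm_mul, LSeries.norm_term_eq, LSeries.norm_term_eq, hre]; simp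
  have hcont : ∀ n, Continuous (F n) := by
    intro n
    refine (cont_ga y).mul ?_
    rcases Nat.eq_zero_or_pos n with rfl | hn
    · simp only [LSeries.term_zero]; exact continuous_const
    · have hn0 : (n : ℂ) ≠ 0 := by exact_mod_cast (by omega : n ≠ 0)
      simp only [LSeries.term_of_ne_zero (by omega : n ≠ 0)]
      refine continuous_const.div ?_ (fun t => by simp [Complex.cpow_eq_zero_iff, hn0])
      refine Continuous.const_cpow (by fun_prop) (Or.inl hn0)
  have h1 : ∀ n, Integrable (F n) := by
    intro n
    refine Integrable.mono' ((integrable_norm_ga y).mul_const ‖LSeries.term a (cy y) n‖)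
      (hcont n).aestronglyMeasurable (ae_of_all _ fun t => (hnorm n t).le)
  have h2 : Summable fun n => ∫ t, ‖F n t‖ := by
    simp_rw [hnorm, integral_mul_const]
    exact ha.norm.mul_left _
  have h := hasSum_integral_of_summable_integral_norm h1 h2
  have e1 : ∀ n, ∫ t, F n t = √(2 * π) * (a n * om y n) := by
    intro n
    rcases Nat.eq_zero_or_pos n with rfl | hn
    · simp [hF, om_zero hy]
    · have : ∀ t, F n t = a n * (ga y t * (n : ℂ) ^ (-((cy y : ℂ) + t * Complex.I))) := by
        intro t
        simp only [hF]
        rw [LSeries.term_of_ne_zero (by omega), Complex.cpow_neg, div_eq_mul_inv]; ring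
      simp_rw [this]
      rw [integral_const_mul, om_fourier hn]; ring
  simp_rw [e1] at h
  have e4 : ∀ t, ∑' n, F n t = ga y t * LSeries a ((cy y : ℂ) + t * Complex.I) := by
    intro t
    simp only [hF, LSeries]
    rw [tsum_mul_left]
  simp_rw [e4] at h
  exact h

lemma summable_mul_om {y : ℝ} (hy : 1 ≤ y) {a : ℕ → ℂ} (ha : LSeriesSummable a (cy y)) :
    Summable (fun n : ℕ => a n * om y n) := by
  have h := (om_sum_eq hy ha).summable
  have h0 : ((√(2 * π) : ℝ) : ℂ) ≠ 0 := by
    have : 0 < √(2 * π) := by positivity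
    exact_mod_cast this.ne'
  exact (summable_mul_left_iff h0).1 h

lemma om_sum_integral {y : ℝ} (hy : 1 ≤ y) {a : ℕ → ℂ} (ha : LSeriesSummable a (cy y)) :
    √(2 * π) * (∑' n : ℕ, a n * om y n) =
      ∫ t : ℝ, ga y t * LSeries a ((cy y : ℂ) + t * Complex.I) := by
  rw [← (om_sum_eq hy ha).tsum_eq, tsum_mul_left]

lemma norm_om_sum_le {y M : ℝ} (hy : 1 ≤ y) {a : ℕ → ℂ} (ha : LSeriesSummable a (cy y))
    (hM : ∀ t : ℝ, ‖LSeries a ((cy y : ℂ) + t * Complex.I)‖ ≤ M) :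
    ‖∑' n : ℕ, a n * om y n‖ ≤ M := by
  have h := om_sum_integral hy ha
  have h0 : 0 < √(2 * π) := by positivity
  have h1 : ‖√(2 * π) * (∑' n : ℕ, a n * om y n)‖ ≤ √(2 * π) * M := by
    rw [h, ← integral_norm_ga y, ← integral_mul_const]
    refine norm_integral_le_of_norm_le ((integrable_norm_ga y).mul_const M) (ae_of_all _ fun t => ?_)
    rw [norm_mul]
    gcongr
    exact hM t
  rw [norm_mul, Complex.norm_real, Real.norm_of_nonneg h0.le] at h1
  exact le_of_mul_le_mul_left h1 h0

lemma sum_norm_om_sum_le {ι : Type*} (s : Finset ι) {y M : ℝ} (hy : 1 ≤ y) {a : ι → ℕ → ℂ}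
    (ha : ∀ i ∈ s, LSeriesSummable (a i) (cy y))
    (hM : ∀ t : ℝ, ∑ i ∈ s, ‖LSeries (a i) ((cy y : ℂ) + t * Complex.I)‖ ≤ M) :
    ∑ i ∈ s, ‖∑' n : ℕ, a i n * om y n‖ ≤ M := by
  have hex : ∀ z : ℂ, ∃ u : ℂ, ‖u‖ ≤ 1 ∧ u * z = ‖z‖ := by
    intro z
    by_cases hz : z = 0
    · exact ⟨0, by simp, by simp [hz]⟩
    · have hz' : (‖z‖ : ℂ) ≠ 0 := by exact_mod_cast norm_ne_zero_iff.2 hz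
      refine ⟨(‖z‖ : ℂ) / z, by simp [norm_ne_zero_iff.2 hz], by field_simp⟩
  choose u hu1 hu2 using hex
  set S : ι → ℂ := fun i => ∑' n : ℕ, a i n * om y n with hS
  set b : ℕ → ℂ := ∑ i ∈ s, u (S i) • a i with hb
  have hre : ∀ t : ℝ, ((cy y : ℂ) + t * Complex.I).re = cy y := by intro t; simp
  have hsb : ∀ z : ℂ, z.re = cy y → ∀ i ∈ s, LSeriesSummable (u (S i) • a i) z := by
    intro z hz i hi
    exact ((LSeriesSummable_iff_of_re_eq_re (by simp [hz])).1 (ha i hi)).smul _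
  have hbs : LSeriesSummable b (cy y) := LSeriesSummable.sum fun i hi => hsb _ (by simp) i hi
  have key := norm_om_sum_le (M := M) hy hbs ?_
  · have : ∑' n : ℕ, b n * om y n = ((∑ i ∈ s, ‖S i‖ : ℝ) : ℂ) := by
      push_cast
      simp_rw [← hu2, hb, Finset.sum_apply, Finset.sum_mul]
      rw [Summable.tsum_finsetSum]
      · refine Finset.sum_congr rfl fun i hi => ?_
        rw [hS, ← tsum_mul_left]
        simp [mul_assoc]
      · intro i hi
        exact summable_mul_om hy (hsb _ (by simp) i hi)
    rw [this, Complex.norm_real, Real.norm_of_nonneg (by positivity)] at key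
    exact key
  · intro t
    refine le_trans ?_ (hM t)
    rw [hb, LSeries_sum (fun i hi => hsb _ (hre t) i hi)]
    refine (norm_sum_le _ _).trans (Finset.sum_le_sum fun i hi => ?_)
    rw [LSeries_smul, norm_mul]
    have := hu1 (S i)
    have := norm_nonneg (LSeries (a i) ((cy y : ℂ) + t * Complex.I))
    nlinarith

end PG

namespace PG

open Finset Real MeasureTheory

lemma rpow_tele {ε : ℝ} (hε : 0 < ε) (n : ℕ) (hn : 1 ≤ n) :
    ((n + 1 : ℕ) : ℝ) ^ (-(1 + ε)) ≤ ((n : ℝ) ^ (-ε) - ((n + 1 : ℕ) : ℝ) ^ (-ε)) / ε := by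
  have hn0 : (0:ℝ) < n := by exact_mod_cast hn
  have hm0 : (0:ℝ) < (n + 1 : ℕ) := by positivity
  set m : ℝ := ((n + 1 : ℕ) : ℝ) with hm
  have hmn : (n:ℝ) = m * (1 - 1 / m) := by
    field_simp; rw [hm]; push_cast; ring
  have hu : 0 < 1 - 1 / m := by
    by_contra hcon
    have : m * (1 - 1 / m) ≤ 0 := by nlinarith
    linarith
  have h1 : 1 + ε / m ≤ (1 - 1 / m) ^ (-ε) := by
    rw [Real.rpow_def_of_pos hu]
    have h2 := Real.log_le_sub_one_of_pos hu
    have h3 := Real.add_one_le_exp (log (1 - 1 / m) * (-ε))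
    have h4 : ε / m = ε * (1 / m) := by ring
    nlinarith
  have h5 : (n:ℝ) ^ (-ε) = m ^ (-ε) * (1 - 1 / m) ^ (-ε) := by
    rw [hmn, Real.mul_rpow hm0.le hu.le]
  rw [h5, le_div_iff₀ hε, neg_add, show (-1 + -ε : ℝ) = -ε - 1 by ring, Real.rpow_sub_one hm0.ne']
  have h6 : 0 < m ^ (-ε) := by positivity
  calc m ^ (-ε) / m * ε = m ^ (-ε) * (1 + ε / m) - m ^ (-ε) := by field_simp; ring
    _ ≤ _ := by gcongr

lemma zeta_le {ε : ℝ} (hε : 0 < ε) : ∑' n : ℕ, (n : ℝ) ^ (-(1 + ε)) ≤ 1 + 1 / ε := by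
  refine Real.tsum_le_of_sum_range_le (fun n => by positivity) (fun N => ?_)
  have key : ∀ N : ℕ, ∑ n ∈ range (N + 2), (n : ℝ) ^ (-(1 + ε)) ≤
      1 + (1 - ((N + 1 : ℕ) : ℝ) ^ (-ε)) / ε := by
    intro N
    induction N with
    | zero =>
      simp [Finset.sum_range_succ]
      rw [Real.zero_rpow (by linarith)]
    | succ N ih =>
      rw [Finset.sum_range_succ]
      have := rpow_tele hε (N + 1) (by omega)
      calc _ ≤ (1 + (1 - ((N + 1 : ℕ) : ℝ) ^ (-ε)) / ε) +
          (((N + 1 : ℕ) : ℝ) ^ (-ε) - ((N + 1 + 1 : ℕ) : ℝ) ^ (-ε)) / ε := by gcongr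
        _ = _ := by ring
  calc _ ≤ ∑ n ∈ range (N + 2), (n : ℝ) ^ (-(1 + ε)) :=
        Finset.sum_le_sum_of_subset_of_nonneg (by intro i; simp; omega) (fun _ _ _ => by positivity)
    _ ≤ _ := key N
    _ ≤ _ := by
      gcongr
      have : 0 ≤ ((N + 1 : ℕ) : ℝ) ^ (-ε) := by positivity
      linarith

lemma sum_om_le {y : ℝ} (hy : 1 ≤ y) : ∑' n : ℕ, om y n ≤ 10 := by
  refine Real.tsum_le_of_sum_range_le (fun n => om_nonneg (by positivity)) (fun N => ?_)
  set x := exp y with hx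
  have hx1 : 1 ≤ x := Real.one_le_exp (by linarith)
  set K := ⌊x⌋₊ with hK
  have hK1 : 1 ≤ K := (Nat.one_le_floor_iff x).2 hx1
  have hKx : (K:ℝ) ≤ x := Nat.floor_le (by linarith)
  have hxK : x < K + 1 := Nat.lt_floor_add_one x
  have hK1' : (1:ℝ) ≤ K := by exact_mod_cast hK1
  calc ∑ n ∈ range N, om y n ≤ ∑ n ∈ range (K + 1) ∪ Ioc K (max (K + 1) N), om y n := by
        refine Finset.sum_le_sum_of_subset_of_nonneg ?_ (fun _ _ _ => om_nonneg (by positivity))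
        intro i; simp; omega
    _ ≤ ∑ n ∈ range (K + 1), om y n + ∑ n ∈ Ioc K (max (K + 1) N), om y n := by
        rw [← Finset.sum_union_inter]
        have : 0 ≤ ∑ n ∈ range (K + 1) ∩ Ioc K (max (K + 1) N), om y n :=
          Finset.sum_nonneg fun _ _ => om_nonneg (by positivity)
        linarith
    _ ≤ ∑ n ∈ range (K + 1), 2 * exp (-y) + ∑ n ∈ Ioc K (max (K + 1) N), 2 * exp y * ((n:ℝ) ^ 2)⁻¹ := by
        gcongr with n hn n hn
        · rcases Nat.eq_zero_or_pos n with rfl | h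
          · simp [om_zero hy]; positivity
          · exact om_le_small hy (by exact_mod_cast h)
        · have h1 : 1 ≤ n := by simp at hn; omega
          refine (om_le_tail hy (by exact_mod_cast h1)).trans ?_
          rw [Real.rpow_neg (by positivity)]
          norm_num
          apply le_of_eq; ring
    _ ≤ 4 + 2 * exp y * (1 / K) := by
        gcongr
        · simp only [sum_const, card_range, nsmul_eq_mul]
          rw [Real.exp_neg, ← hx]
          push_cast
          rw [← mul_assoc, ← div_eq_mul_inv, div_le_iff₀ (by linarith)]
          nlinarith
        · rw [← Finset.mul_sum]
          gcongr
          refine (sum_Ioc_inv_sq_le_sub (α := ℝ) (k := K) (n := max (K + 1) N) (by omega) (by simp)).trans ?_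
          rw [one_div]
          have : (0:ℝ) ≤ ((max (K + 1) N : ℕ) : ℝ)⁻¹ := by positivity
          linarith
    _ ≤ 10 := by
        rw [← hx, mul_one_div]
        have : 2 * x / K ≤ 4 := by
          rw [div_le_iff₀ (by linarith)]; linarith
        linarith

/-- primes above `X`, weighted by log -/
noncomputable def lamP (X : ℝ) (n : ℕ) : ℝ := if n.Prime ∧ X < n then log n else 0

lemma lamP_nonneg (X : ℝ) (n : ℕ) : 0 ≤ lamP X n := by
  unfold lamP; split_ifs
  · exact Real.log_natCast_nonneg n
  · exact le_rfl

lemma lamP_le_log (X : ℝ) (n : ℕ) : lamP X n ≤ log n := by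
  unfold lamP; split_ifs
  · exact le_rfl
  · exact Real.log_natCast_nonneg n

lemma summable_lamP_om {y : ℝ} (hy : 1 ≤ y) (X : ℝ) : Summable fun n : ℕ => lamP X n * om y n := by
  have := summable_log_om_mul hy 1 le_rfl
  simp only [Nat.cast_one, one_mul] at this
  refine Summable.of_nonneg_of_le (fun n => mul_nonneg (lamP_nonneg X n) (om_nonneg (by positivity)))
    (fun n => ?_) this
  exact mul_le_mul_of_nonneg_right (lamP_le_log X n) (om_nonneg (by positivity))

lemma cheb_lower : ∃ c0 > 0, ∃ y0 : ℝ, ∀ y ≥ y0, 1 ≤ y → ∀ X : ℝ, X ≤ exp (y - 3) →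
    c0 ≤ ∑' n : ℕ, lamP X n * om y n := by
  have htend : Filter.Tendsto (fun x : ℝ => ((x - 1) * log 2 - log (x + 2) - 2 * √x * log x) / x)
      Filter.atTop (nhds (log 2)) := by
    have h1 : Filter.Tendsto (fun x : ℝ => x⁻¹) Filter.atTop (nhds 0) := tendsto_inv_atTop_zero
    have h2 : Filter.Tendsto (fun x : ℝ => log x / √x) Filter.atTop (nhds 0) := by
      simp_rw [Real.sqrt_eq_rpow]
      exact (isLittleO_log_rpow_atTop (by norm_num)).tendsto_div_nhds_zero
    have h3 : Filter.Tendsto (fun x : ℝ => log (x + 2) / (x + 2) * (1 + 2 * x⁻¹)) Filter.atTop (nhds 0) := by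
      have : Filter.Tendsto (fun x : ℝ => log x / x) Filter.atTop (nhds 0) := by
        simpa using (isLittleO_log_rpow_atTop (r := 1) (by norm_num)).tendsto_div_nhds_zero
      have h4 := (this.comp (Filter.tendsto_atTop_add_const_right _ 2 Filter.tendsto_id)).mul
        ((h1.const_mul 2).const_add 1)
      simpa using h4
    have h5 := (((h1.const_sub 1).mul_const (log 2)).sub h3).sub (h2.const_mul 2)
    simp only [sub_zero, one_mul, mul_zero] at h5
    refine h5.congr' ?_
    filter_upwards [Filter.eventually_gt_atTop 0] with x hx
    have hs : √x * √x = x := Real.mul_self_sqrt hx.le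
    have hs0 : 0 < √x := Real.sqrt_pos.2 hx
    have e1 : log x / √x = √x * log x / x := by
      rw [div_eq_div_iff hs0.ne' hx.ne']; linear_combination (-(log x)) * hs
    rw [e1]
    field_simp
  have hev : ∀ᶠ x in Filter.atTop, 0.69 * x ≤ Chebyshev.theta x := by
    have := htend.eventually_const_le (u := 0.69) (by have := Real.log_two_gt_d9; linarith)
    filter_upwards [this, Filter.eventually_ge_atTop 1] with x hx h1
    rw [le_div_iff₀ (by linarith)] at hx
    exact hx.trans (Chebyshev.theta_ge' h1)
  obtain ⟨x0, hx0⟩ := Filter.eventually_atTop.1 hev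
  refine ⟨exp (-1 - 9 / 2) / 2, by positivity, log (max x0 1), fun y hyy hy X hX => ?_⟩
  set x := exp y with hx
  have hxx : x0 ≤ x := (le_max_left _ _).trans ((Real.log_le_iff_le_exp (by positivity)).1 hyy)
  have ht1 := hx0 x hxx
  have he3 : exp (y - 3) ≤ x * (1 / 8) := by
    rw [Real.exp_sub, ← hx, div_eq_mul_inv, ← one_div]
    have h2 : (8:ℝ) ≤ exp 3 := by
      have := Real.exp_one_gt_d9
      have h3 : exp 3 = exp 1 ^ 3 := by rw [← Real.exp_nat_mul]; norm_num
      rw [h3]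
      calc (8:ℝ) = 2 ^ 3 := by norm_num
        _ ≤ _ := by gcongr; linarith
    gcongr
  have ht2 : Chebyshev.theta (exp (y - 3)) ≤ 0.175 * x := by
    refine (Chebyshev.theta_le_log4_mul_x (by positivity)).trans ?_
    have : log 4 ≤ 1.4 := by
      rw [show (4:ℝ) = 2 ^ 2 by norm_num, Real.log_pow]
      have := Real.log_two_lt_d9
      norm_num; linarith
    have h4 : 0 ≤ log 4 := Real.log_nonneg (by norm_num)
    nlinarith [Real.exp_pos (y - 3)]
  have hxpos : 0 < x := Real.exp_pos y
  set S := (Ioc ⌊exp (y - 3)⌋₊ ⌊x⌋₊).filter Nat.Prime with hS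
  have hfl : ⌊exp (y - 3)⌋₊ ≤ ⌊x⌋₊ := Nat.floor_mono (Real.exp_le_exp.2 (by linarith))
  have hsum : x / 2 ≤ ∑ p ∈ S, log p := by
    have : Chebyshev.theta x = Chebyshev.theta (exp (y - 3)) + ∑ p ∈ S, log p := by
      unfold Chebyshev.theta
      rw [hS, ← Finset.sum_union, ← Finset.filter_union, Finset.Ioc_union_Ioc_eq_Ioc (by simp) hfl]
      refine Finset.disjoint_filter_filter ?_
      exact Finset.Ioc_disjoint_Ioc_of_le le_rfl
    linarith
  calc exp (-1 - 9 / 2) / 2 = (x / 2) * (exp (-1 - 9 / 2) / x) := by field_simp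
    _ ≤ (∑ p ∈ S, log p) * (exp (-1 - 9 / 2) / x) := by gcongr
    _ = ∑ p ∈ S, log p * (exp (-1 - 9 / 2) / x) := by rw [Finset.sum_mul]
    _ ≤ ∑ p ∈ S, lamP X p * om y p := by
        refine Finset.sum_le_sum fun p hp => ?_
        simp only [hS, Finset.mem_filter, Finset.mem_Ioc] at hp
        obtain ⟨⟨hp1, hp2⟩, hpp⟩ := hp
        have hp1' : exp (y - 3) < p := (Nat.floor_lt (by positivity)).1 hp1
        have hp2' : (p:ℝ) ≤ x := (Nat.le_floor_iff hxpos.le).1 hp2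
        have hp0 : (0:ℝ) < p := by exact_mod_cast hpp.pos
        rw [lamP, if_pos ⟨hpp, hX.trans_lt hp1'⟩]
        refine mul_le_mul_of_nonneg_left ?_ (Real.log_natCast_nonneg p)
        have hl1 : y - 3 < log p := (Real.lt_log_iff_exp_lt hp0).2 hp1'
        have hl2 : log p ≤ y := (Real.log_le_iff_le_exp hp0).2 hp2'
        unfold om
        rw [Real.rpow_def_of_pos hp0, ← Real.exp_add, hx, ← Real.exp_sub]
        apply Real.exp_le_exp.2
        have h1y : log p * (1 / y) ≤ 1 := by
          rw [mul_one_div, div_le_one (by linarith)]; exact hl2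
        have : (log p - y) ^ 2 ≤ 9 := by nlinarith
        nlinarith
    _ ≤ _ := Summable.sum_le_tsum _ (fun n _ => mul_nonneg (lamP_nonneg X n) (om_nonneg (by positivity)))
        (summable_lamP_om hy X)

end PG

namespace PG

open Finset Real MeasureTheory
open ArithmeticFunction hiding log

noncomputable def ppw (n : ℕ) : ℝ := if n.Prime then 0 else vonMangoldt n * (n : ℝ) ^ (-(3 / 4) : ℝ)

lemma ppw_nonneg (n : ℕ) : 0 ≤ ppw n := by
  unfold ppw; split_ifs
  · exact le_rfl
  · exact mul_nonneg vonMangoldt_nonneg (by positivity)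

lemma summable_ppw : Summable ppw := by
  have h0 : ∀ n, n ∉ {n : ℕ | IsPrimePow n} → ppw n = 0 := by
    intro n hn
    unfold ppw
    rw [vonMangoldt_eq_zero_iff.2 hn]; simp
  rw [← Set.indicator_eq_self.2 (Function.support_subset_iff'.2 h0), ← summable_subtype_iff_indicator]
  have h1 : Summable ((ppw ∘ ((↑) : {n : ℕ | IsPrimePow n} → ℕ)) ∘ Nat.Primes.prodNatEquiv) := by
    have hs1 : Summable fun p : Nat.Primes => 8 * ((p : ℕ) : ℝ) ^ (-(5 / 4) : ℝ) :=
      ((summable_rpow_neg (a := -(5 / 4)) (by norm_num)).mul_left 8).comp_injective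
        (Subtype.val_injective (p := Nat.Prime))
    have hs2 : Summable fun k : ℕ => (2 / 3 : ℝ) ^ k := summable_geometric_of_lt_one (by norm_num) (by norm_num)
    have hs := hs1.mul_of_nonneg hs2 (fun _ => by positivity) (fun _ => by positivity)
    refine Summable.of_nonneg_of_le (fun x => ppw_nonneg _) (fun x => ?_) hs
    obtain ⟨p, k⟩ := x
    have hp : (p : ℕ).Prime := p.2
    have hp2 : (2:ℝ) ≤ (p : ℕ) := by exact_mod_cast hp.two_le
    have hp0 : (0:ℝ) < (p : ℕ) := by linarith
    simp only [Function.comp, Nat.Primes.prodNatEquiv_apply]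
    rcases Nat.eq_zero_or_pos k with rfl | hk
    · simp [ppw, hp]
      positivity
    · obtain ⟨j, rfl⟩ : ∃ j, k = j + 1 := ⟨k - 1, by omega⟩
      have hnp : ¬ ((p:ℕ) ^ (j + 1 + 1)).Prime := Nat.Prime.not_prime_pow (by omega)
      rw [ppw, if_neg hnp, vonMangoldt_apply_pow (by omega), vonMangoldt_apply_prime hp]
      have hlog : log (p:ℕ) ≤ 4 * ((p:ℕ):ℝ) ^ (1 / 4 : ℝ) := by
        have := Real.log_le_rpow_div (x := ((p:ℕ):ℝ)) (ε := 1 / 4) (by positivity) (by norm_num)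
        linarith
      have e1 : (((p:ℕ) ^ (j + 1 + 1) : ℕ) : ℝ) ^ (-(3 / 4) : ℝ) =
          ((p:ℕ):ℝ) ^ (-(3 / 2) : ℝ) * (((p:ℕ):ℝ) ^ (-(3 / 4) : ℝ)) ^ j := by
        push_cast
        rw [← Real.rpow_natCast, ← Real.rpow_natCast, ← Real.rpow_mul hp0.le, ← Real.rpow_mul hp0.le,
          ← Real.rpow_add hp0]
        congr 1; push_cast; ring
      have h23 : ((p:ℕ):ℝ) ^ (-(3 / 4) : ℝ) ≤ 2 / 3 := by
        refine (Real.rpow_le_rpow_of_nonpos (by norm_num) hp2 (by norm_num)).trans ?_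
        by_contra! hcon
        have h4 : (2 / 3 : ℝ) ^ 4 < ((2:ℝ) ^ (-(3 / 4) : ℝ)) ^ 4 := by gcongr
        rw [← Real.rpow_natCast ((2:ℝ) ^ (-(3 / 4) : ℝ)), ← Real.rpow_mul (by norm_num)] at h4
        norm_num at h4
      rw [e1]
      calc _ ≤ (4 * ((p:ℕ):ℝ) ^ (1 / 4 : ℝ)) * (((p:ℕ):ℝ) ^ (-(3 / 2) : ℝ) * (2 / 3) ^ j) := by
            gcongr
        _ = 4 * (((p:ℕ):ℝ) ^ (1 / 4 : ℝ) * ((p:ℕ):ℝ) ^ (-(3 / 2) : ℝ)) * (2 / 3) ^ j := by ring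
        _ = 4 * (((p:ℕ):ℝ) ^ (-(5 / 4) : ℝ)) * (2 / 3) ^ j := by
            rw [← Real.rpow_add hp0]; norm_num
        _ ≤ _ := by
            rw [pow_succ]
            have : 0 ≤ (((p:ℕ):ℝ) ^ (-(5 / 4) : ℝ)) * (2 / 3) ^ j := by positivity
            nlinarith
  exact (Equiv.summable_iff Nat.Primes.prodNatEquiv).1 h1

lemma summable_Lam_om {y : ℝ} (hy : 1 ≤ y) : Summable fun n : ℕ => vonMangoldt n * om y n := by
  have := summable_log_om_mul hy 1 le_rfl
  simp only [Nat.cast_one, one_mul] at this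
  refine Summable.of_nonneg_of_le (fun n => mul_nonneg vonMangoldt_nonneg (om_nonneg (by positivity)))
    (fun n => ?_) this
  exact mul_le_mul_of_nonneg_right (vonMangoldt_le_log) (om_nonneg (by positivity))

lemma lamP_le_Lam (X : ℝ) (n : ℕ) : lamP X n ≤ vonMangoldt n := by
  unfold lamP; split_ifs with h
  · rw [vonMangoldt_apply_prime h.1]
  · exact vonMangoldt_nonneg

lemma pp_tail : ∃ C > 0, ∀ y : ℝ, 1 ≤ y → ∀ X : ℝ, 1 ≤ X →
    ∑' n : ℕ, (vonMangoldt n - lamP X n) * om y n ≤ C * (X ^ 2 * exp (-(y / 4))) := by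
  set S := ∑' n, ppw n with hS
  have hS0 : 0 ≤ S := tsum_nonneg ppw_nonneg
  refine ⟨4 + 2 * S, by positivity, fun y hy X hX => ?_⟩
  set K := ⌊X⌋₊ with hK
  have hE := Real.exp_pos (-(y / 4))
  have hb : ∀ n : ℕ, (vonMangoldt n - lamP X n) * om y n ≤
      (if n ∈ range (K + 1) then 2 * X * exp (-(y / 4)) else 0) + 2 * exp (-(y / 4)) * ppw n := by
    intro n
    rcases Nat.eq_zero_or_pos n with rfl | hn
    · simp [lamP]
      have := ppw_nonneg 0
      positivity
    have hn1 : (1:ℝ) ≤ n := by exact_mod_cast hn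
    have ho := om_le hy hn1
    have ho0 := om_nonneg (y := y) (v := n) (by positivity)
    have hp := ppw_nonneg n
    by_cases hnX : n ∈ range (K + 1)
    · rw [if_pos hnX]
      have hnX' : (n:ℝ) ≤ X := by
        rw [Finset.mem_range, Nat.lt_succ_iff] at hnX
        exact (Nat.le_floor_iff (by linarith)).1 hnX
      have h1 : vonMangoldt n - lamP X n ≤ X := by
        have := vonMangoldt_le_log (n := n)
        have := lamP_nonneg X n
        have := Real.log_le_sub_one_of_pos (x := (n:ℝ)) (by linarith)
        linarith
      have h2 : om y n ≤ 2 * exp (-(y / 4)) := by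
        refine ho.trans ?_
        have : (n:ℝ) ^ (-(3 / 4) : ℝ) ≤ 1 := Real.rpow_le_one_of_one_le_of_nonpos hn1 (by norm_num)
        nlinarith
      calc _ ≤ X * (2 * exp (-(y / 4))) := by gcongr
        _ ≤ _ := by nlinarith [mul_nonneg hE.le hp]
    · rw [if_neg hnX, zero_add]
      have hnX' : X < n := by
        rw [Finset.mem_range, not_lt] at hnX
        exact (Nat.floor_lt (by linarith)).1 hnX
      by_cases hpr : n.Prime
      · simp only [lamP, ppw, hpr, hnX', and_self, if_true, vonMangoldt_apply_prime hpr]; simp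
      · have : lamP X n = 0 := by simp [lamP, hpr]
        rw [this, sub_zero, ppw, if_neg hpr]
        calc _ ≤ vonMangoldt n * (2 * ((n:ℝ) ^ (-(3 / 4) : ℝ) * exp (-(y / 4)))) :=
              mul_le_mul_of_nonneg_left ho vonMangoldt_nonneg
          _ = _ := by ring
  have hs1 : Summable fun n : ℕ => (if n ∈ range (K + 1) then 2 * X * exp (-(y / 4)) else 0 : ℝ) :=
    summable_of_ne_finset_zero (s := range (K + 1)) (fun n hn => by rw [if_neg hn])
  have hs2 := summable_ppw.mul_left (2 * exp (-(y / 4)))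
  have hs0 : Summable fun n : ℕ => (vonMangoldt n - lamP X n) * om y n := by
    simp_rw [sub_mul]
    exact (summable_Lam_om hy).sub (summable_lamP_om hy X)
  calc _ ≤ _ := Summable.tsum_le_tsum hb hs0 (hs1.add hs2)
    _ = (K + 1) * (2 * X * exp (-(y / 4))) + 2 * exp (-(y / 4)) * S := by
        rw [hs1.tsum_add hs2, tsum_mul_left, tsum_eq_sum (s := range (K + 1)) (fun n hn => by rw [if_neg hn]),
          Finset.sum_congr rfl (fun n hn => if_pos hn)]
        simp [hS]
    _ ≤ (2 * X) * (2 * X * exp (-(y / 4))) + 2 * exp (-(y / 4)) * S * X ^ 2 := by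
        have : (K:ℝ) ≤ X := Nat.floor_le (by linarith)
        have h2 : 1 ≤ X ^ 2 := by nlinarith
        have h3 : 0 ≤ 2 * exp (-(y / 4)) * S := by positivity
        refine add_le_add (mul_le_mul_of_nonneg_right (by linarith) (by positivity)) ?_
        nlinarith
    _ = _ := by ring

end PG

namespace PG

open Finset Real

lemma cpow_diff {N u : ℝ} (hN : 0 < N) (hu : N ≤ u) {s : ℂ} (hs : 0 < s.re) :
    ‖(u : ℂ) ^ (-s) - (N : ℂ) ^ (-s)‖ ≤ ‖s‖ * N ^ (-s.re - 1) * (u - N) := by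
  have hs0 : s ≠ 0 := by rintro rfl; simp at hs
  have hd : ∀ t ∈ Set.Icc N u, HasDerivWithinAt (fun y : ℝ => (y : ℂ) ^ (-s)) (-s * (t : ℂ) ^ (-s - 1))
      (Set.Icc N u) t := by
    intro t ht
    exact (hasDerivAt_ofReal_cpow_const (x := t) (by linarith [ht.1]) (r := -s)
      (neg_ne_zero.2 hs0)).hasDerivWithinAt
  have := (convex_Icc N u).norm_image_sub_le_of_norm_hasDerivWithin_le hd
    (C := ‖s‖ * N ^ (-s.re - 1)) (x := N) (y := u) ?_ (by simp [hu]) (by simp [hu])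
  · simpa [abs_of_nonneg (sub_nonneg.2 hu)] using this
  · intro t ht
    have ht0 : 0 < t := by linarith [ht.1]
    rw [norm_mul, norm_neg, Complex.norm_cpow_eq_rpow_re_of_pos ht0]
    gcongr
    simp only [Complex.sub_re, Complex.neg_re, Complex.one_re]
    exact Real.rpow_le_rpow_of_nonpos hN ht.1 (by linarith)

lemma cpow_int_diff {N h : ℝ} (hN : 0 < N) (hh : 0 ≤ h) {s : ℂ} (hs : 0 < s.re) (hs1 : s ≠ 1) :
    ‖h * (N : ℂ) ^ (-s) - ((N : ℂ) ^ (1 - s) - ((N + h : ℝ) : ℂ) ^ (1 - s)) / (s - 1)‖ ≤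
      ‖s‖ * N ^ (-s.re - 1) * h * h := by
  have hs1' : s - 1 ≠ 0 := sub_ne_zero.2 hs1
  have hd : ∀ t ∈ Set.Icc N (N + h), HasDerivWithinAt
      (fun y : ℝ => (y : ℂ) ^ (-s + 1) / (-s + 1) - y * (N : ℂ) ^ (-s)) ((t : ℂ) ^ (-s) - (N : ℂ) ^ (-s))
      (Set.Icc N (N + h)) t := by
    intro t ht
    have h1 := hasDerivAt_ofReal_cpow_const' (x := t) (by linarith [ht.1]) (r := -s)
      (by intro h; apply hs1; linear_combination -h)
    have h2 : HasDerivAt (fun y : ℝ => (y : ℂ) * (N : ℂ) ^ (-s)) (1 * (N : ℂ) ^ (-s)) t :=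
      (Complex.ofRealCLM.hasDerivAt (x := t)).mul_const _
    rw [one_mul] at h2
    exact (h1.sub h2).hasDerivWithinAt
  have := (convex_Icc N (N + h)).norm_image_sub_le_of_norm_hasDerivWithin_le hd
    (C := ‖s‖ * N ^ (-s.re - 1) * h) (x := N) (y := N + h) ?_ (by simp [hh]) (by simp [hh])
  · rw [show N + h - N = h by ring, Real.norm_of_nonneg hh] at this
    refine le_trans (le_of_eq ?_) this
    rw [← norm_neg]
    congr 1
    have : -s + 1 = -(s - 1) := by ring
    have e2 : 1 - s = -(s-1) := by ring
    rw [this, e2]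
    push_cast
    field_simp
    ring
  · intro t ht
    refine (cpow_diff hN ht.1 hs).trans ?_
    gcongr
    linarith [ht.2]

/-- block term -/
noncomputable def Bt (q : ℕ) (f : ZMod q → ℂ) (j : ℕ) (s : ℂ) : ℂ :=
  ∑ a ∈ range q, f a * ((q * j + a : ℕ) : ℂ) ^ (-s)

lemma norm_Bt_triv {q : ℕ} (hq : 1 ≤ q) {f : ZMod q → ℂ} (hf : ∀ a, ‖f a‖ ≤ 1) {j : ℕ} (hj : 1 ≤ j) {s : ℂ}
    (hs : 0 < s.re) : ‖Bt q f j s‖ ≤ q * ((q * j : ℕ) : ℝ) ^ (-s.re) := by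
  have hqj : 0 < q * j := by positivity
  unfold Bt
  refine (norm_sum_le _ _).trans ?_
  calc _ ≤ ∑ a ∈ range q, ((q * j : ℕ) : ℝ) ^ (-s.re) := by
        refine Finset.sum_le_sum fun a _ => ?_
        rw [norm_mul, Complex.norm_natCast_cpow_of_pos (by omega)]
        have h1 : ((q * j + a : ℕ) : ℝ) ^ (-s).re ≤ ((q * j : ℕ) : ℝ) ^ (-s.re) :=
          Real.rpow_le_rpow_of_nonpos (by exact_mod_cast hqj) (by push_cast; simp) (by simp [hs.le])
        have := hf a
        have h0 : 0 ≤ ((q * j + a : ℕ) : ℝ) ^ (-s).re := by positivity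
        nlinarith [norm_nonneg (f a)]
    _ = _ := by simp

/-- `f` averaged -/
noncomputable def avg (q : ℕ) (f : ZMod q → ℂ) : ℂ := (∑ a ∈ range q, f a) / q

noncomputable def It (q j : ℕ) (s : ℂ) : ℂ :=
  (((q * j : ℕ) : ℂ) ^ (1 - s) - ((q * (j + 1) : ℕ) : ℂ) ^ (1 - s)) / (s - 1)

lemma norm_avg_le {q : ℕ} (hq : 1 ≤ q) {f : ZMod q → ℂ} (hf : ∀ a, ‖f a‖ ≤ 1) : ‖avg q f‖ ≤ 1 := by
  unfold avg
  rw [norm_div, Complex.norm_natCast, div_le_one (by positivity)]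
  refine (norm_sum_le _ _).trans ?_
  calc _ ≤ ∑ a ∈ range q, (1:ℝ) := Finset.sum_le_sum fun a _ => hf _
    _ = _ := by simp

lemma norm_Et_cancel {q : ℕ} (hq : 1 ≤ q) {f : ZMod q → ℂ} (hf : ∀ a, ‖f a‖ ≤ 1) {j : ℕ} (hj : 1 ≤ j) {s : ℂ}
    (hs : 0 < s.re) (hs1 : s ≠ 1 ∨ avg q f = 0) :
    ‖Bt q f j s - avg q f * It q j s‖ ≤ 2 * (q * ((q * j : ℕ) : ℝ) ^ (-s.re)) * (‖s‖ / j) := by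
  have hqj : 0 < q * j := by positivity
  have hqj' : (0:ℝ) < (q * j : ℕ) := by exact_mod_cast hqj
  have hq0 : (q:ℂ) ≠ 0 := by exact_mod_cast (by omega : q ≠ 0)
  set N : ℝ := ((q * j : ℕ) : ℝ) with hN
  have hpos : 0 ≤ ‖s‖ * N ^ (-s.re - 1) * q := by positivity
  have e : Bt q f j s - avg q f * It q j s =
      ∑ a ∈ range q, f a * (((q * j + a : ℕ) : ℂ) ^ (-s) - (N : ℂ) ^ (-s)) +
      avg q f * (((q:ℝ):ℂ) * (N : ℂ) ^ (-s) - ((N : ℂ) ^ (1 - s) - ((N + q : ℝ) : ℂ) ^ (1 - s)) / (s - 1)) := by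
    have e1 : ((N + q : ℝ) : ℂ) = ((q * (j + 1) : ℕ) : ℂ) := by rw [hN]; push_cast; ring
    have e2 : (N : ℂ) = ((q * j : ℕ) : ℂ) := by rw [hN]; push_cast; rfl
    rw [e1, e2]
    unfold Bt It avg
    simp_rw [mul_sub, Finset.sum_sub_distrib, ← Finset.sum_mul]
    push_cast
    field_simp
    ring
  have h1 : ‖∑ a ∈ range q, f a * (((q * j + a : ℕ) : ℂ) ^ (-s) - (N : ℂ) ^ (-s))‖ ≤
      q * (‖s‖ * N ^ (-s.re - 1) * q) := by
    refine (norm_sum_le _ _).trans ?_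
    calc _ ≤ ∑ a ∈ range q, (‖s‖ * N ^ (-s.re - 1) * q) := by
          refine Finset.sum_le_sum fun a ha => ?_
          have haq : (a:ℝ) ≤ q := by exact_mod_cast (Finset.mem_range.1 ha).le
          have h2 := cpow_diff (N := N) (u := N + a) hqj' (by simp) hs
          have e3 : ((q * j + a : ℕ) : ℂ) = ((N + a : ℝ) : ℂ) := by rw [hN]; push_cast; ring
          rw [norm_mul, e3]
          have h3 : ‖((N + a : ℝ) : ℂ) ^ (-s) - (N : ℂ) ^ (-s)‖ ≤ ‖s‖ * N ^ (-s.re - 1) * q := by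
            refine h2.trans ?_
            gcongr
            linarith
          have := hf a
          nlinarith [norm_nonneg (f a), norm_nonneg (((N + a : ℝ) : ℂ) ^ (-s) - (N : ℂ) ^ (-s))]
      _ = _ := by simp
  have h2 : ‖avg q f * (((q:ℝ):ℂ) * (N : ℂ) ^ (-s) - ((N : ℂ) ^ (1 - s) - ((N + q : ℝ) : ℂ) ^ (1 - s)) / (s - 1))‖
      ≤ q * (‖s‖ * N ^ (-s.re - 1) * q) := by
    rcases hs1 with hs1 | h0
    · rw [norm_mul]
      have h3 := cpow_int_diff (N := N) (h := q) hqj' (by positivity) hs hs1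
      have h4 := norm_avg_le hq hf
      calc _ ≤ 1 * (‖s‖ * N ^ (-s.re - 1) * q * q) := by gcongr
        _ = _ := by ring
    · rw [h0, zero_mul, norm_zero]; positivity
  rw [e]
  refine (norm_add_le _ _).trans ((add_le_add h1 h2).trans (le_of_eq ?_))
  rw [Real.rpow_sub_one hqj'.ne', hN]
  have hj0 : (j:ℝ) ≠ 0 := by positivity
  have hq0 : (q:ℝ) ≠ 0 := by positivity
  push_cast
  field_simp
  ring

lemma norm_It_le {q : ℕ} (hq : 1 ≤ q) {j : ℕ} (hj : 1 ≤ j) {s : ℂ}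
    (hs : 0 < s.re) (hs1 : s ≠ 1) : ‖It q j s‖ ≤ q * ((q * j : ℕ) : ℝ) ^ (-s.re) := by
  have hqj : 0 < q * j := by positivity
  have hqj' : (0:ℝ) < (q * j : ℕ) := by exact_mod_cast hqj
  set N : ℝ := ((q * j : ℕ) : ℝ) with hN
  have hd : ∀ t ∈ Set.Icc N (N + q), HasDerivWithinAt
      (fun y : ℝ => (y : ℂ) ^ (-s + 1) / (-s + 1)) ((t : ℂ) ^ (-s)) (Set.Icc N (N + q)) t := by
    intro t ht
    exact (hasDerivAt_ofReal_cpow_const' (x := t) (by linarith [ht.1]) (r := -s)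
      (by intro h; apply hs1; linear_combination -h)).hasDerivWithinAt
  have := (convex_Icc N (N + q)).norm_image_sub_le_of_norm_hasDerivWithin_le hd
    (C := N ^ (-s.re)) (x := N) (y := N + q) ?_ (by simp) (by simp)
  · rw [show N + q - N = q by ring, Real.norm_of_nonneg (by positivity), mul_comm] at this
    refine le_trans (le_of_eq ?_) this
    congr 1
    unfold It
    have e1 : ((N + q : ℝ) : ℂ) = ((q * (j + 1) : ℕ) : ℂ) := by rw [hN]; push_cast; ring
    have e2 : (N : ℂ) = ((q * j : ℕ) : ℂ) := by rw [hN]; push_cast; rfl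
    rw [e1, e2]
    have hs1' : s - 1 ≠ 0 := sub_ne_zero.2 hs1
    have e3 : -s + 1 = -(s - 1) := by ring
    have e4 : 1 - s = -(s-1) := by ring
    rw [e3, e4]
    field_simp
    ring
  · intro t ht
    have ht0 : 0 < t := by linarith [ht.1]
    rw [Complex.norm_cpow_eq_rpow_re_of_pos ht0]
    simp only [Complex.neg_re]
    exact Real.rpow_le_rpow_of_nonpos hqj' ht.1 (by linarith)

lemma norm_Et {q : ℕ} (hq : 1 ≤ q) {f : ZMod q → ℂ} (hf : ∀ a, ‖f a‖ ≤ 1) {j : ℕ} (hj : 1 ≤ j) {s : ℂ}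
    {l : ℝ} (hl : 2 ≤ l) (hql : (q:ℝ) ≤ exp l) (hsl : ‖s‖ ≤ exp l) (hσ : 1 - 1 / l ≤ s.re)
    (hs1 : s ≠ 1 ∨ avg q f = 0) :
    ‖Bt q f j s - avg q f * It q j s‖ ≤ 2 * exp 3 * (j : ℝ) ^ (-(1 + 1 / l)) := by
  have hl0 : 0 < l := by linarith
  have h1l : 1 / l ≤ 1 / 2 := by gcongr
  have h1l0 : 0 < 1 / l := by positivity
  have hs : 0 < s.re := by linarith
  have hj' : (1:ℝ) ≤ j := by exact_mod_cast hj
  have hj0 : (0:ℝ) < j := by linarith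
  have hq0 : (0:ℝ) < q := by exact_mod_cast hq
  have hq1 : (1:ℝ) ≤ q := by exact_mod_cast hq
  have hT : ‖Bt q f j s - avg q f * It q j s‖ ≤ 2 * (q * ((q * j : ℕ) : ℝ) ^ (-s.re)) := by
    refine (norm_sub_le _ _).trans ?_
    have h1 := norm_Bt_triv hq hf hj hs
    have h2 : ‖avg q f * It q j s‖ ≤ q * ((q * j : ℕ) : ℝ) ^ (-s.re) := by
      rcases hs1 with hs1 | h0
      · rw [norm_mul]
        have := norm_avg_le hq hf
        have := norm_It_le hq hj hs hs1
        nlinarith [norm_nonneg (It q j s), norm_nonneg (avg q f)]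
      · rw [h0, zero_mul, norm_zero]; positivity
    linarith
  have hC := norm_Et_cancel hq hf hj hs hs1
  set T := 2 * (q * ((q * j : ℕ) : ℝ) ^ (-s.re)) with hTdef
  have hT0 : 0 ≤ T := by positivity
  have hmin : ‖Bt q f j s - avg q f * It q j s‖ ≤ T * (exp l / j) ^ (2 / l) := by
    have hε0 : 0 ≤ 2 / l := by positivity
    have hε1 : 2 / l ≤ 1 := by rw [div_le_one hl0]; exact hl
    rcases le_total 1 (exp l / j) with h | h
    · refine hT.trans (le_mul_of_one_le_right hT0 (Real.one_le_rpow h hε0))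
    · refine hC.trans ?_
      gcongr
      calc ‖s‖ / j ≤ exp l / j := by gcongr
        _ = (exp l / j) ^ (1:ℝ) := by rw [Real.rpow_one]
        _ ≤ _ := Real.rpow_le_rpow_of_exponent_ge (by positivity) h hε1
  refine hmin.trans ?_
  have e1 : (exp l / j) ^ (2 / l) = exp 2 * (j:ℝ) ^ (-(2 / l)) := by
    rw [Real.div_rpow (by positivity) hj0.le, ← Real.exp_mul, Real.rpow_neg hj0.le]
    rw [show l * (2 / l) = 2 by field_simp]; ring
  have e2 : (q:ℝ) * ((q * j : ℕ) : ℝ) ^ (-s.re) = (q:ℝ) ^ (1 - s.re) * (j:ℝ) ^ (-s.re) := by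
    push_cast
    rw [Real.mul_rpow hq0.le hj0.le, Real.rpow_sub hq0, Real.rpow_one, Real.rpow_neg hq0.le]
    field_simp
  have h3 : (q:ℝ) ^ (1 - s.re) ≤ exp 1 := by
    calc (q:ℝ) ^ (1 - s.re) ≤ (q:ℝ) ^ (1 / l) := Real.rpow_le_rpow_of_exponent_le hq1 (by linarith)
      _ ≤ (exp l) ^ (1 / l) := by gcongr
      _ = _ := by rw [← Real.exp_mul]; congr 1; field_simp
  have h4 : (j:ℝ) ^ (-s.re) * (j:ℝ) ^ (-(2 / l)) ≤ (j : ℝ) ^ (-(1 + 1 / l)) := by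
    rw [← Real.rpow_add hj0]
    refine Real.rpow_le_rpow_of_exponent_le hj' ?_
    have : 2 / l = 2 * (1 / l) := by ring
    linarith
  have e3 : exp 3 = exp 1 * exp 2 := by rw [← Real.exp_add]; norm_num
  rw [hTdef, e1, e2, e3]
  calc _ = 2 * (q:ℝ) ^ (1 - s.re) * exp 2 * ((j:ℝ) ^ (-s.re) * (j:ℝ) ^ (-(2 / l))) := by ring
    _ ≤ 2 * exp 1 * exp 2 * ((j : ℝ) ^ (-(1 + 1 / l))) := by gcongr
    _ = _ := by ring

/-- first block -/
lemma norm_Bt_zero {q : ℕ} {f : ZMod q → ℂ} (hf : ∀ a, ‖f a‖ ≤ 1) {s : ℂ}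
    {l : ℝ} (hl : 2 ≤ l) (hql : (q:ℝ) ≤ exp l) (hσ : 1 - 1 / l ≤ s.re) :
    ‖Bt q f 0 s‖ ≤ exp 2 * (1 + l) := by
  have hl0 : 0 < l := by linarith
  have h1l : 1 / l ≤ 1 / 2 := by gcongr
  have h1l0 : 0 < 1 / l := by positivity
  have hs : 0 < s.re := by linarith
  have hs0 : s ≠ 0 := by rintro rfl; simp at hs
  have hz := zeta_le (ε := 1 / l) h1l0
  rw [one_div_one_div] at hz
  have hsum : Summable fun n : ℕ => (n:ℝ) ^ (-(1 + 1 / l)) := summable_rpow_neg (by linarith)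
  unfold Bt
  refine (norm_sum_le _ _).trans ?_
  calc _ ≤ ∑ a ∈ range q, exp 2 * (a:ℝ) ^ (-(1 + 1 / l)) := by
        refine Finset.sum_le_sum fun a ha => ?_
        rcases Nat.eq_zero_or_pos a with rfl | ha0
        · simp [Complex.zero_cpow (neg_ne_zero.2 hs0)]; positivity
        · have ha1 : (1:ℝ) ≤ a := by exact_mod_cast ha0
          have haq : (a:ℝ) ≤ exp l := le_trans (by exact_mod_cast (Finset.mem_range.1 ha).le) hql
          rw [norm_mul, mul_zero, zero_add, Complex.norm_natCast_cpow_of_pos ha0]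
          have h2 : (a:ℝ) ^ (-s).re ≤ exp 2 * (a:ℝ) ^ (-(1 + 1 / l)) := by
            calc (a:ℝ) ^ (-s).re ≤ (a:ℝ) ^ (2 / l + -(1 + 1 / l)) := by
                  refine Real.rpow_le_rpow_of_exponent_le ha1 ?_
                  have : 2 / l = 2 * (1 / l) := by ring
                  simp only [Complex.neg_re]
                  linarith
              _ = (a:ℝ) ^ (2 / l) * (a:ℝ) ^ (-(1 + 1 / l)) := Real.rpow_add (by linarith) _ _
              _ ≤ (exp l) ^ (2 / l) * (a:ℝ) ^ (-(1 + 1 / l)) := by gcongr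
              _ = _ := by rw [← Real.exp_mul]; congr 2; field_simp
          have := hf a
          have h0 : 0 ≤ (a:ℝ) ^ (-s).re := by positivity
          nlinarith [norm_nonneg (f a)]
    _ ≤ _ := by
        rw [← Finset.mul_sum]
        gcongr
        exact (hsum.sum_le_tsum _ (fun _ _ => by positivity)).trans hz

end PG

namespace PG

open Finset Real

lemma sum_Bt (q : ℕ) (f : ZMod q → ℂ) (s : ℂ) (J : ℕ) :
    ∑ j ∈ range J, Bt q f j s = ∑ n ∈ range (q * J), f n * (n : ℂ) ^ (-s) := by
  induction J with
  | zero => simp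
  | succ J ih =>
    rw [Finset.sum_range_succ, ih, mul_add, mul_one, Finset.sum_range_add]
    congr 1
    unfold Bt
    refine Finset.sum_congr rfl fun a _ => ?_
    push_cast
    simp

lemma tendsto_Bt {q : ℕ} (hq : 1 ≤ q) {f : ZMod q → ℂ} (hf : ∀ a, ‖f a‖ ≤ 1) {s : ℂ} (hs : 1 < s.re) :
    Filter.Tendsto (fun J => ∑ j ∈ range J, Bt q f j s) Filter.atTop
      (nhds (LSeries (fun n : ℕ => f n) s)) := by
  have hsum : LSeriesSummable (fun n : ℕ => f n) s :=
    LSeriesSummable_of_bounded_of_one_lt_re (m := 1) (fun n _ => hf _) hs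
  have h1 := hsum.hasSum.tendsto_sum_nat
  have h2 : Filter.Tendsto (fun J => q * J) Filter.atTop Filter.atTop :=
    Filter.tendsto_id.const_mul_atTop' (by omega)
  have h3 := h1.comp h2
  refine h3.congr fun J => ?_
  rw [sum_Bt]
  refine Finset.sum_congr rfl fun n _ => ?_
  rcases Nat.eq_zero_or_pos n with rfl | hn
  · have : s ≠ 0 := by rintro rfl; simp at hs; linarith
    simp [this]
  · rw [LSeries.term_of_ne_zero (by omega), Complex.cpow_neg, div_eq_mul_inv]

lemma sum_It {q : ℕ} (s : ℂ) (J : ℕ) :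
    ∑ j ∈ range J, It q (j + 1) s =
      ((q : ℂ) ^ (1 - s) - ((q * (J + 1) : ℕ) : ℂ) ^ (1 - s)) / (s - 1) := by
  induction J with
  | zero => simp
  | succ J ih =>
    rw [Finset.sum_range_succ, ih]
    unfold It
    rw [← add_div]
    congr 1
    ring

lemma exp_const : 2 * exp 3 + exp 2 ≤ 50 := by
  have h := Real.exp_one_lt_d9
  have h0 := Real.exp_pos 1
  have e3 : exp 3 = exp 1 ^ 3 := by rw [← Real.exp_nat_mul]; norm_num
  have e2 : exp 2 = exp 1 ^ 2 := by rw [← Real.exp_nat_mul]; norm_num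
  rw [e3, e2]
  have h2 : exp 1 ^ 2 ≤ 2.7182818286 ^ 2 := by gcongr
  have h3 : exp 1 ^ 3 ≤ 2.7182818286 ^ 3 := by gcongr
  norm_num at h2 h3
  linarith

lemma sum_E_le {l : ℝ} (hl : 2 ≤ l) (J : ℕ) :
    ∑ j ∈ range J, 2 * exp 3 * ((j + 1 : ℕ) : ℝ) ^ (-(1 + 1 / l)) ≤ 2 * exp 3 * (1 + l) := by
  have hl0 : 0 < l := by linarith
  have h1l0 : 0 < 1 / l := by positivity
  have hz := zeta_le (ε := 1 / l) h1l0
  rw [one_div_one_div] at hz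
  have hsum : Summable fun n : ℕ => (n:ℝ) ^ (-(1 + 1 / l)) := summable_rpow_neg (by linarith)
  rw [← Finset.mul_sum]
  gcongr
  have h1 : ∑ j ∈ range J, ((j + 1 : ℕ) : ℝ) ^ (-(1 + 1 / l)) ≤ ∑ n ∈ range (J + 1), (n:ℝ) ^ (-(1 + 1 / l)) := by
    rw [Finset.sum_range_succ' (fun n : ℕ => (n:ℝ) ^ (-(1 + 1 / l)))]
    have : 0 ≤ ((0:ℕ):ℝ) ^ (-(1 + 1 / l)) := by positivity
    linarith
  exact h1.trans ((hsum.sum_le_tsum _ (fun _ _ => by positivity)).trans hz)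

lemma LSeries_bound {q : ℕ} (hq : 1 ≤ q) {f : ZMod q → ℂ} (hf : ∀ a, ‖f a‖ ≤ 1) {s : ℂ} (hs : 1 < s.re)
    {l : ℝ} (hl : 2 ≤ l) (hql : (q:ℝ) ≤ exp l) (hsl : ‖s‖ ≤ exp l) :
    ‖LSeries (fun n : ℕ => f n) s‖ ≤ 100 * l + 2 / ‖s - 1‖ := by
  have hl0 : 0 < l := by linarith
  have h1l0 : 0 < 1 / l := by positivity
  have hs1 : s ≠ 1 := by rintro rfl; simp at hs
  have ht := ((tendsto_Bt hq hf hs).comp (Filter.tendsto_add_atTop_nat 1)).norm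
  refine le_of_tendsto ht (Filter.Eventually.of_forall fun J => ?_)
  simp only [Function.comp]
  have hq1 : (1:ℝ) ≤ q := by exact_mod_cast hq
  have e : ∑ j ∈ range (J + 1), Bt q f j s = ∑ j ∈ range J, (Bt q f (j + 1) s - avg q f * It q (j + 1) s)
      + avg q f * ∑ j ∈ range J, It q (j + 1) s + Bt q f 0 s := by
    rw [Finset.sum_range_succ', Finset.sum_sub_distrib, Finset.mul_sum]; ring
  have h1 : ‖∑ j ∈ range J, (Bt q f (j + 1) s - avg q f * It q (j + 1) s)‖ ≤ 2 * exp 3 * (1 + l) := by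
    refine (norm_sum_le _ _).trans (le_trans (Finset.sum_le_sum fun j _ => ?_) (sum_E_le hl J))
    exact norm_Et hq hf (by omega) hl hql hsl (by linarith) (Or.inl hs1)
  have h2 : ‖avg q f * ∑ j ∈ range J, It q (j + 1) s‖ ≤ 2 / ‖s - 1‖ := by
    rw [norm_mul, sum_It, norm_div]
    have ha := norm_avg_le hq hf
    have hb : ∀ n : ℕ, 1 ≤ n → ‖(n:ℂ) ^ (1 - s)‖ ≤ 1 := by
      intro n hn
      rw [Complex.norm_natCast_cpow_of_pos (by omega)]
      exact Real.rpow_le_one_of_one_le_of_nonpos (by exact_mod_cast hn) (by simp; linarith)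
    have hc : ‖(q : ℂ) ^ (1 - s) - ((q * (J + 1) : ℕ) : ℂ) ^ (1 - s)‖ ≤ 2 := by
      refine (norm_sub_le _ _).trans ?_
      have := hb q hq
      have := hb (q * (J + 1)) (Nat.mul_pos hq (by omega))
      linarith
    have h0 : 0 < ‖s - 1‖ := norm_pos_iff.2 (sub_ne_zero.2 hs1)
    calc _ ≤ 1 * (2 / ‖s - 1‖) := by gcongr
      _ = _ := one_mul _
  have h3 := norm_Bt_zero (s := s) hf hl hql (by linarith)
  rw [e]
  refine (norm_add_le _ _).trans ?_
  have h4 := norm_add_le (∑ j ∈ range J, (Bt q f (j + 1) s - avg q f * It q (j + 1) s))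
    (avg q f * ∑ j ∈ range J, It q (j + 1) s)
  have := exp_const
  have h5 : (2 * exp 3 + exp 2) * (1 + l) ≤ 50 * (1 + l) := by gcongr
  nlinarith

lemma avg_char {q : ℕ} [NeZero q] {χ : DirichletCharacter ℂ q} (hχ : χ ≠ 1) : avg q χ = 0 := by
  have h := MulChar.sum_eq_zero_of_ne_one hχ
  unfold avg
  have : ∑ a ∈ range q, χ (a : ZMod q) = ∑ a : ZMod q, χ a := by
    obtain ⟨q', rfl⟩ : ∃ q', q = q' + 1 := ⟨q - 1, by have := NeZero.pos q; omega⟩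
    rw [Finset.sum_range]
    refine Finset.sum_congr rfl fun i _ => ?_
    congr 1
    exact Fin.cast_val_eq_self i
  rw [this, h, zero_div]

lemma LFunction_bound {q : ℕ} [NeZero q] {χ : DirichletCharacter ℂ q} (hχ : χ ≠ 1)
    {l : ℝ} (hl : 2 ≤ l) (hql : (q:ℝ) ≤ exp l) {s : ℂ} (hsl : ‖s‖ < exp l) (hσ : 1 - 1 / l < s.re) :
    ‖χ.LFunction s‖ ≤ 100 * l := by
  have hq : 1 ≤ q := NeZero.pos q
  have hl0 : 0 < l := by linarith
  have h1l : 1 / l ≤ 1 / 2 := by gcongr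
  have h1l0 : 0 < 1 / l := by positivity
  have hf : ∀ a : ZMod q, ‖χ a‖ ≤ 1 := fun a => χ.norm_le_one a
  set U : Set ℂ := {s | 1 - 1 / l < s.re} ∩ Metric.ball 0 (exp l) with hU
  have hUo : IsOpen U := (isOpen_lt continuous_const Complex.continuous_re).inter Metric.isOpen_ball
  have hUc : IsPreconnected U :=
    ((convex_halfSpace_re_gt _).inter (convex_ball _ _)).isPreconnected
  set u : ℕ → ℝ := fun j => 2 * exp 3 * ((j + 1 : ℕ) : ℝ) ^ (-(1 + 1 / l)) with hu
  have hus : Summable u := by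
    have hsum : Summable fun n : ℕ => (n:ℝ) ^ (-(1 + 1 / l)) := summable_rpow_neg (by linarith)
    exact ((summable_nat_add_iff 1).2 hsum).mul_left _
  have hle : ∀ j : ℕ, ∀ w ∈ U, ‖Bt q χ (j + 1) w‖ ≤ u j := by
    intro j w hw
    have hw2 : ‖w‖ < exp l := by simpa using hw.2
    have := norm_Et (j := j + 1) hq hf (by omega) hl hql hw2.le hw.1.le (Or.inr (avg_char hχ))
    rw [avg_char hχ, zero_mul, sub_zero] at this
    exact this
  have hdB : ∀ j, DifferentiableOn ℂ (Bt q χ j) U := by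
    intro j
    unfold Bt
    refine DifferentiableOn.fun_sum fun a _ => ?_
    by_cases h0 : q * j + a = 0
    · rw [h0]
      have : ∀ w ∈ U, χ (a : ZMod q) * ((0:ℕ):ℂ) ^ (-w) = 0 := by
        intro w hw
        have hw0 : w ≠ 0 := by
          rintro rfl
          have := hw.1
          simp only [Set.mem_ofPred_eq, Complex.zero_re] at this
          linarith
        simp [hw0]
      exact (differentiableOn_const (c := (0:ℂ))).congr this
    · refine DifferentiableOn.const_mul ?_ _
      exact (differentiable_id.neg.const_cpow (Or.inl (by exact_mod_cast h0))).differentiableOn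
  set G : ℂ → ℂ := fun w => Bt q χ 0 w + ∑' j, Bt q χ (j + 1) w with hG
  have hGd : DifferentiableOn ℂ G U :=
    (hdB 0).add (Complex.differentiableOn_tsum_of_summable_norm hus (fun j => hdB (j + 1)) hUo hle)
  have hLd : DifferentiableOn ℂ χ.LFunction U := (χ.differentiable_LFunction hχ).differentiableOn
  have hGL : ∀ w ∈ U, 1 < w.re → G w = χ.LFunction w := by
    intro w hw h1
    rw [DirichletCharacter.LFunction_eq_LSeries χ h1]
    have hs : Summable fun j => Bt q χ (j + 1) w := Summable.of_norm_bounded hus (fun j => hle j w hw)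
    have ht := hs.hasSum.tendsto_sum_nat.const_add (Bt q χ 0 w)
    have ht2 := (tendsto_Bt hq hf h1).comp (Filter.tendsto_add_atTop_nat 1)
    refine tendsto_nhds_unique ht (ht2.congr fun J => ?_)
    simp only [Function.comp]
    rw [Finset.sum_range_succ', add_comm]
  have hexp : (3:ℝ) ≤ exp l := by
    have := Real.add_one_le_exp l; linarith
  have h2U : (2:ℂ) ∈ U := by
    constructor
    · show 1 - 1 / l < (2:ℂ).re
      rw [show (2:ℂ).re = 2 by simp]; linarith
    · simp; linarith
  have heq : Set.EqOn G χ.LFunction U := by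
    refine (hGd.analyticOnNhd hUo).eqOn_of_preconnected_of_eventuallyEq (hLd.analyticOnNhd hUo) hUc h2U ?_
    have hV : {w : ℂ | 1 < w.re} ∈ nhds (2:ℂ) :=
      (isOpen_lt continuous_const Complex.continuous_re).mem_nhds (by simp)
    filter_upwards [hUo.mem_nhds h2U, hV] with w hw1 hw2
    exact hGL w hw1 hw2
  have hsU : s ∈ U := ⟨hσ, by simpa using hsl⟩
  rw [← heq hsU]
  have h1 : ‖∑' j, Bt q χ (j + 1) s‖ ≤ 2 * exp 3 * (1 + l) := by
    refine (tsum_of_norm_bounded hus.hasSum (fun j => hle j s hsU)).trans ?_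
    exact Real.tsum_le_of_sum_range_le (fun j => by positivity) (fun J => sum_E_le hl J)
  have h3 := norm_Bt_zero (s := s) hf hl hql hσ.le
  have h5 : (2 * exp 3 + exp 2) * (1 + l) ≤ 50 * (1 + l) := by
    have := exp_const
    gcongr
  simp only [hG]
  refine (norm_add_le _ _).trans ?_
  nlinarith

/-- derivative bound -/
lemma deriv_LFunction_bound {q : ℕ} [NeZero q] {χ : DirichletCharacter ℂ q} (hχ : χ ≠ 1)
    {l : ℝ} (hl : 2 ≤ l) (hql : (q:ℝ) ≤ exp l) {s : ℂ} (hsl : ‖s‖ + 1 < exp l) (hσ : 1 - 1 / (2 * l) ≤ s.re) :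
    ‖deriv χ.LFunction s‖ ≤ 400 * l ^ 2 := by
  have hl0 : 0 < l := by linarith
  have h1l : 1 / l ≤ 1 / 2 := by gcongr
  have h1l0 : 0 < 1 / l := by positivity
  have e : 1 / (2 * l) = 1 / l / 2 := by field_simp
  have e4 : 1 / (4 * l) = 1 / l / 4 := by field_simp
  have h := Complex.norm_deriv_le_of_forall_mem_sphere_norm_le (c := s) (R := 1 / (4 * l)) (C := 100 * l)
    (f := χ.LFunction) (by positivity) (χ.differentiable_LFunction hχ).diffContOnCl ?_
  · refine h.trans (le_of_eq ?_)
    field_simp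
    norm_num
  · intro z hz
    have hz' : ‖z - s‖ = 1 / (4 * l) := by simpa [dist_eq_norm] using hz
    apply LFunction_bound hχ hl hql
    · have : ‖z‖ ≤ ‖z - s‖ + ‖s‖ := by simpa using norm_add_le (z - s) s
      rw [e4] at hz'
      linarith
    · have := (abs_le.1 (Complex.abs_re_le_norm (z - s))).1
      simp only [Complex.sub_re] at this
      rw [e4] at hz'
      rw [e] at hσ
      linarith

end PG

namespace PG
open Real Finset

lemma chl_apply {n m : ℕ} (χ : DirichletCharacter ℂ n) (hm : n ∣ m) {a : ℕ} (ha : a.Coprime m) :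
    DirichletCharacter.changeLevel hm χ (a : ZMod m) = χ (a : ZMod n) := by
  have h := DirichletCharacter.changeLevel_eq_cast_of_dvd' χ hm (a := (a : ℤ))
    (by rw [Nat.isCoprime_iff_coprime]; exact ha)
  simpa using h

lemma ch_zero {n : ℕ} (χ : DirichletCharacter ℂ n) {a : ℕ} (ha : ¬ a.Coprime n) : χ (a : ZMod n) = 0 := by
  apply MulChar.map_nonunit
  rwa [ZMod.isUnit_iff_coprime]

/-- product of two characters at the product level -/
noncomputable def chProd {q1 q2 : ℕ} (χ1 : DirichletCharacter ℂ q1) (χ2 : DirichletCharacter ℂ q2) :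
    DirichletCharacter ℂ (q1 * q2) :=
  DirichletCharacter.changeLevel (dvd_mul_right q1 q2) χ1 * DirichletCharacter.changeLevel (dvd_mul_left q2 q1) χ2

lemma chProd_apply {q1 q2 : ℕ} (χ1 : DirichletCharacter ℂ q1) (χ2 : DirichletCharacter ℂ q2) (a : ℕ) :
    chProd χ1 χ2 (a : ZMod (q1 * q2)) = χ1 (a : ZMod q1) * χ2 (a : ZMod q2) := by
  by_cases h : a.Coprime (q1 * q2)
  · unfold chProd
    rw [MulChar.mul_apply, chl_apply _ _ h, chl_apply _ _ h]
  · rw [ch_zero _ h]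
    rw [Nat.coprime_mul_iff_right, not_and_or] at h
    rcases h with h | h <;> rw [ch_zero _ h] <;> simp

lemma chProd_inv_ne_one {q1 q2 : ℕ} (h1 : q1 ≠ 0) (h2 : q2 ≠ 0) {χ1 : DirichletCharacter ℂ q1} {χ2 : DirichletCharacter ℂ q2}
    (hp1 : χ1.IsPrimitive) (hp2 : χ2.IsPrimitive)
    (hne : (⟨q1, χ1⟩ : Σ q, DirichletCharacter ℂ q) ≠ ⟨q2, χ2⟩) : chProd χ1 χ2⁻¹ ≠ 1 := by
  intro h
  apply hne
  have : NeZero (q1 * q2) := ⟨mul_ne_zero h1 h2⟩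
  unfold chProd at h
  rw [map_inv, mul_inv_eq_one] at h
  have hq : q1 = q2 := by
    have e1 := DirichletCharacter.conductor_changeLevel χ1 (dvd_mul_right q1 q2)
    have e2 := DirichletCharacter.conductor_changeLevel χ2 (dvd_mul_left q2 q1)
    rw [h] at e1
    rw [DirichletCharacter.isPrimitive_def] at hp1 hp2
    rw [← hp1, ← hp2, ← e1, ← e2]
  subst hq
  rw [DirichletCharacter.changeLevel_injective _ h]

lemma real_cases {q : ℕ} {χ : DirichletCharacter ℂ q} (hχ : χ ^ 2 = 1) (a : ZMod q) : χ a = 0 ∨ χ a = 1 ∨ χ a = -1 := by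
  by_cases h : IsUnit a
  · right
    have : (χ ^ 2) a = 1 := by rw [hχ]; exact MulChar.one_apply h
    rw [MulChar.pow_apply' _ two_ne_zero] at this
    rcases mul_self_eq_one_iff.1 ((sq (χ a)).symm.trans this) with h | h
    · exact Or.inl h
    · exact Or.inr h
  · left; exact MulChar.map_nonunit χ h

lemma real_cases' {q : ℕ} {χ : DirichletCharacter ℂ q} (hχ : χ ^ 2 = 1) (a : ZMod q) :
    ∃ u : ℝ, χ a = u ∧ (u = 0 ∨ u = 1 ∨ u = -1) := by
  rcases real_cases hχ a with h | h | h
  · exact ⟨0, by simp [h], by simp⟩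
  · exact ⟨1, by simp [h], by simp⟩
  · exact ⟨-1, by simp [h], by simp⟩

lemma four_ge_one {q1 q2 : ℕ} {χ1 : DirichletCharacter ℂ q1} {χ2 : DirichletCharacter ℂ q2}
    (h1 : χ1 ^ 2 = 1) (h2 : χ2 ^ 2 = 1) {σ : ℝ} (hσ : 1 < σ) :
    1 ≤ ‖riemannZeta σ‖ * ‖LSeries (fun n : ℕ => χ1 n) σ‖ * ‖LSeries (fun n : ℕ => χ2 n) σ‖ *
      ‖LSeries (fun n : ℕ => chProd χ1 χ2 n) σ‖ := by
  have hs : 1 < (σ : ℂ).re := by simpa using hσ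
  have H := (((riemannZeta_eulerProduct_hasProd hs).norm.mul (χ1.LSeries_eulerProduct_hasProd hs).norm).mul
    (χ2.LSeries_eulerProduct_hasProd hs).norm).mul ((chProd χ1 χ2).LSeries_eulerProduct_hasProd hs).norm
  refine ge_of_tendsto' H fun s => ?_
  refine Finset.prod_induction _ (fun z : ℝ => 1 ≤ z) (fun a b ha hb => one_le_mul_of_one_le_of_one_le ha hb) le_rfl
    fun p _ => ?_
  obtain ⟨u, hu, hu3⟩ := real_cases' h1 (p : ℕ)
  obtain ⟨v, hv, hv3⟩ := real_cases' h2 (p : ℕ)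
  rw [chProd_apply, hu, hv]
  have hp0 : (0:ℝ) < (p:ℕ) := by exact_mod_cast p.2.pos
  have hp1 : (1:ℝ) < (p:ℕ) := by exact_mod_cast p.2.one_lt
  set x : ℝ := ((p:ℕ):ℝ) ^ (-σ) with hx
  have hx0 : 0 < x := by positivity
  have hx1 : x < 1 := Real.rpow_lt_one_of_one_lt_of_neg hp1 (by linarith)
  have ex : ((p:ℕ):ℂ) ^ (-(σ:ℂ)) = (x : ℂ) := by
    rw [hx, Complex.ofReal_cpow hp0.le]; push_cast; rfl
  rw [ex]
  have en : ∀ w : ℝ, ‖(1 - (w:ℂ) * x)⁻¹‖ = |1 - w * x|⁻¹ := by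
    intro w
    rw [norm_inv, ← Real.norm_eq_abs, ← Complex.norm_real]; push_cast; rfl
  have en1 : ‖(1 - (x:ℂ))⁻¹‖ = |1 - x|⁻¹ := by
    rw [norm_inv, ← Real.norm_eq_abs, ← Complex.norm_real]; push_cast; rfl
  have huv : (u:ℂ) * v = ((u * v : ℝ) : ℂ) := by push_cast; rfl
  rw [huv, en, en, en, en1, ← mul_inv, ← mul_inv, ← mul_inv, ← abs_mul, ← abs_mul, ← abs_mul]
  have hq : 0 < 1 - x ^ 2 := by nlinarith
  have hkey : 0 < (1 - x) * (1 - u * x) * (1 - v * x) * (1 - u * v * x) ∧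
      (1 - x) * (1 - u * x) * (1 - v * x) * (1 - u * v * x) ≤ 1 := by
    have a1 : 0 < 1 - x := by linarith
    have a2 : 0 < 1 + x := by linarith
    have a3 : (1 - x) ≤ 1 := by linarith
    have a4 : (1 - x) * (1 + x) ≤ 1 := by nlinarith
    have a5 : 0 < (1 - x) * (1 + x) := by positivity
    have a6 : (1 - x) * (1 - x) ≤ 1 := by nlinarith
    rcases hu3 with rfl | rfl | rfl <;> rcases hv3 with rfl | rfl | rfl <;> norm_num
    · exact ⟨hx1, hx0.le⟩
    · refine ⟨by positivity, ?_⟩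
      exact a6
    · refine ⟨by positivity, ?_⟩
      exact a4
    · refine ⟨by positivity, ?_⟩
      exact a6
    · refine ⟨by positivity, ?_⟩
      calc (1 - x) * (1 - x) * (1 - x) * (1 - x) = ((1 - x) * (1 - x)) * ((1 - x) * (1 - x)) := by ring
        _ ≤ 1 := mul_le_one₀ a6 (by positivity) a6
    · refine ⟨by positivity, ?_⟩
      calc (1 - x) * (1 - x) * (1 + x) * (1 + x) = ((1 - x) * (1 + x)) * ((1 - x) * (1 + x)) := by ring
        _ ≤ 1 := mul_le_one₀ a4 (by positivity) a4
    · refine ⟨by positivity, ?_⟩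
      exact a4
    · refine ⟨by positivity, ?_⟩
      calc (1 - x) * (1 + x) * (1 - x) * (1 + x) = ((1 - x) * (1 + x)) * ((1 - x) * (1 + x)) := by ring
        _ ≤ 1 := mul_le_one₀ a4 (by positivity) a4
    · refine ⟨by positivity, ?_⟩
      calc (1 - x) * (1 + x) * (1 + x) * (1 - x) = ((1 - x) * (1 + x)) * ((1 - x) * (1 + x)) := by ring
        _ ≤ 1 := mul_le_one₀ a4 (by positivity) a4
  rw [abs_of_pos hkey.1]
  exact (one_le_inv₀ hkey.1).2 hkey.2

lemma norm_LF_step {q : ℕ} [NeZero q] {χ : DirichletCharacter ℂ q} (hχ : χ ≠ 1)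
    {l : ℝ} (hl : 2 ≤ l) (hql : (q:ℝ) ≤ exp l) {t σ σ' : ℝ} (hs1 : 1 - 1 / (2 * l) ≤ σ) (hs2 : σ ≤ 2)
    (hs1' : 1 - 1 / (2 * l) ≤ σ') (hs2' : σ' ≤ 2) (ht : |t| + 3 < exp l) :
    ‖χ.LFunction (σ + t * Complex.I) - χ.LFunction (σ' + t * Complex.I)‖ ≤ 400 * l ^ 2 * |σ - σ'| := by
  have hl0 : 0 < 1 / (2 * l) := by positivity
  have hl1 : 1 / (2 * l) ≤ 1 := by rw [div_le_one (by linarith)]; linarith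
  have hconv : Convex ℝ (segment ℝ ((σ':ℂ) + t * Complex.I) ((σ:ℂ) + t * Complex.I)) := convex_segment _ _
  have := hconv.norm_image_sub_le_of_norm_deriv_le (𝕜 := ℂ) (f := χ.LFunction) (C := 400 * l ^ 2)
    (fun x _ => (χ.differentiable_LFunction hχ) x) ?_ (left_mem_segment ℝ _ _) (right_mem_segment ℝ _ _)
  · refine this.trans (le_of_eq ?_)
    congr 1
    rw [← Real.norm_eq_abs, ← Complex.norm_real]; congr 1; push_cast; ring
  · rintro z ⟨a, b, ha, hb, hab, rfl⟩
    set w : ℝ := a * σ' + b * σ with hw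
    have hz : a • ((σ':ℂ) + t * Complex.I) + b • ((σ:ℂ) + t * Complex.I) = (w:ℂ) + t * Complex.I := by
      simp only [Complex.real_smul, hw]
      push_cast
      have : (a:ℂ) + b = 1 := by exact_mod_cast hab
      linear_combination (t * Complex.I) * this
    rw [hz]
    have hw1 : 1 - 1 / (2 * l) ≤ w := by
      have : a * (1 - 1 / (2 * l)) + b * (1 - 1 / (2 * l)) = 1 - 1 / (2 * l) := by rw [← add_mul, hab, one_mul]
      nlinarith
    have hw2 : w ≤ 2 := by
      have : a * 2 + b * 2 = (2:ℝ) := by rw [← add_mul, hab, one_mul]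
      nlinarith
    refine deriv_LFunction_bound hχ hl hql ?_ (by simpa using hw1)
    have h1 : ‖(w:ℂ) + t * Complex.I‖ ≤ |w| + |t| := by
      refine (norm_add_le _ _).trans (le_of_eq ?_)
      simp
    rw [abs_of_nonneg (by linarith)] at h1
    linarith

lemma norm_zeta_le {δ : ℝ} (h0 : 0 < δ) (h1 : δ ≤ 1) : ‖riemannZeta ((1 + δ : ℝ) : ℂ)‖ ≤ 2 / δ := by
  have h := zeta_le h0
  have hs : 1 < ((1 + δ : ℝ) : ℂ).re := by simp [h0]
  rw [zeta_eq_tsum_one_div_nat_cpow hs]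
  refine (norm_tsum_le_tsum_norm ?_).trans ?_
  · have : Summable fun n : ℕ => ‖(1:ℂ) / (n:ℂ) ^ ((1 + δ : ℝ) : ℂ)‖ :=
      (Complex.summable_one_div_nat_cpow.2 hs).norm
    exact this
  · have e : ∀ n : ℕ, ‖(1:ℂ) / (n:ℂ) ^ ((1 + δ : ℝ) : ℂ)‖ = (n:ℝ) ^ (-(1 + δ)) := by
      intro n
      rcases Nat.eq_zero_or_pos n with rfl | hn
      · have : (1 + δ : ℝ) ≠ 0 := by linarith
        have h2 : ((1 + δ : ℝ) : ℂ) ≠ 0 := by exact_mod_cast this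
        have h3 : -(1 + δ) ≠ 0 := by linarith
        rw [Nat.cast_zero, Complex.zero_cpow h2, Nat.cast_zero, Real.zero_rpow h3]; simp
      · rw [norm_div, norm_one, Complex.norm_natCast_cpow_of_pos hn, Real.rpow_neg (Nat.cast_nonneg n), one_div]; simp
    simp_rw [e]
    refine h.trans ?_
    rw [le_div_iff₀ h0, add_mul, div_mul_cancel₀ _ h0.ne']; linarith

lemma landau {q1 q2 : ℕ} [NeZero q1] [NeZero q2] {χ1 : DirichletCharacter ℂ q1} {χ2 : DirichletCharacter ℂ q2}
    (h1 : χ1 ^ 2 = 1) (h2 : χ2 ^ 2 = 1) (hn1 : χ1 ≠ 1) (hn2 : χ2 ≠ 1) (hp1 : χ1.IsPrimitive) (hp2 : χ2.IsPrimitive)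
    (hne : (⟨q1, χ1⟩ : Σ q, DirichletCharacter ℂ q) ≠ ⟨q2, χ2⟩) {l : ℝ} (hl : 2 ≤ l)
    (hq : ((q1 * q2 : ℕ):ℝ) ≤ exp l) (b1 : ‖χ1.LFunction 1‖ ≤ 1 / (10 ^ 8 * l ^ 3))
    (b2 : ‖χ2.LFunction 1‖ ≤ 1 / (10 ^ 8 * l ^ 3)) : False := by
  have hl0 : 0 < l := by linarith
  set δ : ℝ := 1 / (10 ^ 8 * l ^ 5) with hδ
  have hδ0 : 0 < δ := by positivity
  have hl5 : (1:ℝ) ≤ l ^ 5 := one_le_pow₀ (by linarith)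
  have hδ1 : δ ≤ 1 := by rw [hδ, div_le_one (by positivity)]; linarith
  have hinv : χ2⁻¹ = χ2 := by
    rw [inv_eq_iff_mul_eq_one, ← sq, h2]
  have hn12 : chProd χ1 χ2 ≠ 1 := by
    have := chProd_inv_ne_one (NeZero.ne q1) (NeZero.ne q2) hp1 hp2 hne
    rwa [hinv] at this
  have : NeZero (q1 * q2) := ⟨mul_ne_zero (NeZero.ne q1) (NeZero.ne q2)⟩
  have h4 := four_ge_one h1 h2 (σ := 1 + δ) (by linarith)
  have hs : 1 < ((1 + δ : ℝ) : ℂ).re := by simp [hδ0]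
  rw [← DirichletCharacter.LFunction_eq_LSeries χ1 hs, ← DirichletCharacter.LFunction_eq_LSeries χ2 hs,
    ← DirichletCharacter.LFunction_eq_LSeries (chProd χ1 χ2) hs] at h4
  have hexp : (7:ℝ) < exp l := by
    have : exp 2 ≤ exp l := Real.exp_le_exp.2 hl
    have h3 : exp 2 = exp 1 ^ 2 := by rw [← Real.exp_nat_mul]; norm_num
    have h4 := Real.exp_one_gt_d9
    nlinarith
  have q1p : (1:ℝ) ≤ q1 := by exact_mod_cast NeZero.pos q1
  have q2p : (1:ℝ) ≤ q2 := by exact_mod_cast NeZero.pos q2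
  push_cast at hq
  have hq1 : (q1:ℝ) ≤ exp l := by nlinarith
  have hq2 : (q2:ℝ) ≤ exp l := by nlinarith
  have hll : 0 < 1 / (2 * l) := by positivity
  have key : ∀ {q : ℕ} [NeZero q] {χ : DirichletCharacter ℂ q}, χ ≠ 1 → (q:ℝ) ≤ exp l →
      ‖χ.LFunction 1‖ ≤ 1 / (10 ^ 8 * l ^ 3) → ‖χ.LFunction ((1 + δ : ℝ):ℂ)‖ ≤ 401 / (10 ^ 8 * l ^ 3) := by
    intro q _ χ hχ hq hb
    have := norm_LF_step hχ hl hq (t := 0) (σ := 1 + δ) (σ' := 1) (by linarith) (by linarith) (by linarith)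
      (by linarith) (by rw [abs_zero]; linarith)
    rw [Complex.ofReal_zero, zero_mul, add_zero, add_zero, add_sub_cancel_left, abs_of_pos hδ0, Complex.ofReal_one] at this
    have t1 := norm_le_norm_add_norm_sub' (χ.LFunction ((1 + δ : ℝ):ℂ)) (χ.LFunction 1)
    have e : 400 * l ^ 2 * δ = 400 / (10 ^ 8 * l ^ 3) := by rw [hδ]; field_simp
    rw [e] at this
    have e2 : (401:ℝ) / (10 ^ 8 * l ^ 3) = 1 / (10 ^ 8 * l ^ 3) + 400 / (10 ^ 8 * l ^ 3) := by ring
    rw [e2]; linarith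
  have k1 := key hn1 hq1 b1
  have k2 := key hn2 hq2 b2
  have k12 : ‖(chProd χ1 χ2).LFunction ((1 + δ : ℝ):ℂ)‖ ≤ 100 * l := by
    refine LFunction_bound hn12 hl (by push_cast; exact hq) ?_ ?_
    · rw [Complex.norm_real, Real.norm_eq_abs, abs_of_pos (by linarith)]; linarith
    · rw [Complex.ofReal_re]
      have : 0 < 1 / l := by positivity
      linarith
  have kz := norm_zeta_le hδ0 hδ1
  have : ‖riemannZeta ((1 + δ : ℝ) : ℂ)‖ * ‖χ1.LFunction ((1 + δ : ℝ):ℂ)‖ * ‖χ2.LFunction ((1 + δ : ℝ):ℂ)‖ *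
      ‖(chProd χ1 χ2).LFunction ((1 + δ : ℝ):ℂ)‖ ≤ (2 / δ) * (401 / (10 ^ 8 * l ^ 3)) * (401 / (10 ^ 8 * l ^ 3)) * (100 * l) := by
    gcongr
  have e : (2 / δ) * (401 / (10 ^ 8 * l ^ 3)) * (401 / (10 ^ 8 * l ^ 3)) * (100 * l) = 200 * 401 ^ 2 / 10 ^ 8 := by
    rw [hδ]; field_simp; norm_num
  rw [e] at this
  have h9 := h4.trans this
  norm_num at h9

end PG

namespace PG
open Real Finset

/-- no exceptional real primitive character at scale l -/
def Good (l : ℝ) : Prop := ∀ (q : ℕ) [NeZero q] (χ : DirichletCharacter ℂ q), χ.IsPrimitive → χ ^ 2 = 1 → χ ≠ 1 →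
  (q : ℝ) ≤ exp (l / 2) → 1 / (10 ^ 8 * l ^ 3) ≤ ‖χ.LFunction 1‖

lemma exists_good (l0 : ℝ) : ∃ l, l0 ≤ l ∧ Good l := by
  set l1 := max l0 2 with hl1
  have h2 : 2 ≤ l1 := le_max_right _ _
  by_cases hg : Good l1
  · exact ⟨l1, le_max_left _ _, hg⟩
  unfold Good at hg
  push Not at hg
  obtain ⟨q1, hq1, χ1, hp1, hs1, hn1, hq1l, hb⟩ := hg
  set b := ‖χ1.LFunction 1‖ with hbdef
  have hb0 : 0 < b := norm_pos_iff.2 (DirichletCharacter.LFunction_apply_one_ne_zero hn1)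
  set l : ℝ := (1 / (10 ^ 8 * b)) ^ ((1:ℝ) / 3) with hl
  have hl3 : l ^ 3 = 1 / (10 ^ 8 * b) := by
    rw [hl, ← Real.rpow_natCast, ← Real.rpow_mul (by positivity)]; norm_num
  have hlb : 1 / (10 ^ 8 * l ^ 3) = b := by rw [hl3]; field_simp
  have hl0 : 0 ≤ l := by positivity
  have hll : l1 ≤ l := by
    refine le_of_pow_le_pow_left₀ (n := 3) (by norm_num) hl0 ?_
    rw [hl3, le_div_iff₀ (by positivity)]
    rw [lt_div_iff₀ (by positivity)] at hb
    linarith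
  refine ⟨l, (le_max_left _ _).trans hll, ?_⟩
  intro q2 _ χ2 hp2 hs2 hn2 hq2
  by_contra! hlt
  by_cases he : (⟨q1, χ1⟩ : Σ q, DirichletCharacter ℂ q) = ⟨q2, χ2⟩
  · cases he
    rw [hlb] at hlt
    exact lt_irrefl _ hlt
  · refine landau hs1 hs2 hn1 hn2 hp1 hp2 he (h2.trans hll) ?_ hlb.ge hlt.le
    push_cast
    calc (q1:ℝ) * q2 ≤ exp (l / 2) * exp (l / 2) := by
          gcongr
          exact hq1l.trans (Real.exp_le_exp.2 (by linarith))
      _ = exp l := by rw [← Real.exp_add]; congr 1; ring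

lemma LF_step {q : ℕ} [NeZero q] {χ : DirichletCharacter ℂ q} (hχ : χ ≠ 1)
    {l : ℝ} (hl : 2 ≤ l) (hql : (q:ℝ) ≤ exp l) {s s' : ℂ} (hs1 : 1 - 1 / (2 * l) ≤ s.re) (hs2 : ‖s‖ + 1 < exp l)
    (hs1' : 1 - 1 / (2 * l) ≤ s'.re) (hs2' : ‖s'‖ + 1 < exp l) :
    ‖χ.LFunction s - χ.LFunction s'‖ ≤ 400 * l ^ 2 * ‖s - s'‖ := by
  have hconv : Convex ℝ ({z : ℂ | 1 - 1 / (2 * l) ≤ z.re} ∩ Metric.ball 0 (exp l - 1)) :=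
    (convex_halfSpace_re_ge _).inter (convex_ball _ _)
  refine hconv.norm_image_sub_le_of_norm_deriv_le (𝕜 := ℂ) (f := χ.LFunction) (C := 400 * l ^ 2)
    (fun x _ => (χ.differentiable_LFunction hχ) x) ?_ ⟨hs1', ?_⟩ ⟨hs1, ?_⟩
  · rintro z ⟨hz1, hz2⟩
    refine deriv_LFunction_bound hχ hl hql ?_ hz1
    have : ‖z‖ < exp l - 1 := by simpa using hz2
    linarith
  · rw [mem_ball_zero_iff]; linarith
  · rw [mem_ball_zero_iff]; linarith

lemma exp_ge_big {l : ℝ} (hl : 10 ^ 9 ≤ l) : 2 * exp (l / 2) + 5 < exp l := by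
  have h1 : exp l = exp (l / 2) * exp (l / 2) := by rw [← Real.exp_add]; congr 1; ring
  have h2 := Real.add_one_le_exp (l / 2)
  rw [h1]; nlinarith

lemma norm_st (σ t : ℝ) : ‖(σ:ℂ) + t * Complex.I‖ ≤ |σ| + |t| := by
  refine (norm_add_le _ _).trans (le_of_eq ?_)
  simp

lemma LF_lower {l : ℝ} (hl : 10 ^ 9 ≤ l) (hg : Good l) {q : ℕ} [NeZero q] {χ : DirichletCharacter ℂ q} (hχ : χ ≠ 1)
    (hp : χ.IsPrimitive) (hql : (q:ℝ) ≤ exp (l / 2)) {t : ℝ} (ht : |t| ≤ exp (l / 2)) :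
    1 / l ^ 18 ≤ ‖χ.LFunction (1 + t * Complex.I)‖ := by
  have hl0 : 0 < l := by linarith
  have hl2 : 2 ≤ l := by linarith
  have hbig := exp_ge_big hl
  have hexp0 := Real.exp_pos (l / 2)
  have hql' : (q:ℝ) ≤ exp l := by linarith
  have hinv : 0 < 1 / (2 * l) := by positivity
  have hinv1 : 0 < 1 / l := by positivity
  have habs : ‖(1:ℂ) + t * Complex.I‖ ≤ 1 + |t| := by simpa using norm_st 1 t
  by_cases hcase : χ ^ 2 = 1 ∧ |t| ≤ 1 / l ^ 8
  · obtain ⟨hr, htt⟩ := hcase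
    have h1 := hg q χ hp hr hχ hql
    have h2 := LF_step hχ hl2 hql' (s := 1 + t * Complex.I) (s' := 1) (by simp [hl0.le]) (by linarith)
      (by simp [hl0.le]) (by simp; linarith)
    have e1 : ‖(1:ℂ) + t * Complex.I - 1‖ = |t| := by simp
    rw [e1] at h2
    have h3 : 400 * l ^ 2 * |t| ≤ 1 / (10 ^ 8 * l ^ 3) / 2 := by
      calc 400 * l ^ 2 * |t| ≤ 400 * l ^ 2 * (1 / l ^ 8) := by gcongr
        _ = (1 / l ^ 3) * (400 / l ^ 3) := by field_simp
        _ ≤ (1 / l ^ 3) * (1 / (2 * 10 ^ 8)) := by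
            refine mul_le_mul_of_nonneg_left ?_ (by positivity)
            rw [div_le_div_iff₀ (by positivity) (by positivity)]
            have : (10 ^ 9) ^ 3 ≤ l ^ 3 := by gcongr
            linarith
        _ = _ := by field_simp
    have h4 := norm_sub_norm_le (χ.LFunction 1) (χ.LFunction (1 + t * Complex.I))
    rw [norm_sub_rev] at h4
    have h5 : 1 / l ^ 18 ≤ 1 / (10 ^ 8 * l ^ 3) / 2 := by
      rw [div_div]
      refine one_div_le_one_div_of_le (by positivity) ?_
      calc 10 ^ 8 * l ^ 3 * 2 ≤ l * l ^ 3 := by nlinarith [pow_pos hl0 3]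
        _ = l ^ 4 := by ring
        _ ≤ l ^ 18 := by gcongr <;> linarith
    linarith
  -- main case
  by_contra! hlt
  set δ : ℝ := 1 / l ^ 21 with hδ
  have hδ0 : 0 < δ := by positivity
  have hδ1 : δ ≤ 1 := by
    rw [hδ, div_le_one (by positivity)]; exact one_le_pow₀ (by linarith)
  have h341 := DirichletCharacter.norm_LSeries_product_ge_one χ hδ0 t
  rw [norm_mul, norm_mul, norm_pow, norm_pow] at h341
  -- principal factor
  have b0 : ‖LSeries (fun n : ℕ => (1 : DirichletCharacter ℂ q) n) (1 + δ)‖ ≤ 3 / δ := by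
    have := LSeries_bound (q := q) NeZero.one_le (f := (1 : DirichletCharacter ℂ q))
      (fun a => DirichletCharacter.norm_le_one _ a) (s := (1 + δ : ℂ)) (by simp [hδ0]) hl2 hql'
      (by
        have : ‖(1 + δ : ℂ)‖ ≤ 1 + δ := by
          refine (norm_add_le _ _).trans (le_of_eq ?_)
          simp [abs_of_pos hδ0]
        linarith)
    rw [add_sub_cancel_left, Complex.norm_real, Real.norm_eq_abs, abs_of_pos hδ0] at this
    refine this.trans ?_
    have e : (3:ℝ) / δ = 1 / δ + 2 / δ := by ring
    rw [e]
    gcongr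
    rw [hδ, one_div_one_div]
    calc 100 * l ≤ l * l := by nlinarith
      _ = l ^ 2 := by ring
      _ ≤ l ^ 21 := by gcongr <;> linarith
  have b1 : ‖LSeries (fun n : ℕ => χ n) (1 + δ + Complex.I * t)‖ ≤ 2 / l ^ 18 := by
    have hs : 1 < (1 + δ + Complex.I * t : ℂ).re := by simp [hδ0]
    rw [← DirichletCharacter.LFunction_eq_LSeries χ hs]
    have hn : ‖(1 + δ + Complex.I * t : ℂ)‖ ≤ 2 + |t| := by
      have := norm_st (1 + δ) t
      rw [abs_of_pos (by linarith)] at this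
      have e : (1 + δ + Complex.I * t : ℂ) = ((1 + δ : ℝ) : ℂ) + t * Complex.I := by push_cast; ring
      rw [e]; linarith
    have h2 := LF_step hχ hl2 hql' (s := 1 + δ + Complex.I * t) (s' := 1 + t * Complex.I)
      (by simp; linarith [inv_pos.2 hl0]) (by linarith)
      (by simp [hl0.le]) (by linarith)
    have e1 : ‖(1 + δ + Complex.I * t : ℂ) - (1 + t * Complex.I)‖ = δ := by
      have : (1 + δ + Complex.I * t : ℂ) - (1 + t * Complex.I) = (δ : ℂ) := by ring
      rw [this, Complex.norm_real, Real.norm_eq_abs, abs_of_pos hδ0]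
    rw [e1] at h2
    have h3 : 400 * l ^ 2 * δ ≤ 1 / l ^ 18 := by
      rw [hδ]
      calc 400 * l ^ 2 * (1 / l ^ 21) = (400 / l) * (1 / l ^ 18) := by field_simp
        _ ≤ 1 * (1 / l ^ 18) := by
          gcongr
          rw [div_le_one hl0]; linarith
        _ = _ := one_mul _
    have h4 := norm_sub_norm_le (χ.LFunction (1 + δ + Complex.I * t)) (χ.LFunction (1 + t * Complex.I))
    have e2 : 2 / l ^ 18 = 1 / l ^ 18 + 1 / l ^ 18 := by ring
    rw [e2]; linarith
  have b2 : ‖LSeries (fun n : ℕ => (χ ^ 2) n) (1 + δ + 2 * Complex.I * t)‖ ≤ 2 * l ^ 8 := by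
    have hs : 1 < (1 + δ + 2 * Complex.I * t : ℂ).re := by simp [hδ0]
    have hn : ‖(1 + δ + 2 * Complex.I * t : ℂ)‖ ≤ 2 + 2 * |t| := by
      have := norm_st (1 + δ) (2 * t)
      rw [abs_of_pos (by linarith), abs_mul, abs_of_pos (by norm_num : (0:ℝ) < 2)] at this
      have e : (1 + δ + 2 * Complex.I * t : ℂ) = ((1 + δ : ℝ) : ℂ) + ((2 * t : ℝ) : ℂ) * Complex.I := by push_cast; ring
      rw [e]; linarith
    have hl8 : 100 * l ≤ l ^ 8 := by
      calc 100 * l ≤ l * l := by nlinarith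
        _ = l ^ 2 := by ring
        _ ≤ l ^ 8 := by gcongr <;> linarith
    have hl80 : 0 < l ^ 8 := by positivity
    by_cases hsq : χ ^ 2 = 1
    · have htt : 1 / l ^ 8 < |t| := by
        by_contra! h; exact hcase ⟨hsq, h⟩
      have := LSeries_bound (q := q) NeZero.one_le (f := (χ ^ 2 : DirichletCharacter ℂ q))
        (fun a => DirichletCharacter.norm_le_one _ a) hs hl2 hql' (by linarith)
      have h5 : 2 * |t| ≤ ‖(1 + δ + 2 * Complex.I * t : ℂ) - 1‖ := by
        have := Complex.abs_im_le_norm ((1 + δ + 2 * Complex.I * t : ℂ) - 1)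
        simpa [abs_mul] using this
      have ht0 : 0 < |t| := lt_trans (by positivity) htt
      have h6 : 2 / ‖(1 + δ + 2 * Complex.I * t : ℂ) - 1‖ ≤ l ^ 8 := by
        calc 2 / ‖(1 + δ + 2 * Complex.I * t : ℂ) - 1‖ ≤ 2 / (2 * |t|) := by gcongr
          _ = 1 / |t| := by field_simp
          _ ≤ 1 / (1 / l ^ 8) := by gcongr
          _ = l ^ 8 := one_div_one_div _
      linarith
    · rw [← DirichletCharacter.LFunction_eq_LSeries (χ ^ 2) hs]
      have := LFunction_bound hsq hl2 hql' (s := 1 + δ + 2 * Complex.I * t) (by linarith) (by linarith)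
      linarith
  have : ‖LSeries (fun n : ℕ => (1 : DirichletCharacter ℂ q) n) (1 + δ)‖ ^ 3 *
      ‖LSeries (fun n : ℕ => χ n) (1 + δ + Complex.I * t)‖ ^ 4 *
      ‖LSeries (fun n : ℕ => (χ ^ 2) n) (1 + δ + 2 * Complex.I * t)‖ ≤ (3 / δ) ^ 3 * (2 / l ^ 18) ^ 4 * (2 * l ^ 8) := by
    gcongr
  have e : (3 / δ) ^ 3 * (2 / l ^ 18) ^ 4 * (2 * l ^ 8) = 864 / l := by
    rw [hδ]; field_simp; norm_num
  rw [e] at this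
  have h9 : (864:ℝ) / l < 1 := by rw [div_lt_one hl0]; linarith
  have h10 := h341.le.trans this
  linarith

lemma LF_region {l : ℝ} (hl : 10 ^ 9 ≤ l) (hg : Good l) {q : ℕ} [NeZero q] {χ : DirichletCharacter ℂ q} (hχ : χ ≠ 1)
    (hp : χ.IsPrimitive) (hql : (q:ℝ) ≤ exp (l / 2)) {s : ℂ} (ht : |s.im| ≤ exp (l / 2)) (hσ : |s.re - 1| ≤ 1 / l ^ 22) :
    χ.LFunction s ≠ 0 ∧ ‖deriv χ.LFunction s / χ.LFunction s‖ ≤ l ^ 22 := by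
  have hl0 : 0 < l := by linarith
  have hl2 : 2 ≤ l := by linarith
  have hbig := exp_ge_big hl
  have hexp0 := Real.exp_pos (l / 2)
  have hql' : (q:ℝ) ≤ exp l := by linarith
  have hlow := LF_lower hl hg hχ hp hql ht
  have hd1 : 1 / l ^ 22 ≤ 1 / (2 * l) := by
    refine one_div_le_one_div_of_le (by positivity) ?_
    calc 2 * l ≤ l * l := by nlinarith
      _ = l ^ 2 := by ring
      _ ≤ l ^ 22 := by gcongr <;> linarith
  have hd2 : 1 / (2 * l) ≤ 1 := by rw [div_le_one (by linarith)]; linarith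
  have hσ' := abs_le.1 hσ
  have hs : ‖s‖ + 1 < exp l := by
    have := norm_st s.re s.im
    rw [Complex.re_add_im] at this
    have h1 : |s.re| ≤ 2 := abs_le.2 ⟨by linarith, by linarith⟩
    linarith
  have hs' : ‖(1:ℂ) + s.im * Complex.I‖ + 1 < exp l := by
    have := norm_st 1 s.im
    rw [abs_one, Complex.ofReal_one] at this
    linarith
  have hre : 1 - 1 / (2 * l) ≤ s.re := by linarith
  have h2 := LF_step hχ hl2 hql' (s := 1 + s.im * Complex.I) (s' := s) (by simp [hl0.le]) hs' hre hs
  have e1 : ‖(1:ℂ) + s.im * Complex.I - s‖ = |s.re - 1| := by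
    have : (1:ℂ) + s.im * Complex.I - s = ((1 - s.re : ℝ) : ℂ) := by
      apply Complex.ext <;> simp
    rw [this, Complex.norm_real, Real.norm_eq_abs, abs_sub_comm]
  rw [e1] at h2
  have h3 : 400 * l ^ 2 * |s.re - 1| ≤ 1 / l ^ 18 / 2 := by
    calc 400 * l ^ 2 * |s.re - 1| ≤ 400 * l ^ 2 * (1 / l ^ 22) := by gcongr
      _ = (400 / l ^ 2) * (1 / l ^ 18) := by field_simp
      _ ≤ (1 / 2) * (1 / l ^ 18) := by
        refine mul_le_mul_of_nonneg_right ?_ (by positivity)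
        rw [div_le_div_iff₀ (by positivity) (by norm_num)]; nlinarith
      _ = _ := by ring
  have h4 := norm_sub_norm_le (χ.LFunction (1 + s.im * Complex.I)) (χ.LFunction s)
  have h5 : 1 / l ^ 18 / 2 ≤ ‖χ.LFunction s‖ := by linarith
  have h50 : 0 < 1 / l ^ 18 / 2 := by positivity
  refine ⟨norm_pos_iff.1 (h50.trans_le h5), ?_⟩
  have h6 := deriv_LFunction_bound hχ hl2 hql' hs hre
  rw [norm_div]
  calc ‖deriv χ.LFunction s‖ / ‖χ.LFunction s‖ ≤ (400 * l ^ 2) / (1 / l ^ 18 / 2) := by gcongr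
    _ = 800 * l ^ 20 := by field_simp; norm_num
    _ ≤ l ^ 2 * l ^ 20 := by gcongr; nlinarith
    _ = l ^ 22 := by ring

end PG

namespace PG
open Real Finset MeasureTheory

/-- the kernel -/
noncomputable def Ker (y : ℝ) (s : ℂ) : ℂ := Complex.exp ((s - cy y) ^ 2 / 2) * Complex.exp ((s - cy y) * y)

lemma Ker_line (y t : ℝ) : Ker y (cy y + t * Complex.I) = ga y t := by
  unfold Ker ga
  rw [add_sub_cancel_left]
  congr 2
  · rw [mul_pow, Complex.I_sq]; ring
  · ring

lemma norm_Ker (y σ t : ℝ) : ‖Ker y (σ + t * Complex.I)‖ = exp (((σ - cy y) ^ 2 - t ^ 2) / 2) * exp ((σ - cy y) * y) := by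
  unfold Ker
  rw [norm_mul, Complex.norm_exp, Complex.norm_exp]
  have e : (σ:ℂ) + t * Complex.I - cy y = ((σ - cy y : ℝ) : ℂ) + t * Complex.I := by push_cast; ring
  rw [e]
  congr 2
  · have : (((σ - cy y : ℝ) : ℂ) + t * Complex.I) ^ 2 / 2 =
        ((((σ - cy y) ^ 2 - t ^ 2) / 2 : ℝ) : ℂ) + (((σ - cy y) * t : ℝ) : ℂ) * Complex.I := by
      push_cast
      have := Complex.I_sq
      linear_combination ((t:ℂ) ^ 2 / 2) * this
    rw [this, Complex.add_re, Complex.ofReal_re, Complex.re_ofReal_mul, Complex.I_re]; ring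
  · simp

lemma exp_two_le : exp 2 ≤ 8 := by
  have h := Real.exp_one_lt_d9
  have e2 : exp 2 = exp 1 ^ 2 := by rw [← Real.exp_nat_mul]; norm_num
  have h0 := Real.exp_pos 1
  rw [e2]; nlinarith

lemma contour {y η T K : ℝ} (hy : 1 ≤ y) (hη : 0 ≤ η) (hη1 : η ≤ 1) (hT : 0 ≤ T) (hK : 0 ≤ K) {D : ℂ → ℂ}
    (hD : ∀ s : ℂ, 1 - η ≤ s.re → s.re ≤ cy y → |s.im| ≤ T → DifferentiableAt ℂ D s ∧ ‖D s‖ ≤ K) :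
    ‖∫ t in (-T)..T, ga y t * D (cy y + t * Complex.I)‖ ≤ K * (32 * exp (-T ^ 2 / 2) + 16 * T * exp (-(η * y))) := by
  have hcy : cy y = 1 + 1 / y := rfl
  have hy0 : 0 < 1 / y := by positivity
  have hy1 : 1 / y ≤ 1 := by rw [div_le_one (by linarith)]; exact hy
  have hle : 1 - η ≤ cy y := by rw [hcy]; linarith
  have h := Complex.integral_boundary_rect_eq_zero_of_differentiableOn (fun s => Ker y s * D s)
    ⟨1 - η, -T⟩ ⟨cy y, T⟩ ?_
  swap
  · rintro s ⟨hs1, hs2⟩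
    simp only [Set.mem_preimage] at hs1 hs2
    rw [Set.uIcc_of_le hle] at hs1
    rw [Set.uIcc_of_le (by linarith)] at hs2
    refine (DifferentiableAt.mul ?_ (hD s hs1.1 hs1.2 (abs_le.2 hs2)).1).differentiableWithinAt
    unfold Ker; fun_prop
  simp only at h
  have hcont : ‖∫ t in (-T)..T, ga y t * D (cy y + t * Complex.I)‖ =
      ‖Complex.I • ∫ t in (-T)..T, Ker y ((cy y:ℝ) + t * Complex.I) * D (cy y + t * Complex.I)‖ := by
    rw [norm_smul, Complex.norm_I, one_mul]
    simp_rw [Ker_line]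
  rw [hcont]
  have hsolve : ∀ a b c d : ℂ, a - b + c - d = 0 → ‖c‖ ≤ ‖a‖ + ‖b‖ + ‖d‖ := by
    intro a b c d h
    have : c = d + b - a := by linear_combination h
    rw [this]
    refine (norm_sub_le _ _).trans ?_
    have := norm_add_le d b
    linarith
  refine (hsolve _ _ _ _ h).trans ?_
  have hsq : ∀ σ : ℝ, 1 - η ≤ σ → σ ≤ cy y → (σ - cy y) ^ 2 ≤ 4 := by
    intro σ h1 h2
    rw [hcy] at h2 ⊢
    have : |σ - (1 + 1 / y)| ≤ 2 := abs_le.2 ⟨by linarith, by linarith⟩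
    calc (σ - (1 + 1 / y)) ^ 2 = |σ - (1 + 1 / y)| ^ 2 := (sq_abs _).symm
      _ ≤ 2 ^ 2 := by gcongr
      _ = 4 := by norm_num
  have hhor : ∀ T' : ℝ, |T'| = T → ‖∫ x in (1 - η)..(cy y), Ker y (x + (T':ℝ) * Complex.I) * D (x + (T':ℝ) * Complex.I)‖ ≤
      K * (16 * exp (-T ^ 2 / 2)) := by
    intro T' hT'
    have := intervalIntegral.norm_integral_le_of_norm_le_const (a := 1 - η) (b := cy y)
      (f := fun x : ℝ => Ker y (x + (T':ℝ) * Complex.I) * D (x + (T':ℝ) * Complex.I))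
      (C := 8 * exp (-T ^ 2 / 2) * K) ?_
    · refine this.trans ?_
      have h2 : |cy y - (1 - η)| ≤ 2 := by
        rw [abs_of_nonneg (by linarith), hcy]; linarith
      calc 8 * exp (-T ^ 2 / 2) * K * |cy y - (1 - η)| ≤ 8 * exp (-T ^ 2 / 2) * K * 2 := by gcongr
        _ = _ := by ring
    · intro x hx
      rw [Set.uIoc_of_le hle] at hx
      rw [norm_mul, norm_Ker]
      have hd := (hD (x + (T':ℝ) * Complex.I) (by simp; linarith [hx.1]) (by simp; exact hx.2) (by simp [hT'])).2
      refine mul_le_mul ?_ hd (norm_nonneg _) (by positivity)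
      have e1 : exp (((x - cy y) ^ 2 - T' ^ 2) / 2) ≤ 8 * exp (-T ^ 2 / 2) := by
        calc exp (((x - cy y) ^ 2 - T' ^ 2) / 2) ≤ exp (2 + -T ^ 2 / 2) := by
              apply Real.exp_le_exp.2
              have := hsq x hx.1.le hx.2
              rw [← sq_abs T', hT']; linarith
          _ = exp 2 * exp (-T ^ 2 / 2) := Real.exp_add _ _
          _ ≤ _ := by gcongr; exact exp_two_le
      have e2 : exp ((x - cy y) * y) ≤ 1 := by
        apply Real.exp_le_one_iff.2
        exact mul_nonpos_of_nonpos_of_nonneg (by linarith [hx.2]) (by linarith)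
      calc exp (((x - cy y) ^ 2 - T' ^ 2) / 2) * exp ((x - cy y) * y) ≤ 8 * exp (-T ^ 2 / 2) * 1 := by gcongr
        _ = _ := mul_one _
  have h1 := hhor (-T) (by rw [abs_neg, abs_of_nonneg hT])
  have h2 := hhor T (abs_of_nonneg hT)
  have h3 : ‖Complex.I • ∫ t in (-T)..T, Ker y ((1 - η : ℝ) + t * Complex.I) * D ((1 - η : ℝ) + t * Complex.I)‖ ≤
      K * (16 * T * exp (-(η * y))) := by
    rw [norm_smul, Complex.norm_I, one_mul]
    have := intervalIntegral.norm_integral_le_of_norm_le_const (a := -T) (b := T)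
      (f := fun t : ℝ => Ker y ((1 - η : ℝ) + t * Complex.I) * D ((1 - η : ℝ) + t * Complex.I))
      (C := 8 * exp (-(η * y)) * K) ?_
    · refine this.trans (le_of_eq ?_)
      rw [abs_of_nonneg (by linarith)]; ring
    · intro t ht
      rw [Set.uIoc_of_le (by linarith)] at ht
      rw [norm_mul, norm_Ker]
      have hd := (hD ((1 - η : ℝ) + t * Complex.I) (by simp) (by simp; linarith) (by simp; exact abs_le.2 ⟨ht.1.le, ht.2⟩)).2
      refine mul_le_mul ?_ hd (norm_nonneg _) (by positivity)
      refine mul_le_mul ?_ ?_ (by positivity) (by norm_num)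
      · refine le_trans (Real.exp_le_exp.2 ?_) exp_two_le
        have := hsq (1 - η) le_rfl hle
        nlinarith [sq_nonneg t]
      · apply Real.exp_le_exp.2
        have h5 : 1 - η - cy y ≤ - η := by rw [hcy]; linarith
        nlinarith
  calc _ ≤ K * (16 * exp (-T ^ 2 / 2)) + K * (16 * exp (-T ^ 2 / 2)) + K * (16 * T * exp (-(η * y))) :=
        add_le_add (add_le_add h1 h2) h3
    _ = _ := by ring

end PG

namespace PG
open Real Finset MeasureTheory Filter

lemma Lam_sum_le {y : ℝ} (hy : 1 ≤ y) :
    Summable (fun n : ℕ => ArithmeticFunction.vonMangoldt n * (n:ℝ) ^ (-(cy y))) ∧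
    ∑' n : ℕ, ArithmeticFunction.vonMangoldt n * (n:ℝ) ^ (-(cy y)) ≤ 6 * y ^ 2 := by
  have hy0 : 0 < y := by linarith
  have hε : 0 < 1 / (2 * y) := by positivity
  have hz := zeta_le hε
  have hsum : Summable fun n : ℕ => (n:ℝ) ^ (-(1 + 1 / (2 * y))) := summable_rpow_neg (by linarith)
  have hle : ∀ n : ℕ, ArithmeticFunction.vonMangoldt n * (n:ℝ) ^ (-(cy y)) ≤ (2 * y) * (n:ℝ) ^ (-(1 + 1 / (2 * y))) := by
    intro n
    rcases Nat.eq_zero_or_pos n with rfl | hn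
    · simp; positivity
    have hn0 : (0:ℝ) < n := by exact_mod_cast hn
    have h1 : ArithmeticFunction.vonMangoldt n ≤ log n := ArithmeticFunction.vonMangoldt_le_log
    have h2 : log n ≤ (n:ℝ) ^ (1 / (2 * y)) / (1 / (2 * y)) := Real.log_le_rpow_div hn0.le hε
    have e : -(1 + 1 / (2 * y)) = 1 / (2 * y) + -(cy y) := by unfold cy; field_simp; ring
    rw [e, Real.rpow_add hn0]
    have e3 : (n:ℝ) ^ (1 / (2 * y)) / (1 / (2 * y)) = 2 * y * (n:ℝ) ^ (1 / (2 * y)) := by field_simp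
    rw [e3] at h2
    rw [← mul_assoc]
    have : (0:ℝ) ≤ (n:ℝ) ^ (-(cy y)) := by positivity
    nlinarith
  have h0 : ∀ n : ℕ, 0 ≤ ArithmeticFunction.vonMangoldt n * (n:ℝ) ^ (-(cy y)) := fun n =>
    mul_nonneg ArithmeticFunction.vonMangoldt_nonneg (by positivity)
  have hs := Summable.of_nonneg_of_le h0 hle (hsum.mul_left _)
  refine ⟨hs, ?_⟩
  refine (hs.tsum_le_tsum hle (hsum.mul_left _)).trans ?_
  rw [tsum_mul_left]
  rw [one_div_one_div] at hz
  calc 2 * y * ∑' n : ℕ, (n:ℝ) ^ (-(1 + 1 / (2 * y))) ≤ 2 * y * (1 + 2 * y) := by gcongr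
    _ ≤ 6 * y ^ 2 := by nlinarith

lemma norm_LSeries_Lam_le {y : ℝ} (hy : 1 ≤ y) {q : ℕ} (χ : DirichletCharacter ℂ q) (t : ℝ) :
    ‖LSeries ((fun n : ℕ => χ n) * (fun n : ℕ => (ArithmeticFunction.vonMangoldt n : ℂ))) (cy y + t * Complex.I)‖ ≤ 6 * y ^ 2 := by
  obtain ⟨hs, hle⟩ := Lam_sum_le hy
  refine le_trans ?_ hle
  refine tsum_of_norm_bounded hs.hasSum fun n => ?_
  rcases Nat.eq_zero_or_pos n with rfl | hn
  · simp
  rw [LSeries.norm_term_eq, if_neg (by omega)]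
  simp only [Pi.mul_apply, norm_mul, Complex.add_re, Complex.ofReal_re, Complex.re_ofReal_mul, Complex.I_re, mul_zero, add_zero]
  rw [Complex.norm_real, Real.norm_of_nonneg ArithmeticFunction.vonMangoldt_nonneg, Real.rpow_neg (Nat.cast_nonneg n), div_eq_mul_inv]
  have := DirichletCharacter.norm_le_one χ (n : ZMod q)
  have h2 : 0 ≤ ArithmeticFunction.vonMangoldt n := ArithmeticFunction.vonMangoldt_nonneg
  refine mul_le_mul_of_nonneg_right ?_ (by positivity)
  nlinarith

lemma SW_bound {y l : ℝ} (hy : 1 ≤ y) (hl : 10 ^ 9 ≤ l) (hg : Good l) (hyl : y ≤ exp (l / 2)) (hly : l ^ 22 ≤ y)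
    {q : ℕ} [NeZero q] {χ : DirichletCharacter ℂ q} (hχ : χ ≠ 1) (hp : χ.IsPrimitive) (hql : (q:ℝ) ≤ exp (l / 2)) :
    ‖∑' n : ℕ, (χ n * (ArithmeticFunction.vonMangoldt n : ℂ)) * om y n‖ ≤
      l ^ 22 * (32 * exp (-y ^ 2 / 2) + 16 * y * exp (-(1 / l ^ 22 * y))) + 24 * y ^ 2 * exp (-y ^ 2 / 4) := by
  have hl0 : 0 < l := by linarith
  have hy0 : 0 < y := by linarith
  have hc1 : 1 < cy y := by unfold cy; have : 0 < 1 / y := by positivity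
                            linarith
  set a : ℕ → ℂ := (fun n : ℕ => χ n) * (fun n : ℕ => (ArithmeticFunction.vonMangoldt n : ℂ)) with ha
  have hre : ∀ t : ℝ, 1 < ((cy y : ℂ) + t * Complex.I).re := by intro t; simpa using hc1
  have hsum : LSeriesSummable a (cy y) := χ.LSeriesSummable_twist_vonMangoldt (by simpa using hc1)
  have hIntg := om_sum_integral hy hsum
  set D : ℂ → ℂ := fun s => - deriv χ.LFunction s / χ.LFunction s with hD
  have hLD : ∀ t : ℝ, LSeries a (cy y + t * Complex.I) = D (cy y + t * Complex.I) := by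
    intro t
    rw [ha, χ.LSeries_twist_vonMangoldt_eq (hre t), hD]
    simp only
    rw [DirichletCharacter.LFunction_eq_LSeries χ (hre t), DirichletCharacter.deriv_LFunction_eq_deriv_LSeries χ (hre t)]
  have hdL := χ.differentiable_LFunction hχ
  have hne : ∀ t : ℝ, χ.LFunction (cy y + t * Complex.I) ≠ 0 := fun t =>
    DirichletCharacter.LFunction_ne_zero_of_one_le_re χ (Or.inl hχ) (hre t).le
  have hcontD : Continuous fun t : ℝ => D (cy y + t * Complex.I) := by
    have c1 : Continuous (deriv χ.LFunction) := (hdL.contDiff (n := 1)).continuous_deriv le_rfl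
    have c2 : Continuous χ.LFunction := hdL.continuous
    have c3 : Continuous fun t : ℝ => (cy y + t * Complex.I : ℂ) := by fun_prop
    exact (c1.comp c3).neg.div (c2.comp c3) hne
  set g : ℝ → ℂ := fun t => ga y t * D (cy y + t * Complex.I) with hgdef
  have hgM : ∀ t, ‖g t‖ ≤ 6 * y ^ 2 * ‖ga y t‖ := by
    intro t
    rw [hgdef]
    simp only [norm_mul]
    rw [← hLD, mul_comm]
    exact mul_le_mul_of_nonneg_right (norm_LSeries_Lam_le hy χ t) (norm_nonneg _)
  have hgi : Integrable g := by
    refine Integrable.mono' ((integrable_norm_ga y).const_mul (6 * y ^ 2)) ?_ (Filter.Eventually.of_forall hgM)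
    exact ((cont_ga y).mul hcontD).aestronglyMeasurable
  have hIntg2 : √(2 * π) * (∑' n : ℕ, a n * om y n) = ∫ t, g t := by
    rw [hIntg]
    refine integral_congr_ae (Filter.Eventually.of_forall fun t => ?_)
    simp only [hgdef, hLD]
  have hsplit := integral_add_compl (s := Set.Ioc (-y) y) measurableSet_Ioc hgi
  have hmid : ‖∫ t in Set.Ioc (-y) y, g t‖ ≤ l ^ 22 * (32 * exp (-y ^ 2 / 2) + 16 * y * exp (-(1 / l ^ 22 * y))) := by
    rw [← intervalIntegral.integral_of_le (by linarith)]
    have hl1 : 1 ≤ l ^ 22 := one_le_pow₀ (by linarith)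
    refine contour hy (by positivity) ?_ hy0.le (by positivity) ?_
    · rw [div_le_one (by positivity)]; exact hl1
    · intro s h1 h2 h3
      have hyy : 1 / y ≤ 1 / l ^ 22 := one_div_le_one_div_of_le (by positivity) hly
      have hcy : cy y = 1 + 1 / y := rfl
      obtain ⟨hz, hb⟩ := LF_region hl hg hχ hp hql (s := s) (h3.trans hyl) (abs_le.2 ⟨by linarith, by linarith⟩)
      refine ⟨?_, ?_⟩
      · have : DifferentiableAt ℂ (deriv χ.LFunction) s :=
          ((hdL.contDiff (n := 2)).differentiable_deriv_two) s
        exact this.neg.div (hdL s) hz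
      · rw [hD]; simp only; rw [neg_div, norm_neg]; exact hb
  have htail : ‖∫ t in (Set.Ioc (-y) y)ᶜ, g t‖ ≤ 24 * y ^ 2 * exp (-y ^ 2 / 4) := by
    have hG : Integrable (fun t : ℝ => 6 * y ^ 2 * exp (-y ^ 2 / 4) * exp (-(1 / 4) * t ^ 2)) :=
      (integrable_exp_neg_mul_sq (by norm_num)).const_mul _
    have h1 : ‖∫ t in (Set.Ioc (-y) y)ᶜ, g t‖ ≤ ∫ t in (Set.Ioc (-y) y)ᶜ, 6 * y ^ 2 * exp (-y ^ 2 / 4) * exp (-(1 / 4) * t ^ 2) := by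
      refine norm_integral_le_of_norm_le hG.integrableOn ?_
      refine (ae_restrict_iff' measurableSet_Ioc.compl).2 (Filter.Eventually.of_forall fun t ht => ?_)
      refine (hgM t).trans ?_
      rw [norm_ga, mul_assoc (6 * y ^ 2), ← Real.exp_add]
      refine mul_le_mul_of_nonneg_left (Real.exp_le_exp.2 ?_) (by positivity)
      have : y ^ 2 ≤ t ^ 2 := by
        rw [Set.mem_compl_iff, Set.mem_Ioc, not_and_or] at ht
        rcases ht with h | h
        · have : t ≤ -y := by linarith
          nlinarith
        · have : y ≤ t := by linarith
          nlinarith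
      linarith
    refine h1.trans ((setIntegral_le_integral hG (Filter.Eventually.of_forall fun t => by positivity)).trans ?_)
    rw [integral_const_mul, integral_gaussian]
    have : √(π / (1 / 4)) ≤ 4 := by
      rw [Real.sqrt_le_left (by norm_num)]
      have := Real.pi_lt_four
      linarith
    calc 6 * y ^ 2 * exp (-y ^ 2 / 4) * √(π / (1 / 4)) ≤ 6 * y ^ 2 * exp (-y ^ 2 / 4) * 4 := by gcongr
      _ = _ := by ring
  have hfin : ‖(√(2 * π) : ℂ) * (∑' n : ℕ, a n * om y n)‖ ≤
      l ^ 22 * (32 * exp (-y ^ 2 / 2) + 16 * y * exp (-(1 / l ^ 22 * y))) + 24 * y ^ 2 * exp (-y ^ 2 / 4) := by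
    rw [hIntg2, ← hsplit]
    exact (norm_add_le _ _).trans (add_le_add hmid htail)
  rw [norm_mul, Complex.norm_real, Real.norm_of_nonneg (Real.sqrt_nonneg _)] at hfin
  have h2pi : 1 ≤ √(2 * π) := by
    rw [Real.one_le_sqrt]; have := Real.pi_gt_three; linarith
  have hn := norm_nonneg (∑' n : ℕ, a n * om y n)
  change ‖∑' n : ℕ, a n * om y n‖ ≤ _
  nlinarith

lemma SW_asymp (B A : ℕ) (hB : 1 ≤ B) : ∀ᶠ y : ℝ in atTop, 1 ≤ y ∧ 10 ^ 9 ≤ 2 * B * log y ∧ (2 * B * log y) ^ 22 ≤ y ∧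
    y ≤ exp (2 * B * log y / 2) ∧
    (2 * B * log y) ^ 22 * (32 * exp (-y ^ 2 / 2) + 16 * y * exp (-(1 / (2 * B * log y) ^ 22 * y))) + 24 * y ^ 2 * exp (-y ^ 2 / 4)
      ≤ 1 / y ^ A := by
  have hB1 : (1:ℝ) ≤ B := by exact_mod_cast hB
  have e1 : ∀ᶠ y : ℝ in atTop, (2 * B * log y) ^ 22 ≤ √y := by
    have h := (isLittleO_pow_log_id_atTop (n := 44)).bound (c := 1 / (2 * B) ^ 44) (by positivity)
    filter_upwards [h, eventually_ge_atTop 1] with y hy hy1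
    have hl0 : 0 ≤ log y := Real.log_nonneg hy1
    rw [id, Real.norm_of_nonneg (by positivity), Real.norm_of_nonneg (by linarith)] at hy
    apply Real.le_sqrt_of_sq_le
    rw [← pow_mul, mul_pow]
    calc (2 * (B:ℝ)) ^ 44 * log y ^ 44 ≤ (2 * (B:ℝ)) ^ 44 * (1 / (2 * B) ^ 44 * y) := by gcongr
      _ = y := by field_simp
  have e2 : ∀ᶠ y : ℝ in atTop, (√y) ^ (2 * A + 4) * exp (-√y) ≤ 1 / 72 := by
    have h := (Real.tendsto_pow_mul_exp_neg_atTop_nhds_zero (2 * A + 4)).comp Real.tendsto_sqrt_atTop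
    exact (h.eventually (ge_mem_nhds (by norm_num : (0:ℝ) < 1 / 72)))
  have e3 : ∀ᶠ y : ℝ in atTop, (10:ℝ) ^ 9 ≤ log y := Real.tendsto_log_atTop.eventually_ge_atTop _
  filter_upwards [e1, e2, e3, eventually_ge_atTop 16] with y h1 h2 h3 h4
  have hy0 : 0 < y := by linarith
  have hs0 : 0 < √y := Real.sqrt_pos.2 hy0
  have hss : √y ^ 2 = y := Real.sq_sqrt hy0.le
  have hs4 : 4 ≤ √y := Real.le_sqrt_of_sq_le (by linarith)
  have hl0 : 0 ≤ log y := by linarith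
  have hsy : √y ≤ y := by nlinarith
  have hL : (10:ℝ) ^ 9 ≤ 2 * B * log y := by nlinarith
  set L := 2 * B * log y with hLdef
  have hL0 : 0 < L := by linarith
  refine ⟨by linarith, hL, h1.trans hsy, ?_, ?_⟩
  · calc y = exp (log y) := (Real.exp_log hy0).symm
      _ ≤ _ := Real.exp_le_exp.2 (by rw [hLdef]; nlinarith)
  · have x1 : exp (-y ^ 2 / 2) ≤ exp (-√y) := Real.exp_le_exp.2 (by nlinarith)
    have x2 : exp (-y ^ 2 / 4) ≤ exp (-√y) := Real.exp_le_exp.2 (by nlinarith)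
    have x3 : exp (-(1 / L ^ 22 * y)) ≤ exp (-√y) := by
      apply Real.exp_le_exp.2
      apply neg_le_neg
      calc √y = 1 / √y * y := by field_simp; exact hss
        _ ≤ 1 / L ^ 22 * y := by gcongr
    have hb : L ^ 22 ≤ y := h1.trans hsy
    calc L ^ 22 * (32 * exp (-y ^ 2 / 2) + 16 * y * exp (-(1 / L ^ 22 * y))) + 24 * y ^ 2 * exp (-y ^ 2 / 4)
        ≤ y * (32 * exp (-√y) + 16 * y * exp (-√y)) + 24 * y ^ 2 * exp (-√y) := by gcongr
      _ ≤ 72 * y ^ 2 * exp (-√y) := by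
        have := Real.exp_pos (-√y)
        have h5 : 32 * y ≤ 32 * y ^ 2 := by nlinarith
        nlinarith
      _ = 72 * ((√y) ^ (2 * A + 4) * exp (-√y)) / y ^ A := by
        have : (√y) ^ (2 * A + 4) = y ^ 2 * y ^ A := by
          rw [← pow_add, show 2 * A + 4 = 2 * (2 + A) by ring, pow_mul, hss]
        rw [this]; field_simp
      _ ≤ 72 * (1 / 72) / y ^ A := by gcongr
      _ = _ := by norm_num

/-- Siegel-Walfisz along a sequence of good scales. -/
lemma SW (B A : ℕ) (hB : 1 ≤ B) (y0 : ℝ) : ∃ y, y0 ≤ y ∧ 1 ≤ y ∧ ∀ (q : ℕ) [NeZero q] (χ : DirichletCharacter ℂ q), χ ≠ 1 →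
    χ.IsPrimitive → (q:ℝ) ≤ y ^ B →
    ‖∑' n : ℕ, (χ n * (ArithmeticFunction.vonMangoldt n : ℂ)) * om y n‖ ≤ 1 / y ^ A := by
  obtain ⟨y1, hy1⟩ := eventually_atTop.1 (SW_asymp B A hB)
  have hB1 : (1:ℝ) ≤ B := by exact_mod_cast hB
  set y2 := max (max y0 y1) 1
  obtain ⟨l, hl, hg⟩ := exists_good (2 * B * log y2)
  set y := exp (l / (2 * B)) with hy
  have hlog : 2 * B * log y = l := by rw [hy, Real.log_exp]; field_simp
  have hy2 : y2 ≤ y := by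
    have h0 : 0 < y2 := lt_of_lt_of_le one_pos (le_max_right _ _)
    rw [hy, ← Real.log_le_iff_le_exp h0, le_div_iff₀ (by positivity)]; linarith
  have ha : y0 ≤ y := ((le_max_left _ _).trans (le_max_left _ _)).trans hy2
  have hb : y1 ≤ y := ((le_max_right _ _).trans (le_max_left _ _)).trans hy2
  obtain ⟨c1, c2, c3, c4, c5⟩ := hy1 y hb
  rw [hlog] at c2 c3 c4 c5
  refine ⟨y, ha, c1, fun q _ χ hχ hp hq => ?_⟩
  refine (SW_bound c1 c2 hg c4 c3 hχ hp ?_).trans c5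
  refine hq.trans (le_of_eq ?_)
  rw [hy, ← Real.exp_nat_mul]; congr 1; field_simp

end PG

namespace PG
open Real Finset

lemma large_sieve {ι : Type*} (S : Finset ι) (f : ι → ℕ → ℂ) (hf : ∀ i n, ‖f i n‖ ≤ 1) {v : ℕ → ℝ} (hv0 : ∀ n, 0 ≤ v n)
    (hv : Summable v) {β : ℕ → ℂ} (hb1 : Summable fun n => ‖β n‖ * v n) (hb2 : Summable fun n => ‖β n‖ ^ 2 * v n)
    {Δ : ℝ} (hΔ : 0 < Δ)
    (hrow : ∀ i ∈ S, ∑ j ∈ S, ‖∑' n, f i n * (starRingEnd ℂ) (f j n) * (v n : ℂ)‖ ≤ Δ) :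
    ∑ i ∈ S, ‖∑' n, β n * f i n * (v n : ℂ)‖ ^ 2 ≤ Δ * ∑' n, ‖β n‖ ^ 2 * v n := by
  set T : ι → ℂ := fun i => ∑' n, β n * f i n * (v n : ℂ) with hT
  set P : ℝ := ∑ i ∈ S, ‖T i‖ ^ 2 with hP
  set K : ℕ → ℂ := fun n => ∑ i ∈ S, (starRingEnd ℂ) (T i) * f i n with hK
  have hsT : ∀ i, Summable fun n => β n * f i n * (v n : ℂ) := by
    intro i
    refine Summable.of_norm_bounded hb1 fun n => ?_
    rw [norm_mul, norm_mul, Complex.norm_real, Real.norm_of_nonneg (hv0 n)]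
    refine mul_le_mul_of_nonneg_right ?_ (hv0 n)
    exact mul_le_of_le_one_right (norm_nonneg _) (hf i n)
  have hsG : ∀ i j, Summable fun n => f i n * (starRingEnd ℂ) (f j n) * (v n : ℂ) := by
    intro i j
    refine Summable.of_norm_bounded hv fun n => ?_
    rw [norm_mul, norm_mul, Complex.norm_real, Real.norm_of_nonneg (hv0 n), RCLike.norm_conj]
    have := mul_le_one₀ (hf i n) (norm_nonneg _) (hf j n)
    exact mul_le_of_le_one_left (hv0 n) this
  -- first identity
  have hP1 : HasSum (fun n => β n * K n * (v n : ℂ)) (P : ℂ) := by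
    have h1 : HasSum (fun n => ∑ i ∈ S, (starRingEnd ℂ) (T i) * (β n * f i n * (v n : ℂ)))
        (∑ i ∈ S, (starRingEnd ℂ) (T i) * T i) := by
      refine hasSum_sum fun i _ => ?_
      exact (hsT i).hasSum.mul_left _
    have e1 : (∑ i ∈ S, (starRingEnd ℂ) (T i) * T i) = (P : ℂ) := by
      rw [hP]; push_cast
      refine Finset.sum_congr rfl fun i _ => ?_
      rw [Complex.conj_mul']
    rw [e1] at h1
    convert h1 using 2 with n
    rw [hK, Finset.mul_sum, Finset.sum_mul]
    refine Finset.sum_congr rfl fun i _ => ?_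
    ring
  have hK1 : HasSum (fun n => ((‖K n‖ ^ 2 * v n : ℝ) : ℂ))
      (∑ i ∈ S, ∑ j ∈ S, (starRingEnd ℂ) (T i) * T j * ∑' n, f i n * (starRingEnd ℂ) (f j n) * (v n : ℂ)) := by
    have h1 : HasSum (fun n => ∑ i ∈ S, ∑ j ∈ S, (starRingEnd ℂ) (T i) * T j * (f i n * (starRingEnd ℂ) (f j n) * (v n : ℂ)))
        (∑ i ∈ S, ∑ j ∈ S, (starRingEnd ℂ) (T i) * T j * ∑' n, f i n * (starRingEnd ℂ) (f j n) * (v n : ℂ)) :=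
      hasSum_sum fun i _ => hasSum_sum fun j _ => (hsG i j).hasSum.mul_left _
    convert h1 using 2 with n
    push_cast
    rw [← Complex.mul_conj', hK]
    simp only [map_sum, map_mul, Complex.conj_conj]
    rw [Finset.sum_mul_sum, Finset.sum_mul]
    refine Finset.sum_congr rfl fun i _ => ?_
    rw [Finset.sum_mul]
    refine Finset.sum_congr rfl fun j _ => ?_
    ring
  set G : ι → ι → ℂ := fun i j => ∑' n, f i n * (starRingEnd ℂ) (f j n) * (v n : ℂ) with hG
  have hsymm : ∀ i j, ‖G i j‖ = ‖G j i‖ := by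
    intro i j
    rw [← RCLike.norm_conj (G i j), hG]
    simp only
    rw [Complex.conj_tsum]
    congr 1
    refine tsum_congr fun n => ?_
    simp only [map_mul, Complex.conj_conj, Complex.conj_ofReal]
    ring
  have hKs : Summable fun n => ‖K n‖ ^ 2 * v n := by
    have h2 := (Complex.hasSum_re hK1).summable
    simpa only [Complex.ofReal_re] using h2
  have hQ : ∑' n, ‖K n‖ ^ 2 * v n ≤ Δ * P := by
    have h1 : ‖((∑' n, ‖K n‖ ^ 2 * v n : ℝ) : ℂ)‖ ≤ Δ * P := by
      rw [Complex.ofReal_tsum, hK1.tsum_eq]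
      calc ‖∑ i ∈ S, ∑ j ∈ S, (starRingEnd ℂ) (T i) * T j * G i j‖
          ≤ ∑ i ∈ S, ∑ j ∈ S, ((‖T i‖ ^ 2 * ‖G i j‖) / 2 + (‖T j‖ ^ 2 * ‖G j i‖) / 2) := by
            refine (norm_sum_le _ _).trans (Finset.sum_le_sum fun i _ => ?_)
            refine (norm_sum_le _ _).trans (Finset.sum_le_sum fun j _ => ?_)
            rw [norm_mul, norm_mul, RCLike.norm_conj, ← hsymm i j]
            have h3 : 2 * (‖T i‖ * ‖T j‖) ≤ ‖T i‖ ^ 2 + ‖T j‖ ^ 2 := by nlinarith [sq_nonneg (‖T i‖ - ‖T j‖)]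
            have h4 := norm_nonneg (G i j)
            nlinarith
        _ = ∑ i ∈ S, ∑ j ∈ S, ‖T i‖ ^ 2 * ‖G i j‖ := by
            simp_rw [Finset.sum_add_distrib]
            rw [Finset.sum_comm (f := fun i j => (‖T j‖ ^ 2 * ‖G j i‖) / 2)]
            rw [← Finset.sum_add_distrib]
            refine Finset.sum_congr rfl fun i _ => ?_
            rw [← Finset.sum_add_distrib]
            refine Finset.sum_congr rfl fun j _ => ?_
            ring
        _ ≤ ∑ i ∈ S, ‖T i‖ ^ 2 * Δ := by
            refine Finset.sum_le_sum fun i hi => ?_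
            rw [← Finset.mul_sum]
            exact mul_le_mul_of_nonneg_left (hrow i hi) (by positivity)
        _ = Δ * P := by rw [← Finset.sum_mul, mul_comm]
    rw [Complex.norm_real] at h1
    exact (le_abs_self _).trans h1
  have hPre : HasSum (fun n => (β n * K n * (v n : ℂ)).re) P := by
    simpa using Complex.hasSum_re hP1
  have hle : ∀ n, 2 * (β n * K n * (v n : ℂ)).re ≤ Δ * (‖β n‖ ^ 2 * v n) + (‖K n‖ ^ 2 * v n) / Δ := by
    intro n
    have h1 : (β n * K n * (v n : ℂ)).re ≤ ‖β n‖ * ‖K n‖ * v n := by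
      refine (Complex.re_le_norm _).trans (le_of_eq ?_)
      rw [norm_mul, norm_mul, Complex.norm_real, Real.norm_of_nonneg (hv0 n)]
    have h2 : 2 * (‖β n‖ * ‖K n‖) ≤ Δ * ‖β n‖ ^ 2 + ‖K n‖ ^ 2 / Δ := by
      have h3 : 0 ≤ (Δ * ‖β n‖ - ‖K n‖) ^ 2 / Δ := by positivity
      have h4 : (Δ * ‖β n‖ - ‖K n‖) ^ 2 / Δ = Δ * ‖β n‖ ^ 2 + ‖K n‖ ^ 2 / Δ - 2 * (‖β n‖ * ‖K n‖) := by
        field_simp; ring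
      linarith
    have h5 := mul_le_mul_of_nonneg_right h2 (hv0 n)
    have h6 : (Δ * ‖β n‖ ^ 2 + ‖K n‖ ^ 2 / Δ) * v n = Δ * (‖β n‖ ^ 2 * v n) + (‖K n‖ ^ 2 * v n) / Δ := by ring
    linarith
  have hfin := hasSum_le hle (hPre.mul_left 2) ((hb2.hasSum.mul_left Δ).add (hKs.hasSum.div_const Δ))
  have h7 : (∑' n, ‖K n‖ ^ 2 * v n) / Δ ≤ P := by
    rw [div_le_iff₀ hΔ]; linarith
  linarith

end PG

namespace PG
open Real Finset

/-- primitive nontrivial characters of modulus at most X -/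
noncomputable def PC (X : ℕ) : Finset (Σ q, DirichletCharacter ℂ q) := by
  classical
  exact (Finset.Icc 1 X).sigma fun q =>
    if h : q = 0 then ∅ else
      have : NeZero q := ⟨h⟩
      Finset.univ.filter fun χ : DirichletCharacter ℂ q => χ.IsPrimitive ∧ χ ≠ 1

lemma mem_PC {X : ℕ} {c : Σ q, DirichletCharacter ℂ q} :
    c ∈ PC X ↔ 1 ≤ c.1 ∧ c.1 ≤ X ∧ c.2.IsPrimitive ∧ c.2 ≠ 1 := by
  classical
  unfold PC
  rw [Finset.mem_sigma, Finset.mem_Icc]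
  by_cases h : c.1 = 0
  · simp [h]
  · simp [h]; tauto

lemma card_PC (X : ℕ) : (PC X).card ≤ X ^ 2 := by
  classical
  unfold PC
  rw [Finset.card_sigma]
  calc _ ≤ ∑ q ∈ Finset.Icc 1 X, X := by
        refine Finset.sum_le_sum fun q hq => ?_
        rw [Finset.mem_Icc] at hq
        have h : q ≠ 0 := by omega
        rw [dif_neg h]
        have : NeZero q := ⟨h⟩
        refine (Finset.card_filter_le _ _).trans ?_
        rw [Finset.card_univ, ← Nat.card_eq_fintype_card,
          DirichletCharacter.card_eq_totient_of_hasEnoughRootsOfUnity]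
        exact (Nat.totient_le q).trans hq.2
    _ = X ^ 2 := by simp [sq]

/-- truncated weight -/
noncomputable def vU (y : ℝ) (U : ℕ) (n : ℕ) : ℝ := if U < n then (n : ℝ) ^ (-(cy y)) else 0

lemma vU_nonneg (y : ℝ) (U n : ℕ) : 0 ≤ vU y U n := by unfold vU; split_ifs <;> positivity

lemma vU_le (y : ℝ) (U n : ℕ) : vU y U n ≤ (n : ℝ) ^ (-(cy y)) := by
  unfold vU; split_ifs
  · exact le_rfl
  · positivity

lemma summable_cy {y : ℝ} (hy : 1 ≤ y) : Summable fun n : ℕ => (n : ℝ) ^ (-(cy y)) := by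
  rw [Real.summable_nat_rpow]; unfold cy
  have : 0 < 1 / y := by positivity
  linarith

lemma summable_vU {y : ℝ} (hy : 1 ≤ y) (U : ℕ) : Summable (vU y U) :=
  Summable.of_nonneg_of_le (vU_nonneg y U) (vU_le y U) (summable_cy hy)

lemma tv_vU {y : ℝ} (hy : 1 ≤ y) (U : ℕ) : TV (vU y U) ≤ 2 / (U + 1) := by
  have hs := summable_vU hy U
  have hc : 1 ≤ cy y := by unfold cy; have : 0 < 1 / y := by positivity
                           linarith
  have e : ∀ n, ‖vU y U (n + 1) - vU y U n‖ = (vU y U n - vU y U (n + 1)) + if n = U then 2 * vU y U (U + 1) else 0 := by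
    intro n
    rcases lt_trichotomy n U with h | h | h
    · have h1 : vU y U n = 0 := by unfold vU; rw [if_neg (by omega)]
      have h2 : vU y U (n + 1) = 0 := by unfold vU; rw [if_neg (by omega)]
      rw [h1, h2, if_neg (by omega)]; simp
    · subst h
      have h1 : vU y n n = 0 := by unfold vU; rw [if_neg (by omega)]
      rw [h1, if_pos rfl, sub_zero, Real.norm_of_nonneg (vU_nonneg _ _ _)]; ring
    · rw [if_neg (by omega), add_zero, norm_sub_rev, Real.norm_of_nonneg]
      unfold vU
      rw [if_pos h, if_pos (by omega), sub_nonneg]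
      have : (0:ℝ) < n := by exact_mod_cast (by omega : 0 < n)
      exact Real.rpow_le_rpow_of_nonpos this (by push_cast; linarith) (by linarith)
  have h1 : HasSum (fun n => vU y U n - vU y U (n + 1)) 0 := by
    have a := hs.hasSum
    have b : HasSum (fun n => vU y U (n + 1)) (∑' n, vU y U n) := by
      have := (hasSum_nat_add_iff' (f := vU y U) 1).2 a
      have h0 : vU y U 0 = 0 := by unfold vU; rw [if_neg (by omega)]
      simpa [h0] using this
    simpa using a.sub b
  have h2 : HasSum (fun n => if n = U then 2 * vU y U (U + 1) else 0) (2 * vU y U (U + 1)) := hasSum_ite_eq U _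
  have h3 := h1.add h2
  unfold TV
  simp_rw [e]
  rw [h3.tsum_eq, zero_add]
  unfold vU
  rw [if_pos (by omega)]
  have hU : (1:ℝ) ≤ (U + 1 : ℕ) := by push_cast; linarith [Nat.cast_nonneg (α := ℝ) U]
  have : ((U + 1 : ℕ) : ℝ) ^ (-(cy y)) ≤ ((U + 1 : ℕ) : ℝ) ^ (-1 : ℝ) :=
    Real.rpow_le_rpow_of_exponent_le hU (by linarith)
  rw [Real.rpow_neg_one] at this
  push_cast at this ⊢
  rw [div_eq_mul_inv]; linarith

lemma conj_ch {q : ℕ} [NeZero q] (χ : DirichletCharacter ℂ q) (a : ZMod q) : (starRingEnd ℂ) (χ a) = χ⁻¹ a := by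
  have := MulChar.star_apply' χ a
  simpa using this

lemma LS_row {y : ℝ} (hy : 1 ≤ y) {X U : ℕ} (hU : 2 * X ^ 4 ≤ U) {c : Σ q, DirichletCharacter ℂ q} (hc : c ∈ PC X) :
    ∑ d ∈ PC X, ‖∑' n : ℕ, c.2 (n : ZMod c.1) * (starRingEnd ℂ) (d.2 (n : ZMod d.1)) * (vU y U n : ℂ)‖ ≤ 2 + y := by
  classical
  have hsv := summable_vU hy U
  have hsv' : Summable fun n => ‖((vU y U n : ℝ) : ℂ)‖ := by
    simpa only [Complex.norm_real] using hsv.norm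
  obtain ⟨hc1, hc2, hc3, hc4⟩ := mem_PC.1 hc
  rw [← Finset.add_sum_erase _ _ hc]
  have hdiag : ‖∑' n : ℕ, c.2 (n : ZMod c.1) * (starRingEnd ℂ) (c.2 (n : ZMod c.1)) * (vU y U n : ℂ)‖ ≤ 1 + y := by
    have hle : ∀ n : ℕ, ‖c.2 (n : ZMod c.1) * (starRingEnd ℂ) (c.2 (n : ZMod c.1)) * (vU y U n : ℂ)‖ ≤ vU y U n := by
      intro n
      rw [norm_mul, norm_mul, Complex.norm_real, Real.norm_of_nonneg (vU_nonneg _ _ _), RCLike.norm_conj]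
      exact mul_le_of_le_one_left (vU_nonneg _ _ _) (mul_le_one₀ (c.2.norm_le_one _) (norm_nonneg _) (c.2.norm_le_one _))
    have h2 := tsum_of_norm_bounded hsv.hasSum hle
    refine h2.trans ?_
    have h3 := Summable.tsum_le_tsum (vU_le y U) hsv (summable_cy hy)
    refine h3.trans ?_
    have h4 := zeta_le (ε := 1 / y) (by positivity)
    unfold cy
    simpa using h4
  have hoff : ∀ d ∈ (PC X).erase c,
      ‖∑' n : ℕ, c.2 (n : ZMod c.1) * (starRingEnd ℂ) (d.2 (n : ZMod d.1)) * (vU y U n : ℂ)‖ ≤ X ^ 2 * (2 / (U + 1)) := by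
    intro d hd
    rw [Finset.mem_erase] at hd
    obtain ⟨hd1, hd2, hd3, hd4⟩ := mem_PC.1 hd.2
    have i1 : NeZero c.1 := ⟨by omega⟩
    have i2 : NeZero d.1 := ⟨by omega⟩
    have i3 : NeZero (c.1 * d.1) := ⟨by have := NeZero.ne c.1; have := NeZero.ne d.1; positivity⟩
    have h1 := char_sum_le hsv' (c.1 * d.1) (chProd c.2 d.2⁻¹)
      (chProd_inv_ne_one (by omega) (by omega) hc3 hd3 (fun h => hd.1 h.symm))
    have e : ∀ n : ℕ, c.2 (n : ZMod c.1) * (starRingEnd ℂ) (d.2 (n : ZMod d.1)) * (vU y U n : ℂ) =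
        chProd c.2 d.2⁻¹ (n : ZMod (c.1 * d.1)) * (vU y U n : ℂ) := by
      intro n
      rw [chProd_apply, conj_ch]
    simp_rw [e]
    refine h1.trans ?_
    have h2 : TV (fun n => ((vU y U n : ℝ) : ℂ)) = TV (vU y U) := by
      unfold TV
      congr 1; ext n
      rw [← Complex.ofReal_sub, Complex.norm_real]
    rw [h2]
    refine mul_le_mul ?_ (tv_vU hy U) (tv_nonneg _) (by positivity)
    push_cast
    rw [sq]
    exact mul_le_mul (by exact_mod_cast hc2) (by exact_mod_cast hd2) (by positivity) (by positivity)
  have h4 : ∑ d ∈ (PC X).erase c,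
      ‖∑' n : ℕ, c.2 (n : ZMod c.1) * (starRingEnd ℂ) (d.2 (n : ZMod d.1)) * (vU y U n : ℂ)‖ ≤ 1 := by
    refine (Finset.sum_le_card_nsmul _ _ _ hoff).trans ?_
    rw [nsmul_eq_mul]
    have h5 : (((PC X).erase c).card : ℝ) ≤ X ^ 2 := by
      exact_mod_cast (Finset.card_le_card (Finset.erase_subset _ _)).trans (card_PC X)
    have h6 : (2 * (X:ℝ) ^ 4) ≤ U := by exact_mod_cast hU
    calc _ ≤ (X:ℝ) ^ 2 * (X ^ 2 * (2 / (U + 1))) := by gcongr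
      _ = (2 * X ^ 4) / (U + 1) := by ring
      _ ≤ 1 := by rw [div_le_one (by positivity)]; linarith
  linarith

lemma one_add_log_le {y : ℝ} (hy : 1 ≤ y) {n : ℕ} (hn : 1 ≤ n) : 1 + log n ≤ 4 * y * (n : ℝ) ^ (1 / (4 * y)) := by
  have hn0 : (0:ℝ) < n := by exact_mod_cast hn
  rw [Real.rpow_def_of_pos hn0]
  have h := Real.add_one_le_exp (log n * (1 / (4 * y)))
  have h2 : 4 * y * (log n * (1 / (4 * y)) + 1) = log n + 4 * y := by field_simp
  have h3 := mul_le_mul_of_nonneg_left h (by positivity : 0 ≤ 4 * y)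
  rw [h2] at h3
  linarith

lemma summable_LS {y : ℝ} (hy : 1 ≤ y) :
    Summable (fun n : ℕ => 16 * y ^ 2 * (n : ℝ) ^ (-(1 + 1 / (2 * y)))) := by
  refine Summable.mul_left _ ?_
  rw [Real.summable_nat_rpow]
  have : 0 < 1 / (2 * y) := by positivity
  linarith

lemma sq_vU_le {y : ℝ} (hy : 1 ≤ y) (U : ℕ) {b : ℕ → ℂ} (hb : ∀ n, 1 ≤ n → ‖b n‖ ≤ 1 + log n) (n : ℕ) :
    ‖b n‖ ^ 2 * vU y U n ≤ 16 * y ^ 2 * (n : ℝ) ^ (-(1 + 1 / (2 * y))) := by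
  rcases Nat.eq_zero_or_pos n with rfl | hn
  · have h0 : vU y U 0 = 0 := by unfold vU; rw [if_neg (by omega)]
    rw [h0]; simp; positivity
  have hn0 : (0:ℝ) < n := by exact_mod_cast hn
  have h1 := (hb n hn).trans (one_add_log_le hy hn)
  calc _ ≤ (4 * y * (n : ℝ) ^ (1 / (4 * y))) ^ 2 * (n : ℝ) ^ (-(cy y)) := by
        refine mul_le_mul ?_ (vU_le _ _ _) (vU_nonneg _ _ _) (by positivity)
        exact pow_le_pow_left₀ (norm_nonneg _) h1 2
    _ = 16 * y ^ 2 * ((n : ℝ) ^ (1 / (4 * y)) * (n : ℝ) ^ (1 / (4 * y)) * (n : ℝ) ^ (-(cy y))) := by ring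
    _ = _ := by
        rw [← Real.rpow_add hn0, ← Real.rpow_add hn0]
        congr 2
        unfold cy; field_simp; ring

lemma LS_main {y : ℝ} (hy : 1 ≤ y) {X U : ℕ} (hU : 2 * X ^ 4 ≤ U) {b : ℕ → ℂ}
    (hb : ∀ n, 1 ≤ n → ‖b n‖ ≤ 1 + log n) (t : ℝ) :
    ∑ c ∈ PC X, ‖LSeries (fun n => if U < n then b n * c.2 (n : ZMod c.1) else 0) ((cy y : ℂ) + t * Complex.I)‖ ^ 2
      ≤ (2 + y) * (16 * y ^ 2 * (1 + 2 * y)) := by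
  have hsq : ∀ n, ‖b n * (n : ℂ) ^ (-(t * Complex.I))‖ * vU y U n = ‖b n‖ * vU y U n := by
    intro n
    by_cases h : U < n
    · have : ‖(n : ℂ) ^ (-(t * Complex.I))‖ = 1 := by
        rw [Complex.norm_natCast_cpow_of_pos (by omega)]; simp
      rw [norm_mul, this, mul_one]
    · unfold vU; rw [if_neg h]; simp
  have hsq2 : ∀ n, ‖b n * (n : ℂ) ^ (-(t * Complex.I))‖ ^ 2 * vU y U n = ‖b n‖ ^ 2 * vU y U n := by
    intro n
    by_cases h : U < n
    · have : ‖(n : ℂ) ^ (-(t * Complex.I))‖ = 1 := by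
        rw [Complex.norm_natCast_cpow_of_pos (by omega)]; simp
      rw [norm_mul, this, mul_one]
    · unfold vU; rw [if_neg h]; simp
  have hs2 : Summable fun n => ‖b n‖ ^ 2 * vU y U n :=
    Summable.of_nonneg_of_le (fun n => mul_nonneg (by positivity) (vU_nonneg _ _ _)) (sq_vU_le hy U hb) (summable_LS hy)
  have hs1 : Summable fun n => ‖b n‖ * vU y U n := by
    refine Summable.of_nonneg_of_le (fun n => mul_nonneg (by positivity) (vU_nonneg _ _ _)) (fun n => ?_)
      ((summable_vU hy U).add hs2)
    have : ‖b n‖ ≤ 1 + ‖b n‖ ^ 2 := by nlinarith [sq_nonneg (‖b n‖ - 1 / 2), norm_nonneg (b n)]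
    have := mul_le_mul_of_nonneg_right this (vU_nonneg y U n)
    linarith
  have h := large_sieve (PC X) (fun c n => c.2 (n : ZMod c.1)) (fun c n => c.2.norm_le_one _) (vU_nonneg y U)
    (summable_vU hy U) (β := fun n => b n * (n : ℂ) ^ (-(t * Complex.I))) (by simp_rw [hsq]; exact hs1)
    (by simp_rw [hsq2]; exact hs2) (Δ := 2 + y) (by linarith) (fun c hc => LS_row hy hU hc)
  simp_rw [hsq2] at h
  have e : ∀ c : (Σ q, DirichletCharacter ℂ q),
      LSeries (fun n => if U < n then b n * c.2 (n : ZMod c.1) else 0) ((cy y : ℂ) + t * Complex.I) =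
      ∑' n : ℕ, b n * (n : ℂ) ^ (-(t * Complex.I)) * c.2 (n : ZMod c.1) * (vU y U n : ℂ) := by
    intro c
    unfold LSeries
    congr 1; ext n
    by_cases h : U < n
    · have hn0 : (n : ℂ) ≠ 0 := by exact_mod_cast (by omega : n ≠ 0)
      rw [LSeries.term_of_ne_zero (by omega), if_pos h]
      unfold vU
      rw [if_pos h, Complex.ofReal_cpow (by positivity), div_eq_mul_inv, ← Complex.cpow_neg, neg_add,
        Complex.cpow_add _ _ hn0]
      push_cast; ring
    · unfold vU
      rw [LSeries.term_def, if_neg h, if_neg h]; simp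
  simp_rw [e]
  refine h.trans (mul_le_mul_of_nonneg_left ?_ (by linarith))
  refine (Summable.tsum_le_tsum (sq_vU_le hy U hb) hs2 (summable_LS hy)).trans ?_
  rw [tsum_mul_left]
  refine mul_le_mul_of_nonneg_left ?_ (by positivity)
  have := zeta_le (ε := 1 / (2 * y)) (by positivity)
  simpa using this
end PG

namespace PG
open Real Finset
open ArithmeticFunction hiding log
open scoped LSeries.notation ArithmeticFunction.zeta ArithmeticFunction.Moebius

/-- truncation -/
noncomputable def trc (f : ArithmeticFunction ℝ) (U : ℕ) : ArithmeticFunction ℝ :=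
  ⟨fun n => if n ≤ U then f n else 0, by simp⟩
/-- tail -/
noncomputable def tl (f : ArithmeticFunction ℝ) (U : ℕ) : ArithmeticFunction ℝ :=
  ⟨fun n => if U < n then f n else 0, by simp⟩

lemma trc_apply (f : ArithmeticFunction ℝ) (U n : ℕ) : trc f U n = if n ≤ U then f n else 0 := rfl
lemma tl_apply (f : ArithmeticFunction ℝ) (U n : ℕ) : tl f U n = if U < n then f n else 0 := rfl

lemma trc_add_tl (f : ArithmeticFunction ℝ) (U : ℕ) : trc f U + tl f U = f := by
  ext n
  rw [ArithmeticFunction.add_apply, trc_apply, tl_apply]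
  by_cases h : n ≤ U
  · rw [if_pos h, if_neg (by omega), add_zero]
  · rw [if_neg h, if_pos (by omega), zero_add]

lemma vaughan_id (U : ℕ) : (Λ : ArithmeticFunction ℝ) = trc Λ U + trc (μ : ArithmeticFunction ℝ) U * ArithmeticFunction.log
    - trc (μ : ArithmeticFunction ℝ) U * trc Λ U * (ζ : ArithmeticFunction ℝ)
    + tl Λ U * ((ζ : ArithmeticFunction ℝ) * tl (μ : ArithmeticFunction ℝ) U) := by
  have h1 := trc_add_tl Λ U
  have h2 := trc_add_tl (μ : ArithmeticFunction ℝ) U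
  have h3 : (μ : ArithmeticFunction ℝ) * (ζ : ArithmeticFunction ℝ) = 1 := coe_moebius_mul_coe_zeta
  have h4 : (Λ : ArithmeticFunction ℝ) * ζ = ArithmeticFunction.log := vonMangoldt_mul_zeta
  rw [← h4]
  set a := trc Λ U
  set b := tl Λ U
  set c := trc (μ : ArithmeticFunction ℝ) U
  set d := tl (μ : ArithmeticFunction ℝ) U
  have h5 : (c + d) * (ζ : ArithmeticFunction ℝ) = 1 := by rw [h2, h3]
  rw [← h1]
  have : a + c * ((a + b) * ζ) - c * a * ζ + b * (ζ * d) = a + b * ((c + d) * (ζ : ArithmeticFunction ℝ)) := by ring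
  rw [this, h5, mul_one]

lemma conv_twist {q : ℕ} (χ : DirichletCharacter ℂ q) (f g : ArithmeticFunction ℝ) :
    (fun n : ℕ => (f n : ℂ) * χ n) ⍟ (fun n : ℕ => (g n : ℂ) * χ n) = fun n : ℕ => ((f * g) n : ℂ) * χ n := by
  ext n
  rw [LSeries.convolution_def]
  simp only
  rw [ArithmeticFunction.mul_apply]
  push_cast
  rw [Finset.sum_mul]
  refine Finset.sum_congr rfl fun p hp => ?_
  rw [Nat.mem_divisorsAntidiagonal] at hp
  rw [← hp.1]; push_cast; rw [map_mul]; ring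

lemma hasSum_dconv {q : ℕ} (χ : DirichletCharacter ℂ q) (f g : ArithmeticFunction ℝ) (V : ℕ) (hf : ∀ n, V < n → f n = 0)
    (h : ℕ → ℝ) (hs : ∀ d, 1 ≤ d → Summable fun m : ℕ => g m * h (d * m)) :
    HasSum (fun n : ℕ => ((f * g) n : ℂ) * χ n * h n)
      (∑ d ∈ Finset.Icc 1 V, (f d * χ d) * ∑' m : ℕ, χ m * ((g m * h (d * m) : ℝ) : ℂ)) := by
  have h1 : ∀ d ∈ Finset.Icc 1 V, HasSum (fun n : ℕ => (f d * χ d) * if d ∣ n then χ (n / d : ℕ) * ((g (n / d) * h n : ℝ) : ℂ) else 0)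
      ((f d * χ d) * ∑' m : ℕ, χ m * ((g m * h (d * m) : ℝ) : ℂ)) := by
    intro d hd
    rw [Finset.mem_Icc] at hd
    have hinj : Function.Injective fun m : ℕ => d * m := fun a b hab => by
      exact Nat.eq_of_mul_eq_mul_left (by omega) hab
    refine HasSum.mul_left _ ?_
    have hs1 : Summable fun m : ℕ => χ m * ((g m * h (d * m) : ℝ) : ℂ) := by
      refine Summable.of_norm_bounded (hs d hd.1).norm fun m => ?_
      rw [norm_mul, Complex.norm_real]
      exact mul_le_of_le_one_left (norm_nonneg _) (χ.norm_le_one _)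
    rw [← hinj.hasSum_iff]
    · have e0 : ((fun n : ℕ => if d ∣ n then χ (n / d : ℕ) * ((g (n / d) * h n : ℝ) : ℂ) else 0) ∘ fun m : ℕ => d * m)
          = fun m : ℕ => χ m * ((g m * h (d * m) : ℝ) : ℂ) := by
        ext m
        rw [Function.comp_apply, if_pos (dvd_mul_right _ _), Nat.mul_div_cancel_left _ (by omega)]
      rw [e0]
      exact hs1.hasSum
    · intro n hn
      rw [if_neg]
      rintro ⟨m, rfl⟩
      exact hn ⟨m, rfl⟩
  have h2 := hasSum_sum h1
  convert h2 using 2 with n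
  rw [ArithmeticFunction.mul_apply, Nat.sum_divisorsAntidiagonal (fun a b => f a * g b)]
  rcases Nat.eq_zero_or_pos n with rfl | hn
  · simp
  push_cast
  rw [Finset.sum_mul, Finset.sum_mul]
  have e1 : ∀ d ∈ Finset.Icc 1 V, ((f d * χ d) * if d ∣ n then χ (n / d : ℕ) * ((g (n / d) : ℂ) * (h n : ℂ)) else 0)
      = if d ∣ n then (f d : ℂ) * g (n / d) * χ n * h n else 0 := by
    intro d _
    split_ifs with hd
    · obtain ⟨m, rfl⟩ := hd
      have : d ≠ 0 := by rintro rfl; simp at hn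
      rw [Nat.mul_div_cancel_left _ (by omega)]
      push_cast; rw [map_mul]; ring
    · simp
  rw [Finset.sum_congr rfl e1, ← Finset.sum_filter]
  symm
  apply Finset.sum_subset_zero_on_sdiff
  · intro d hd
    rw [Finset.mem_filter] at hd
    rw [Nat.mem_divisors]; exact ⟨hd.2, by omega⟩
  · intro d hd
    rw [Finset.mem_sdiff, Finset.mem_filter, Nat.mem_divisors, Finset.mem_Icc] at hd
    have : V < d := by
      by_contra h
      exact hd.2 ⟨⟨Nat.pos_of_dvd_of_pos hd.1.1 hn, by omega⟩, hd.1.1⟩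
    rw [hf d this]; simp
  · intros; rfl

lemma tv_cast (g : ℕ → ℝ) : TV (fun n => ((g n : ℝ) : ℂ)) = TV g := by
  unfold TV
  congr 1; ext n
  rw [← Complex.ofReal_sub, Complex.norm_real]

lemma dconv_bound {q : ℕ} [NeZero q] (χ : DirichletCharacter ℂ q) (hχ : χ ≠ 1) (f g : ArithmeticFunction ℝ) (V : ℕ) (hf : ∀ n, V < n → f n = 0)
    {F T : ℝ} (hF : ∀ n, |f n| ≤ F)
    (h : ℕ → ℝ) (hs : ∀ d, 1 ≤ d → Summable fun m : ℕ => g m * h (d * m))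
    (htv : ∀ d, 1 ≤ d → TV (fun m : ℕ => g m * h (d * m)) ≤ T) :
    ‖∑' n : ℕ, ((f * g) n : ℂ) * χ n * h n‖ ≤ V * (F * (q * T)) := by
  rw [(hasSum_dconv χ f g V hf h hs).tsum_eq]
  have hF0 : 0 ≤ F := (abs_nonneg _).trans (hF 0)
  calc _ ≤ ∑ d ∈ Finset.Icc 1 V, F * (q * T) := by
        refine norm_sum_le_of_le _ fun d hd => ?_
        rw [Finset.mem_Icc] at hd
        rw [norm_mul, norm_mul, Complex.norm_real]
        have h1 : ‖f d‖ * ‖χ d‖ ≤ F :=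
          (mul_le_of_le_one_right (norm_nonneg _) (χ.norm_le_one _)).trans (hF d)
        refine mul_le_mul h1 ?_ (norm_nonneg _) hF0
        have h2 := char_sum_le (g := fun m => ((g m * h (d * m) : ℝ) : ℂ))
          (by simpa only [Complex.norm_real] using (hs d hd.1).norm) q χ hχ
        refine h2.trans (mul_le_mul_of_nonneg_left ?_ (by positivity))
        rw [tv_cast]
        exact htv d hd.1
    _ = _ := by simp

lemma lss_of_log {y : ℝ} (hy : 1 ≤ y) {a : ℕ → ℂ} (ha : ∀ n, 1 ≤ n → ‖a n‖ ≤ 1 + log n) : LSeriesSummable a (cy y) := by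
  have hs : Summable (fun n : ℕ => 4 * y * (n : ℝ) ^ (-(1 + 3 / (4 * y)))) := by
    refine Summable.mul_left _ ?_
    rw [Real.summable_nat_rpow]
    have : 0 < 3 / (4 * y) := by positivity
    linarith
  refine Summable.of_norm_bounded hs fun n => ?_
  rcases Nat.eq_zero_or_pos n with rfl | hn
  · simp; positivity
  have hn0 : (0:ℝ) < n := by exact_mod_cast hn
  rw [LSeries.norm_term_eq, if_neg (by omega), Complex.ofReal_re, div_eq_mul_inv, ← Real.rpow_neg hn0.le]
  have h1 := (ha n hn).trans (one_add_log_le hy hn)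
  calc _ ≤ (4 * y * (n : ℝ) ^ (1 / (4 * y))) * (n : ℝ) ^ (-(cy y)) := by gcongr
    _ = 4 * y * ((n : ℝ) ^ (1 / (4 * y)) * (n : ℝ) ^ (-(cy y))) := by ring
    _ = _ := by
      rw [← Real.rpow_add hn0]
      congr 2
      unfold cy; field_simp; ring

lemma norm_LSeries_ch_le {y : ℝ} (hy : 1 ≤ y) {a : ℕ → ℂ} (ha : ∀ n, ‖a n‖ ≤ 1) (t : ℝ) :
    ‖LSeries a ((cy y : ℂ) + t * Complex.I)‖ ≤ 1 + y := by
  have hz := zeta_le (ε := 1 / y) (by positivity)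
  have hz' : ∑' n : ℕ, (n : ℝ) ^ (-(cy y)) ≤ 1 + y := by unfold cy; simpa using hz
  refine le_trans ?_ hz'
  refine tsum_of_norm_bounded (summable_cy hy).hasSum fun n => ?_
  rcases Nat.eq_zero_or_pos n with rfl | hn
  · simp; positivity
  have hn0 : (0:ℝ) < n := by exact_mod_cast hn
  have hre : ((cy y : ℂ) + t * Complex.I).re = cy y := by simp
  rw [LSeries.norm_term_eq, if_neg (by omega), hre, div_eq_mul_inv, ← Real.rpow_neg hn0.le]
  exact mul_le_of_le_one_left (by positivity) (ha n)

lemma abs_mu_le (n : ℕ) : |((μ : ArithmeticFunction ℝ) n)| ≤ 1 := by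
  have := ArithmeticFunction.abs_moebius_le_one (n := n)
  rw [ArithmeticFunction.intCoe_apply]
  exact_mod_cast this

lemma type2 {y : ℝ} (hy : 1 ≤ y) {X U : ℕ} (hU : 2 * X ^ 4 ≤ U) :
    (∀ c ∈ PC X, LSeriesSummable (fun n : ℕ => ((tl Λ U * ((ζ : ArithmeticFunction ℝ) * tl (μ : ArithmeticFunction ℝ) U)) n : ℂ) * c.2 n) (cy y)) ∧
    ∑ c ∈ PC X, ‖∑' n : ℕ, ((tl Λ U * ((ζ : ArithmeticFunction ℝ) * tl (μ : ArithmeticFunction ℝ) U)) n : ℂ) * c.2 n * om y n‖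
      ≤ (1 + y) * ((2 + y) * (16 * y ^ 2 * (1 + 2 * y))) := by
  have hA : ∀ c : (Σ q, DirichletCharacter ℂ q), ∀ n : ℕ, 1 ≤ n → ‖((tl Λ U n : ℝ) : ℂ) * c.2 n‖ ≤ 1 + log n := by
    intro c n hn
    rw [norm_mul, Complex.norm_real]
    refine (mul_le_of_le_one_right (norm_nonneg _) (c.2.norm_le_one _)).trans ?_
    have h0 := Real.log_natCast_nonneg n
    rw [tl_apply]; split_ifs
    · rw [Real.norm_of_nonneg vonMangoldt_nonneg]
      linarith [vonMangoldt_le_log (n := n)]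
    · simp; linarith
  have hB : ∀ c : (Σ q, DirichletCharacter ℂ q), ∀ n : ℕ, 1 ≤ n → ‖((tl (μ : ArithmeticFunction ℝ) U n : ℝ) : ℂ) * c.2 n‖ ≤ 1 + log n := by
    intro c n hn
    rw [norm_mul, Complex.norm_real]
    refine (mul_le_of_le_one_right (norm_nonneg _) (c.2.norm_le_one _)).trans ?_
    have h0 := Real.log_natCast_nonneg n
    rw [tl_apply]; split_ifs
    · rw [Real.norm_eq_abs]
      linarith [abs_mu_le n]
    · simp; linarith
  have hZ1 : ∀ c : (Σ q, DirichletCharacter ℂ q), ∀ n : ℕ, ‖(((ζ : ArithmeticFunction ℝ) n : ℝ) : ℂ) * c.2 n‖ ≤ 1 := by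
    intro c n
    rw [norm_mul, Complex.norm_real]
    refine (mul_le_of_le_one_right (norm_nonneg _) (c.2.norm_le_one _)).trans ?_
    rw [ArithmeticFunction.natCoe_apply, ArithmeticFunction.zeta_apply]
    split_ifs <;> simp
  have hZ : ∀ c : (Σ q, DirichletCharacter ℂ q), ∀ n : ℕ, 1 ≤ n → ‖(((ζ : ArithmeticFunction ℝ) n : ℝ) : ℂ) * c.2 n‖ ≤ 1 + log n := by
    intro c n hn
    have h0 := Real.log_natCast_nonneg n
    linarith [hZ1 c n]
  have hre : ∀ t : ℝ, ((cy y : ℂ) + t * Complex.I).re = (cy y : ℂ).re := by intro t; simp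
  have sm : ∀ {a : ℕ → ℂ}, (∀ n, 1 ≤ n → ‖a n‖ ≤ 1 + log n) → ∀ t : ℝ, LSeriesSummable a ((cy y : ℂ) + t * Complex.I) := by
    intro a ha t
    exact (lss_of_log hy ha).of_re_le_re (hre t).ge
  have hsum : ∀ c ∈ PC X, LSeriesSummable (fun n : ℕ => ((tl Λ U * ((ζ : ArithmeticFunction ℝ) * tl (μ : ArithmeticFunction ℝ) U)) n : ℂ) * c.2 n) (cy y) := by
    intro c _
    rw [← conv_twist, ← conv_twist]
    exact (lss_of_log hy (hA c)).convolution ((lss_of_log hy (hZ c)).convolution (lss_of_log hy (hB c)))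
  refine ⟨hsum, ?_⟩
  refine sum_norm_om_sum_le (PC X) hy hsum fun t => ?_
  have e : ∀ c : (Σ q, DirichletCharacter ℂ q),
      LSeries (fun n : ℕ => ((tl Λ U * ((ζ : ArithmeticFunction ℝ) * tl (μ : ArithmeticFunction ℝ) U)) n : ℂ) * c.2 n) ((cy y : ℂ) + t * Complex.I)
      = LSeries (fun n : ℕ => ((tl Λ U n : ℝ) : ℂ) * c.2 n) ((cy y : ℂ) + t * Complex.I) *
        (LSeries (fun n : ℕ => (((ζ : ArithmeticFunction ℝ) n : ℝ) : ℂ) * c.2 n) ((cy y : ℂ) + t * Complex.I) *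
        LSeries (fun n : ℕ => ((tl (μ : ArithmeticFunction ℝ) U n : ℝ) : ℂ) * c.2 n) ((cy y : ℂ) + t * Complex.I)) := by
    intro c
    rw [← conv_twist, ← conv_twist]
    rw [LSeries_convolution' (sm (hA c) t) ((sm (hZ c) t).convolution (sm (hB c) t)),
      LSeries_convolution' (sm (hZ c) t) (sm (hB c) t)]
  have lsA := LS_main hy hU (b := fun n => ((Λ n : ℝ) : ℂ)) (fun n hn => by
    rw [Complex.norm_real, Real.norm_of_nonneg vonMangoldt_nonneg]
    linarith [vonMangoldt_le_log (n := n)]) t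
  have lsB := LS_main hy hU (b := fun n => (((μ : ArithmeticFunction ℝ) n : ℝ) : ℂ)) (fun n hn => by
    rw [Complex.norm_real, Real.norm_eq_abs]
    have h0 := Real.log_natCast_nonneg n
    linarith [abs_mu_le n]) t
  have ee : ∀ (f : ArithmeticFunction ℝ) (c : (Σ q, DirichletCharacter ℂ q)),
      (fun n : ℕ => ((tl f U n : ℝ) : ℂ) * c.2 n) = fun n : ℕ => if U < n then ((f n : ℝ) : ℂ) * c.2 n else 0 := by
    intro f c; ext n
    rw [tl_apply]; split_ifs <;> simp
  simp_rw [← ee] at lsA lsB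
  set M := (2 + y) * (16 * y ^ 2 * (1 + 2 * y)) with hM
  calc _ ≤ ∑ c ∈ PC X, (1 + y) * ((‖LSeries (fun n : ℕ => ((tl Λ U n : ℝ) : ℂ) * c.2 n) ((cy y : ℂ) + t * Complex.I)‖ ^ 2
          + ‖LSeries (fun n : ℕ => ((tl (μ : ArithmeticFunction ℝ) U n : ℝ) : ℂ) * c.2 n) ((cy y : ℂ) + t * Complex.I)‖ ^ 2) / 2) := by
        refine Finset.sum_le_sum fun c _ => ?_
        rw [e c, norm_mul, norm_mul]
        have hz := norm_LSeries_ch_le hy (hZ1 c) t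
        set a := ‖LSeries (fun n : ℕ => ((tl Λ U n : ℝ) : ℂ) * c.2 n) ((cy y : ℂ) + t * Complex.I)‖
        set b := ‖LSeries (fun n : ℕ => ((tl (μ : ArithmeticFunction ℝ) U n : ℝ) : ℂ) * c.2 n) ((cy y : ℂ) + t * Complex.I)‖
        set z := ‖LSeries (fun n : ℕ => (((ζ : ArithmeticFunction ℝ) n : ℝ) : ℂ) * c.2 n) ((cy y : ℂ) + t * Complex.I)‖
        have ha : 0 ≤ a := norm_nonneg _
        have hb : 0 ≤ b := norm_nonneg _
        have h1 : a * b ≤ (a ^ 2 + b ^ 2) / 2 := by nlinarith [sq_nonneg (a - b)]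
        calc a * (z * b) = z * (a * b) := by ring
          _ ≤ (1 + y) * ((a ^ 2 + b ^ 2) / 2) := mul_le_mul hz h1 (by positivity) (by linarith)
    _ = (1 + y) * ((∑ c ∈ PC X, ‖LSeries (fun n : ℕ => ((tl Λ U n : ℝ) : ℂ) * c.2 n) ((cy y : ℂ) + t * Complex.I)‖ ^ 2
          + ∑ c ∈ PC X, ‖LSeries (fun n : ℕ => ((tl (μ : ArithmeticFunction ℝ) U n : ℝ) : ℂ) * c.2 n) ((cy y : ℂ) + t * Complex.I)‖ ^ 2) / 2) := by
        rw [← Finset.mul_sum, ← Finset.sum_div, Finset.sum_add_distrib]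
    _ ≤ _ := mul_le_mul_of_nonneg_left (by linarith) (by linarith)
end PG

namespace PG
open Real Finset
open ArithmeticFunction hiding log
open scoped LSeries.notation ArithmeticFunction.zeta ArithmeticFunction.Moebius

lemma abs_trc_conv_le (U n : ℕ) : |(trc (μ : ArithmeticFunction ℝ) U * trc Λ U) n| ≤ (U : ℝ) ^ 2 := by
  by_cases hn : U ^ 2 < n
  · rw [ArithmeticFunction.mul_apply, Finset.sum_eq_zero]
    · simp
    · intro p hp
      rw [Nat.mem_divisorsAntidiagonal] at hp
      rw [trc_apply, trc_apply]
      by_cases h1 : p.1 ≤ U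
      · rw [if_neg (c := p.2 ≤ U), mul_zero]
        intro h2
        have := Nat.mul_le_mul h1 h2
        rw [hp.1] at this; nlinarith
      · rw [if_neg h1, zero_mul]
  · rw [ArithmeticFunction.mul_apply]
    refine (Finset.abs_sum_le_sum_abs _ _).trans ?_
    calc _ ≤ ∑ p ∈ n.divisorsAntidiagonal, Λ p.2 := by
          refine Finset.sum_le_sum fun p _ => ?_
          rw [abs_mul]
          have h1 : |trc (μ : ArithmeticFunction ℝ) U p.1| ≤ 1 := by
            rw [trc_apply]; split_ifs
            · exact abs_mu_le _
            · simp
          have h2 : |trc Λ U p.2| ≤ Λ p.2 := by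
            rw [trc_apply]; split_ifs
            · rw [abs_of_nonneg vonMangoldt_nonneg]
            · simp [vonMangoldt_nonneg]
          calc _ ≤ 1 * Λ p.2 := mul_le_mul h1 h2 (abs_nonneg _) zero_le_one
            _ = _ := one_mul _
      _ = log n := by
          rw [Nat.sum_divisorsAntidiagonal' (fun a b => Λ b), vonMangoldt_sum]
      _ ≤ n := by
          have := Real.log_le_self (Nat.cast_nonneg (α := ℝ) n); exact this
      _ ≤ _ := by exact_mod_cast (by omega)

lemma trc_conv_zero (U n : ℕ) (hn : U ^ 2 < n) : (trc (μ : ArithmeticFunction ℝ) U * trc Λ U) n = 0 := by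
  rw [ArithmeticFunction.mul_apply, Finset.sum_eq_zero]
  intro p hp
  rw [Nat.mem_divisorsAntidiagonal] at hp
  rw [trc_apply, trc_apply]
  by_cases h1 : p.1 ≤ U
  · rw [if_neg (c := p.2 ≤ U), mul_zero]
    intro h2
    have := Nat.mul_le_mul h1 h2
    rw [hp.1] at this; nlinarith
  · rw [if_neg h1, zero_mul]

theorem vaughan : ∃ C > 0, ∀ y : ℝ, 1 ≤ y → ∀ X : ℕ, 1 ≤ X → (X : ℝ) ≤ exp (y / 100) →
    ∑ c ∈ PC X, ‖∑' n : ℕ, (c.2 n * (vonMangoldt n : ℂ)) * om y n‖ ≤ C * y ^ 5 := by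
  obtain ⟨C1, hC1, H1⟩ := tv_om_mul
  obtain ⟨C2, hC2, H2⟩ := tv_log_om_mul
  refine ⟨16 * (4 + C1 + C2) + 288, by positivity, fun y hy X hX hXy => ?_⟩
  set U : ℕ := 2 * X ^ 4 with hU
  obtain ⟨hsum, h4⟩ := type2 (X := X) (U := U) hy le_rfl
  have hX1 : (1:ℝ) ≤ X := by exact_mod_cast hX
  have hUR : (U:ℝ) = 2 * X ^ 4 := by rw [hU]; push_cast; ring
  have hU1 : (1:ℝ) ≤ U := by
    rw [hUR]; nlinarith [one_le_pow₀ hX1 (n := 4)]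
  set E := exp (-(y / 4)) with hE
  have hE0 : 0 < E := exp_pos _
  have key : ∀ c ∈ PC X, ‖∑' n : ℕ, (c.2 n * (vonMangoldt n : ℂ)) * om y n‖ ≤ (4 + C1 + C2) * ((U:ℝ) ^ 4 * X * E)
      + ‖∑' n : ℕ, ((tl Λ U * ((ζ : ArithmeticFunction ℝ) * tl (μ : ArithmeticFunction ℝ) U)) n : ℂ) * c.2 n * om y n‖ := by
    intro c hc
    obtain ⟨hc1, hc2, hc3, hc4⟩ := mem_PC.1 hc
    have : NeZero c.1 := ⟨by omega⟩
    have hcX : (c.1 : ℝ) ≤ X := by exact_mod_cast hc2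
    -- T1
    have s1 : HasSum (fun n : ℕ => ((trc Λ U n : ℝ) : ℂ) * c.2 n * om y n)
        (∑ n ∈ Finset.range (U + 1), ((trc Λ U n : ℝ) : ℂ) * c.2 n * om y n) := by
      apply hasSum_sum_of_ne_finset_zero
      intro n hn
      rw [Finset.mem_range] at hn
      rw [trc_apply, if_neg (by omega)]; simp
    have b1 : ‖∑' n : ℕ, ((trc Λ U n : ℝ) : ℂ) * c.2 n * om y n‖ ≤ 4 * ((U:ℝ) ^ 4 * X * E) := by
      rw [s1.tsum_eq]
      have : ∀ n ∈ Finset.range (U + 1), ‖((trc Λ U n : ℝ) : ℂ) * c.2 n * om y n‖ ≤ U * (2 * exp (-y)) := by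
        intro n hn
        rw [Finset.mem_range] at hn
        rcases Nat.eq_zero_or_pos n with rfl | hn1
        · simp; positivity
        have h1 : (1:ℝ) ≤ n := by exact_mod_cast hn1
        rw [norm_mul, norm_mul, Complex.norm_real, Complex.norm_real, trc_apply, if_pos (by omega),
          Real.norm_of_nonneg vonMangoldt_nonneg, Real.norm_of_nonneg (om_nonneg (by linarith))]
        refine mul_le_mul ?_ (om_le_small hy h1) (om_nonneg (by linarith)) (by positivity)
        refine (mul_le_of_le_one_right vonMangoldt_nonneg (c.2.norm_le_one _)).trans ?_
        refine vonMangoldt_le_log.trans ((Real.log_le_self (by linarith)).trans ?_)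
        exact_mod_cast (by omega : n ≤ U)
      refine (norm_sum_le_of_le _ this).trans ?_
      rw [Finset.sum_const, Finset.card_range, nsmul_eq_mul]
      push_cast
      have hEE : exp (-y) ≤ E := Real.exp_le_exp.2 (by linarith)
      calc ((U:ℝ) + 1) * (U * (2 * exp (-y))) ≤ (2 * U) * (U * (2 * E)) := by gcongr; linarith
        _ = 4 * ((U ^ 2 * 1) * 1 * E) := by ring
        _ ≤ 4 * ((U ^ 2 * U ^ 2) * X * E) := by
            have := one_le_pow₀ hU1 (n := 2)
            gcongr
        _ = _ := by ring
    -- T2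
    have hs2 : ∀ d : ℕ, 1 ≤ d → Summable fun m : ℕ => (ArithmeticFunction.log m) * om y ((d * m : ℕ) : ℝ) := by
      intro d hd
      simpa [ArithmeticFunction.log_apply] using summable_log_om_mul hy d hd
    have hf2 : ∀ n, U < n → trc (μ : ArithmeticFunction ℝ) U n = 0 := by
      intro n hn; rw [trc_apply, if_neg (by omega)]
    have s2 := (hasSum_dconv c.2 (trc (μ : ArithmeticFunction ℝ) U) ArithmeticFunction.log U hf2 (fun n => om y n) hs2).summable
    have b2 := dconv_bound c.2 hc4 (trc (μ : ArithmeticFunction ℝ) U) ArithmeticFunction.log U hf2 (F := 1) (T := C2 * E)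
      (fun n => by
        rw [trc_apply]; split_ifs
        · exact abs_mu_le _
        · simp) (fun n => om y n) hs2 (fun d hd => by
        simpa [ArithmeticFunction.log_apply] using H2 y hy d hd)
    have b2' : ‖∑' n : ℕ, ((trc (μ : ArithmeticFunction ℝ) U * ArithmeticFunction.log) n : ℂ) * c.2 n * om y n‖ ≤ C2 * ((U:ℝ) ^ 4 * X * E) := by
      refine b2.trans ?_
      calc (U:ℝ) * (1 * (c.1 * (C2 * E))) = C2 * ((U * 1) * c.1 * E) := by ring
        _ ≤ C2 * ((U * U ^ 3) * X * E) := by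
            have := one_le_pow₀ hU1 (n := 3)
            gcongr
        _ = _ := by ring
    -- T3
    have ez : ∀ m : ℕ, ∀ d : ℕ, (ζ : ArithmeticFunction ℝ) m * om y ((d * m : ℕ) : ℝ) = om y (d * m) := by
      intro m d
      rw [ArithmeticFunction.natCoe_apply, ArithmeticFunction.zeta_apply]
      split_ifs with h
      · subst h; simp [om_zero hy]
      · simp
    have hs3 : ∀ d : ℕ, 1 ≤ d → Summable fun m : ℕ => (ζ : ArithmeticFunction ℝ) m * om y ((d * m : ℕ) : ℝ) := by
      intro d hd
      simp_rw [ez]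
      exact summable_om_mul hy d hd
    have s3 := (hasSum_dconv c.2 (trc (μ : ArithmeticFunction ℝ) U * trc Λ U) (ζ : ArithmeticFunction ℝ) (U ^ 2)
      (trc_conv_zero U) (fun n => om y n) hs3).summable
    have b3 := dconv_bound c.2 hc4 (trc (μ : ArithmeticFunction ℝ) U * trc Λ U) (ζ : ArithmeticFunction ℝ) (U ^ 2)
      (trc_conv_zero U) (F := (U:ℝ) ^ 2) (T := C1 * E) (abs_trc_conv_le U) (fun n => om y n) hs3 (fun d hd => by
        simp_rw [ez]; exact H1 y hy d hd)
    have b3' : ‖∑' n : ℕ, ((trc (μ : ArithmeticFunction ℝ) U * trc Λ U * (ζ : ArithmeticFunction ℝ)) n : ℂ) * c.2 n * om y n‖ ≤ C1 * ((U:ℝ) ^ 4 * X * E) := by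
      refine b3.trans ?_
      push_cast
      calc (U:ℝ) ^ 2 * (U ^ 2 * (c.1 * (C1 * E))) = C1 * (U ^ 4 * c.1 * E) := by ring
        _ ≤ _ := by gcongr
    have s4 := summable_mul_om hy (hsum c hc)
    have e : ∀ n : ℕ, (c.2 n * (vonMangoldt n : ℂ)) * om y n =
        ((trc Λ U n : ℝ) : ℂ) * c.2 n * om y n + ((trc (μ : ArithmeticFunction ℝ) U * ArithmeticFunction.log) n : ℂ) * c.2 n * om y n
        - ((trc (μ : ArithmeticFunction ℝ) U * trc Λ U * (ζ : ArithmeticFunction ℝ)) n : ℂ) * c.2 n * om y n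
        + ((tl Λ U * ((ζ : ArithmeticFunction ℝ) * tl (μ : ArithmeticFunction ℝ) U)) n : ℂ) * c.2 n * om y n := by
      intro n
      have := congrArg (fun f : ArithmeticFunction ℝ => f n) (vaughan_id U)
      have e3 : ∀ a b : ArithmeticFunction ℝ, (a - b) n = a n - b n := by
        intro a b
        have : (a - b + b) n = a n := by rw [sub_add_cancel]
        rw [ArithmeticFunction.add_apply] at this; linarith
      simp only [ArithmeticFunction.add_apply, e3] at this
      rw [this]
      push_cast
      ring
    simp_rw [e]
    rw [((s1.summable.add s2).sub s3).tsum_add s4, (s1.summable.add s2).tsum_sub s3, s1.summable.tsum_add s2]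
    refine (norm_add_le _ _).trans (add_le_add ?_ le_rfl)
    refine (norm_sub_le _ _).trans ?_
    refine (add_le_add (norm_add_le _ _) le_rfl).trans ?_
    linarith
  refine (Finset.sum_le_sum key).trans ?_
  rw [Finset.sum_add_distrib, Finset.sum_const, nsmul_eq_mul]
  have hcard : ((PC X).card : ℝ) ≤ X ^ 2 := by exact_mod_cast card_PC X
  have hb : ((PC X).card : ℝ) * ((4 + C1 + C2) * ((U:ℝ) ^ 4 * X * E)) ≤ 16 * (4 + C1 + C2) := by
    calc _ ≤ (X:ℝ) ^ 2 * ((4 + C1 + C2) * ((U:ℝ) ^ 4 * X * E)) := by gcongr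
      _ = 16 * (4 + C1 + C2) * (X ^ 19 * E) := by rw [hUR]; ring
      _ ≤ 16 * (4 + C1 + C2) * 1 := by
          refine mul_le_mul_of_nonneg_left ?_ (by positivity)
          calc (X:ℝ) ^ 19 * E ≤ (exp (y / 100)) ^ 19 * E := by gcongr
            _ = exp (19 * (y / 100) + -(y / 4)) := by rw [← Real.exp_nat_mul, hE, ← Real.exp_add]; norm_num
            _ ≤ 1 := by rw [Real.exp_le_one_iff]; linarith
      _ = _ := mul_one _
  have hy5 := one_le_pow₀ hy (n := 5)
  have h4' : (1 + y) * ((2 + y) * (16 * y ^ 2 * (1 + 2 * y))) ≤ 288 * y ^ 5 := by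
    calc _ ≤ (y + y) * ((2 * y + y) * (16 * y ^ 2 * (y + 2 * y))) := by gcongr; linarith
      _ = _ := by ring
  have : 16 * (4 + C1 + C2) * 1 ≤ 16 * (4 + C1 + C2) * y ^ 5 := mul_le_mul_of_nonneg_left hy5 (by positivity)
  linarith [h4]
end PG

namespace PG
open Real Finset

lemma sum_pow_om_sqf {m : ℕ} (hm : Squarefree m) (K : ℕ) :
    ∑ d ∈ m.divisors, (K : ℝ) ^ d.primeFactors.card = ((K : ℝ) + 1) ^ m.primeFactors.card := by
  have h0 : m ≠ 0 := hm.ne_zero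
  have h1 : m.divisors = m.divisors.filter Squarefree := by
    rw [Finset.filter_true_of_mem]
    intro d hd
    exact hm.squarefree_of_dvd (Nat.dvd_of_mem_divisors hd)
  rw [h1, Nat.sum_divisors_filter_squarefree h0]
  have h2 : UniqueFactorizationMonoid.normalizedFactors m = m.primeFactorsList := Nat.factors_eq m
  have h3 : (UniqueFactorizationMonoid.normalizedFactors m).toFinset = m.primeFactors := by
    rw [h2]; rfl
  rw [h3, ← Finset.sum_pow_mul_eq_add_pow]
  refine Finset.sum_congr rfl fun s hs => ?_
  rw [Finset.mem_powerset] at hs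
  rw [one_pow, mul_one]
  congr 1
  congr 1
  have : s.val.prod = ∏ p ∈ s, p := Finset.prod_val s
  rw [this, Nat.primeFactors_prod]
  intro p hp
  exact Nat.prime_of_mem_primeFactors (hs hp)

lemma harm_le (X : ℕ) : ∑ n ∈ Finset.Icc 1 X, (1 : ℝ) / n ≤ 1 + log X := by
  have h := harmonic_le_one_add_log X
  rw [harmonic_eq_sum_Icc] at h
  push_cast at h
  simpa using h

lemma sum_tau_div (K X : ℕ) :
    ∑ m ∈ (Finset.Icc 1 X).filter Squarefree, (K : ℝ) ^ m.primeFactors.card / m ≤ (1 + log X) ^ K := by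
  have hl : 0 ≤ log X := Real.log_natCast_nonneg X
  induction K with
  | zero =>
    rw [pow_zero]
    calc _ ≤ ∑ m ∈ ({1} : Finset ℕ), (1:ℝ) := by
          rw [← Finset.sum_filter_add_sum_filter_not _ (fun m => m = 1)]
          have e2 : ∑ m ∈ ((Finset.Icc 1 X).filter Squarefree).filter (fun m => ¬ m = 1), (((0:ℕ) : ℝ) ^ m.primeFactors.card / m) = 0 := by
            refine Finset.sum_eq_zero fun m hm => ?_
            simp only [Finset.mem_filter, Finset.mem_Icc] at hm
            have : m.primeFactors.card ≠ 0 := by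
              rw [Finset.card_ne_zero, Nat.nonempty_primeFactors]; omega
            simp [this]
          rw [e2, add_zero]
          calc _ ≤ ∑ m ∈ ((Finset.Icc 1 X).filter Squarefree).filter (fun m => m = 1), (1:ℝ) := by
                refine Finset.sum_le_sum fun m hm => ?_
                rw [(Finset.mem_filter.1 hm).2]; simp
            _ ≤ _ := by
                refine Finset.sum_le_sum_of_subset_of_nonneg ?_ (fun _ _ _ => zero_le_one)
                intro m hm; rw [Finset.mem_singleton]; exact (Finset.mem_filter.1 hm).2
      _ = 1 := by simp
  | succ K ih =>
    set S := (Finset.Icc 1 X).filter Squarefree with hS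
    calc _ = ∑ m ∈ S, ∑ d ∈ m.divisors, (K : ℝ) ^ d.primeFactors.card / d * (1 / ((m / d : ℕ) : ℝ)) := by
          refine Finset.sum_congr rfl fun m hm => ?_
          simp only [hS, Finset.mem_filter, Finset.mem_Icc] at hm
          push_cast
          rw [← sum_pow_om_sqf hm.2, Finset.sum_div]
          refine Finset.sum_congr rfl fun d hd => ?_
          have hd' := Nat.dvd_of_mem_divisors hd
          have hd0 : (d:ℝ) ≠ 0 := by
            have := Nat.pos_of_mem_divisors hd
            exact_mod_cast this.ne'
          rw [Nat.cast_div hd' hd0]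
          have : (m:ℝ) ≠ 0 := by exact_mod_cast (by omega : m ≠ 0)
          field_simp
      _ = ∑ x ∈ S.sigma (fun m => m.divisors), (K : ℝ) ^ x.2.primeFactors.card / x.2 * (1 / ((x.1 / x.2 : ℕ) : ℝ)) := by
          rw [Finset.sum_sigma]
      _ ≤ ∑ x ∈ S ×ˢ Finset.Icc 1 X, (K : ℝ) ^ x.1.primeFactors.card / x.1 * (1 / (x.2 : ℝ)) := by
          have hmem : ∀ x : Σ _ : ℕ, ℕ, x ∈ S.sigma (fun m => m.divisors) → x.1 ∈ S ∧ x.2 ∣ x.1 ∧ 1 ≤ x.1 ∧ x.1 ≤ X ∧ 1 ≤ x.2 := by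
            intro x hx
            rw [Finset.mem_sigma] at hx
            have h1 := hx.1
            simp only [hS, Finset.mem_filter, Finset.mem_Icc] at h1
            exact ⟨hx.1, Nat.dvd_of_mem_divisors hx.2, h1.1.1, h1.1.2, Nat.pos_of_mem_divisors hx.2⟩
          have hinj : Set.InjOn (fun x : Σ _ : ℕ, ℕ => (x.2, x.1 / x.2)) (S.sigma (fun m => m.divisors) : Set (Σ _ : ℕ, ℕ)) := by
            rintro ⟨a, b⟩ ha ⟨c, d⟩ hc h
            have h1 := hmem _ ha
            have h2 := hmem _ hc
            simp only [Prod.mk.injEq] at h h1 h2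
            obtain ⟨rfl, h⟩ := h
            have : a = c := by
              rw [← Nat.div_mul_cancel h1.2.1, ← Nat.div_mul_cancel h2.2.1, h]
            subst this; rfl
          rw [← Finset.sum_image (f := fun z : ℕ × ℕ => (K : ℝ) ^ z.1.primeFactors.card / z.1 * (1 / (z.2 : ℝ))) hinj]
          refine Finset.sum_le_sum_of_subset_of_nonneg ?_ (fun _ _ _ => by positivity)
          intro z hz
          rw [Finset.mem_image] at hz
          obtain ⟨x, hx, rfl⟩ := hz
          have h := hmem x hx
          have h1 := h.1
          simp only [hS, Finset.mem_filter, Finset.mem_Icc] at h1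
          rw [Finset.mem_product, Finset.mem_Icc]
          simp only [hS, Finset.mem_filter, Finset.mem_Icc]
          refine ⟨⟨⟨h.2.2.2.2, (Nat.le_of_dvd (by omega) h.2.1).trans h.2.2.2.1⟩, h1.2.squarefree_of_dvd h.2.1⟩, ?_, ?_⟩
          · exact Nat.div_pos (Nat.le_of_dvd (by omega) h.2.1) (by omega)
          · exact (Nat.div_le_self _ _).trans h.2.2.2.1
      _ = (∑ d ∈ S, (K : ℝ) ^ d.primeFactors.card / d) * ∑ e ∈ Finset.Icc 1 X, (1 / (e : ℝ)) := by
          rw [Finset.sum_product, Finset.sum_mul_sum]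
      _ ≤ (1 + log X) ^ K * (1 + log X) := by
          refine mul_le_mul ih (harm_le X) (Finset.sum_nonneg fun _ _ => by positivity) (by positivity)
      _ = _ := by rw [pow_succ]

lemma totient_sqf {m : ℕ} (hm : Squarefree m) : m.totient = ∏ p ∈ m.primeFactors, (p - 1) := by
  rw [Nat.totient_eq_div_primeFactors_mul, Nat.prod_primeFactors_of_squarefree hm,
    Nat.div_self (Nat.pos_of_ne_zero hm.ne_zero), one_mul]

lemma inv_totient_le {m : ℕ} (hm : Squarefree m) : (1 : ℝ) / m.totient ≤ 2 ^ m.primeFactors.card / m := by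
  have hm0 : 0 < m := Nat.pos_of_ne_zero hm.ne_zero
  have ht : (0:ℝ) < m.totient := by exact_mod_cast Nat.totient_pos.2 hm0
  rw [div_le_div_iff₀ ht (by exact_mod_cast hm0), one_mul]
  have : m ≤ 2 ^ m.primeFactors.card * m.totient := by
    rw [totient_sqf hm]
    conv_lhs => rw [← Nat.prod_primeFactors_of_squarefree hm]
    rw [← Finset.prod_const, ← Finset.prod_mul_distrib]
    refine Finset.prod_le_prod' fun p hp => ?_
    have := (Nat.prime_of_mem_primeFactors hp).two_le
    omega
  exact_mod_cast this

lemma sum_tau (K X : ℕ) :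
    ∑ m ∈ (Finset.Icc 1 X).filter Squarefree, (K : ℝ) ^ m.primeFactors.card / m.totient ≤ (1 + log X) ^ (2 * K) := by
  refine le_trans ?_ (sum_tau_div (2 * K) X)
  refine Finset.sum_le_sum fun m hm => ?_
  rw [Finset.mem_filter] at hm
  have := inv_totient_le hm.2
  push_cast
  rw [mul_pow, div_eq_mul_one_div, mul_comm ((2:ℝ) ^ _), mul_div_assoc]
  exact mul_le_mul_of_nonneg_left this (by positivity)

lemma pow_om_le (K : ℕ) (hK : 1 ≤ K) {m : ℕ} (hm : Squarefree m) :
    (K : ℝ) ^ m.primeFactors.card ≤ (K : ℝ) ^ (K ^ 2) * √m := by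
  have hK1 : (1:ℝ) ≤ K := by exact_mod_cast hK
  rw [← Finset.prod_const, ← Finset.prod_filter_mul_prod_filter_not _ (fun p => p < K ^ 2)]
  refine mul_le_mul ?_ ?_ (Finset.prod_nonneg fun _ _ => by positivity) (by positivity)
  · rw [Finset.prod_const]
    refine pow_le_pow_right₀ hK1 ?_
    calc _ ≤ (Finset.range (K ^ 2)).card := by
          refine Finset.card_le_card fun p hp => ?_
          rw [Finset.mem_filter] at hp
          rw [Finset.mem_range]; exact hp.2
      _ = _ := Finset.card_range _
  · have h1 : √(m:ℝ) = ∏ p ∈ m.primeFactors, √(p:ℝ) := by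
      conv_lhs => rw [← Nat.prod_primeFactors_of_squarefree hm]
      push_cast
      rw [Real.sqrt_prod]
      intros; positivity
    rw [h1, ← Finset.prod_filter_mul_prod_filter_not (s := m.primeFactors) (p := fun p => p < K ^ 2) (f := fun p : ℕ => √(p:ℝ))]
    have h2 : (1:ℝ) ≤ ∏ p ∈ m.primeFactors with p < K ^ 2, √(p:ℝ) := by
      rw [← Finset.prod_const_one (s := m.primeFactors.filter (fun p => p < K ^ 2))]
      refine Finset.prod_le_prod (fun _ _ => zero_le_one) (fun p hp => ?_)
      rw [Finset.mem_filter] at hp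
      rw [Real.one_le_sqrt]
      exact_mod_cast (Nat.prime_of_mem_primeFactors hp.1).one_le
    refine le_trans ?_ (le_mul_of_one_le_left (Finset.prod_nonneg fun _ _ => by positivity) h2)
    refine Finset.prod_le_prod (fun _ _ => by positivity) fun p hp => ?_
    rw [Finset.mem_filter] at hp
    apply Real.le_sqrt_of_sq_le
    exact_mod_cast (by omega : K ^ 2 ≤ p)
end PG

namespace PG
open Real Finset

noncomputable def th (y : ℝ) (X : ℕ) (c : Σ q, DirichletCharacter ℂ q) : ℂ :=
  ∑' n : ℕ, (c.2 n * (lamP X n : ℂ)) * om y n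

noncomputable def Th (y : ℝ) (X : ℕ) : ℝ := ∑' n : ℕ, lamP X n * om y n

/-- sum of absolute values of nontrivial twisted sums of modulus q -/
noncomputable def Es (y : ℝ) (X q : ℕ) : ℝ := by
  classical
  exact if h : q = 0 then 0 else
    have : NeZero q := ⟨h⟩
    ∑ χ ∈ (Finset.univ : Finset (DirichletCharacter ℂ q)).filter (fun χ => χ ≠ 1), ‖th y X ⟨q, χ⟩‖

lemma Es_def (y : ℝ) (X q : ℕ) [NeZero q] [DecidableEq (DirichletCharacter ℂ q)] : Es y X q =
    ∑ χ ∈ (Finset.univ : Finset (DirichletCharacter ℂ q)).filter (fun χ => χ ≠ 1), ‖th y X ⟨q, χ⟩‖ := by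
  unfold Es
  rw [dif_neg (NeZero.ne q)]
  refine Finset.sum_congr ?_ (fun _ _ => rfl)
  ext; simp

lemma Es_nonneg (y : ℝ) (X q : ℕ) : 0 ≤ Es y X q := by
  classical
  unfold Es; split_ifs
  · exact le_rfl
  · exact Finset.sum_nonneg fun _ _ => norm_nonneg _

lemma lamP_coprime {X q n : ℕ} (hq : 1 ≤ q) (hqX : q ≤ X) (h : lamP X n ≠ 0) : n.Coprime q := by
  unfold lamP at h
  split_ifs at h with h1
  · rw [Nat.Prime.coprime_iff_not_dvd h1.1]
    intro hd
    have := Nat.le_of_dvd (by omega) hd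
    have h2 : X < n := by exact_mod_cast h1.2
    omega
  · exact absurd rfl h

lemma summable_th {y : ℝ} (hy : 1 ≤ y) (X : ℕ) {q : ℕ} (χ : DirichletCharacter ℂ q) :
    Summable fun n : ℕ => (χ n * (lamP X n : ℂ)) * om y n := by
  refine Summable.of_norm_bounded (summable_lamP_om hy X) fun n => ?_
  rw [norm_mul, norm_mul, Complex.norm_real, Complex.norm_real, Real.norm_of_nonneg (lamP_nonneg _ _),
    Real.norm_of_nonneg (om_nonneg (by positivity))]
  refine mul_le_mul_of_nonneg_right ?_ (om_nonneg (by positivity))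
  exact mul_le_of_le_one_left (lamP_nonneg _ _) (χ.norm_le_one _)

lemma ap_prime {y : ℝ} (hy : 1 ≤ y) {X q : ℕ} (hq : 1 ≤ q) (hqX : q ≤ X) {b : ℕ} (hb : b.Coprime q) :
    |∑' n : ℕ, (if (n : ZMod q) = b then lamP X n * om y n else 0) - Th y X / q.totient| ≤ Es y X q / q.totient := by
  classical
  have : NeZero q := ⟨by omega⟩
  have hu : IsUnit (b : ZMod q) := (ZMod.isUnit_iff_coprime b q).2 hb
  have hφ : (0:ℝ) < q.totient := by exact_mod_cast Nat.totient_pos.2 (by omega)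
  have hφC : (q.totient : ℂ) ≠ 0 := by exact_mod_cast (Nat.totient_pos.2 (by omega)).ne'
  have h1 : HasSum (fun n : ℕ => ∑ χ : DirichletCharacter ℂ q, χ (b : ZMod q)⁻¹ * ((χ n * (lamP X n : ℂ)) * om y n))
      (∑ χ : DirichletCharacter ℂ q, χ (b : ZMod q)⁻¹ * th y X ⟨q, χ⟩) :=
    hasSum_sum fun χ _ => (summable_th hy X χ).hasSum.mul_left _
  have e1 : ∀ n : ℕ, ∑ χ : DirichletCharacter ℂ q, χ (b : ZMod q)⁻¹ * ((χ n * (lamP X n : ℂ)) * om y n)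
      = (q.totient : ℂ) * ((if (n : ZMod q) = b then lamP X n * om y n else 0 : ℝ) : ℂ) := by
    intro n
    have h2 := DirichletCharacter.sum_char_inv_mul_char_eq ℂ hu (n : ZMod q)
    simp_rw [← mul_assoc]
    rw [← Finset.sum_mul, ← Finset.sum_mul, h2]
    by_cases h : (n : ZMod q) = b
    · rw [if_pos h.symm, if_pos h]; push_cast; ring
    · rw [if_neg (fun h' => h h'.symm), if_neg h]; simp
  simp_rw [e1] at h1
  have h3 := h1.tsum_eq
  rw [tsum_mul_left, ← Complex.ofReal_tsum] at h3
  set A := ∑' n : ℕ, (if (n : ZMod q) = b then lamP X n * om y n else 0) with hA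
  have hone : th y X ⟨q, 1⟩ = (Th y X : ℂ) := by
    unfold th Th
    rw [Complex.ofReal_tsum]
    congr 1; ext n
    by_cases h : lamP X n = 0
    · simp [h]
    · have h4 : IsUnit (n : ZMod q) := (ZMod.isUnit_iff_coprime n q).2 (lamP_coprime hq hqX h)
      rw [MulChar.one_apply h4]; push_cast; ring
  have hinv : IsUnit (b : ZMod q)⁻¹ := by
    have h := ZMod.isUnit_inv (m := q) (n := (b : ℤ)) (by exact_mod_cast hu)
    exact_mod_cast h
  have h5 : (q.totient : ℂ) * A - Th y X = ∑ χ ∈ (Finset.univ : Finset (DirichletCharacter ℂ q)).filter (fun χ => χ ≠ 1),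
      χ (b : ZMod q)⁻¹ * th y X ⟨q, χ⟩ := by
    rw [h3, Finset.filter_ne', ← Finset.add_sum_erase _ _ (Finset.mem_univ (1 : DirichletCharacter ℂ q)), hone,
      MulChar.one_apply hinv]
    ring
  have h6 : |(q.totient : ℝ) * A - Th y X| ≤ Es y X q := by
    rw [← Real.norm_eq_abs, ← Complex.norm_real]
    push_cast
    rw [h5, Es_def]
    refine norm_sum_le_of_le _ fun χ _ => ?_
    rw [norm_mul]
    exact mul_le_of_le_one_left (norm_nonneg _) (χ.norm_le_one _)
  have h7 : A - Th y X / q.totient = ((q.totient : ℝ) * A - Th y X) / q.totient := by field_simp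
  rw [h7, abs_div, abs_of_pos hφ]
  exact div_le_div_of_nonneg_right h6 hφ.le

lemma th_prim {y : ℝ} {X q : ℕ} (hq : 1 ≤ q) (hqX : q ≤ X) (χ : DirichletCharacter ℂ q) :
    th y X ⟨q, χ⟩ = th y X ⟨χ.conductor, χ.primitiveCharacter⟩ := by
  unfold th
  congr 1; ext n
  by_cases h : lamP X n = 0
  · simp [h]
  · have h1 := lamP_coprime hq hqX h
    have h2 := chl_apply χ.primitiveCharacter χ.conductor_dvd_level h1
    rw [DirichletCharacter.changeLevel_primitiveCharacter] at h2
    simp only [h2]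

lemma Es_le {y : ℝ} {X q : ℕ} (hq : 1 ≤ q) (hqX : q ≤ X) :
    Es y X q ≤ ∑ c ∈ (PC X).filter (fun c => c.1 ∣ q), ‖th y X c‖ := by
  classical
  have : NeZero q := ⟨by omega⟩
  rw [Es_def]
  have e : ∀ χ ∈ (Finset.univ : Finset (DirichletCharacter ℂ q)).filter (fun χ => χ ≠ 1), ‖th y X ⟨q, χ⟩‖
      = ‖th y X ⟨χ.conductor, χ.primitiveCharacter⟩‖ := by
    intro χ _; rw [th_prim hq hqX]
  rw [Finset.sum_congr rfl e]
  have hinj : Set.InjOn (fun χ : DirichletCharacter ℂ q => (⟨χ.conductor, χ.primitiveCharacter⟩ : Σ q, DirichletCharacter ℂ q))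
      ((Finset.univ : Finset (DirichletCharacter ℂ q)).filter (fun χ => χ ≠ 1) : Set (DirichletCharacter ℂ q)) := by
    intro χ _ ψ _ h
    simp only at h
    have h1 := χ.changeLevel_primitiveCharacter
    have h2 := ψ.changeLevel_primitiveCharacter
    rw [← h1, ← h2]
    have key : ∀ (a b : Σ q, DirichletCharacter ℂ q) (ha : a.1 ∣ q) (hb : b.1 ∣ q), a = b →
        DirichletCharacter.changeLevel ha a.2 = DirichletCharacter.changeLevel hb b.2 := by
      intro a b ha hb hab; subst hab; rfl
    exact key ⟨χ.conductor, χ.primitiveCharacter⟩ ⟨ψ.conductor, ψ.primitiveCharacter⟩ χ.conductor_dvd_level ψ.conductor_dvd_level h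
  rw [← Finset.sum_image (f := fun c => ‖th y X c‖) hinj]
  refine Finset.sum_le_sum_of_subset_of_nonneg ?_ (fun _ _ _ => norm_nonneg _)
  intro c hc
  rw [Finset.mem_image] at hc
  obtain ⟨χ, hχ, rfl⟩ := hc
  rw [Finset.mem_filter] at hχ
  rw [Finset.mem_filter, mem_PC]
  have hd := χ.conductor_dvd_level
  refine ⟨⟨Nat.pos_of_dvd_of_pos hd (by omega), (Nat.le_of_dvd (by omega) hd).trans hqX,
    χ.primitiveCharacter_isPrimitive, ?_⟩, hd⟩
  intro h
  replace h : χ.primitiveCharacter = 1 := h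
  apply hχ.2
  rw [← χ.changeLevel_primitiveCharacter, h, map_one]

lemma th_sub_psi : ∃ C > 0, ∀ y : ℝ, 1 ≤ y → ∀ X : ℕ, 1 ≤ X → ∀ c : Σ q, DirichletCharacter ℂ q,
    ‖th y X c‖ ≤ ‖∑' n : ℕ, (c.2 n * (ArithmeticFunction.vonMangoldt n : ℂ)) * om y n‖ + C * ((X:ℝ) ^ 2 * exp (-(y / 4))) := by
  obtain ⟨C, hC, H⟩ := pp_tail
  refine ⟨C, hC, fun y hy X hX c => ?_⟩
  have hX1 : (1:ℝ) ≤ X := by exact_mod_cast hX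
  have h := H y hy X hX1
  have sL : Summable fun n : ℕ => (c.2 n * (ArithmeticFunction.vonMangoldt n : ℂ)) * om y n := by
    refine Summable.of_norm_bounded (summable_Lam_om hy) fun n => ?_
    rw [norm_mul, norm_mul, Complex.norm_real, Complex.norm_real, Real.norm_of_nonneg ArithmeticFunction.vonMangoldt_nonneg,
      Real.norm_of_nonneg (om_nonneg (by positivity))]
    refine mul_le_mul_of_nonneg_right ?_ (om_nonneg (by positivity))
    exact mul_le_of_le_one_left ArithmeticFunction.vonMangoldt_nonneg (c.2.norm_le_one _)
  have s2 : Summable fun n : ℕ => (ArithmeticFunction.vonMangoldt n - lamP X n) * om y n := by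
    simp_rw [sub_mul]
    exact (summable_Lam_om hy).sub (summable_lamP_om hy X)
  have e : th y X c = ∑' n : ℕ, (c.2 n * (ArithmeticFunction.vonMangoldt n : ℂ)) * om y n
      - ∑' n : ℕ, (c.2 n * ((ArithmeticFunction.vonMangoldt n - lamP X n : ℝ) : ℂ)) * om y n := by
    have s3 : Summable fun n : ℕ => (c.2 n * ((ArithmeticFunction.vonMangoldt n - lamP X n : ℝ) : ℂ)) * om y n := by
      have := sL.sub (summable_th hy X c.2)
      refine (summable_congr fun n => ?_).2 this
      push_cast; ring
    rw [← sL.tsum_sub s3]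
    unfold th
    congr 1; ext n; push_cast; ring
  rw [e]
  refine (norm_sub_le _ _).trans (add_le_add le_rfl ?_)
  refine le_trans ?_ h
  refine tsum_of_norm_bounded s2.hasSum fun n => ?_
  have h0 : 0 ≤ ArithmeticFunction.vonMangoldt n - lamP X n := sub_nonneg.2 (lamP_le_Lam X n)
  rw [norm_mul, norm_mul, Complex.norm_real, Complex.norm_real, Real.norm_of_nonneg h0,
    Real.norm_of_nonneg (om_nonneg (by positivity))]
  refine mul_le_mul_of_nonneg_right ?_ (om_nonneg (by positivity))
  exact mul_le_of_le_one_left h0 (c.2.norm_le_one _)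
end PG

namespace PG
open Real Finset

noncomputable def Xy (y : ℝ) : ℕ := ⌊exp (y / 100)⌋₊

lemma one_le_Xy {y : ℝ} (hy : 1 ≤ y) : 1 ≤ Xy y := by
  unfold Xy
  rw [Nat.one_le_floor_iff]; exact Real.one_le_exp (by linarith)

lemma Xy_le (y : ℝ) : (Xy y : ℝ) ≤ exp (y / 100) := Nat.floor_le (exp_pos _).le

noncomputable def aw (C0 q : ℕ) : ℝ := (C0 : ℝ) ^ q.primeFactors.card / q.totient

lemma aw_nonneg (C0 q : ℕ) : 0 ≤ aw C0 q := by unfold aw; positivity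

lemma aw_mul (C0 : ℕ) {a b : ℕ} (h : a.Coprime b) : aw C0 (a * b) = aw C0 a * aw C0 b := by
  unfold aw
  rw [Nat.Coprime.primeFactors_mul h, Finset.card_union_of_disjoint h.disjoint_primeFactors, Nat.totient_mul h, pow_add]
  push_cast
  rw [mul_div_mul_comm]

lemma sum_aw_dvd (C0 X : ℕ) (d : ℕ) (hd : 1 ≤ d) :
    ∑ q ∈ ((Finset.Icc 1 X).filter Squarefree).filter (fun q => d ∣ q), aw C0 q ≤
      aw C0 d * ∑ m ∈ (Finset.Icc 1 X).filter Squarefree, aw C0 m := by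
  have hmem : ∀ q ∈ ((Finset.Icc 1 X).filter Squarefree).filter (fun q => d ∣ q),
      1 ≤ q ∧ q ≤ X ∧ Squarefree q ∧ d ∣ q := by
    intro q hq
    simp only [Finset.mem_filter, Finset.mem_Icc] at hq
    tauto
  have e : ∀ q ∈ ((Finset.Icc 1 X).filter Squarefree).filter (fun q => d ∣ q), aw C0 q = aw C0 d * aw C0 (q / d) := by
    intro q hq
    obtain ⟨h1, h2, h3, h4⟩ := hmem q hq
    have h5 : d * (q / d) = q := Nat.mul_div_cancel' h4
    rw [← h5] at h3
    rw [← aw_mul C0 (Nat.coprime_of_squarefree_mul h3), h5]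
  rw [Finset.sum_congr rfl e, ← Finset.mul_sum]
  refine mul_le_mul_of_nonneg_left ?_ (aw_nonneg _ _)
  have hinj : Set.InjOn (fun q => q / d) (((Finset.Icc 1 X).filter Squarefree).filter (fun q => d ∣ q) : Set ℕ) := by
    intro a ha b hb h
    rw [← Nat.mul_div_cancel' (hmem a ha).2.2.2, ← Nat.mul_div_cancel' (hmem b hb).2.2.2]
    simp only at h
    rw [h]
  rw [← Finset.sum_image (f := fun m => aw C0 m) hinj]
  refine Finset.sum_le_sum_of_subset_of_nonneg ?_ (fun _ _ _ => aw_nonneg _ _)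
  intro m hm
  rw [Finset.mem_image] at hm
  obtain ⟨q, hq, rfl⟩ := hm
  obtain ⟨h1, h2, h3, h4⟩ := hmem q hq
  simp only [Finset.mem_filter, Finset.mem_Icc]
  exact ⟨⟨Nat.div_pos (Nat.le_of_dvd (by omega) h4) (by omega), (Nat.div_le_self _ _).trans h2⟩,
    h3.squarefree_of_dvd (Nat.div_dvd_of_dvd h4)⟩

lemma aw_le (C0 : ℕ) (hC0 : 1 ≤ C0) {m : ℕ} (hm : Squarefree m) :
    aw C0 m ≤ ((2 * C0 : ℕ) : ℝ) ^ ((2 * C0) ^ 2) / √m := by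
  have hm0 : (0:ℝ) < m := by exact_mod_cast Nat.pos_of_ne_zero hm.ne_zero
  have h1 := pow_om_le (2 * C0) (by omega) hm
  have h2 := inv_totient_le hm
  unfold aw
  calc (C0 : ℝ) ^ m.primeFactors.card / m.totient = (C0 : ℝ) ^ m.primeFactors.card * (1 / m.totient) := by ring
    _ ≤ (C0 : ℝ) ^ m.primeFactors.card * (2 ^ m.primeFactors.card / m) := mul_le_mul_of_nonneg_left h2 (by positivity)
    _ = ((2 * C0 : ℕ) : ℝ) ^ m.primeFactors.card / m := by push_cast; rw [mul_pow]; ring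
    _ ≤ ((2 * C0 : ℕ) : ℝ) ^ ((2 * C0) ^ 2) * √m / m := div_le_div_of_nonneg_right h1 hm0.le
    _ = _ := by
        have h3 : (m:ℝ) = √m * √m := (Real.mul_self_sqrt hm0.le).symm
        have h4 : 0 < √(m:ℝ) := Real.sqrt_pos.2 hm0
        conv_lhs => rw [h3]
        field_simp
        rw [Real.sqrt_sq h4.le]

lemma exp_neg_le (N : ℕ) {y : ℝ} (hy : 1 ≤ y) : exp (-(y / 5)) ≤ (5 ^ N * N.factorial) / y ^ N := by
  have h := Real.pow_div_factorial_le_exp (y / 5) (by positivity) N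
  rw [Real.exp_neg, inv_eq_one_div, div_le_div_iff₀ (exp_pos _) (by positivity), one_mul]
  rw [div_le_iff₀ (by positivity), div_pow, div_le_iff₀ (by positivity)] at h
  linarith

theorem bv (C0 A : ℕ) (hC0 : 1 ≤ C0) (y0 : ℝ) : ∃ y, y0 ≤ y ∧ 1 ≤ y ∧
    ∑ q ∈ (Finset.Icc 1 (Xy y)).filter Squarefree, aw C0 q * Es y (Xy y) q ≤ 1 / y ^ A := by
  classical
  obtain ⟨Cv, hCv, HV⟩ := vaughan
  obtain ⟨Ct, hCt, HT⟩ := th_sub_psi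
  set D : ℝ := ((2 * C0 : ℕ) : ℝ) ^ ((2 * C0) ^ 2) with hD
  have hD0 : 0 < D := by positivity
  set B' : ℕ := 5 + 2 * C0 + A + 1 with hB'
  set B : ℕ := 2 * B' with hB
  set A1 : ℕ := 2 * B + 2 * C0 + A + 1 with hA1
  set κ : ℝ := Ct * (5 ^ A1 * A1.factorial) with hκ
  have hκ0 : 0 < κ := by positivity
  obtain ⟨y, hyy, hy, HS⟩ := SW B A1 (by omega) (max y0 (D * 2 ^ (2 * C0) * ((1 + κ) + (Cv + κ))))
  refine ⟨y, (le_max_left _ _).trans hyy, hy, ?_⟩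
  have hyc := (le_max_right _ _).trans hyy
  have hy0 : 0 < y := by linarith
  set X := Xy y with hX
  have hX1 := one_le_Xy hy
  have hXle := Xy_le y
  set S := (Finset.Icc 1 X).filter Squarefree with hS
  set L := ∑ m ∈ S, aw C0 m with hL
  have hL1 : L ≤ 2 ^ (2 * C0) * y ^ (2 * C0) := by
    refine (sum_tau C0 X).trans ?_
    rw [← mul_pow]
    have h0 := Real.log_natCast_nonneg X
    have h1 : log X ≤ y / 100 := by
      rw [Real.log_le_iff_le_exp (by exact_mod_cast hX1)]; exact hXle
    exact pow_le_pow_left₀ (by linarith) (by linarith) _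
  have hL0 : 0 ≤ L := Finset.sum_nonneg fun _ _ => aw_nonneg _ _
  -- step 1
  have step1 : ∑ q ∈ S, aw C0 q * Es y X q ≤ ∑ c ∈ PC X, ‖th y X c‖ * (D / √c.1 * L) := by
    calc _ ≤ ∑ q ∈ S, ∑ c ∈ PC X, (if c.1 ∣ q then aw C0 q * ‖th y X c‖ else 0) := by
          refine Finset.sum_le_sum fun q hq => ?_
          simp only [hS, Finset.mem_filter, Finset.mem_Icc] at hq
          rw [← Finset.sum_filter, ← Finset.mul_sum]
          exact mul_le_mul_of_nonneg_left (Es_le hq.1.1 hq.1.2) (aw_nonneg _ _)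
      _ = ∑ c ∈ PC X, ‖th y X c‖ * ∑ q ∈ S.filter (fun q => c.1 ∣ q), aw C0 q := by
          rw [Finset.sum_comm]
          refine Finset.sum_congr rfl fun c _ => ?_
          rw [← Finset.sum_filter, Finset.mul_sum]
          exact Finset.sum_congr rfl fun _ _ => mul_comm _ _
      _ ≤ _ := by
          refine Finset.sum_le_sum fun c hc => ?_
          refine mul_le_mul_of_nonneg_left ?_ (norm_nonneg _)
          by_cases hsq : Squarefree c.1
          · refine (sum_aw_dvd C0 X c.1 (mem_PC.1 hc).1).trans ?_
            exact mul_le_mul_of_nonneg_right (aw_le C0 hC0 hsq) hL0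
          · rw [Finset.filter_false_of_mem, Finset.sum_empty]
            · positivity
            · intro q hq hd
              simp only [hS, Finset.mem_filter] at hq
              exact hsq (hq.2.squarefree_of_dvd hd)
  -- eta
  set η := Ct * ((X:ℝ) ^ 2 * exp (-(y / 4))) with hη
  have hη2 : (X:ℝ) ^ 2 * η ≤ κ / y ^ A1 := by
    calc (X:ℝ) ^ 2 * η = Ct * (X ^ 4 * exp (-(y / 4))) := by rw [hη]; ring
      _ ≤ Ct * ((exp (y / 100)) ^ 4 * exp (-(y / 4))) := by gcongr
      _ = Ct * exp (4 * (y / 100) + -(y / 4)) := by rw [Real.exp_add, ← Real.exp_nat_mul]; norm_num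
      _ ≤ Ct * exp (-(y / 5)) := by gcongr; linarith
      _ ≤ Ct * ((5 ^ A1 * A1.factorial) / y ^ A1) := by gcongr; exact exp_neg_le A1 hy
      _ = _ := by rw [hκ]; ring
  have hη0 : 0 ≤ η := by positivity
  have hη1 : η ≤ κ / y ^ A1 := by
    refine le_trans ?_ hη2
    have : (1:ℝ) ≤ (X:ℝ) ^ 2 := one_le_pow₀ (by exact_mod_cast hX1)
    exact le_mul_of_one_le_left hη0 this
  -- low
  have low : ∑ c ∈ (PC X).filter (fun c => (c.1 : ℝ) ≤ y ^ B), ‖th y X c‖ * (1 / √c.1) ≤ y ^ (2 * B) * ((1 + κ) / y ^ A1) := by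
    have h1 : ∀ c ∈ (PC X).filter (fun c => (c.1 : ℝ) ≤ y ^ B), ‖th y X c‖ * (1 / √c.1) ≤ (1 + κ) / y ^ A1 := by
      intro c hc
      rw [Finset.mem_filter, mem_PC] at hc
      obtain ⟨⟨h1, h2, h3, h4⟩, h5⟩ := hc
      have : NeZero c.1 := ⟨by omega⟩
      have h6 := HS c.1 c.2 h4 h3 h5
      have h7 := HT y hy X hX1 c
      have h8 : 1 / √(c.1:ℝ) ≤ 1 := by
        rw [div_le_one (by positivity), Real.one_le_sqrt]; exact_mod_cast h1
      refine (mul_le_of_le_one_right (norm_nonneg _) h8).trans ?_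
      rw [add_div]; linarith
    refine (Finset.sum_le_card_nsmul _ _ _ h1).trans ?_
    rw [nsmul_eq_mul]
    refine mul_le_mul_of_nonneg_right ?_ (by positivity)
    have h2 : ((PC X).filter (fun c => (c.1 : ℝ) ≤ y ^ B)).card ≤ ⌊y ^ B⌋₊ ^ 2 := by
      refine le_trans (Finset.card_le_card ?_) (card_PC _)
      intro c hc
      rw [Finset.mem_filter, mem_PC] at hc
      rw [mem_PC]
      exact ⟨hc.1.1, Nat.le_floor hc.2, hc.1.2.2⟩
    calc (((PC X).filter (fun c => (c.1 : ℝ) ≤ y ^ B)).card : ℝ) ≤ (⌊y ^ B⌋₊ : ℝ) ^ 2 := by exact_mod_cast h2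
      _ ≤ (y ^ B) ^ 2 := by gcongr; exact Nat.floor_le (by positivity)
      _ = _ := by rw [← pow_mul, mul_comm]
  have high : ∑ c ∈ (PC X).filter (fun c => ¬ (c.1 : ℝ) ≤ y ^ B), ‖th y X c‖ * (1 / √c.1) ≤ (Cv + κ) * y ^ 5 / y ^ B' := by
    calc _ ≤ ∑ c ∈ (PC X).filter (fun c => ¬ (c.1 : ℝ) ≤ y ^ B), ‖th y X c‖ * (1 / y ^ B') := by
          refine Finset.sum_le_sum fun c hc => ?_
          rw [Finset.mem_filter] at hc
          refine mul_le_mul_of_nonneg_left ?_ (norm_nonneg _)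
          refine one_div_le_one_div_of_le (by positivity) ?_
          apply Real.le_sqrt_of_sq_le
          rw [← pow_mul, mul_comm B' 2]
          exact (not_le.1 hc.2).le
      _ ≤ ∑ c ∈ PC X, ‖th y X c‖ * (1 / y ^ B') :=
          Finset.sum_le_sum_of_subset_of_nonneg (Finset.filter_subset _ _) (fun _ _ _ => by positivity)
      _ = (∑ c ∈ PC X, ‖th y X c‖) * (1 / y ^ B') := by rw [Finset.sum_mul]
      _ ≤ ((Cv + κ) * y ^ 5) * (1 / y ^ B') := by
          refine mul_le_mul_of_nonneg_right ?_ (by positivity)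
          calc _ ≤ ∑ c ∈ PC X, (‖∑' n : ℕ, (c.2 n * (ArithmeticFunction.vonMangoldt n : ℂ)) * om y n‖ + η) :=
                Finset.sum_le_sum fun c _ => HT y hy X hX1 c
            _ = ∑ c ∈ PC X, ‖∑' n : ℕ, (c.2 n * (ArithmeticFunction.vonMangoldt n : ℂ)) * om y n‖ + (PC X).card * η := by
                rw [Finset.sum_add_distrib, Finset.sum_const, nsmul_eq_mul]
            _ ≤ Cv * y ^ 5 + κ := by
                refine add_le_add (HV y hy X hX1 hXle) ?_
                have h1 : ((PC X).card : ℝ) ≤ (X:ℝ) ^ 2 := by exact_mod_cast card_PC X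
                refine (mul_le_mul_of_nonneg_right h1 hη0).trans (hη2.trans ?_)
                exact div_le_self hκ0.le (one_le_pow₀ hy)
            _ ≤ _ := by
                have := one_le_pow₀ hy (n := 5)
                nlinarith
      _ = _ := by ring
  refine step1.trans ?_
  have e1 : ∑ c ∈ PC X, ‖th y X c‖ * (D / √c.1 * L) = D * L * ∑ c ∈ PC X, ‖th y X c‖ * (1 / √c.1) := by
    rw [Finset.mul_sum]
    refine Finset.sum_congr rfl fun c _ => ?_
    ring
  rw [e1, ← Finset.sum_filter_add_sum_filter_not (PC X) (fun c => (c.1 : ℝ) ≤ y ^ B)]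
  calc _ ≤ D * (2 ^ (2 * C0) * y ^ (2 * C0)) * (y ^ (2 * B) * ((1 + κ) / y ^ A1) + (Cv + κ) * y ^ 5 / y ^ B') := by
        have h0 : 0 ≤ ∑ c ∈ (PC X).filter (fun c => (c.1 : ℝ) ≤ y ^ B), ‖th y X c‖ * (1 / √c.1) :=
          Finset.sum_nonneg fun _ _ => by positivity
        have h0' : 0 ≤ ∑ c ∈ (PC X).filter (fun c => ¬ (c.1 : ℝ) ≤ y ^ B), ‖th y X c‖ * (1 / √c.1) :=
          Finset.sum_nonneg fun _ _ => by positivity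
        refine mul_le_mul ?_ (add_le_add low high) (add_nonneg h0 h0') (by positivity)
        exact mul_le_mul_of_nonneg_left hL1 hD0.le
    _ = (D * 2 ^ (2 * C0) * ((1 + κ) + (Cv + κ))) / (y * y ^ A) := by
        rw [hA1, hB']
        rw [show y ^ (2 * B + 2 * C0 + A + 1) = y ^ (2 * B) * y ^ (2 * C0) * y ^ A * y by rw [← pow_add, ← pow_add, ← pow_succ],
          show y ^ (5 + 2 * C0 + A + 1) = y ^ 5 * y ^ (2 * C0) * y ^ A * y by rw [← pow_add, ← pow_add, ← pow_succ]]
        field_simp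
    _ ≤ y / (y * y ^ A) := by gcongr
    _ = _ := by field_simp
end PG

namespace PG
open Finset

lemma tensor {S T1 T2 : Type} [Fintype S] [Fintype T1] [Fintype T2] : ∀ {N : ℕ}
    (w1 : Fin N → T1 → ℝ) (u1 : Fin N → S → T1 → ℝ) (w2 : Fin N → T2 → ℝ) (u2 : Fin N → S → T2 → ℝ)
    (_ : ∀ j s, 0 ≤ w1 j s) (_ : ∀ j s, 0 ≤ w2 j s)
    (_ : ∀ j (C : S → ℝ), ∑ s, w1 j s * (∑ a, C a * u1 j a s) ^ 2 ≤ ∑ t, w2 j t * (∑ a, C a * u2 j a t) ^ 2)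
    (c : (Fin N → S) → ℝ),
    ∑ σ : Fin N → T1, (∏ j, w1 j (σ j)) * (∑ r, c r * ∏ j, u1 j (r j) (σ j)) ^ 2 ≤
    ∑ σ : Fin N → T2, (∏ j, w2 j (σ j)) * (∑ r, c r * ∏ j, u2 j (r j) (σ j)) ^ 2 := by
  intro N
  induction N with
  | zero => intro w1 u1 w2 u2 _ _ _ c; simp
  | succ N ih =>
    intro w1 u1 w2 u2 h1 h2 h c
    have split : ∀ (T : Type) [Fintype T] (f : (Fin (N+1) → T) → ℝ),
        ∑ σ, f σ = ∑ σ' : Fin N → T, ∑ s : T, f (Fin.cons s σ') := by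
      intro T _ f
      rw [← (Fin.consEquiv (fun _ => T)).sum_comp, Fintype.sum_prod_type_right]
      rfl
    have e1 : ∀ {T : Type} [Fintype T] (w : Fin (N+1) → T → ℝ) (u : Fin (N+1) → S → T → ℝ) (σ' : Fin N → T) (s : T),
        (∏ j, w j ((Fin.cons s σ' : Fin (N+1) → T) j)) * (∑ r, c r * ∏ j, u j (r j) ((Fin.cons s σ' : Fin (N+1) → T) j)) ^ 2 =
        (∏ j : Fin N, w j.succ (σ' j)) * (w 0 s * (∑ a, (∑ r' : Fin N → S, c (Fin.cons a r') * ∏ j : Fin N, u j.succ (r' j) (σ' j)) * u 0 a s) ^ 2) := by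
      intro T _ w u σ' s
      rw [split S]
      simp only [Fin.prod_univ_succ, Fin.cons_zero, Fin.cons_succ]
      rw [Finset.sum_comm]
      simp only [Finset.sum_mul]
      have : ∀ a r', c (Fin.cons a r') * (u 0 a s * ∏ j : Fin N, u j.succ (r' j) (σ' j)) =
        c (Fin.cons a r') * (∏ j : Fin N, u j.succ (r' j) (σ' j)) * u 0 a s := fun a r' => by ring
      simp only [this]
      ring
    rw [split T1, split T2]
    simp only [e1]
    calc _ ≤ ∑ σ' : Fin N → T1, (∏ j : Fin N, w1 j.succ (σ' j)) * ∑ t, w2 0 t * (∑ a, (∑ r' : Fin N → S, c (Fin.cons a r') * ∏ j : Fin N, u1 j.succ (r' j) (σ' j)) * u2 0 a t) ^ 2 := by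
          refine Finset.sum_le_sum fun σ' _ => ?_
          rw [← Finset.mul_sum]
          exact mul_le_mul_of_nonneg_left (h 0 _) (Finset.prod_nonneg fun j _ => h1 _ _)
      _ = ∑ t, w2 0 t * ∑ σ' : Fin N → T1, (∏ j : Fin N, w1 j.succ (σ' j)) * (∑ r' : Fin N → S, (∑ a, c (Fin.cons a r') * u2 0 a t) * ∏ j : Fin N, u1 j.succ (r' j) (σ' j)) ^ 2 := by
          simp only [Finset.mul_sum]
          rw [Finset.sum_comm]
          refine Finset.sum_congr rfl fun t _ => Finset.sum_congr rfl fun σ' _ => ?_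
          simp only [Finset.sum_mul]
          rw [Finset.sum_comm]
          simp only [mul_right_comm]
          ring
      _ ≤ ∑ t, w2 0 t * ∑ σ' : Fin N → T2, (∏ j : Fin N, w2 j.succ (σ' j)) * (∑ r' : Fin N → S, (∑ a, c (Fin.cons a r') * u2 0 a t) * ∏ j : Fin N, u2 j.succ (r' j) (σ' j)) ^ 2 := by
          refine Finset.sum_le_sum fun t _ => mul_le_mul_of_nonneg_left ?_ (h2 _ _)
          exact ih _ _ _ _ (fun j s => h1 _ _) (fun j s => h2 _ _) (fun j => h j.succ) _
      _ = _ := by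
          simp only [Finset.mul_sum]
          rw [Finset.sum_comm]
          refine Finset.sum_congr rfl fun t _ => Finset.sum_congr rfl fun σ' _ => ?_
          simp only [Finset.sum_mul]
          rw [Finset.sum_comm]
          simp only [mul_right_comm]
          ring

/-- sieve local function -/
noncomputable def su {k : ℕ} (p : ℝ) (a s : Option (Fin k)) : ℝ := if a = none then 1 else if s = a then 1 - p else 1

/-- model weights, first kind -/
noncomputable def w1 {k : ℕ} (p : ℝ) (s : Option (Fin k)) : ℝ := if s = none then 1 - k / p else 1 / p
noncomputable def D1 {k : ℕ} (p : ℝ) (s : Option (Fin k)) : ℝ := if s = none then 1 else p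

/-- model weights, second kind -/
noncomputable def w2 {k : ℕ} (m : Fin k) (p : ℝ) (s : Option (Fin k)) : ℝ :=
  if s = none then 1 - (k - 1) / (p - 1) else if s = some m then 0 else 1 / (p - 1)
noncomputable def D2 {k : ℕ} (m : Fin k) (p : ℝ) (s : Option (Fin k)) : ℝ :=
  if s = none then 1 - k / (p - 1) ^ 2 else if s = some m then 0 else p - k - 1
/-- collapse -/
noncomputable def co {k : ℕ} (m : Fin k) (a t : Option (Fin k)) : ℝ :=
  if a = t ∨ (a = some m ∧ t = none) then 1 else 0

lemma local1 {k : ℕ} {p : ℝ} (hp : 0 < p) (C : Option (Fin k) → ℝ) :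
    ∑ s, w1 p s * (∑ a, C a * su p a s) ^ 2 ≤ ∑ t, D1 p t * (∑ a, C a * (if a = t then 1 else 0)) ^ 2 := by
  have e : ∀ i : Fin k, ∑ a, C a * su p a (some i) = C none + ∑ i, C (some i) - p * C (some i) := by
    intro i
    rw [Fintype.sum_option]
    have : ∀ x : Fin k, C (some x) * su p (some x) (some i) = C (some x) - if i = x then p * C (some x) else 0 := by
      intro x; unfold su; by_cases h : i = x
      · simp [h]; ring
      · simp [h]
    simp only [this, Finset.sum_sub_distrib, Finset.sum_ite_eq, Finset.mem_univ, if_true]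
    simp [su]; ring
  have e0 : ∑ a, C a * su p a none = C none + ∑ i, C (some i) := by
    rw [Fintype.sum_option]; simp [su]
  rw [Fintype.sum_option (fun s => w1 p s * (∑ a, C a * su p a s) ^ 2), Fintype.sum_option (fun t => D1 p t * _)]
  simp only [e, e0]
  simp only [mul_ite, mul_one, mul_zero, Finset.sum_ite_eq', Finset.mem_univ, if_true]
  simp only [w1, D1, if_true, reduceCtorEq, if_false]
  set T := ∑ i, C (some i) with hT
  have : ∑ x : Fin k, 1 / p * (C none + T - p * C (some x)) ^ 2 = k / p * (C none + T) ^ 2 - 2 * (C none + T) * T + ∑ x : Fin k, p * C (some x) ^ 2 := by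
    have : ∀ x : Fin k, 1 / p * (C none + T - p * C (some x)) ^ 2 = 1 / p * (C none + T) ^ 2 - 2 * (C none + T) * C (some x) + p * C (some x) ^ 2 := by
      intro x; field_simp; ring
    simp only [this, Finset.sum_add_distrib, Finset.sum_sub_distrib, ← Finset.mul_sum, ← hT]
    simp; ring
  rw [this]
  nlinarith [sq_nonneg T]

lemma local2 {k : ℕ} (m : Fin k) {p : ℝ} (hp : 2 * k + 1 ≤ p) (C : Option (Fin k) → ℝ) :
    ∑ t, D2 m p t * (∑ a, C a * co m a t) ^ 2 ≤ ∑ s, w2 m p s * (∑ a, C a * su p a s) ^ 2 := by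
  have hk : (1:ℝ) ≤ k := by exact_mod_cast Fin.pos m
  have hp1 : 0 < p - 1 := by linarith
  have e : ∀ i : Fin k, ∑ a, C a * su p a (some i) = C none + ∑ i, C (some i) - p * C (some i) := by
    intro i
    rw [Fintype.sum_option]
    have : ∀ x : Fin k, C (some x) * su p (some x) (some i) = C (some x) - if i = x then p * C (some x) else 0 := by
      intro x; unfold su; by_cases h : i = x
      · simp [h]; ring
      · simp [h]
    simp only [this, Finset.sum_sub_distrib, Finset.sum_ite_eq, Finset.mem_univ, if_true]
    simp [su]; ring
  have e0 : ∑ a, C a * su p a none = C none + ∑ i, C (some i) := by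
    rw [Fintype.sum_option]; simp [su]
  have f0 : ∑ a, C a * co m a none = C none + C (some m) := by
    rw [Fintype.sum_option]; simp [co]
  have f : ∀ i : Fin k, ∑ a, C a * co m a (some i) = C (some i) := by
    intro i
    rw [Fintype.sum_option]; simp [co]
  rw [Fintype.sum_option (fun s => w2 m p s * (∑ a, C a * su p a s) ^ 2), Fintype.sum_option (fun t => D2 m p t * (∑ a, C a * co m a t) ^ 2)]
  simp only [e, e0, f, f0]
  simp only [w2, D2, if_true, reduceCtorEq, if_false, Option.some.injEq]
  have g1 : ∀ F : Fin k → ℝ, ∑ x, (if x = m then 0 else F x) = ∑ x ∈ univ.erase m, F x := by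
    intro F
    rw [← Finset.sum_erase_add univ _ (Finset.mem_univ m)]
    simp only [if_true, add_zero]
    exact Finset.sum_congr rfl fun x hx => by rw [if_neg (Finset.ne_of_mem_erase hx)]
  simp only [ite_mul, zero_mul, g1]
  set E := (univ : Finset (Fin k)).erase m with hE
  have hcard : (E.card : ℝ) = k - 1 := by
    rw [hE, Finset.card_erase_of_mem (Finset.mem_univ m), Finset.card_univ, Fintype.card_fin, Nat.cast_sub (Fin.pos m)]
    simp
  set C0 := C none + C (some m) with hC0
  set T := ∑ i ∈ E, C (some i) with hT
  have hTT : ∑ i, C (some i) = T + C (some m) := by rw [hT, hE, Finset.sum_erase_add _ _ (Finset.mem_univ m)]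
  rw [hTT, show C none + (T + C (some m)) = C0 + T by rw [hC0]; ring]
  have : ∑ x ∈ E, 1 / (p-1) * (C0 + T - p * C (some x)) ^ 2 = (k - 1) / (p-1) * (C0 + T) ^ 2 - 2 * p / (p-1) * (C0 + T) * T + p^2/(p-1) * ∑ x ∈ E, C (some x) ^ 2 := by
    have : ∀ x : Fin k, 1 / (p-1) * (C0 + T - p * C (some x)) ^ 2 = 1 / (p-1) * (C0 + T) ^ 2 - 2 * p / (p-1) * (C0 + T) * C (some x) + p^2/(p-1) * C (some x) ^ 2 := by
      intro x; field_simp; ring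
    simp only [this, Finset.sum_add_distrib, Finset.sum_sub_distrib, ← Finset.mul_sum, ← hT, Finset.sum_const, nsmul_eq_mul, hcard]
    ring
  rw [this, ← Finset.mul_sum]
  set Q := ∑ x ∈ E, C (some x) ^ 2 with hQ
  have hQ0 : 0 ≤ Q := Finset.sum_nonneg fun _ _ => sq_nonneg _
  have hcs : T ^ 2 ≤ (k - 1) * Q := by
    rw [← hcard]; exact sq_sum_le_card_mul_sum_sq
  set e := 1 / (p - 1) with he
  have he0 : 0 < e := by positivity
  have hpe : p * e = 1 + e := by rw [he]; field_simp; ring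
  have hke : k * e ≤ 1 / 2 := by rw [he, mul_one_div, div_le_iff₀ hp1]; linarith
  have h1 : (k:ℝ) / (p-1)^2 = k * e ^ 2 := by rw [he]; field_simp
  have h2 : ((k:ℝ)-1) / (p-1) = (k-1) * e := by rw [he]; field_simp
  have h3 : 2 * p / (p-1) = 2 * (1 + e) := by rw [← hpe, he]; field_simp
  have h4 : p^2/(p-1) = p + 1 + e := by
    have : p^2/(p-1) = p * (p * e) := by rw [he]; field_simp
    rw [this, hpe]; linarith
  rw [h1, h2, h3, h4]
  have h5 : 2 * e * C0 * T ≤ k * e^2 * C0^2 + Q := by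
    have : 0 ≤ (k * e * C0 - T)^2 := sq_nonneg _
    have h6 : 2 * k * e * C0 * T ≤ k * (k * e^2 * C0^2 + Q) := by nlinarith
    have : k * (2 * e * C0 * T) ≤ k * (k * e^2 * C0^2 + Q) := by linarith
    exact le_of_mul_le_mul_left this (by linarith)
  have h6 : (1 + 2 * e) * T^2 ≤ k * Q := by
    have : (1 + 2 * e) * T^2 ≤ (1+2*e) * ((k-1) * Q) := mul_le_mul_of_nonneg_left hcs (by linarith)
    have h7 : (1+2*e) * ((k-1)) ≤ k := by nlinarith
    have := mul_le_mul_of_nonneg_right h7 hQ0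
    linarith
  nlinarith [mul_nonneg he0.le hQ0]

end PG

namespace PG
open Finset

noncomputable def Xs {N k : ℕ} (p : Fin N → ℕ) (c : (Fin N → Option (Fin k)) → ℝ) (σ : Fin N → Option (Fin k)) : ℝ :=
  ∑ r, c r * ∏ j, su (p j) (r j) (σ j)

noncomputable def v2 {k : ℕ} (p : ℝ) (a a' t : Option (Fin k)) : ℝ := if t = none then 1 else su p a t * su p a' t - 1

noncomputable def mu {N k : ℕ} (p : Fin N → ℕ) (c : (Fin N → Option (Fin k)) → ℝ) (t : Fin N → Option (Fin k)) : ℝ :=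
  ∑ r, ∑ r', c r * c r' * ∏ j, v2 (p j) (r j) (r' j) (t j)

noncomputable def ind {N k : ℕ} (t σ : Fin N → Option (Fin k)) : ℝ := ∏ j, if t j = none ∨ t j = σ j then 1 else 0

def supp {N k : ℕ} (t : Fin N → Option (Fin k)) : Finset (Fin N) := univ.filter fun j => t j ≠ none

def nm {N : ℕ} (p : Fin N → ℕ) (A : Finset (Fin N)) : ℕ := ∏ j ∈ A, p j

lemma su_mul {k : ℕ} (p : ℝ) (a a' s : Option (Fin k)) :
    su p a s * su p a' s = ∑ t, v2 p a a' t * (if t = none ∨ t = s then 1 else 0) := by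
  rw [Fintype.sum_option]
  cases s with
  | none =>
    simp [v2]
    simp only [su]
    cases a <;> cases a' <;> simp
  | some i => simp [v2]

lemma prod_sum_fn {N : ℕ} {T : Type} [Fintype T] (f : Fin N → T → ℝ) :
    ∏ j, ∑ s, f j s = ∑ x : Fin N → T, ∏ j, f j (x j) := by
  classical
  rw [Finset.prod_univ_sum, Fintype.piFinset_univ]

lemma Xs_sq {N k : ℕ} (p : Fin N → ℕ) (c : (Fin N → Option (Fin k)) → ℝ) (σ : Fin N → Option (Fin k)) :
    Xs p c σ ^ 2 = ∑ t, mu p c t * ind t σ := by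
  unfold Xs mu
  rw [sq, Finset.sum_mul_sum]
  simp only [Finset.sum_mul]
  conv_rhs => rw [Finset.sum_comm]
  refine Finset.sum_congr rfl fun r _ => ?_
  conv_rhs => rw [Finset.sum_comm]
  refine Finset.sum_congr rfl fun r' _ => ?_
  simp only [mul_assoc, ← Finset.mul_sum]
  unfold ind
  simp only [← Finset.prod_mul_distrib]
  rw [← prod_sum_fn (fun j t => v2 (p j) (r j) (r' j) t * (if t = none ∨ t = σ j then 1 else 0))]
  simp only [← su_mul]
  rw [Finset.prod_mul_distrib]; ring

lemma model_eq {N k : ℕ} (p : Fin N → ℕ) (c : (Fin N → Option (Fin k)) → ℝ) (w : Fin N → Option (Fin k) → ℝ)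
    (hw : ∀ j, ∑ s, w j s = 1) :
    ∑ σ : Fin N → Option (Fin k), (∏ j, w j (σ j)) * Xs p c σ ^ 2 = ∑ t, mu p c t * ∏ j ∈ supp t, w j (t j) := by
  simp only [Xs_sq, Finset.mul_sum]
  rw [Finset.sum_comm]
  refine Finset.sum_congr rfl fun t _ => ?_
  have : ∀ σ : Fin N → Option (Fin k), (∏ j, w j (σ j)) * (mu p c t * ind t σ) = mu p c t * ∏ j, w j (σ j) * (if t j = none ∨ t j = σ j then 1 else 0) := by
    intro σ; unfold ind; rw [Finset.prod_mul_distrib]; ring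
  simp only [this, ← Finset.mul_sum]
  congr 1
  rw [← prod_sum_fn (fun j s => w j s * (if t j = none ∨ t j = s then 1 else 0)), supp, Finset.prod_filter]
  refine Finset.prod_congr rfl fun j _ => ?_
  by_cases h : t j = none
  · simp [h, hw]
  · simp [h]

lemma w1_sum {k : ℕ} (p : ℝ) : ∑ s : Option (Fin k), w1 p s = 1 := by
  rw [Fintype.sum_option]; simp [w1]; ring

lemma w2_sum {k : ℕ} (m : Fin k) (p : ℝ) : ∑ s : Option (Fin k), w2 m p s = 1 := by
  rw [Fintype.sum_option]; simp only [w2, if_true, reduceCtorEq, if_false, Option.some.injEq]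
  rw [← Finset.sum_erase_add univ _ (Finset.mem_univ m)]
  rw [Finset.sum_congr rfl (g := fun _ => 1 / (p - 1)) fun x hx => by rw [if_neg (Finset.ne_of_mem_erase hx)]]
  rw [Finset.sum_const, Finset.card_erase_of_mem (Finset.mem_univ m), Finset.card_univ, Fintype.card_fin, nsmul_eq_mul, Nat.cast_sub (Fin.pos m)]
  simp; ring

lemma model1 {N k : ℕ} (p : Fin N → ℕ) (hp : ∀ j, k < p j) (c : (Fin N → Option (Fin k)) → ℝ) :
    ∑ t, mu p c t * (1 / (nm p (supp t) : ℝ)) ≤ ∑ r, (∏ j, D1 (p j : ℝ) (r j)) * c r ^ 2 := by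
  have h0 : ∀ j, (0:ℝ) < p j := fun j => by exact_mod_cast (Nat.zero_le k).trans_lt (hp j)
  have h := tensor (fun j => w1 (p j : ℝ)) (fun j => su (k := k) (p j)) (fun j => D1 (p j : ℝ)) (fun j a t => if a = t then 1 else 0)
    (fun j s => by
      unfold w1; split_ifs
      · rw [sub_nonneg, div_le_one (h0 j)]; exact_mod_cast (hp j).le
      · have := h0 j; positivity) (fun j s => by unfold D1; have := h0 j; split_ifs <;> positivity)
    (fun j C => local1 (h0 j) C) c
  have e := model_eq p c (fun j => w1 (p j : ℝ)) (fun j => w1_sum _)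
  unfold Xs at e
  rw [e] at h
  refine le_trans (le_of_eq ?_) (h.trans (le_of_eq ?_))
  · refine Finset.sum_congr rfl fun t _ => ?_
    unfold nm
    push_cast
    rw [one_div, ← Finset.prod_inv_distrib]
    congr 1
    refine Finset.prod_congr rfl fun j hj => ?_
    simp only [supp, mem_filter] at hj
    simp [w1, hj.2]
  · refine Finset.sum_congr rfl fun t _ => ?_
    congr 2
    have : ∀ r : Fin N → Option (Fin k), (∏ j, if r j = t j then (1:ℝ) else 0) = if r = t then 1 else 0 := by
      intro r
      rw [Finset.prod_ite_zero]
      simp [funext_iff]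
    simp [this]

lemma model2 {N k : ℕ} (m : Fin k) (p : Fin N → ℕ) (hp : ∀ j, 2 * k + 1 ≤ p j) (c : (Fin N → Option (Fin k)) → ℝ) :
    ∑ τ : Fin N → Option (Fin k), (∏ j, D2 m (p j : ℝ) (τ j)) * (∑ r, c r * ∏ j, co m (r j) (τ j)) ^ 2 ≤
    ∑ t, mu p c t * ∏ j ∈ supp t, w2 m (p j : ℝ) (t j) := by
  have hk : (1:ℝ) ≤ k := by exact_mod_cast Fin.pos m
  have h0 : ∀ j, 2 * (k:ℝ) + 1 ≤ p j := fun j => by exact_mod_cast hp j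
  have h := tensor (fun j => D2 m (p j : ℝ)) (fun j => co m) (fun j => w2 m (p j : ℝ)) (fun j => su (k := k) (p j))
    (fun j s => by
      have := h0 j
      unfold D2; split_ifs
      · rw [sub_nonneg, div_le_one (by nlinarith)]
        nlinarith
      · exact le_rfl
      · linarith)
    (fun j s => by
      have := h0 j
      unfold w2; split_ifs
      · rw [sub_nonneg, div_le_one (by linarith)]; linarith
      · exact le_rfl
      · exact div_nonneg (by norm_num) (by linarith))
    (fun j C => local2 m (h0 j) C) c
  have e := model_eq p c (fun j => w2 m (p j : ℝ)) (fun j => w2_sum _ _)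
  unfold Xs at e
  rw [e] at h
  exact h

lemma v2_some {k : ℕ} (p : ℝ) (a a' : Option (Fin k)) (i : Fin k) : v2 p a a' (some i) =
    -(p * (if a = some i then 1 else 0)) - p * (if a' = some i then 1 else 0) + p ^ 2 * ((if a = some i then 1 else 0) * (if a' = some i then 1 else 0)) := by
  have hs : ∀ b : Option (Fin k), su p b (some i) = 1 - p * (if b = some i then 1 else 0) := by
    intro b
    unfold su
    cases b with
    | none => simp
    | some l => by_cases h : i = l <;> simp [h, eq_comm]
  rw [v2, if_neg (by simp), hs, hs]; ring

lemma mu_supp {N k : ℕ} (p : Fin N → ℕ) (c : (Fin N → Option (Fin k)) → ℝ) (t : Fin N → Option (Fin k)) (h : mu p c t ≠ 0) :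
    ∃ r r', c r ≠ 0 ∧ c r' ≠ 0 ∧ supp t ⊆ supp r ∪ supp r' := by
  unfold mu at h
  obtain ⟨r, _, hr⟩ := Finset.exists_ne_zero_of_sum_ne_zero h
  obtain ⟨r', _, hr'⟩ := Finset.exists_ne_zero_of_sum_ne_zero hr
  refine ⟨r, r', ?_, ?_, ?_⟩
  · intro h; simp [h] at hr'
  · intro h; simp [h] at hr'
  · intro j hj
    have h1 := Finset.prod_ne_zero_iff.1 (right_ne_zero_of_mul hr') j (mem_univ _)
    simp only [supp, mem_filter, mem_univ, true_and, mem_union] at hj ⊢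
    by_contra hcon
    push Not at hcon
    obtain ⟨i, hi⟩ := Option.ne_none_iff_exists'.1 hj
    rw [hi, v2_some, hcon.1, hcon.2] at h1
    simp at h1

lemma v2_sum {k : ℕ} {p : ℝ} (hp : 2 ≤ p) (t : Option (Fin k)) :
    ∑ a : Option (Fin k), ∑ a' : Option (Fin k), (if a = none then 1 else 1 / (p-1)) * (if a' = none then 1 else 1 / (p-1)) * |v2 p a a' t|
      ≤ (if t = none then 1 else 8) * (1 + k / (p - 1)) ^ 2 := by
  set e : Option (Fin k) → ℝ := fun a => if a = none then 1 else 1 / (p-1) with he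
  have hp1 : 0 < p - 1 := by linarith
  have he0 : ∀ a, 0 ≤ e a := fun a => by simp only [he]; split_ifs <;> positivity
  have hs : ∑ a, e a = 1 + k / (p-1) := by
    rw [Fintype.sum_option]; simp [he]; field_simp
  have hS : 1 ≤ 1 + k / (p-1) := by have : 0 ≤ k / (p-1) := by positivity
                                    linarith
  change ∑ a, ∑ a', e a * e a' * |v2 p a a' t| ≤ _
  cases t with
  | none =>
    simp only [v2, if_true, abs_one, mul_one, one_mul]
    rw [← hs, sq, Finset.sum_mul_sum]
  | some i =>
    simp only [reduceCtorEq, if_false]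
    set S := 1 + k / (p-1)
    set b : Option (Fin k) → ℝ := fun a => if a = some i then 1 else 0 with hb
    have hbe : ∑ a, e a * b a = 1 / (p-1) := by simp [hb, he]
    have h2 : p * (1/(p-1)) ≤ 2 := by rw [mul_one_div, div_le_iff₀ hp1]; linarith
    have h20 : 0 ≤ p * (1/(p-1)) := by positivity
    calc _ ≤ ∑ a, ∑ a', (p * ((e a * b a) * e a') + p * (e a * (e a' * b a')) + p^2 * ((e a * b a) * (e a' * b a'))) := by
          refine Finset.sum_le_sum fun a _ => Finset.sum_le_sum fun a' _ => ?_
          have hb0 : ∀ a, 0 ≤ b a := fun a => by simp only [hb]; split_ifs <;> norm_num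
          have : |v2 p a a' (some i)| ≤ p * b a + p * b a' + p^2 * (b a * b a') := by
            rw [v2_some]
            have x1 : 0 ≤ p * b a := mul_nonneg (by linarith) (hb0 _)
            have x2 : 0 ≤ p * b a' := mul_nonneg (by linarith) (hb0 _)
            have x3 : 0 ≤ p^2 * (b a * b a') := mul_nonneg (by positivity) (mul_nonneg (hb0 _) (hb0 _))
            change |-(p * b a) - p * b a' + p^2 * (b a * b a')| ≤ _
            rw [abs_le]; constructor <;> linarith
          have := mul_le_mul_of_nonneg_left this (mul_nonneg (he0 a) (he0 a'))
          linarith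
      _ = p * (1/(p-1)) * S + p * (1/(p-1)) * S + (p * (1/(p-1)))^2 := by
          simp only [Finset.sum_add_distrib, ← Finset.mul_sum, ← Finset.sum_mul, hbe, hs]
          ring
      _ ≤ 2 * S + 2 * S + 2 ^ 2 := by gcongr
      _ ≤ 8 * S ^ 2 := by nlinarith

lemma mu_le {N k : ℕ} (p : Fin N → ℕ) (hp : ∀ j, 2 ≤ p j) (c : (Fin N → Option (Fin k)) → ℝ) (B : ℝ) (hB : 0 ≤ B)
    (hc : ∀ r, |c r| ≤ B * ∏ j ∈ supp r, (1 / ((p j : ℝ) - 1))) (t : Fin N → Option (Fin k)) :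
    |mu p c t| ≤ B ^ 2 * 8 ^ (supp t).card * (∏ j, (1 + k / ((p j : ℝ) - 1))) ^ 2 := by
  have hc' : ∀ r, |c r| ≤ B * ∏ j, (if r j = none then 1 else 1 / ((p j : ℝ) - 1)) := by
    intro r
    refine (hc r).trans (le_of_eq ?_)
    rw [supp, Finset.prod_filter]
    congr 1
    refine Finset.prod_congr rfl fun j _ => ?_
    by_cases h : r j = none <;> simp [h]
  have hp2 : ∀ j, (2:ℝ) ≤ p j := fun j => by exact_mod_cast hp j
  have hpos : ∀ r : Fin N → Option (Fin k), 0 ≤ ∏ j, (if r j = none then 1 else 1 / ((p j : ℝ) - 1)) := fun r =>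
    Finset.prod_nonneg fun j _ => by
      have := hp2 j
      split_ifs
      · norm_num
      · exact div_nonneg (by norm_num) (by linarith)
  calc |mu p c t| ≤ ∑ r, ∑ r', |c r * c r' * ∏ j, v2 (p j : ℝ) (r j) (r' j) (t j)| := by
        unfold mu
        exact (Finset.abs_sum_le_sum_abs _ _).trans (Finset.sum_le_sum fun r _ => Finset.abs_sum_le_sum_abs _ _)
    _ ≤ ∑ r : Fin N → Option (Fin k), ∑ r' : Fin N → Option (Fin k), B^2 * ∏ j, ((if r j = none then 1 else 1 / ((p j : ℝ) - 1)) * (if r' j = none then 1 else 1 / ((p j : ℝ) - 1)) * |v2 (p j : ℝ) (r j) (r' j) (t j)|) := by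
        refine Finset.sum_le_sum fun r _ => Finset.sum_le_sum fun r' _ => ?_
        rw [abs_mul, abs_mul, Finset.abs_prod, Finset.prod_mul_distrib, Finset.prod_mul_distrib, ← mul_assoc]
        refine mul_le_mul_of_nonneg_right ?_ (Finset.prod_nonneg fun _ _ => abs_nonneg _)
        refine (mul_le_mul (hc' r) (hc' r') (abs_nonneg _) (mul_nonneg hB (hpos r))).trans (le_of_eq (by ring))
    _ = B^2 * ∏ j, ∑ a : Option (Fin k), ∑ a' : Option (Fin k), ((if a = none then 1 else 1 / ((p j : ℝ) - 1)) * (if a' = none then 1 else 1 / ((p j : ℝ) - 1)) * |v2 (p j : ℝ) a a' (t j)|) := by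
        simp only [← Finset.mul_sum]
        congr 1
        rw [prod_sum_fn]
        refine Finset.sum_congr rfl fun r _ => ?_
        rw [prod_sum_fn]
    _ ≤ B^2 * ∏ j, ((if t j = none then 1 else 8) * (1 + k / ((p j : ℝ) - 1)) ^ 2) := by
        refine mul_le_mul_of_nonneg_left ?_ (by positivity)
        refine Finset.prod_le_prod (fun j _ => ?_) (fun j _ => v2_sum (hp2 j) _)
        have := hp2 j
        have : (0:ℝ) ≤ 1 / ((p j : ℝ) - 1) := div_nonneg (by norm_num) (by linarith)
        refine Finset.sum_nonneg fun a _ => Finset.sum_nonneg fun a' _ => mul_nonneg (mul_nonneg ?_ ?_) (abs_nonneg _)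
        · split_ifs <;> first | exact this | norm_num
        · split_ifs <;> first | exact this | norm_num
    _ = _ := by
        rw [Finset.prod_mul_distrib, Finset.prod_pow, ← mul_assoc]
        congr 2
        rw [supp, Finset.prod_ite, Finset.prod_const, Finset.prod_const, one_pow, one_mul]

end PG

namespace PG
open Finset

def fib {N k : ℕ} (r : Fin N → Option (Fin k)) (i : Fin k) : Finset (Fin N) := univ.filter fun j => r j = some i

lemma fib_inj {N k : ℕ} : Function.Injective (fib (N := N) (k := k)) := by
  intro r r' h
  have h' : ∀ j i, r j = some i ↔ r' j = some i := by
    intro j i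
    have := congrArg (fun s => j ∈ s i) h
    simpa [fib] using this
  funext j
  exact Option.ext fun i => h' j i

lemma prod_supp {N k : ℕ} (r : Fin N → Option (Fin k)) (f : Fin N → ℝ) :
    ∏ j ∈ supp r, f j = ∏ i, ∏ j ∈ fib r i, f j := by
  unfold supp fib
  simp only [Finset.prod_filter]
  rw [Finset.prod_comm]
  refine Finset.prod_congr rfl fun j _ => ?_
  cases h : r j with
  | none => simp
  | some i => simp

lemma exists_fib {N k : ℕ} (x : Fin k → Finset (Fin N)) (hx : ∀ i i' j, j ∈ x i → j ∈ x i' → i = i') :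
    ∃ r, fib r = x := by
  classical
  refine ⟨fun j => if h : ∃ i, j ∈ x i then some h.choose else none, ?_⟩
  funext i
  ext j
  simp only [fib, mem_filter, mem_univ, true_and]
  constructor
  · intro h
    split_ifs at h with h1
    have := h1.choose_spec
    simp only [Option.some.injEq] at h
    rwa [h] at this
  · intro h
    have h1 : ∃ i, j ∈ x i := ⟨i, h⟩
    rw [dif_pos h1, hx _ _ _ h1.choose_spec h]

lemma split_sum {N : ℕ} (T : Finset (Fin N)) (F : Finset (Fin N) → ℝ) :
    ∑ A, F A = ∑ T1 ∈ T.powerset, ∑ B ∈ Tᶜ.powerset, F (T1 ∪ B) := by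
  rw [← Finset.sum_product']
  refine Finset.sum_bij' (fun A _ => (A ∩ T, A ∩ Tᶜ)) (fun x _ => x.1 ∪ x.2) ?_ ?_ ?_ ?_ ?_
  · intro A _; simp
  · intro x _; simp
  · intro A _; simp only; rw [← Finset.inter_union_distrib_left]; simp
  · intro x hx
    simp only [mem_product, mem_powerset] at hx
    have h2 := hx.2
    have h1 := hx.1
    ext j
    · simp only [mem_inter, mem_union]
      constructor
      · rintro ⟨h | h, h'⟩
        · exact h
        · exact absurd h' (mem_compl.1 (h2 h))
      · intro h; exact ⟨Or.inl h, h1 h⟩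
    · simp only [mem_inter, mem_union]
      constructor
      · rintro ⟨h | h, h'⟩
        · exact absurd (h1 h) (mem_compl.1 h')
        · exact h
      · intro h; exact ⟨Or.inr h, h2 h⟩
  · intro A _
    simp only
    rw [← Finset.inter_union_distrib_left]; simp

lemma prod_disj {N : ℕ} {T1 B T : Finset (Fin N)} (h1 : T1 ⊆ T) (h2 : B ⊆ Tᶜ) : Disjoint T1 B := by
  rw [Finset.disjoint_left]
  intro j hj hb
  exact mem_compl.1 (h2 hb) (h1 hj)

/-- restricting a decreasing multiplicative sum to sets disjoint from T -/
lemma beta_le {N : ℕ} (T : Finset (Fin N)) (G : Finset (Fin N) → ℝ) (f : Fin N → ℝ) (hf : ∀ j, 0 ≤ f j)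
    (hGm : ∀ A B, A ⊆ B → G B ≤ G A) :
    ∑ A, G A * ∏ j ∈ A, f j ≤ (∏ j ∈ T, (1 + f j)) * ∑ B ∈ Tᶜ.powerset, G B * ∏ j ∈ B, f j := by
  rw [split_sum T, Finset.prod_one_add, Finset.sum_mul]
  refine Finset.sum_le_sum fun T1 hT1 => ?_
  rw [Finset.mul_sum]
  refine Finset.sum_le_sum fun B hB => ?_
  rw [Finset.prod_union (prod_disj (mem_powerset.1 hT1) (mem_powerset.1 hB))]
  have := mul_le_mul_of_nonneg_right (hGm B (T1 ∪ B) subset_union_right) (mul_nonneg (Finset.prod_nonneg fun j (_ : j ∈ T1) => hf j) (Finset.prod_nonneg fun j (_ : j ∈ B) => hf j))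
  linarith

/-- sum over sets containing j -/
lemma sum_mem_le {N : ℕ} (j : Fin N) (G : Finset (Fin N) → ℝ) (f : Fin N → ℝ) (hf : ∀ j, 0 ≤ f j) (hG0 : ∀ A, 0 ≤ G A)
    (hGm : ∀ A B, A ⊆ B → G B ≤ G A) :
    ∑ A, (G A * ∏ j ∈ A, f j) * (if j ∈ A then 1 else 0) ≤ f j * ∑ A, G A * ∏ j ∈ A, f j := by
  have hpf : ∀ A : Finset (Fin N), 0 ≤ ∏ j ∈ A, f j := fun A => Finset.prod_nonneg fun j _ => hf j
  calc _ = ∑ A ∈ univ.filter (fun A : Finset (Fin N) => j ∈ A), (G A * ∏ j ∈ A, f j) := by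
        rw [Finset.sum_filter]; refine Finset.sum_congr rfl fun A _ => ?_
        split_ifs <;> simp
    _ ≤ ∑ A ∈ univ.filter (fun A : Finset (Fin N) => j ∈ A), f j * (G (A.erase j) * ∏ j ∈ A.erase j, f j) := by
        refine Finset.sum_le_sum fun A hA => ?_
        rw [← Finset.mul_prod_erase A f (mem_filter.1 hA).2]
        have := mul_le_mul_of_nonneg_right (hGm (A.erase j) A (erase_subset _ _)) (mul_nonneg (hf j) (hpf (A.erase j)))
        linarith
    _ = f j * ∑ A ∈ univ.filter (fun A : Finset (Fin N) => j ∈ A), (G (A.erase j) * ∏ j ∈ A.erase j, f j) := by rw [Finset.mul_sum]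
    _ = f j * ∑ A ∈ (univ.filter (fun A : Finset (Fin N) => j ∈ A)).image (fun A : Finset (Fin N) => A.erase j), (G A * ∏ j ∈ A, f j) := by
        rw [Finset.sum_image]
        intro A hA B hB h
        simp only [coe_filter, mem_univ, true_and, Set.mem_ofPred_eq] at hA hB
        have h' : A.erase j = B.erase j := h
        rw [← Finset.insert_erase hA, h', Finset.insert_erase hB]
    _ ≤ _ := by
        refine mul_le_mul_of_nonneg_left ?_ (hf j)
        exact Finset.sum_le_univ_sum_of_nonneg fun A => mul_nonneg (hG0 A) (hpf A)

lemma alpha_le {N : ℕ} (G : Finset (Fin N) → ℝ) (f d : Fin N → ℝ) (hf : ∀ j, 0 ≤ f j) (hd : ∀ j, 0 ≤ d j) (hG0 : ∀ A, 0 ≤ G A)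
    (hGm : ∀ A B, A ⊆ B → G B ≤ G A) :
    ∑ A, G A * ∏ j ∈ A, (f j + d j) ≤ Real.exp (∑ j, d j) * ∑ A, G A * ∏ j ∈ A, f j := by
  have hpf : ∀ A : Finset (Fin N), 0 ≤ ∏ j ∈ A, f j := fun A => Finset.prod_nonneg fun j _ => hf j
  have hpd : ∀ A : Finset (Fin N), 0 ≤ ∏ j ∈ A, d j := fun A => Finset.prod_nonneg fun j _ => hd j
  calc _ = ∑ A : Finset (Fin N), ∑ B ∈ A.powerset, G A * ((∏ j ∈ B, d j) * ∏ j ∈ A \ B, f j) := by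
        refine Finset.sum_congr rfl fun A _ => ?_
        simp only [add_comm (f _)]
        rw [Finset.prod_add, Finset.mul_sum]
    _ ≤ ∑ A : Finset (Fin N), ∑ B ∈ A.powerset, (∏ j ∈ B, d j) * (G (A \ B) * ∏ j ∈ A \ B, f j) := by
        refine Finset.sum_le_sum fun A _ => Finset.sum_le_sum fun B _ => ?_
        have := mul_le_mul_of_nonneg_right (hGm (A \ B) A sdiff_subset) (mul_nonneg (hpd B) (hpf (A \ B)))
        linarith
    _ = ∑ B : Finset (Fin N), (∏ j ∈ B, d j) * ∑ A ∈ univ.filter (fun A : Finset (Fin N) => B ⊆ A), (G (A \ B) * ∏ j ∈ A \ B, f j) := by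
        simp only [Finset.mul_sum]
        refine Finset.sum_comm' ?_
        intro A B; simp
    _ ≤ ∑ B : Finset (Fin N), (∏ j ∈ B, d j) * ∑ A, (G A * ∏ j ∈ A, f j) := by
        refine Finset.sum_le_sum fun B _ => mul_le_mul_of_nonneg_left ?_ (hpd B)
        rw [← Finset.sum_image (f := fun A => G A * ∏ j ∈ A, f j) (g := fun A : Finset (Fin N) => A \ B)]
        · exact Finset.sum_le_univ_sum_of_nonneg fun A => mul_nonneg (hG0 A) (hpf A)
        · intro A hA A' hA' h
          simp only [coe_filter, mem_univ, true_and, Set.mem_ofPred_eq] at hA hA'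
          have h' : A \ B = A' \ B := h
          rw [← Finset.sdiff_union_of_subset hA, h', Finset.sdiff_union_of_subset hA']
    _ ≤ _ := by
        rw [← Finset.sum_mul]
        refine mul_le_mul_of_nonneg_right ?_ (Finset.sum_nonneg fun A _ => mul_nonneg (hG0 A) (hpf A))
        rw [Real.exp_sum, ← Finset.powerset_univ, ← Finset.prod_one_add]
        exact Finset.prod_le_prod (fun j _ => by have := hd j; linarith) (fun j _ => by
          have := Real.add_one_le_exp (d j); linarith)

lemma tuple_bound {k : ℕ} {T : Type} [Fintype T] (f e : Fin k → T → ℝ) (κ : Fin k → ℝ) (hf : ∀ i a, 0 ≤ f i a) (he : ∀ i a, 0 ≤ e i a)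
    (h : ∀ i, ∑ a, f i a * e i a ≤ κ i * ∑ a, f i a) :
    ∑ x : Fin k → T, (∏ i, f i (x i)) * ∏ i, e i (x i) ≤ (∏ i, κ i) * ∑ x : Fin k → T, ∏ i, f i (x i) := by
  simp only [← Finset.prod_mul_distrib]
  rw [← prod_sum_fn (fun i a => f i a * e i a), ← prod_sum_fn f, ← Finset.prod_mul_distrib]
  exact Finset.prod_le_prod (fun i _ => Finset.sum_nonneg fun a _ => mul_nonneg (hf i a) (he i a)) (fun i _ => h i)

/-- sieve coefficients -/
noncomputable def cc {N : ℕ} (k : ℕ) (p : Fin N → ℕ) (G : Finset (Fin N) → ℝ) (R : ℝ) (r : Fin N → Option (Fin k)) : ℝ :=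
  if (nm p (supp r) : ℝ) ≤ R then (∏ i, G (fib r i)) * ∏ j ∈ supp r, (1 / ((p j : ℝ) - 1)) else 0

lemma claim1 {N k : ℕ} (p : Fin N → ℕ) (hp : ∀ j, 2 ≤ p j) (G : Finset (Fin N) → ℝ) (R : ℝ) :
    ∑ r, (∏ j, D1 (p j : ℝ) (r j)) * cc k p G R r ^ 2 ≤ (∑ A, G A ^ 2 * ∏ j ∈ A, ((p j : ℝ) / ((p j : ℝ) - 1) ^ 2)) ^ k := by
  have hp2 : ∀ j, (2:ℝ) ≤ p j := fun j => by exact_mod_cast hp j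
  set F : Finset (Fin N) → ℝ := fun A => G A ^ 2 * ∏ j ∈ A, ((p j : ℝ) / ((p j : ℝ) - 1) ^ 2) with hF
  have hF0 : ∀ A, 0 ≤ F A := fun A => mul_nonneg (sq_nonneg _) (Finset.prod_nonneg fun j _ => by positivity)
  have key : ∀ r : Fin N → Option (Fin k), (∏ j, D1 (p j : ℝ) (r j)) * cc k p G R r ^ 2 ≤ ∏ i, F (fib r i) := by
    intro r
    unfold cc
    split_ifs
    · apply le_of_eq
      have : ∏ j, D1 (p j : ℝ) (r j) = ∏ j ∈ supp r, (p j : ℝ) := by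
        rw [supp, Finset.prod_filter]
        refine Finset.prod_congr rfl fun j _ => ?_
        by_cases h : r j = none <;> simp [D1, h]
      rw [this, hF, Finset.prod_mul_distrib, ← prod_supp, mul_pow, Finset.prod_pow, ← mul_assoc, mul_comm (∏ j ∈ supp r, (p j:ℝ)), mul_assoc, ← Finset.prod_pow, ← Finset.prod_pow, ← Finset.prod_mul_distrib]
      congr 1
      refine Finset.prod_congr rfl fun j _ => ?_
      rw [one_div, inv_pow, div_eq_mul_inv]
    · simp only [ne_eq, OfNat.ofNat_ne_zero, not_false_eq_true, zero_pow, mul_zero]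
      exact Finset.prod_nonneg fun i _ => hF0 _
  calc _ ≤ ∑ r : Fin N → Option (Fin k), ∏ i, F (fib r i) := Finset.sum_le_sum fun r _ => key r
    _ = ∑ x ∈ univ.image (fib (N := N) (k := k)), ∏ i, F (x i) := by
        rw [Finset.sum_image fun _ _ _ _ h => fib_inj h]
    _ ≤ ∑ x : Fin k → Finset (Fin N), ∏ i, F (x i) := Finset.sum_le_univ_sum_of_nonneg fun x => Finset.prod_nonneg fun i _ => hF0 _
    _ = _ := by rw [← prod_sum_fn (fun _ => F)]; simp

end PG

namespace PG
open Finset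

noncomputable def gk {N : ℕ} (k : ℕ) (p : Fin N → ℕ) (j : Fin N) : ℝ := ((p j : ℝ) - k - 1) / (p j : ℝ) ^ 2

lemma one_sub_sum_le {N : ℕ} (s : Finset (Fin N)) (f : Fin N → ℝ) (h0 : ∀ j, 0 ≤ f j) (h1 : ∀ j, f j ≤ 1) :
    1 - ∑ j ∈ s, f j ≤ ∏ j ∈ s, (1 - f j) := by
  induction s using Finset.induction_on with
  | empty => simp
  | insert a s ha ih =>
    rw [Finset.sum_insert ha, Finset.prod_insert ha]
    have h2 : ∏ j ∈ s, (1 - f j) ≤ 1 := Finset.prod_le_one (fun j _ => by linarith [h1 j]) (fun j _ => by linarith [h0 j])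
    nlinarith [h0 a, h1 a]

lemma coll_ge {N k : ℕ} (m : Fin k) (p : Fin N → ℕ) (hp : ∀ j, 2 ≤ p j)
    (G : Finset (Fin N) → ℝ) (hG0 : ∀ A, 0 ≤ G A) (hGm : ∀ A B, A ⊆ B → G B ≤ G A) (R Z : ℝ) (hZ : 0 < Z)
    (hGZ : ∀ A, G A ≠ 0 → (nm p A : ℝ) ≤ Z) (τ : Fin N → Option (Fin k)) (hτ : fib τ m = ∅) (hτR : (nm p (supp τ) : ℝ) ≤ R / Z) :
    (∏ i ∈ univ.erase m, G (fib τ i)) * (∏ j ∈ supp τ, (1 / ((p j : ℝ) - 1))) * ((∏ j ∈ supp τ, ((p j : ℝ) / (p j + 1))) * ∑ A, G A * ∏ j ∈ A, (1 / (p j : ℝ)))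
    ≤ ∑ r, cc k p G R r * ∏ j, co m (r j) (τ j) := by
  have hp2 : ∀ j, (2:ℝ) ≤ p j := fun j => by exact_mod_cast hp j
  have hφ : ∀ A : Finset (Fin N), 0 ≤ ∏ j ∈ A, (1 / ((p j : ℝ) - 1)) := fun A => Finset.prod_nonneg fun j _ =>
    div_nonneg (by norm_num) (by linarith [hp2 j])
  have hcc0 : ∀ r, 0 ≤ cc k p G R r := fun r => by
    unfold cc; split_ifs
    · exact mul_nonneg (Finset.prod_nonneg fun i _ => hG0 _) (hφ _)
    · exact le_rfl
  have hco0 : ∀ a t, 0 ≤ co m a t := fun a t => by unfold co; split_ifs <;> norm_num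
  have hτj : ∀ j, τ j ≠ some m := by
    intro j h
    have : j ∈ fib τ m := by simp [fib, h]
    rw [hτ] at this; simp at this
  set T := supp τ with hT
  set rB : Finset (Fin N) → Fin N → Option (Fin k) := fun B j => if j ∈ B then some m else τ j with hrB
  have hf1 : ∀ B, fib (rB B) m = B := by
    intro B; ext j
    simp only [fib, hrB, mem_filter, mem_univ, true_and]
    by_cases h : j ∈ B <;> simp [h, hτj]
  have hf2 : ∀ B ∈ Tᶜ.powerset, ∀ i ≠ m, fib (rB B) i = fib τ i := by
    intro B hB i hi; ext j
    simp only [fib, hrB, mem_filter, mem_univ, true_and]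
    by_cases h : j ∈ B
    · have h1 := mem_compl.1 (mem_powerset.1 hB h)
      simp only [hT, supp, mem_filter, mem_univ, true_and, not_not] at h1
      simp [h, h1, Ne.symm hi]
    · simp [h]
  have hs : ∀ B, supp (rB B) = T ∪ B := by
    intro B; ext j
    simp only [supp, hrB, hT, mem_filter, mem_univ, true_and, mem_union]
    by_cases h : j ∈ B <;> simp [h]
  have hcoB : ∀ B ∈ Tᶜ.powerset, ∏ j, co m (rB B j) (τ j) = 1 := by
    intro B hB
    refine Finset.prod_eq_one fun j _ => ?_
    simp only [co, hrB]
    by_cases h : j ∈ B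
    · have h1 := mem_compl.1 (mem_powerset.1 hB h)
      simp only [hT, supp, mem_filter, mem_univ, true_and, not_not] at h1
      simp [h, h1]
    · simp [h]
  have hinj : Function.Injective rB := by
    intro B B' h
    rw [← hf1 B, h, hf1 B']
  set Q := (∏ i ∈ univ.erase m, G (fib τ i)) * (∏ j ∈ T, (1 / ((p j : ℝ) - 1))) with hQ
  have hQ0 : 0 ≤ Q := mul_nonneg (Finset.prod_nonneg fun i _ => hG0 _) (hφ _)
  have h1 : ∑ B ∈ Tᶜ.powerset, Q * (G B * ∏ j ∈ B, (1 / (p j : ℝ))) ≤ ∑ r, cc k p G R r * ∏ j, co m (r j) (τ j) := by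
    calc _ ≤ ∑ B ∈ Tᶜ.powerset, cc k p G R (rB B) * ∏ j, co m (rB B j) (τ j) := by
          refine Finset.sum_le_sum fun B hB => ?_
          rw [hcoB B hB, mul_one]
          by_cases hG : G B = 0
          · rw [hG]; simpa using hcc0 _
          · have hd := prod_disj (subset_refl T) (mem_powerset.1 hB)
            have hn : (nm p (supp (rB B)) : ℝ) ≤ R := by
              rw [hs, nm, Finset.prod_union hd]
              push_cast
              have a1 := hGZ B hG
              have a2 := hτR
              unfold nm at a1 a2
              push_cast at a1 a2
              calc _ ≤ R / Z * Z := mul_le_mul a2 a1 (by positivity) ((by positivity : (0:ℝ) ≤ ∏ j ∈ T, (p j : ℝ)).trans a2)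
                _ = R := by field_simp
            unfold cc
            rw [if_pos hn, hs, Finset.prod_union hd, ← Finset.mul_prod_erase univ _ (mem_univ m), hf1,
              Finset.prod_congr (s₁ := univ.erase m) rfl (fun i hi => congrArg G (hf2 B hB i (ne_of_mem_erase hi)))]
            have : ∏ j ∈ B, (1 / (p j : ℝ)) ≤ ∏ j ∈ B, (1 / ((p j : ℝ) - 1)) :=
              Finset.prod_le_prod (fun j _ => by positivity) (fun j _ => one_div_le_one_div_of_le (by linarith [hp2 j]) (by linarith))
            have := mul_le_mul_of_nonneg_left this (mul_nonneg hQ0 (hG0 B))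
            rw [hQ] at this ⊢
            linarith
      _ = ∑ r ∈ Tᶜ.powerset.image rB, cc k p G R r * ∏ j, co m (r j) (τ j) := by
          rw [Finset.sum_image fun _ _ _ _ h => hinj h]
      _ ≤ _ := Finset.sum_le_univ_sum_of_nonneg fun r => mul_nonneg (hcc0 r) (Finset.prod_nonneg fun j _ => hco0 _ _)
  refine le_trans ?_ h1
  rw [← Finset.mul_sum]
  refine mul_le_mul_of_nonneg_left ?_ hQ0
  have h2 := beta_le T G (fun j => 1 / (p j : ℝ)) (fun j => by positivity) hGm
  have h3 : (∏ j ∈ T, ((p j : ℝ) / (p j + 1))) * ∏ j ∈ T, (1 + 1 / (p j : ℝ)) = 1 := by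
    rw [← Finset.prod_mul_distrib]
    refine Finset.prod_eq_one fun j _ => ?_
    have := hp2 j
    field_simp
  have h4 : 0 ≤ ∏ j ∈ T, ((p j : ℝ) / (p j + 1)) := by positivity
  calc _ ≤ (∏ j ∈ T, ((p j : ℝ) / (p j + 1))) * ((∏ j ∈ T, (1 + 1 / (p j : ℝ))) * ∑ B ∈ Tᶜ.powerset, G B * ∏ j ∈ B, (1 / (p j : ℝ))) :=
        mul_le_mul_of_nonneg_left h2 h4
    _ = _ := by rw [← mul_assoc, h3, one_mul]

lemma gk_nonneg {N k : ℕ} (p : Fin N → ℕ) (hp : ∀ j, 2 * k + 2 ≤ p j) (j : Fin N) : 0 ≤ gk k p j := by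
  have : 2 * (k:ℝ) + 2 ≤ p j := by exact_mod_cast hp j
  unfold gk
  exact div_nonneg (by linarith [(Nat.cast_nonneg k : (0:ℝ) ≤ k)]) (by positivity)

lemma tau_ge {N k : ℕ} (m : Fin k) (p : Fin N → ℕ) (hp : ∀ j, 2 * k + 2 ≤ p j) (hη : ((k:ℝ) + 3) ^ 2 * ∑ j, 1 / ((p j : ℝ) - 1) ^ 2 ≤ 1 / 4)
    (G : Finset (Fin N) → ℝ) (hG0 : ∀ A, 0 ≤ G A) (hGm : ∀ A B, A ⊆ B → G B ≤ G A) (R Z : ℝ) (hZ : 0 < Z)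
    (hGZ : ∀ A, G A ≠ 0 → (nm p A : ℝ) ≤ Z) (τ : Fin N → Option (Fin k)) (hτ : fib τ m = ∅) (hτR : (nm p (supp τ) : ℝ) ≤ R / Z) :
    1 / 2 * (∑ A, G A * ∏ j ∈ A, (1 / (p j : ℝ))) ^ 2 * ∏ i ∈ univ.erase m, (G (fib τ i) ^ 2 * ∏ j ∈ fib τ i, gk k p j)
    ≤ (∏ j, D2 m (p j : ℝ) (τ j)) * (∑ r, cc k p G R r * ∏ j, co m (r j) (τ j)) ^ 2 := by
  have hp2 : ∀ j, 2 * (k:ℝ) + 2 ≤ p j := fun j => by exact_mod_cast hp j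
  have hk : (1:ℝ) ≤ k := by exact_mod_cast Fin.pos m
  have h1 := coll_ge m p (fun j => by have := hp j; omega) G hG0 hGm R Z hZ hGZ τ hτ hτR
  have hτj : ∀ j, τ j ≠ some m := by
    intro j h
    have : j ∈ fib τ m := by simp [fib, h]
    rw [hτ] at this; simp at this
  have hD : ∏ j, D2 m (p j : ℝ) (τ j) = (∏ j ∈ supp τ, ((p j : ℝ) - k - 1)) * ∏ j ∈ (supp τ)ᶜ, (1 - k / ((p j : ℝ) - 1) ^ 2) := by
    rw [← Finset.prod_mul_prod_compl (supp τ)]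
    congr 1
    · refine Finset.prod_congr rfl fun j hj => ?_
      simp only [supp, mem_filter, mem_univ, true_and] at hj
      simp [D2, hj, hτj]
    · refine Finset.prod_congr rfl fun j hj => ?_
      simp only [supp, mem_compl, mem_filter, mem_univ, true_and, not_not] at hj
      simp [D2, hj]
  have hD1 : 1 / 2 ≤ ∏ j ∈ (supp τ)ᶜ, (1 - k / ((p j : ℝ) - 1) ^ 2) := by
    refine le_trans ?_ (one_sub_sum_le _ (fun j => k / ((p j : ℝ) - 1) ^ 2) (fun j => by positivity) (fun j => ?_))
    · have : ∑ j ∈ (supp τ)ᶜ, k / ((p j : ℝ) - 1) ^ 2 ≤ ∑ j, k / ((p j : ℝ) - 1) ^ 2 :=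
        Finset.sum_le_univ_sum_of_nonneg fun j => by positivity
      have h2 : ∑ j, (k:ℝ) / ((p j : ℝ) - 1) ^ 2 = (k:ℝ) * ∑ j, 1 / ((p j : ℝ) - 1) ^ 2 := by
        rw [Finset.mul_sum]; exact Finset.sum_congr rfl fun j _ => by ring
      have h3 : 0 ≤ ∑ j, 1 / ((p j : ℝ) - 1) ^ 2 := Finset.sum_nonneg fun j _ => by positivity
      have h4 : (k:ℝ) * ∑ j, 1 / ((p j : ℝ) - 1) ^ 2 ≤ ((k:ℝ) + 3) ^ 2 * ∑ j, 1 / ((p j : ℝ) - 1) ^ 2 :=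
        mul_le_mul_of_nonneg_right (by nlinarith) h3
      linarith
    · have := hp2 j
      rw [div_le_one (by nlinarith)]; nlinarith
  set β := ∑ A, G A * ∏ j ∈ A, (1 / (p j : ℝ)) with hβ
  have hβ0 : 0 ≤ β := Finset.sum_nonneg fun A _ => mul_nonneg (hG0 A) (by positivity)
  have hpk : 0 ≤ ∏ j ∈ supp τ, ((p j : ℝ) - k - 1) := Finset.prod_nonneg fun j _ => by linarith [hp2 j]
  have hpp : 0 ≤ ∏ j ∈ supp τ, (1 / ((p j : ℝ) - 1)) := Finset.prod_nonneg fun j _ => div_nonneg (by norm_num) (by linarith [hp2 j])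
  have hGp : 0 ≤ ∏ i ∈ univ.erase m, G (fib τ i) := Finset.prod_nonneg fun i _ => hG0 _
  rw [hD]
  have hsup : ∏ i ∈ univ.erase m, ∏ j ∈ fib τ i, gk k p j = ∏ j ∈ supp τ, gk k p j := by
    rw [prod_supp, ← Finset.mul_prod_erase univ _ (mem_univ m), hτ]; simp
  rw [Finset.prod_mul_distrib, hsup]
  have hga : ∏ j ∈ supp τ, gk k p j ≤ (∏ j ∈ supp τ, ((p j : ℝ) - k - 1)) * (∏ j ∈ supp τ, (1 / ((p j : ℝ) - 1))) ^ 2 * (∏ j ∈ supp τ, ((p j : ℝ) / (p j + 1))) ^ 2 := by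
    rw [← Finset.prod_pow, ← Finset.prod_pow, ← Finset.prod_mul_distrib, ← Finset.prod_mul_distrib]
    refine Finset.prod_le_prod (fun j _ => gk_nonneg p hp j) fun j _ => ?_
    have := hp2 j
    unfold gk
    rw [mul_assoc, div_eq_mul_inv]
    refine mul_le_mul_of_nonneg_left ?_ (by linarith)
    rw [← mul_pow, ← inv_pow]
    refine pow_le_pow_left₀ (by positivity) ?_ 2
    rw [div_mul_div_comm, inv_eq_one_div, div_le_div_iff₀ (by linarith) (mul_pos (by linarith) (by linarith))]
    nlinarith
  calc _ ≤ 1 / 2 * β ^ 2 * ((∏ i ∈ univ.erase m, G (fib τ i) ^ 2) * ((∏ j ∈ supp τ, ((p j : ℝ) - k - 1)) * (∏ j ∈ supp τ, (1 / ((p j : ℝ) - 1))) ^ 2 * (∏ j ∈ supp τ, ((p j : ℝ) / (p j + 1))) ^ 2)) := by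
        refine mul_le_mul_of_nonneg_left (mul_le_mul_of_nonneg_left hga ?_) (by positivity)
        positivity
    _ = (∏ j ∈ supp τ, ((p j : ℝ) - k - 1)) * (1 / 2) * ((∏ i ∈ univ.erase m, G (fib τ i)) * (∏ j ∈ supp τ, (1 / ((p j : ℝ) - 1))) * ((∏ j ∈ supp τ, ((p j : ℝ) / (p j + 1))) * β)) ^ 2 := by
        rw [Finset.prod_pow]; ring
    _ ≤ _ := by
        refine mul_le_mul (mul_le_mul_of_nonneg_left hD1 hpk) (pow_le_pow_left₀ (by positivity) h1 2) (sq_nonneg _) ?_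
        exact mul_nonneg hpk (by linarith)

lemma claim2 {N k : ℕ} (m : Fin k) (p : Fin N → ℕ) (hp : ∀ j, 2 * k + 2 ≤ p j) (hη : ((k:ℝ) + 3) ^ 2 * ∑ j, 1 / ((p j : ℝ) - 1) ^ 2 ≤ 1 / 4)
    (G : Finset (Fin N) → ℝ) (hG0 : ∀ A, 0 ≤ G A) (hGm : ∀ A B, A ⊆ B → G B ≤ G A) (R Z : ℝ) (hZ : 0 < Z) (hR : 0 < R)
    (hGZ : ∀ A, G A ≠ 0 → (nm p A : ℝ) ≤ Z) (L : ℝ) (hL0 : 0 ≤ L)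
    (hL : ∑ A, (G A ^ 2 * ∏ j ∈ A, gk k p j) * Real.log (nm p A) ≤ L * ∑ A, G A ^ 2 * ∏ j ∈ A, gk k p j)
    (hV : 0 < Real.log (R / Z)) (hLV : 4 * k * L ≤ Real.log (R / Z)) :
    1 / 4 * (∑ A, G A * ∏ j ∈ A, (1 / (p j : ℝ))) ^ 2 * (∑ A, G A ^ 2 * ∏ j ∈ A, gk k p j) ^ (k - 1)
    ≤ ∑ τ : Fin N → Option (Fin k), (∏ j, D2 m (p j : ℝ) (τ j)) * (∑ r, cc k p G R r * ∏ j, co m (r j) (τ j)) ^ 2 := by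
  have hp2 : ∀ j, 2 * (k:ℝ) + 2 ≤ p j := fun j => by exact_mod_cast hp j
  have hk : (1:ℝ) ≤ k := by exact_mod_cast Fin.pos m
  have hga := gk_nonneg (k := k) p hp
  set V := Real.log (R / Z) with hVdef
  set F : Finset (Fin N) → ℝ := fun A => G A ^ 2 * ∏ j ∈ A, gk k p j with hF
  have hF0 : ∀ A, 0 ≤ F A := fun A => mul_nonneg (sq_nonneg _) (Finset.prod_nonneg fun j _ => hga j)
  set f : Fin k → Finset (Fin N) → ℝ := fun i A => if i = m then (if A = ∅ then 1 else 0) else F A with hf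
  have hf0 : ∀ i A, 0 ≤ f i A := fun i A => by
    simp only [hf]; split_ifs
    · norm_num
    · norm_num
    · exact hF0 A
  have hnm1 : ∀ A, (1:ℝ) ≤ nm p A := fun A => by
    have : 1 ≤ nm p A := Finset.one_le_prod' fun j _ => by have := hp j; omega
    exact_mod_cast this
  have hlog0 : ∀ A, 0 ≤ Real.log (nm p A) := fun A => Real.log_nonneg (hnm1 A)
  have hsum : ∑ x : Fin k → Finset (Fin N), ∏ i, f i (x i) = (∑ A, F A) ^ (k - 1) := by
    rw [← prod_sum_fn f, ← Finset.mul_prod_erase univ _ (mem_univ m)]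
    have e1 : ∑ s, f m s = 1 := by simp [hf]
    have e2 : ∀ i ∈ univ.erase m, ∑ s, f i s = ∑ A, F A := fun i hi => by
      simp only [hf, if_neg (ne_of_mem_erase hi)]
    rw [e1, one_mul, Finset.prod_congr rfl e2, Finset.prod_const, Finset.card_erase_of_mem (mem_univ m), Finset.card_univ, Fintype.card_fin]
  set Pi0 := (∑ A, F A) ^ (k - 1) with hPi
  have hPi0 : 0 ≤ Pi0 := pow_nonneg (Finset.sum_nonneg fun A _ => hF0 A) _
  set B1 : (Fin k → Finset (Fin N)) → ℝ := fun x => ∑ j, ∑ i1, ∑ i2 ∈ univ.erase i1, (if j ∈ x i1 then 1 else 0) * (if j ∈ x i2 then 1 else 0) with hB1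
  set B2 : (Fin k → Finset (Fin N)) → ℝ := fun x => ∑ i, Real.log (nm p (x i)) / V with hB2
  have hB10 : ∀ x, 0 ≤ B1 x := fun x => by
    simp only [hB1]
    refine Finset.sum_nonneg fun j _ => Finset.sum_nonneg fun i1 _ => Finset.sum_nonneg fun i2 _ => ?_
    split_ifs <;> norm_num
  have hB20 : ∀ x, 0 ≤ B2 x := fun x => Finset.sum_nonneg fun i _ => div_nonneg (hlog0 _) hV.le
  -- bound for the first kind of bad tuples
  have bad1 : ∑ x : Fin k → Finset (Fin N), (∏ i, f i (x i)) * B1 x ≤ 1 / 4 * Pi0 := by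
    have step : ∀ j, ∀ i1 : Fin k, ∀ i2 ∈ univ.erase i1, ∑ x : Fin k → Finset (Fin N), (∏ i, f i (x i)) * ((if j ∈ x i1 then 1 else 0) * (if j ∈ x i2 then 1 else 0)) ≤ gk k p j ^ 2 * Pi0 := by
      intro j i1 i2 hi2
      have hne : i2 ≠ i1 := ne_of_mem_erase hi2
      have := tuple_bound f (fun i A => if i = i1 ∨ i = i2 then (if j ∈ A then 1 else 0) else 1) (fun i => if i = i1 ∨ i = i2 then gk k p j else 1) hf0
        (fun i A => by split_ifs <;> norm_num) (fun i => by
          by_cases h : i = i1 ∨ i = i2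
          · simp only [if_pos h]
            by_cases him : i = m
            · simp [hf, him]
              rw [Finset.sum_eq_zero fun x _ => ?_]
              · exact hga j
              · split_ifs with h1 h2
                · rw [h2] at h1; simp at h1
                · rfl
                · rfl
            · simp only [hf, if_neg him]
              exact sum_mem_le j (fun A => G A ^ 2) (gk k p) hga (fun A => sq_nonneg _) (fun A B hAB => pow_le_pow_left₀ (hG0 _) (hGm A B hAB) 2)
          · simp [if_neg h])
      rw [hsum] at this
      have e : ∀ g : Fin k → ℝ, ∏ i, (if i = i1 ∨ i = i2 then g i else 1) = g i1 * g i2 := by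
        intro g
        rw [← Finset.prod_filter]
        have : univ.filter (fun i => i = i1 ∨ i = i2) = {i1, i2} := by ext; simp
        rw [this, Finset.prod_pair hne.symm]
      simp only [e] at this
      rwa [sq]
    calc _ = ∑ j, ∑ i1 : Fin k, ∑ i2 ∈ univ.erase i1, ∑ x : Fin k → Finset (Fin N), (∏ i, f i (x i)) * ((if j ∈ x i1 then 1 else 0) * (if j ∈ x i2 then 1 else 0)) := by
          simp only [hB1, Finset.mul_sum]
          rw [Finset.sum_comm]
          refine Finset.sum_congr rfl fun j _ => ?_
          rw [Finset.sum_comm]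
          refine Finset.sum_congr rfl fun i1 _ => ?_
          rw [Finset.sum_comm]
      _ ≤ ∑ j, ∑ i1 : Fin k, ∑ i2 ∈ univ.erase i1, gk k p j ^ 2 * Pi0 :=
          Finset.sum_le_sum fun j _ => Finset.sum_le_sum fun i1 _ => Finset.sum_le_sum fun i2 hi2 => step j i1 i2 hi2
      _ ≤ ∑ j, (k:ℝ) ^ 2 * (1 / ((p j : ℝ) - 1) ^ 2 * Pi0) := by
          refine Finset.sum_le_sum fun j _ => ?_
          simp only [Finset.sum_const, Finset.card_erase_of_mem (mem_univ _), Finset.card_univ, Fintype.card_fin, nsmul_eq_mul, ← mul_assoc]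
          have hc : ((k - 1 : ℕ) : ℝ) ≤ k := by exact_mod_cast Nat.sub_le _ _
          have hg : gk k p j ^ 2 ≤ 1 / ((p j : ℝ) - 1) ^ 2 := by
            rw [← one_div_pow]
            refine pow_le_pow_left₀ (hga j) ?_ 2
            have := hp2 j
            unfold gk
            rw [div_le_div_iff₀ (by nlinarith) (by linarith)]
            nlinarith
          rw [sq (k:ℝ)]
          gcongr
      _ = k ^ 2 * (∑ j, 1 / ((p j : ℝ) - 1) ^ 2) * Pi0 := by rw [← Finset.mul_sum, ← Finset.sum_mul]; ring
      _ ≤ 1 / 4 * Pi0 := by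
          refine mul_le_mul_of_nonneg_right (le_trans ?_ hη) hPi0
          refine mul_le_mul_of_nonneg_right ?_ (Finset.sum_nonneg fun j _ => by positivity)
          nlinarith
  have bad2 : ∑ x : Fin k → Finset (Fin N), (∏ i, f i (x i)) * B2 x ≤ 1 / 4 * Pi0 := by
    have step : ∀ i0 : Fin k, ∑ x : Fin k → Finset (Fin N), (∏ i, f i (x i)) * (Real.log (nm p (x i0)) / V) ≤ L / V * Pi0 := by
      intro i0
      have := tuple_bound f (fun i A => if i = i0 then Real.log (nm p A) / V else 1) (fun i => if i = i0 then L / V else 1) hf0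
        (fun i A => by
          split_ifs
          · exact div_nonneg (hlog0 _) hV.le
          · norm_num) (fun i => by
          by_cases h : i = i0
          · simp only [if_pos h]
            by_cases him : i = m
            · simp [hf, him, nm]
              positivity
            · simp only [hf, if_neg him]
              rw [div_mul_eq_mul_div, le_div_iff₀ hV, Finset.sum_mul]
              refine le_trans (le_of_eq ?_) hL
              refine Finset.sum_congr rfl fun A _ => ?_
              field_simp
              simp only [hF]; ring
          · simp [if_neg h])
      rw [hsum] at this
      simpa using this
    calc _ = ∑ i0 : Fin k, ∑ x : Fin k → Finset (Fin N), (∏ i, f i (x i)) * (Real.log (nm p (x i0)) / V) := by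
          simp only [hB2, Finset.mul_sum]
          rw [Finset.sum_comm]
      _ ≤ ∑ i0 : Fin k, L / V * Pi0 := Finset.sum_le_sum fun i0 _ => step i0
      _ = k * L / V * Pi0 := by simp; ring
      _ ≤ 1 / 4 * Pi0 := by
          refine mul_le_mul_of_nonneg_right ?_ hPi0
          rw [div_le_iff₀ hV]; linarith
  -- good tuples
  set good : Finset (Fin k → Finset (Fin N)) := univ.filter fun x => (∀ i i' j, j ∈ x i → j ∈ x i' → i = i') ∧ ∑ i, Real.log (nm p (x i)) ≤ V with hgood
  have hge : 1 / 2 * Pi0 ≤ ∑ x ∈ good, ∏ i, f i (x i) := by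
    have : Pi0 ≤ ∑ x ∈ good, (∏ i, f i (x i)) + ∑ x : Fin k → Finset (Fin N), (∏ i, f i (x i)) * B1 x + ∑ x : Fin k → Finset (Fin N), (∏ i, f i (x i)) * B2 x := by
      rw [← hsum, hgood, Finset.sum_filter, ← Finset.sum_add_distrib, ← Finset.sum_add_distrib]
      refine Finset.sum_le_sum fun x _ => ?_
      have hx0 : 0 ≤ ∏ i, f i (x i) := Finset.prod_nonneg fun i _ => hf0 _ _
      split_ifs with h
      · nlinarith [mul_nonneg hx0 (hB10 x), mul_nonneg hx0 (hB20 x)]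
      · have : 1 ≤ B1 x + B2 x := by
          by_cases h1 : ∀ i i' j, j ∈ x i → j ∈ x i' → i = i'
          · have h2 : V < ∑ i, Real.log (nm p (x i)) := by
              by_contra hcon; exact h ⟨h1, not_lt.1 hcon⟩
            have : 1 ≤ B2 x := by
              simp only [hB2]
              rw [← Finset.sum_div, le_div_iff₀ hV]; linarith
            linarith [hB10 x]
          · push Not at h1
            obtain ⟨i, i', j, hi, hi', hne⟩ := h1
            have : 1 ≤ B1 x := by
              simp only [hB1]
              have h3 : ∀ a b : Prop, [Decidable a] → [Decidable b] → (0:ℝ) ≤ (if a then 1 else 0) * (if b then 1 else 0) := by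
                intro a b _ _; split_ifs <;> norm_num
              refine le_trans ?_ (Finset.single_le_sum (fun j _ => Finset.sum_nonneg fun i1 _ => Finset.sum_nonneg fun i2 _ => h3 _ _) (mem_univ j))
              refine le_trans ?_ (Finset.single_le_sum (fun i1 _ => Finset.sum_nonneg fun i2 _ => h3 _ _) (mem_univ i))
              refine le_trans ?_ (Finset.single_le_sum (fun i2 _ => h3 _ _) (mem_erase.2 ⟨hne.symm, mem_univ i'⟩))
              simp [hi, hi']
            linarith [hB20 x]
        nlinarith
    linarith
  set β := ∑ A, G A * ∏ j ∈ A, (1 / (p j : ℝ)) with hβ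
  have hD0 : ∀ τ : Fin N → Option (Fin k), 0 ≤ (∏ j, D2 m (p j : ℝ) (τ j)) * (∑ r, cc k p G R r * ∏ j, co m (r j) (τ j)) ^ 2 := by
    intro τ
    refine mul_nonneg (Finset.prod_nonneg fun j _ => ?_) (sq_nonneg _)
    have := hp2 j
    unfold D2; split_ifs
    · rw [sub_nonneg, div_le_one (by nlinarith)]
      nlinarith
    · exact le_rfl
    · linarith
  set tg : Finset (Fin N → Option (Fin k)) := univ.filter fun τ => (nm p (supp τ) : ℝ) ≤ R / Z with htg
  calc _ = 1 / 2 * β ^ 2 * (1 / 2 * Pi0) := by ring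
    _ ≤ 1 / 2 * β ^ 2 * ∑ x ∈ good, ∏ i, f i (x i) := mul_le_mul_of_nonneg_left hge (by positivity)
    _ ≤ 1 / 2 * β ^ 2 * ∑ x ∈ tg.image fib, ∏ i, f i (x i) := by
        refine mul_le_mul_of_nonneg_left ?_ (by positivity)
        refine Finset.sum_le_sum_of_subset_of_nonneg ?_ (fun x _ _ => Finset.prod_nonneg fun i _ => hf0 _ _)
        intro x hx
        simp only [hgood, mem_filter, mem_univ, true_and] at hx
        obtain ⟨τ, rfl⟩ := exists_fib x hx.1
        refine mem_image_of_mem _ ?_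
        simp only [htg, mem_filter, mem_univ, true_and]
        have e : (nm p (supp τ) : ℝ) = ∏ i, (nm p (fib τ i) : ℝ) := by
          unfold nm; push_cast; rw [prod_supp]
        rw [e, ← Real.log_le_log_iff (Finset.prod_pos fun i _ => by linarith [hnm1 (fib τ i)]) (by positivity), Real.log_prod (fun i _ => by linarith [hnm1 (fib τ i)])]
        exact hx.2
    _ = ∑ τ ∈ tg, 1 / 2 * β ^ 2 * ∏ i, f i (fib τ i) := by
        rw [Finset.sum_image fun _ _ _ _ h => fib_inj h, Finset.mul_sum]
    _ ≤ ∑ τ ∈ tg, (∏ j, D2 m (p j : ℝ) (τ j)) * (∑ r, cc k p G R r * ∏ j, co m (r j) (τ j)) ^ 2 := by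
        refine Finset.sum_le_sum fun τ hτ => ?_
        rw [← Finset.mul_prod_erase univ _ (mem_univ m)]
        by_cases hm : fib τ m = ∅
        · have := tau_ge m p hp hη G hG0 hGm R Z hZ hGZ τ hm (mem_filter.1 hτ).2
          have e1 : f m (fib τ m) = 1 := by simp [hf, hm]
          rw [e1, one_mul]
          have e2 : ∏ i ∈ univ.erase m, f i (fib τ i) = ∏ i ∈ univ.erase m, (G (fib τ i) ^ 2 * ∏ j ∈ fib τ i, gk k p j) :=
            Finset.prod_congr rfl fun i hi => by simp only [hf, hF, if_neg (ne_of_mem_erase hi)]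
          rw [e2]
          exact this
        · have e1 : f m (fib τ m) = 0 := by simp [hf, hm]
          rw [e1, zero_mul, mul_zero]; exact hD0 τ
    _ ≤ _ := Finset.sum_le_univ_sum_of_nonneg hD0

end PG

namespace PG
open Finset

/-- `p` enumerates the primes up to `R` not dividing `W` -/
structure PS {N : ℕ} (W : ℕ) (R : ℝ) (p : Fin N → ℕ) : Prop where
  pr : ∀ j, (p j).Prime
  inj : Function.Injective p
  nd : ∀ j, ¬ p j ∣ W
  sur : ∀ q : ℕ, q.Prime → (q : ℝ) ≤ R → ¬ q ∣ W → ∃ j, p j = q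
  le : ∀ j, (p j : ℝ) ≤ R

lemma exists_PS (W : ℕ) (R : ℝ) (hR : 0 ≤ R) : ∃ N : ℕ, ∃ p : Fin N → ℕ, PS W R p := by
  set s := (Finset.range (⌊R⌋₊ + 1)).filter fun q => q.Prime ∧ ¬ q ∣ W with hs
  have hmem : ∀ j, (s.orderEmbOfFin rfl j) ∈ s := fun j => Finset.orderEmbOfFin_mem s rfl j
  refine ⟨s.card, fun j => s.orderEmbOfFin rfl j, ⟨fun j => ?_, (s.orderEmbOfFin rfl).injective, fun j => ?_, fun q hq hqR hqW => ?_, fun j => ?_⟩⟩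
  · have := hmem j; simp only [hs, mem_filter] at this; exact this.2.1
  · have := hmem j; simp only [hs, mem_filter] at this; exact this.2.2
  · have : q ∈ s := by
      simp only [hs, mem_filter, mem_range]
      exact ⟨Nat.lt_succ_of_le (Nat.le_floor hqR), hq, hqW⟩
    have h2 : q ∈ Set.range (s.orderEmbOfFin rfl) := by rw [Finset.range_orderEmbOfFin]; exact this
    exact h2
  · have := hmem j; simp only [hs, mem_filter, mem_range] at this
    exact le_trans (by exact_mod_cast Nat.lt_succ_iff.1 this.1) (Nat.floor_le hR)

variable {N : ℕ} {W : ℕ} {R : ℝ} {p : Fin N → ℕ}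

lemma PS.dvd_nm (h : PS W R p) (A : Finset (Fin N)) (j : Fin N) : p j ∣ nm p A ↔ j ∈ A := by
  unfold nm
  rw [Prime.dvd_finsetProd_iff (h.pr j).prime]
  constructor
  · rintro ⟨a, ha, hd⟩
    rw [Nat.prime_dvd_prime_iff_eq (h.pr j) (h.pr a)] at hd
    rwa [h.inj hd]
  · exact fun hj => ⟨j, hj, dvd_rfl⟩

lemma PS.nm_inj (h : PS W R p) : Function.Injective (nm p) := by
  intro A B hAB
  ext j
  rw [← h.dvd_nm A, ← h.dvd_nm B, hAB]

lemma PS.nm_pos (h : PS W R p) (A : Finset (Fin N)) : 0 < nm p A :=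
  Finset.prod_pos fun j _ => (h.pr j).pos

lemma PS.nm_coprime (h : PS W R p) (A : Finset (Fin N)) : (nm p A).Coprime W := by
  unfold nm
  rw [Nat.coprime_prod_left_iff]
  intro j _
  exact (Nat.Prime.coprime_iff_not_dvd (h.pr j)).2 (h.nd j)

lemma PS.nm_pf (h : PS W R p) (A : Finset (Fin N)) : (nm p A).primeFactors = A.image p := by
  have : nm p A = ∏ q ∈ A.image p, q := by
    unfold nm; rw [Finset.prod_image fun _ _ _ _ e => h.inj e]
  rw [this, Nat.primeFactors_prod]
  intro q hq
  obtain ⟨j, _, rfl⟩ := mem_image.1 hq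
  exact h.pr j

lemma PS.nm_card (h : PS W R p) (A : Finset (Fin N)) : (nm p A).primeFactors.card = A.card := by
  rw [h.nm_pf, Finset.card_image_of_injective _ h.inj]

lemma PS.nm_sqf (h : PS W R p) (A : Finset (Fin N)) : Squarefree (nm p A) := by
  unfold nm
  refine Finset.squarefree_prod_of_pairwise_isCoprime (fun i hi j hj hij => ?_) fun j _ => (h.pr j).squarefree
  simp only [Function.onFun]
  rw [Nat.coprime_iff_isRelPrime.symm]
  exact (Nat.coprime_primes (h.pr i) (h.pr j)).2 fun e => hij (h.inj e)

lemma prod_one_sub_sq_ge (s : Finset ℕ) (hs : ∀ q ∈ s, 2 ≤ q) : (1:ℝ) / 2 ≤ ∏ q ∈ s, (1 - 1 / (q:ℝ) ^ 2) := by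
  have hM : ∀ M : ℕ, 1 ≤ M → ∏ q ∈ Finset.Icc 2 M, (1 - 1 / (q:ℝ) ^ 2) = ((M:ℝ) + 1) / (2 * (M:ℝ)) := by
    intro M hM
    induction M, hM using Nat.le_induction with
    | base => norm_num
    | succ n hn ih =>
      rw [Finset.prod_Icc_succ_top (by omega), ih]
      have : (0:ℝ) < n := by exact_mod_cast hn
      push_cast; field_simp; ring
  have h01 : ∀ q ∈ Finset.Icc 2 (s.sup id + 1), 0 ≤ 1 - 1 / (q:ℝ) ^ 2 ∧ 1 - 1 / (q:ℝ) ^ 2 ≤ 1 := by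
    intro q hq
    have : (2:ℝ) ≤ q := by exact_mod_cast (Finset.mem_Icc.1 hq).1
    constructor
    · rw [sub_nonneg, div_le_one (by nlinarith)]; nlinarith
    · have : 0 ≤ 1 / (q:ℝ) ^ 2 := by positivity
      linarith
  have hsub : s ⊆ Finset.Icc 2 (s.sup id + 1) := by
    intro q hq
    rw [Finset.mem_Icc]
    have : id q ≤ s.sup id := Finset.le_sup hq
    exact ⟨hs q hq, by simp only [id] at this; omega⟩
  calc (1:ℝ) / 2 ≤ ∏ q ∈ Finset.Icc 2 (s.sup id + 1), (1 - 1 / (q:ℝ) ^ 2) := by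
        rw [hM _ (by omega), div_le_div_iff₀ (by norm_num) (by positivity)]
        push_cast; linarith
    _ ≤ _ := by
        rw [← Finset.prod_sdiff hsub]
        refine mul_le_of_le_one_left (Finset.prod_nonneg fun q hq => (h01 q (hsub hq)).1) ?_
        exact Finset.prod_le_one (fun q hq => (h01 q (sdiff_subset hq)).1) fun q hq => (h01 q (sdiff_subset hq)).2

lemma phi_prod (hW : Squarefree W) : (W.totient : ℝ) / W = ∏ q ∈ W.primeFactors, (1 - 1 / (q:ℝ)) := by
  have h1 : (W:ℝ) = ∏ q ∈ W.primeFactors, (q:ℝ) := by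
    conv_lhs => rw [← Nat.prod_primeFactors_of_squarefree hW]
    push_cast; rfl
  rw [totient_sqf hW, h1]
  push_cast
  rw [← Finset.prod_div_distrib]
  refine Finset.prod_congr rfl fun q hq => ?_
  have h2 := (Nat.prime_of_mem_primeFactors hq).pos
  have : (0:ℝ) < q := by exact_mod_cast h2
  rw [Nat.cast_sub (by omega)]
  field_simp
  simp

lemma vw_ge (hW : Squarefree W) : 1 / 2 ≤ (W.totient : ℝ) / W * ∑ D ∈ W.primeFactors.powerset, 1 / ((∏ q ∈ D, q : ℕ) : ℝ) := by
  have : ∑ D ∈ W.primeFactors.powerset, 1 / ((∏ q ∈ D, q : ℕ) : ℝ) = ∏ q ∈ W.primeFactors, (1 + 1 / (q:ℝ)) := by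
    rw [Finset.prod_one_add]
    refine Finset.sum_congr rfl fun D _ => ?_
    push_cast; simp
  rw [this, phi_prod hW, ← Finset.prod_mul_distrib]
  refine le_trans (prod_one_sub_sq_ge W.primeFactors fun q hq => (Nat.prime_of_mem_primeFactors hq).two_le) (le_of_eq ?_)
  refine Finset.prod_congr rfl fun q hq => ?_
  ring

lemma vw_le (hW : Squarefree W) : (W.totient : ℝ) / W * ∑ D ∈ W.primeFactors.powerset, 1 / ((∏ q ∈ D, q : ℕ) : ℝ) ≤ 1 := by
  have : ∑ D ∈ W.primeFactors.powerset, 1 / ((∏ q ∈ D, q : ℕ) : ℝ) = ∏ q ∈ W.primeFactors, (1 + 1 / (q:ℝ)) := by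
    rw [Finset.prod_one_add]
    refine Finset.sum_congr rfl fun D _ => ?_
    push_cast; simp
  rw [this, phi_prod hW, ← Finset.prod_mul_distrib]
  refine Finset.prod_le_one (fun q hq => ?_) fun q hq => ?_
  all_goals
    have : (2:ℝ) ≤ q := by exact_mod_cast (Nat.prime_of_mem_primeFactors hq).two_le
  · have h2 : 1 / (q:ℝ) ≤ 1 := by rw [div_le_one (by linarith)]; linarith
    exact mul_nonneg (by linarith) (by positivity)
  · have : 0 ≤ 1 / (q:ℝ) ^ 2 := by positivity
    have e : (1 - 1 / (q:ℝ)) * (1 + 1 / q) = 1 - 1 / (q:ℝ) ^ 2 := by ring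
    linarith

/-- sum of reciprocals of `nm A ≤ Y` -/
noncomputable def SY (p : Fin N → ℕ) (Y : ℝ) : ℝ := ∑ A, if (nm p A : ℝ) ≤ Y then 1 / (nm p A : ℝ) else 0

lemma SY_le (h : PS W R p) (hW : Squarefree W) {Y : ℝ} (hY : 3 ≤ Y) (hYW : (W:ℝ) ≤ Y) :
    SY p Y ≤ 6 * ((W.totient : ℝ) / W) * Real.log Y := by
  set V := ∑ D ∈ W.primeFactors.powerset, 1 / ((∏ q ∈ D, q : ℕ) : ℝ) with hV
  have hW0 : 0 < W := Nat.pos_of_ne_zero hW.ne_zero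
  have hS0 : 0 ≤ SY p Y := Finset.sum_nonneg fun A _ => by split_ifs <;> positivity
  have hphi0 : 0 ≤ (W.totient : ℝ) / W := by positivity
  have key : SY p Y * V ≤ 3 * Real.log Y := by
    have hDd : ∀ D ∈ W.primeFactors.powerset, (∏ q ∈ D, q) ∣ W := by
      intro D hD
      conv_rhs => rw [← Nat.prod_primeFactors_of_squarefree hW]
      exact Finset.prod_dvd_prod_of_subset _ _ _ (mem_powerset.1 hD)
    set T := ((univ : Finset (Finset (Fin N))).filter fun A => (nm p A : ℝ) ≤ Y) ×ˢ W.primeFactors.powerset with hT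
    have hinj : Set.InjOn (fun x : Finset (Fin N) × Finset ℕ => nm p x.1 * ∏ q ∈ x.2, q) (T : Set (Finset (Fin N) × Finset ℕ)) := by
      rintro ⟨A, D⟩ hA ⟨B, E⟩ hB he
      simp only at he
      simp only [hT, mem_coe, mem_product, mem_filter, mem_univ, true_and] at hA hB
      have hD : ∀ (A : Finset (Fin N)) (D : Finset ℕ), D ∈ W.primeFactors.powerset → ∀ j, p j ∣ nm p A * ∏ q ∈ D, q ↔ j ∈ A := by
        intro A D hD j
        rw [(h.pr j).dvd_mul, h.dvd_nm]
        refine or_iff_left fun hh => h.nd j (hh.trans (hDd D hD))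
      have hAB : A = B := by
        ext j; rw [← hD A D hA.2, ← hD B E hB.2, he]
      subst hAB
      have h3 := Nat.eq_of_mul_eq_mul_left (h.nm_pos A) he
      have h4 : ∀ D ∈ W.primeFactors.powerset, (∏ q ∈ D, q).primeFactors = D := fun D hD =>
        Nat.primeFactors_prod fun q hq => Nat.prime_of_mem_primeFactors (mem_powerset.1 hD hq)
      rw [← h4 D hA.2, ← h4 E hB.2, h3]
    calc SY p Y * V = ∑ x ∈ T, 1 / ((nm p x.1 * ∏ q ∈ x.2, q : ℕ) : ℝ) := by
          rw [hT, Finset.sum_product, SY, ← Finset.sum_filter, Finset.sum_mul]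
          refine Finset.sum_congr rfl fun A _ => ?_
          rw [hV, Finset.mul_sum]
          refine Finset.sum_congr rfl fun D _ => ?_
          push_cast
          rw [div_mul_div_comm, one_mul]
      _ = ∑ n ∈ T.image (fun x : Finset (Fin N) × Finset ℕ => nm p x.1 * ∏ q ∈ x.2, q), 1 / (n:ℝ) := by
          rw [Finset.sum_image hinj]
      _ ≤ ∑ n ∈ Finset.Icc 1 (⌊Y⌋₊ * W), 1 / (n:ℝ) := by
          refine Finset.sum_le_sum_of_subset_of_nonneg ?_ (fun _ _ _ => by positivity)
          intro n hn
          obtain ⟨⟨A, D⟩, hx, rfl⟩ := mem_image.1 hn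
          simp only [hT, mem_product, mem_filter, mem_univ, true_and] at hx
          have h5 := Nat.le_of_dvd hW0 (hDd D hx.2)
          have h6 := Nat.pos_of_dvd_of_pos (hDd D hx.2) hW0
          rw [Finset.mem_Icc]
          exact ⟨Nat.mul_pos (h.nm_pos A) h6, Nat.mul_le_mul (Nat.le_floor hx.1) h5⟩
      _ ≤ 1 + Real.log ((⌊Y⌋₊ * W : ℕ)) := harm_le _
      _ ≤ 1 + Real.log (Y * Y) := by
          have hf : 0 < ⌊Y⌋₊ := Nat.floor_pos.2 (by linarith)
          gcongr
          push_cast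
          exact mul_le_mul (Nat.floor_le (by linarith)) hYW (by positivity) (by linarith)
      _ ≤ _ := by
          rw [Real.log_mul (by linarith) (by linarith)]
          have : 1 ≤ Real.log Y := by
            rw [Real.le_log_iff_exp_le (by linarith)]
            linarith [Real.exp_one_lt_d9]
          linarith
  have hv := vw_ge hW
  rw [← hV] at hv
  have h1 : SY p Y * (1 / 2) ≤ SY p Y * ((W.totient : ℝ) / W * V) := mul_le_mul_of_nonneg_left hv hS0
  have h2 : (W.totient : ℝ) / W * (SY p Y * V) ≤ (W.totient : ℝ) / W * (3 * Real.log Y) := mul_le_mul_of_nonneg_left key hphi0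
  nlinarith

lemma exists_nm (h : PS W R p) {a : ℕ} (ha : Squarefree a) (hc : a.Coprime W) (haR : (a:ℝ) ≤ R) : ∃ A, nm p A = a := by
  refine ⟨univ.filter fun j => p j ∣ a, ?_⟩
  have : (univ.filter fun j => p j ∣ a).image p = a.primeFactors := by
    ext q
    simp only [mem_image, mem_filter, mem_univ, true_and, Nat.mem_primeFactors]
    constructor
    · rintro ⟨j, hj, rfl⟩
      exact ⟨h.pr j, hj, ha.ne_zero⟩
    · rintro ⟨hq, hd, h0⟩
      have hqa : q ≤ a := Nat.le_of_dvd (Nat.pos_of_ne_zero h0) hd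
      obtain ⟨j, rfl⟩ := h.sur q hq (le_trans (by exact_mod_cast hqa) haR) (fun hqW => by
        have := Nat.dvd_gcd hd hqW
        rw [hc] at this
        exact hq.one_lt.ne' (Nat.dvd_one.1 this))
      exact ⟨j, hd, rfl⟩
  unfold nm
  rw [← Finset.prod_image (s := univ.filter fun j => p j ∣ a) (g := p) (f := fun q => q) (fun _ _ _ _ e => h.inj e), this]
  exact Nat.prod_primeFactors_of_squarefree ha

lemma sum_inv_sq_le (M : ℕ) : ∑ m ∈ Finset.Icc 1 M, 1 / (m:ℝ) ^ 2 ≤ 2 := by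
  have : ∀ M : ℕ, 1 ≤ M → ∑ m ∈ Finset.Icc 1 M, 1 / (m:ℝ) ^ 2 ≤ 2 - 1 / (M:ℝ) := by
    intro M hM
    induction M, hM using Nat.le_induction with
    | base => norm_num
    | succ n hn ih =>
      rw [Finset.sum_Icc_succ_top (by omega)]
      have h0 : (0:ℝ) < n := by exact_mod_cast hn
      have : 1 / ((n + 1 : ℕ) : ℝ) ^ 2 ≤ 1 / (n:ℝ) - 1 / ((n + 1 : ℕ):ℝ) := by
        push_cast
        rw [div_sub_div _ _ (by positivity) (by positivity), div_le_div_iff₀ (by positivity) (by positivity)]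
        nlinarith
      linarith
  rcases Nat.eq_zero_or_pos M with rfl | hM
  · norm_num
  · have := this M hM
    have : 0 ≤ 1 / (M:ℝ) := by positivity
    linarith

lemma SY_ge (h : PS W R p) (hW : Squarefree W) {Y : ℝ} (hY : 1 ≤ Y) (hYR : Y ≤ R) :
    1 / 2 * ((W.totient : ℝ) / W) * Real.log Y ≤ SY p Y := by
  set V := ∑ D ∈ W.primeFactors.powerset, 1 / ((∏ q ∈ D, q : ℕ) : ℝ) with hV
  have hS0 : 0 ≤ SY p Y := Finset.sum_nonneg fun A _ => by split_ifs <;> positivity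
  have hphi0 : 0 ≤ (W.totient : ℝ) / W := by positivity
  have key : Real.log Y ≤ 2 * (SY p Y * V) := by
    set T := Finset.Icc 1 ⌊Y⌋₊ ×ˢ ((univ : Finset (Finset (Fin N))).filter fun A => (nm p A : ℝ) ≤ Y) ×ˢ W.primeFactors.powerset with hT
    set F : ℕ × Finset (Fin N) × Finset ℕ → ℕ := fun x => x.1 ^ 2 * (nm p x.2.1 * ∏ q ∈ x.2.2, q) with hF
    have hex : ∀ n ∈ Finset.Icc 1 ⌊Y⌋₊, ∃ x ∈ T, F x = n := by
      intro n hn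
      rw [Finset.mem_Icc] at hn
      obtain ⟨a, b, ha0, hb0, hab, hsq⟩ := Nat.sq_mul_squarefree_of_pos (show 0 < n by omega)
      set D := a.primeFactors ∩ W.primeFactors with hD
      set e := ∏ q ∈ a.primeFactors \ W.primeFactors, q with he
      have hae : a = e * ∏ q ∈ D, q := by
        conv_lhs => rw [← Nat.prod_primeFactors_of_squarefree hsq]
        rw [he, hD, ← Finset.prod_sdiff (Finset.inter_subset_left : a.primeFactors ∩ W.primeFactors ⊆ a.primeFactors), Finset.sdiff_inter_self_left]
      have hea : e ∣ a := ⟨_, hae⟩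
      have hle : e ≤ n := le_trans (Nat.le_of_dvd ha0 hea) (by rw [← hab]; exact Nat.le_mul_of_pos_left _ (by positivity))
      have hn' : (n:ℝ) ≤ Y := (Nat.le_floor_iff (by linarith)).1 hn.2
      have heY : (e:ℝ) ≤ Y := le_trans (by exact_mod_cast hle) hn'
      obtain ⟨A, hA⟩ := exists_nm h (hsq.squarefree_of_dvd hea) (by
        rw [he, Nat.coprime_prod_left_iff]
        intro q hq
        rw [mem_sdiff, Nat.mem_primeFactors, Nat.mem_primeFactors] at hq
        refine (Nat.Prime.coprime_iff_not_dvd hq.1.1).2 fun hd => hq.2 ⟨hq.1.1, hd, hW.ne_zero⟩) (heY.trans hYR)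
      refine ⟨(b, A, D), ?_, ?_⟩
      · simp only [hT, mem_product, Finset.mem_Icc, mem_filter, mem_univ, true_and, mem_powerset]
        refine ⟨⟨hb0, ?_⟩, by rw [hA]; exact heY, Finset.inter_subset_right⟩
        have : b ≤ b ^ 2 * a := le_trans (Nat.le_self_pow (by norm_num) b) (Nat.le_mul_of_pos_right _ ha0)
        omega
      · simp only [hF]
        rw [hA, ← hae, hab]
    choose! x hx hFx using hex
    have hinj : Set.InjOn x (Finset.Icc 1 ⌊Y⌋₊ : Set ℕ) := by
      intro n hn n' hn' he
      rw [← hFx n (mem_coe.1 hn), ← hFx n' (mem_coe.1 hn'), he]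
    calc Real.log Y ≤ ∑ n ∈ Finset.Icc 1 ⌊Y⌋₊, 1 / (n:ℝ) := by
          have := log_le_harmonic_floor Y (by linarith)
          rw [harmonic_eq_sum_Icc] at this
          push_cast at this
          simpa using this
      _ = ∑ n ∈ Finset.Icc 1 ⌊Y⌋₊, 1 / ((F (x n) : ℕ) : ℝ) := Finset.sum_congr rfl fun n hn => by rw [hFx n hn]
      _ = ∑ z ∈ (Finset.Icc 1 ⌊Y⌋₊).image x, 1 / ((F z : ℕ) : ℝ) := by rw [Finset.sum_image (by exact_mod_cast hinj)]
      _ ≤ ∑ z ∈ T, 1 / ((F z : ℕ) : ℝ) := by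
          refine Finset.sum_le_sum_of_subset_of_nonneg ?_ (fun _ _ _ => by positivity)
          intro z hz
          obtain ⟨n, hn, rfl⟩ := mem_image.1 hz
          exact hx n hn
      _ = (∑ m ∈ Finset.Icc 1 ⌊Y⌋₊, 1 / (m:ℝ) ^ 2) * (SY p Y * V) := by
          rw [hT, Finset.sum_product, Finset.sum_mul]
          refine Finset.sum_congr rfl fun m _ => ?_
          rw [Finset.sum_product, SY, ← Finset.sum_filter, Finset.sum_mul, Finset.mul_sum]
          refine Finset.sum_congr rfl fun A _ => ?_
          rw [hV, Finset.mul_sum, Finset.mul_sum]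
          refine Finset.sum_congr rfl fun D _ => ?_
          simp only [hF]
          push_cast
          rw [div_mul_div_comm, div_mul_div_comm, one_mul, one_mul]
      _ ≤ _ := mul_le_mul_of_nonneg_right (sum_inv_sq_le _) (mul_nonneg hS0 (Finset.sum_nonneg fun _ _ => by positivity))
  have hv := vw_le hW
  rw [← hV] at hv
  have h1 : SY p Y * ((W.totient : ℝ) / W * V) ≤ SY p Y * 1 := mul_le_mul_of_nonneg_left hv hS0
  have h2 : (W.totient : ℝ) / W * Real.log Y ≤ (W.totient : ℝ) / W * (2 * (SY p Y * V)) := mul_le_mul_of_nonneg_left key hphi0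
  nlinarith

end PG

namespace PG
open Finset

noncomputable def gJ (J : ℕ) (z a : ℝ) : ℝ := ∑ l ∈ range (J + 1), if a ≤ z ^ (2 ^ l) then ((1:ℝ) / 2) ^ l else 0

lemma gJ_nonneg (J : ℕ) (z a : ℝ) : 0 ≤ gJ J z a :=
  Finset.sum_nonneg fun l _ => by split_ifs <;> positivity

lemma gJ_anti (J : ℕ) (z : ℝ) {a b : ℝ} (h : a ≤ b) : gJ J z b ≤ gJ J z a := by
  refine Finset.sum_le_sum fun l _ => ?_
  split_ifs with h1 h2
  · exact le_rfl
  · exact absurd (h.trans h1) h2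
  · positivity
  · exact le_rfl

lemma geom_half (n : ℕ) : ∑ l ∈ range n, ((1:ℝ) / 2) ^ l ≤ 2 := by
  have : ∑ l ∈ range n, ((1:ℝ) / 2) ^ l = 2 - 2 * (1 / 2) ^ n := by
    induction n with
    | zero => norm_num
    | succ n ih => rw [Finset.sum_range_succ, ih, pow_succ]; ring
  have h : 0 ≤ ((1:ℝ) / 2) ^ n := by positivity
  linarith

lemma gJ_le (J : ℕ) (z a : ℝ) : gJ J z a ≤ 2 := by
  refine le_trans (Finset.sum_le_sum fun l _ => ?_) (geom_half (J + 1))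
  split_ifs
  · exact le_rfl
  · positivity

lemma gJ_ge (J : ℕ) {z a : ℝ} (h : a ≤ z) : 1 ≤ gJ J z a := by
  refine le_trans ?_ (Finset.single_le_sum (f := fun l => if a ≤ z ^ (2 ^ l) then ((1:ℝ) / 2) ^ l else 0) (fun l _ => by split_ifs <;> positivity) (mem_range.2 (Nat.succ_pos J)))
  simp [h]

lemma pow_tower_mono {z : ℝ} (hz : 1 ≤ z) {l l' : ℕ} (h : l ≤ l') : z ^ (2 ^ l) ≤ z ^ (2 ^ l') :=
  pow_le_pow_right₀ hz (Nat.pow_le_pow_right (by norm_num) h)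

lemma gJ_ne {J : ℕ} {z a : ℝ} (hz : 1 ≤ z) (h : gJ J z a ≠ 0) : a ≤ z ^ (2 ^ J) := by
  by_contra hcon
  refine h (Finset.sum_eq_zero fun l hl => if_neg fun h2 => hcon (h2.trans (pow_tower_mono hz ?_)))
  exact Nat.lt_succ_iff.1 (mem_range.1 hl)

lemma sq_tower (P : ℕ → Prop) [DecidablePred P] (hP : ∀ l, P l → P (l + 1)) (n : ℕ) :
    (∑ l ∈ range n, if P l then ((1:ℝ) / 2) ^ l else 0) ^ 2 ≤ 4 * ∑ l ∈ range n, if P l then ((1:ℝ) / 4) ^ l else 0 := by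
  induction n generalizing P with
  | zero => simp
  | succ n ih =>
    by_cases h0 : P 0
    · have h1 : (∑ l ∈ range (n + 1), if P l then ((1:ℝ) / 2) ^ l else 0) ≤ 2 := by
        refine le_trans (Finset.sum_le_sum fun l _ => ?_) (geom_half (n + 1))
        split_ifs
        · exact le_rfl
        · positivity
      have h2 : 0 ≤ (∑ l ∈ range (n + 1), if P l then ((1:ℝ) / 2) ^ l else 0) :=
        Finset.sum_nonneg fun l _ => by split_ifs <;> positivity
      have h3 : 1 ≤ ∑ l ∈ range (n + 1), if P l then ((1:ℝ) / 4) ^ l else 0 := by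
        refine le_trans ?_ (Finset.single_le_sum (f := fun l => if P l then ((1:ℝ) / 4) ^ l else 0) (fun l _ => by split_ifs <;> positivity) (mem_range.2 (Nat.succ_pos n)))
        simp [h0]
      nlinarith
    · rw [Finset.sum_range_succ', Finset.sum_range_succ', if_neg h0, if_neg h0, add_zero, add_zero]
      have := ih (fun l => P (l + 1)) (fun l => hP (l + 1))
      have e1 : (∑ l ∈ range n, if P (l + 1) then ((1:ℝ) / 2) ^ (l + 1) else 0) = 1 / 2 * ∑ l ∈ range n, if P (l + 1) then ((1:ℝ) / 2) ^ l else 0 := by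
        rw [Finset.mul_sum]
        refine Finset.sum_congr rfl fun l _ => ?_
        split_ifs
        · rw [pow_succ]; ring
        · simp
      have e2 : (∑ l ∈ range n, if P (l + 1) then ((1:ℝ) / 4) ^ (l + 1) else 0) = 1 / 4 * ∑ l ∈ range n, if P (l + 1) then ((1:ℝ) / 4) ^ l else 0 := by
        rw [Finset.mul_sum]
        refine Finset.sum_congr rfl fun l _ => ?_
        split_ifs
        · rw [pow_succ]; ring
        · simp
      rw [e1, e2, mul_pow]
      linarith

lemma gJ_sq_le (J : ℕ) {z : ℝ} (hz : 1 ≤ z) (a : ℝ) :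
    gJ J z a ^ 2 ≤ 4 * ∑ l ∈ range (J + 1), if a ≤ z ^ (2 ^ l) then ((1:ℝ) / 4) ^ l else 0 :=
  sq_tower (fun l => a ≤ z ^ (2 ^ l)) (fun l h => h.trans (pow_tower_mono hz (Nat.le_succ l))) (J + 1)

variable {N : ℕ} {W : ℕ} {R : ℝ} {p : Fin N → ℕ}

noncomputable def GG (p : Fin N → ℕ) (J : ℕ) (z : ℝ) (A : Finset (Fin N)) : ℝ := gJ J z (nm p A)

lemma prod_inv_nm (p : Fin N → ℕ) (A : Finset (Fin N)) : ∏ j ∈ A, (1 / (p j : ℝ)) = 1 / (nm p A : ℝ) := by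
  unfold nm; push_cast; simp

lemma log_tower (z : ℝ) (l : ℕ) : Real.log (z ^ (2 ^ l)) = 2 ^ l * Real.log z := by
  rw [Real.log_pow]; push_cast; ring

lemma GG_anti (h : PS W R p) (J : ℕ) (z : ℝ) (A B : Finset (Fin N)) (hAB : A ⊆ B) : GG p J z B ≤ GG p J z A := by
  refine gJ_anti J z ?_
  have : nm p A ≤ nm p B := Nat.le_of_dvd (h.nm_pos B) (Finset.prod_dvd_prod_of_subset _ _ _ hAB)
  exact_mod_cast this

lemma beta_ge (h : PS W R p) (hW : Squarefree W) (J : ℕ) {z : ℝ} (hz : 3 ≤ z) (hzR : z ^ (2 ^ J) ≤ R) :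
    ((J:ℝ) + 1) * (1 / 2 * ((W.totient : ℝ) / W) * Real.log z) ≤ ∑ A, GG p J z A * ∏ j ∈ A, (1 / (p j : ℝ)) := by
  have e : ∑ A, GG p J z A * ∏ j ∈ A, (1 / (p j : ℝ)) = ∑ l ∈ range (J + 1), (1 / 2 : ℝ) ^ l * SY p (z ^ (2 ^ l)) := by
    simp only [prod_inv_nm, GG, gJ, SY, Finset.sum_mul, Finset.mul_sum]
    rw [Finset.sum_comm]
    refine Finset.sum_congr rfl fun l _ => Finset.sum_congr rfl fun A _ => ?_
    split_ifs <;> ring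
  rw [e]
  calc _ = ∑ l ∈ range (J + 1), (1 / 2 * ((W.totient : ℝ) / W) * Real.log z) := by simp
    _ ≤ _ := by
      refine Finset.sum_le_sum fun l hl => ?_
      have h1 := SY_ge h hW (Y := z ^ (2 ^ l)) (one_le_pow₀ (by linarith)) (le_trans (pow_tower_mono (by linarith) (Nat.lt_succ_iff.1 (mem_range.1 hl))) hzR)
      rw [log_tower] at h1
      have h2 := mul_le_mul_of_nonneg_left h1 (show (0:ℝ) ≤ (1 / 2) ^ l by positivity)
      have h3 : ((1:ℝ) / 2) ^ l * 2 ^ l = 1 := by rw [← mul_pow]; norm_num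
      calc _ = (((1:ℝ) / 2) ^ l * 2 ^ l) * (1 / 2 * ((W.totient : ℝ) / W) * Real.log z) := by rw [h3, one_mul]
        _ ≤ _ := by refine le_trans (le_of_eq ?_) h2; ring

lemma a2log_le (h : PS W R p) (hW : Squarefree W) (J : ℕ) {z : ℝ} (hz : 3 ≤ z) (hzW : (W:ℝ) ≤ z) :
    ∑ A, GG p J z A ^ 2 * (∏ j ∈ A, (1 / (p j : ℝ))) * Real.log (nm p A) ≤ 24 * ((J:ℝ) + 1) * ((W.totient : ℝ) / W) * Real.log z ^ 2 := by
  have hphi0 : 0 ≤ (W.totient : ℝ) / W := by positivity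
  have hlz : 0 ≤ Real.log z := Real.log_nonneg (by linarith)
  have hln : ∀ A, 0 ≤ Real.log (nm p A) := fun A => Real.log_natCast_nonneg _
  calc _ ≤ ∑ A, ∑ l ∈ range (J + 1), 4 * (((1:ℝ) / 4) ^ l * (2 ^ l * Real.log z)) * (if (nm p A : ℝ) ≤ z ^ (2 ^ l) then 1 / (nm p A : ℝ) else 0) := by
        refine Finset.sum_le_sum fun A _ => ?_
        rw [prod_inv_nm]
        have hn0 : (0:ℝ) < nm p A := by exact_mod_cast h.nm_pos A
        calc _ ≤ (4 * ∑ l ∈ range (J + 1), if (nm p A : ℝ) ≤ z ^ (2 ^ l) then ((1:ℝ) / 4) ^ l else 0) * (1 / (nm p A : ℝ)) * Real.log (nm p A) := by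
              refine mul_le_mul_of_nonneg_right (mul_le_mul_of_nonneg_right (gJ_sq_le J (by linarith) _) (by positivity)) (hln A)
          _ = ∑ l ∈ range (J + 1), 4 * (((1:ℝ) / 4) ^ l * Real.log (nm p A)) * (if (nm p A : ℝ) ≤ z ^ (2 ^ l) then 1 / (nm p A : ℝ) else 0) := by
              rw [Finset.mul_sum, Finset.sum_mul, Finset.sum_mul]
              refine Finset.sum_congr rfl fun l _ => ?_
              split_ifs <;> ring
          _ ≤ _ := by
              refine Finset.sum_le_sum fun l _ => ?_
              split_ifs with hl
              · have : Real.log (nm p A) ≤ 2 ^ l * Real.log z := by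
                  rw [← log_tower]; exact Real.log_le_log hn0 hl
                refine mul_le_mul_of_nonneg_right ?_ (by positivity)
                exact mul_le_mul_of_nonneg_left (mul_le_mul_of_nonneg_left this (by positivity)) (by norm_num)
              · simp
    _ = ∑ l ∈ range (J + 1), 4 * (((1:ℝ) / 4) ^ l * (2 ^ l * Real.log z)) * SY p (z ^ (2 ^ l)) := by
        rw [Finset.sum_comm]
        simp only [SY, Finset.mul_sum]
    _ ≤ ∑ l ∈ range (J + 1), 24 * ((W.totient : ℝ) / W) * Real.log z ^ 2 := by
        refine Finset.sum_le_sum fun l _ => ?_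
        have hzl : z ≤ z ^ (2 ^ l) := le_self_pow₀ (by linarith) (by positivity)
        have h1 := SY_le h hW (Y := z ^ (2 ^ l)) (by linarith) (by linarith)
        rw [log_tower] at h1
        have h2 := mul_le_mul_of_nonneg_left h1 (show (0:ℝ) ≤ 4 * (((1:ℝ) / 4) ^ l * (2 ^ l * Real.log z)) by positivity)
        refine h2.trans (le_of_eq ?_)
        have h3 : ((1:ℝ) / 4) ^ l * 2 ^ l * 2 ^ l = 1 := by rw [← mul_pow, ← mul_pow]; norm_num
        calc _ = (((1:ℝ) / 4) ^ l * 2 ^ l * 2 ^ l) * (24 * ((W.totient : ℝ) / W) * Real.log z ^ 2) := by ring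
          _ = _ := by rw [h3, one_mul]
    _ = _ := by simp; ring

lemma a2_le (h : PS W R p) (hW : Squarefree W) (J : ℕ) {z : ℝ} (hz : 3 ≤ z) (hzW : (W:ℝ) ≤ z) :
    ∑ A, GG p J z A ^ 2 * (∏ j ∈ A, (1 / (p j : ℝ))) ≤ 48 * ((W.totient : ℝ) / W) * Real.log z := by
  have hphi0 : 0 ≤ (W.totient : ℝ) / W := by positivity
  have hlz : 0 ≤ Real.log z := Real.log_nonneg (by linarith)
  calc _ ≤ ∑ A, ∑ l ∈ range (J + 1), 4 * (((1:ℝ) / 4) ^ l) * (if (nm p A : ℝ) ≤ z ^ (2 ^ l) then 1 / (nm p A : ℝ) else 0) := by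
        refine Finset.sum_le_sum fun A _ => ?_
        rw [prod_inv_nm]
        calc _ ≤ (4 * ∑ l ∈ range (J + 1), if (nm p A : ℝ) ≤ z ^ (2 ^ l) then ((1:ℝ) / 4) ^ l else 0) * (1 / (nm p A : ℝ)) := by
              exact mul_le_mul_of_nonneg_right (gJ_sq_le J (by linarith) _) (by positivity)
          _ = _ := by
              rw [Finset.mul_sum, Finset.sum_mul]
              refine Finset.sum_congr rfl fun l _ => ?_
              split_ifs <;> ring
    _ = ∑ l ∈ range (J + 1), 4 * (((1:ℝ) / 4) ^ l) * SY p (z ^ (2 ^ l)) := by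
        rw [Finset.sum_comm]
        simp only [SY, Finset.mul_sum]
    _ ≤ ∑ l ∈ range (J + 1), ((1:ℝ) / 2) ^ l * (24 * ((W.totient : ℝ) / W) * Real.log z) := by
        refine Finset.sum_le_sum fun l _ => ?_
        have hzl : z ≤ z ^ (2 ^ l) := le_self_pow₀ (by linarith) (by positivity)
        have h1 := SY_le h hW (Y := z ^ (2 ^ l)) (by linarith) (by linarith)
        rw [log_tower] at h1
        have h2 := mul_le_mul_of_nonneg_left h1 (show (0:ℝ) ≤ 4 * (((1:ℝ) / 4) ^ l) by positivity)
        refine h2.trans (le_of_eq ?_)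
        have h3 : ((1:ℝ) / 4) ^ l * 2 ^ l = (1 / 2) ^ l := by rw [← mul_pow]; norm_num
        rw [← h3]; ring
    _ ≤ 2 * (24 * ((W.totient : ℝ) / W) * Real.log z) := by
        rw [← Finset.sum_mul]
        exact mul_le_mul_of_nonneg_right (geom_half _) (by positivity)
    _ = _ := by ring

lemma a2_ge (h : PS W R p) (hW : Squarefree W) (J : ℕ) {z : ℝ} (hz : 3 ≤ z) (hzR : z ≤ R) :
    1 / 2 * ((W.totient : ℝ) / W) * Real.log z ≤ ∑ A, GG p J z A ^ 2 * (∏ j ∈ A, (1 / (p j : ℝ))) := by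
  refine (SY_ge h hW (by linarith) hzR).trans ?_
  unfold SY
  refine Finset.sum_le_sum fun A _ => ?_
  rw [prod_inv_nm]
  split_ifs with hl
  · have := gJ_ge J hl
    refine le_mul_of_one_le_left (by positivity) ?_
    unfold GG; nlinarith
  · positivity

end PG

namespace PG
open Finset

variable {N : ℕ} {W : ℕ} {R : ℝ} {p : Fin N → ℕ}

lemma sum_inv_sq_tail (h : PS W R p) {w : ℕ} (hw : 2 ≤ w) (hp : ∀ j, w < p j) :
    ∑ j, 1 / ((p j : ℝ) - 1) ^ 2 ≤ 1 / ((w:ℝ) - 1) := by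
  have hw2 : (2:ℝ) ≤ w := by exact_mod_cast hw
  have key : ∀ M : ℕ, w ≤ M → ∑ n ∈ Finset.Ioc w M, 1 / ((n:ℝ) - 1) ^ 2 ≤ 1 / ((w:ℝ) - 1) - 1 / ((M:ℝ) - 1) := by
    intro M hM
    induction M, hM using Nat.le_induction with
    | base => simp
    | succ n hn ih =>
      rw [← Finset.insert_Ioc_right_eq_Ioc_add_one hn, Finset.sum_insert (by simp)]
      have h0 : (2:ℝ) ≤ n := by exact_mod_cast hw.trans hn
      have : 1 / (((n + 1 : ℕ):ℝ) - 1) ^ 2 ≤ 1 / ((n:ℝ) - 1) - 1 / (((n + 1 : ℕ):ℝ) - 1) := by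
        push_cast
        rw [add_sub_cancel_right, div_sub_div _ _ (by linarith) (by linarith), div_le_div_iff₀ (by positivity) (mul_pos (by linarith) (by linarith))]
        nlinarith
      linarith
  set M := max w (⌊R⌋₊) with hM
  have h2 := key M (le_max_left _ _)
  have h3 : ∑ j, 1 / ((p j : ℝ) - 1) ^ 2 = ∑ n ∈ univ.image p, 1 / ((n:ℝ) - 1) ^ 2 := by
    rw [Finset.sum_image fun _ _ _ _ e => h.inj e]
  have h4 : ∑ n ∈ univ.image p, 1 / ((n:ℝ) - 1) ^ 2 ≤ ∑ n ∈ Finset.Ioc w M, 1 / ((n:ℝ) - 1) ^ 2 := by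
    refine Finset.sum_le_sum_of_subset_of_nonneg ?_ (fun _ _ _ => by positivity)
    intro n hn
    obtain ⟨j, _, rfl⟩ := mem_image.1 hn
    rw [Finset.mem_Ioc]
    exact ⟨hp j, (Nat.le_floor (h.le j)).trans (le_max_right _ _)⟩
  have h5 : (2:ℝ) ≤ M := le_trans hw2 (by exact_mod_cast le_max_left _ _)
  have h6 : 0 ≤ 1 / ((M:ℝ) - 1) := div_nonneg zero_le_one (by linarith)
  linarith

lemma prod_polylog (h : PS W R p) (k : ℕ) (hR : 1 < R) :
    ∏ j, (1 + (k:ℝ) / ((p j : ℝ) - 1)) ≤ (1 + Real.log R) ^ (6 * k) := by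
  have hl : 0 < Real.log R := Real.log_pos hR
  set ε := 1 / Real.log R with hε
  have hε0 : 0 < ε := by positivity
  have hp2 : ∀ j, (2:ℝ) ≤ p j := fun j => by exact_mod_cast (h.pr j).two_le
  have hz : ∏ j, (1 + (p j : ℝ) ^ (-(1 + ε))) ≤ 1 + Real.log R := by
    have h1 := zeta_le hε0
    have h2 : 1 + 1 / ε = 1 + Real.log R := by rw [hε, one_div_one_div]
    rw [h2] at h1
    refine le_trans ?_ h1
    rw [Finset.prod_one_add]
    have e : ∀ A : Finset (Fin N), ∏ j ∈ A, (p j : ℝ) ^ (-(1 + ε)) = ((nm p A : ℕ) : ℝ) ^ (-(1 + ε)) := by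
      intro A
      unfold nm; push_cast
      rw [Real.finsetProd_rpow _ _ fun j _ => by positivity]
    simp only [e, Finset.powerset_univ]
    rw [← Finset.sum_image (s := univ) (g := nm p) (f := fun n : ℕ => (n:ℝ) ^ (-(1 + ε))) fun _ _ _ _ e => h.nm_inj e]
    refine Summable.sum_le_tsum _ (fun n _ => by positivity) ?_
    exact Real.summable_nat_rpow.2 (by linarith)
  calc _ ≤ ∏ j, (1 + (p j : ℝ) ^ (-(1 + ε))) ^ (6 * k) := by
        refine Finset.prod_le_prod (fun j _ => ?_) fun j _ => ?_
        · have := hp2 j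
          have : 0 ≤ (k:ℝ) / ((p j : ℝ) - 1) := div_nonneg (by positivity) (by linarith)
          linarith
        · have hp := hp2 j
          have hp0 : (0:ℝ) < p j := by linarith
          have h1 := one_add_mul_le_pow (show (-2:ℝ) ≤ (p j : ℝ) ^ (-(1 + ε)) by
            have : 0 ≤ (p j : ℝ) ^ (-(1 + ε)) := by positivity
            linarith) (6 * k)
          refine le_trans ?_ h1
          have h2 : (p j : ℝ) ^ ε ≤ 3 := by
            rw [Real.rpow_def_of_pos hp0]
            have : Real.log (p j) * ε ≤ 1 := by
              rw [hε, mul_one_div, div_le_one hl]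
              exact Real.log_le_log hp0 (h.le j)
            calc _ ≤ Real.exp 1 := Real.exp_le_exp.2 this
              _ ≤ 3 := by linarith [Real.exp_one_lt_d9]
          have h3 : 1 / (3 * (p j : ℝ)) ≤ (p j : ℝ) ^ (-(1 + ε)) := by
            rw [Real.rpow_neg hp0.le, Real.rpow_add hp0, Real.rpow_one, ← one_div]
            refine one_div_le_one_div_of_le (by positivity) ?_
            rw [mul_comm]
            exact mul_le_mul_of_nonneg_right h2 hp0.le
          have h4 : (k:ℝ) / ((p j : ℝ) - 1) ≤ 6 * k * (1 / (3 * (p j : ℝ))) := by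
            rw [mul_one_div, div_le_div_iff₀ (by linarith) (by linarith)]
            have : (0:ℝ) ≤ k := by positivity
            nlinarith
          have h5 : 6 * (k:ℝ) * (1 / (3 * (p j : ℝ))) ≤ 6 * k * (p j : ℝ) ^ (-(1 + ε)) := mul_le_mul_of_nonneg_left h3 (by positivity)
          push_cast
          linarith
    _ = (∏ j, (1 + (p j : ℝ) ^ (-(1 + ε)))) ^ (6 * k) := by rw [Finset.prod_pow]
    _ ≤ _ := pow_le_pow_left₀ (Finset.prod_nonneg fun j _ => by positivity) hz _

/-- the sieve coefficients -/
noncomputable def cs (k : ℕ) (p : Fin N → ℕ) (J : ℕ) (z R : ℝ) : (Fin N → Option (Fin k)) → ℝ := cc k p (GG p J z) R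

lemma mu_cs_le (h : PS W R p) (k J : ℕ) (z : ℝ) (hR : 1 < R) (t : Fin N → Option (Fin k)) :
    |mu p (cs k p J z R) t| ≤ (4 ^ k * (1 + Real.log R) ^ (12 * k)) * 8 ^ (supp t).card := by
  have hp2 : ∀ j, (2:ℝ) ≤ p j := fun j => by exact_mod_cast (h.pr j).two_le
  have h1 := mu_le p (fun j => (h.pr j).two_le) (cs k p J z R) (2 ^ k) (by positivity) (fun r => ?_) t
  · refine h1.trans ?_
    have h2 := prod_polylog h k hR
    have h0 : 0 ≤ ∏ j, (1 + (k:ℝ) / ((p j : ℝ) - 1)) := Finset.prod_nonneg fun j _ => by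
      have := hp2 j
      have : 0 ≤ (k:ℝ) / ((p j : ℝ) - 1) := div_nonneg (by positivity) (by linarith)
      linarith
    have h3 := pow_le_pow_left₀ h0 h2 2
    rw [← pow_mul] at h3
    calc _ ≤ (2 ^ k) ^ 2 * 8 ^ (supp t).card * (1 + Real.log R) ^ (6 * k * 2) := mul_le_mul_of_nonneg_left h3 (by positivity)
      _ = _ := by
        rw [← pow_mul, mul_comm k 2, pow_mul 2 2 k, show 6 * k * 2 = 12 * k by ring]
        norm_num; ring
  · unfold cs cc
    have h3 : 0 ≤ ∏ j ∈ supp r, (1 / ((p j : ℝ) - 1)) := Finset.prod_nonneg fun j _ => div_nonneg zero_le_one (by linarith [hp2 j])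
    split_ifs
    · rw [abs_mul, abs_of_nonneg h3]
      refine mul_le_mul_of_nonneg_right ?_ h3
      rw [Finset.abs_prod]
      calc _ ≤ ∏ i : Fin k, (2:ℝ) := Finset.prod_le_prod (fun _ _ => abs_nonneg _) fun i _ => by
            rw [abs_of_nonneg (show 0 ≤ GG p J z (fib r i) from gJ_nonneg _ _ _)]; exact gJ_le _ _ _
        _ = _ := by simp
    · rw [abs_zero]; positivity

lemma mu_cs_supp (h : PS W R p) (k J : ℕ) (z : ℝ) (hR : 1 < R) (t : Fin N → Option (Fin k))
    (ht : mu p (cs k p J z R) t ≠ 0) : (nm p (supp t) : ℝ) ≤ R ^ 2 := by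
  obtain ⟨r, r', hr, hr', hs⟩ := mu_supp p (cs k p J z R) t ht
  have hc : ∀ r, cs k p J z R r ≠ 0 → (nm p (supp r) : ℝ) ≤ R := by
    intro r hr
    by_contra hcon
    exact hr (if_neg hcon)
  have h1 : nm p (supp t) ∣ nm p (supp r) * nm p (supp r') := by
    refine (Finset.prod_dvd_prod_of_subset _ _ p hs).trans ?_
    rw [← Finset.sdiff_union_self_eq_union, Finset.prod_union Finset.sdiff_disjoint]
    exact Nat.mul_dvd_mul (Finset.prod_dvd_prod_of_subset _ _ _ sdiff_subset) dvd_rfl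
  have h2 := Nat.le_of_dvd (Nat.mul_pos (h.nm_pos _) (h.nm_pos _)) h1
  calc (nm p (supp t) : ℝ) ≤ (nm p (supp r) : ℝ) * nm p (supp r') := by exact_mod_cast h2
    _ ≤ R * R := mul_le_mul (hc r hr) (hc r' hr') (by positivity) (by linarith)
    _ = _ := by ring

set_option maxHeartbeats 1000000 in
lemma sieve_model (h : PS W R p) (hW : Squarefree W) (k J : ℕ) (hk : k = 2 ^ J) {z : ℝ} (hz : 3 ≤ z) (hzW : (W:ℝ) ≤ z)
    (hzR : 400 * k * ((J:ℝ) + 1) * Real.log z ≤ Real.log R) (hR : 1 < R)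
    {w : ℕ} (hw : 5 + 4 * (k + 3) ^ 2 ≤ w) (hp : ∀ j, w < p j) :
    ∃ a : ℝ, 1 / 4 * (((W.totient : ℝ) / W) * Real.log z) ≤ a ∧ a ≤ 48 * (((W.totient : ℝ) / W) * Real.log z) ∧
      ∑ t, mu p (cs k p J z R) t * (1 / (nm p (supp t) : ℝ)) ≤ 2 * a ^ k ∧
      ∀ m, 1 / 16 * ((J:ℝ) + 1) ^ 2 * (((W.totient : ℝ) / W) * Real.log z) ^ 2 * a ^ (k - 1) ≤
        ∑ t, mu p (cs k p J z R) t * ∏ j ∈ supp t, w2 m (p j : ℝ) (t j) := by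
  have hk1 : 1 ≤ k := by rw [hk]; exact Nat.one_le_two_pow
  have hk1' : (1:ℝ) ≤ k := by exact_mod_cast hk1
  have hkR : ((2:ℝ) ^ J) = k := by rw [hk]; push_cast; rfl
  have hpk : ∀ j, 2 * k + 2 ≤ p j := fun j => by have := hp j; nlinarith
  have hpk' : ∀ j, 2 * (k:ℝ) + 2 ≤ p j := fun j => by exact_mod_cast hpk j
  set Φ := ((W.totient : ℝ) / W) * Real.log z with hΦ
  have hW0 : 0 < W := Nat.pos_of_ne_zero hW.ne_zero
  have hphi : 0 < (W.totient : ℝ) / W := div_pos (by exact_mod_cast Nat.totient_pos.2 hW0) (by exact_mod_cast hW0)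
  have hlz : 0 < Real.log z := Real.log_pos (by linarith)
  have hΦ0 : 0 < Φ := by positivity
  set E := ∑ j, 1 / ((p j : ℝ) - 1) ^ 2 with hE
  have hE0 : 0 ≤ E := Finset.sum_nonneg fun j _ => by positivity
  have hη : ((k:ℝ) + 3) ^ 2 * E ≤ 1 / 4 := by
    have h1 := sum_inv_sq_tail h (by omega) hp
    have hw' : 5 + 4 * ((k:ℝ) + 3) ^ 2 ≤ w := by exact_mod_cast hw
    have h2 : 1 / ((w:ℝ) - 1) ≤ 1 / (4 * ((k:ℝ) + 3) ^ 2) := one_div_le_one_div_of_le (by positivity) (by linarith)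
    calc _ ≤ ((k:ℝ) + 3) ^ 2 * (1 / (4 * ((k:ℝ) + 3) ^ 2)) := mul_le_mul_of_nonneg_left (h1.trans h2) (by positivity)
      _ = 1 / 4 := by field_simp
  set G := GG p J z with hG
  have hG0 : ∀ A, 0 ≤ G A := fun A => gJ_nonneg _ _ _
  have hGm := GG_anti h J z
  set a := ∑ A, G A ^ 2 * ∏ j ∈ A, gk k p j with ha
  have hg0 := gk_nonneg (k := k) p hpk
  have hgp : ∀ j, gk k p j ≤ 1 / (p j : ℝ) := by
    intro j
    have := hpk' j
    unfold gk
    rw [div_le_div_iff₀ (by nlinarith) (by linarith)]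
    nlinarith
  set d : Fin N → ℝ := fun j => (p j : ℝ) / ((p j : ℝ) - 1) ^ 2 - gk k p j with hd
  have hpp : ∀ j, 1 / (p j : ℝ) ≤ (p j : ℝ) / ((p j : ℝ) - 1) ^ 2 := fun j => by
    have := hpk' j
    rw [div_le_div_iff₀ (by linarith) (by nlinarith)]
    nlinarith
  have hd0 : ∀ j, 0 ≤ d j := fun j => sub_nonneg.2 ((hgp j).trans (hpp j))
  have hdE : ∑ j, d j ≤ ((k:ℝ) + 3) * E := by
    rw [hE, Finset.mul_sum]
    refine Finset.sum_le_sum fun j _ => ?_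
    have := hpk' j
    simp only [hd, gk]
    have h0 : (0:ℝ) < (p j : ℝ) - 1 := by linarith
    have h1 : (0:ℝ) < (p j : ℝ) := by linarith
    rw [mul_one_div, sub_le_iff_le_add, div_add_div _ _ (by positivity) (by positivity), div_le_div_iff₀ (by positivity) (by positivity)]
    have e : (((k:ℝ) + 3) * (p j : ℝ) ^ 2 + ((p j : ℝ) - 1) ^ 2 * ((p j : ℝ) - k - 1)) - (p j : ℝ) * (p j : ℝ) ^ 2 = (2 * k + 1 + 2) * (p j : ℝ) - (k + 1) := by ring
    have : (p j : ℝ) * (p j : ℝ) ^ 2 ≤ ((k:ℝ) + 3) * (p j : ℝ) ^ 2 + ((p j : ℝ) - 1) ^ 2 * ((p j : ℝ) - k - 1) := by nlinarith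
    calc _ = ((p j : ℝ) * (p j : ℝ) ^ 2) * ((p j : ℝ) - 1) ^ 2 := by ring
      _ ≤ _ := mul_le_mul_of_nonneg_right this (by positivity)
  have hkd : (k:ℝ) * ∑ j, d j ≤ 1 / 4 := by
    calc _ ≤ (k:ℝ) * (((k:ℝ) + 3) * E) := mul_le_mul_of_nonneg_left hdE (by positivity)
      _ ≤ ((k:ℝ) + 3) ^ 2 * E := by
        rw [← mul_assoc]; exact mul_le_mul_of_nonneg_right (by nlinarith) hE0
      _ ≤ _ := hη
  have hd1 : ∑ j, d j ≤ 1 / 4 := by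
    have : 0 ≤ ∑ j, d j := Finset.sum_nonneg fun j _ => hd0 j
    nlinarith
  have he2 : Real.exp (1 / 4) ≤ 2 := by
    have h2 : Real.exp (1 / 4) ≤ 1 / (1 - 1 / 4) := Real.exp_bound_div_one_sub_of_interval (by norm_num) (by norm_num)
    norm_num at h2 ⊢; linarith
  set α := ∑ A, G A ^ 2 * ∏ j ∈ A, ((p j : ℝ) / ((p j : ℝ) - 1) ^ 2) with hα
  have hαa : α ≤ Real.exp (∑ j, d j) * a := by
    have := alpha_le (fun A => G A ^ 2) (gk k p) d hg0 hd0 (fun A => sq_nonneg _) (fun A B hAB => pow_le_pow_left₀ (hG0 _) (hGm A B hAB) 2)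
    simpa [hd, hα] using this
  have ha0 : 0 ≤ a := Finset.sum_nonneg fun A _ => mul_nonneg (sq_nonneg _) (Finset.prod_nonneg fun j _ => hg0 j)
  have hα0 : 0 ≤ α := Finset.sum_nonneg fun A _ => by positivity
  have hR' : Real.log z ≤ Real.log R := by
    have : (1:ℝ) ≤ 400 * k * ((J:ℝ) + 1) := by
      have : (0:ℝ) ≤ J := by positivity
      nlinarith
    nlinarith
  have hzR1 : z ≤ R := (Real.log_le_log_iff (by linarith) (by linarith)).1 hR'
  have hZR : z ^ (2 ^ J) ≤ R := by
    rw [← Real.log_le_log_iff (by positivity) (by linarith), log_tower, hkR]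
    refine le_trans ?_ hzR
    have : (0:ℝ) ≤ J := by positivity
    refine mul_le_mul_of_nonneg_right ?_ hlz.le
    nlinarith
  have halow : 1 / 4 * Φ ≤ a := by
    have h1 := a2_ge h hW J hz hzR1
    have h2 : ∑ A, GG p J z A ^ 2 * (∏ j ∈ A, (1 / (p j : ℝ))) ≤ α :=
      Finset.sum_le_sum fun A _ => mul_le_mul_of_nonneg_left (Finset.prod_le_prod (fun j _ => by positivity) fun j _ => hpp j) (sq_nonneg _)
    have h3 : Real.exp (∑ j, d j) ≤ 2 := (Real.exp_le_exp.2 hd1).trans he2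
    have h4 := mul_le_mul_of_nonneg_right h3 ha0
    rw [hΦ]; linarith
  refine ⟨a, halow, ?_, ?_, fun m => ?_⟩
  · have h1 := a2_le h hW J hz hzW
    have h2 : a ≤ ∑ A, GG p J z A ^ 2 * (∏ j ∈ A, (1 / (p j : ℝ))) :=
      Finset.sum_le_sum fun A _ => mul_le_mul_of_nonneg_left (Finset.prod_le_prod (fun j _ => hg0 j) fun j _ => hgp j) (sq_nonneg _)
    rw [hΦ]; linarith
  · refine (model1 p (fun j => by have := hpk j; omega) _).trans ((claim1 p (fun j => (h.pr j).two_le) G R).trans ?_)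
    calc α ^ k ≤ (Real.exp (∑ j, d j) * a) ^ k := pow_le_pow_left₀ hα0 hαa k
      _ = Real.exp (k * ∑ j, d j) * a ^ k := by rw [mul_pow, ← Real.exp_nat_mul]
      _ ≤ 2 * a ^ k := mul_le_mul_of_nonneg_right ((Real.exp_le_exp.2 hkd).trans he2) (by positivity)
  · have hZ0 : 0 < z ^ (2 ^ J) := by positivity
    have hlog : Real.log (R / z ^ (2 ^ J)) = Real.log R - k * Real.log z := by
      rw [Real.log_div (by linarith) (by positivity), log_tower, hkR]
    have hL : ∑ A, (G A ^ 2 * ∏ j ∈ A, gk k p j) * Real.log (nm p A) ≤ (96 * ((J:ℝ) + 1) * Real.log z) * a := by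
      have h1 := a2log_le h hW J hz hzW
      have h2 : ∑ A, (G A ^ 2 * ∏ j ∈ A, gk k p j) * Real.log (nm p A) ≤ ∑ A, GG p J z A ^ 2 * (∏ j ∈ A, (1 / (p j : ℝ))) * Real.log (nm p A) :=
        Finset.sum_le_sum fun A _ => mul_le_mul_of_nonneg_right (mul_le_mul_of_nonneg_left (Finset.prod_le_prod (fun j _ => hg0 j) fun j _ => hgp j) (sq_nonneg _)) (Real.log_natCast_nonneg _)
      refine h2.trans (h1.trans ?_)
      calc _ = (96 * ((J:ℝ) + 1) * Real.log z) * (1 / 4 * Φ) := by rw [hΦ]; ring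
        _ ≤ _ := mul_le_mul_of_nonneg_left halow (by positivity)
    have hJk : 400 * (k:ℝ) * ((J:ℝ) + 1) * Real.log z = 384 * (k:ℝ) * ((J:ℝ) + 1) * Real.log z + 16 * (k:ℝ) * (J * Real.log z) + 16 * (k * Real.log z) := by ring
    have hp1 : 0 ≤ (k:ℝ) * (J * Real.log z) := by positivity
    have hp3 : 0 < (k:ℝ) * Real.log z := by positivity
    have hp4 : 0 ≤ 384 * (k:ℝ) * ((J:ℝ) + 1) * Real.log z := by positivity
    have hc := claim2 m p hpk hη G hG0 hGm R (z ^ (2 ^ J)) hZ0 (by linarith) (fun A hA => gJ_ne (by linarith) hA) (96 * ((J:ℝ) + 1) * Real.log z) (by positivity) hL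
      (by rw [hlog]; linarith) (by rw [hlog]; linarith)
    refine le_trans ?_ (hc.trans (model2 m p (fun j => by have := hpk j; omega) _))
    have hb := beta_ge h hW J hz hZR
    have hb2 := pow_le_pow_left₀ (by positivity) hb 2
    refine mul_le_mul_of_nonneg_right ?_ (by positivity)
    refine le_trans (le_of_eq ?_) (mul_le_mul_of_nonneg_left hb2 (by norm_num : (0:ℝ) ≤ 1 / 4))
    rw [hΦ]; ring

end PG

namespace PG
open Finset

variable {N k : ℕ} {W : ℕ} {R : ℝ} {p : Fin N → ℕ}

open Classical in
/-- the local pattern of `n` -/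
noncomputable def sg (p : Fin N → ℕ) (h : Fin k → ℕ) (n : ℕ) (j : Fin N) : Option (Fin k) :=
  if H : ∃ i, p j ∣ n + h i then some H.choose else none

def InT (p : Fin N → ℕ) (h : Fin k → ℕ) (t : Fin N → Option (Fin k)) (n : ℕ) : Prop :=
  ∀ j i, t j = some i → p j ∣ n + h i

open Classical in
lemma ind_sg {h : Fin k → ℕ} (hu : ∀ j i i' n, p j ∣ n + h i → p j ∣ n + h i' → i = i')
    (t : Fin N → Option (Fin k)) (n : ℕ) : ind t (sg p h n) = if InT p h t n then 1 else 0 := by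
  have key : ∀ j, (t j = none ∨ t j = sg p h n j) ↔ ∀ i, t j = some i → p j ∣ n + h i := by
    intro j
    constructor
    · rintro (h1 | h1) i hi
      · rw [h1] at hi; cases hi
      · rw [h1] at hi
        unfold sg at hi
        split_ifs at hi with H
        cases hi
        exact H.choose_spec
    · intro H
      rcases ht : t j with _ | i
      · left; rfl
      · right
        have h1 := H i ht
        have h2 : ∃ i, p j ∣ n + h i := ⟨i, h1⟩
        unfold sg
        rw [dif_pos h2]
        rw [hu j i _ n h1 h2.choose_spec]
  unfold ind
  split_ifs with H
  · refine Finset.prod_eq_one fun j _ => ?_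
    rw [if_pos ((key j).2 (H j))]
  · unfold InT at H
    push Not at H
    obtain ⟨j, i, h1, h2⟩ := H
    refine Finset.prod_eq_zero (Finset.mem_univ j) ?_
    rw [if_neg]
    intro h3
    exact h2 ((key j).1 h3 i h1)

lemma crt_aux (hP : PS W R p) (h : Fin k → ℕ) (t : Fin N → Option (Fin k)) (ν : ℕ) (A : Finset (Fin N)) :
    (∀ j ∈ A, t j ≠ none) → ∃ a, ∀ n, (n ≡ ν [MOD W] ∧ ∀ j ∈ A, ∀ i, t j = some i → p j ∣ n + h i) ↔ n ≡ a [MOD W * nm p A] := by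
  classical
  induction A using Finset.induction_on with
  | empty => intro _; exact ⟨ν, fun n => by simp [nm]⟩
  | insert j A hj ih =>
    intro hA
    obtain ⟨a, ha⟩ := ih fun j' hj' => hA j' (Finset.mem_insert_of_mem hj')
    obtain ⟨i, hi⟩ := Option.ne_none_iff_exists'.1 (hA j (Finset.mem_insert_self _ _))
    have hpos := (hP.pr j).pos
    have hb : ∀ n, p j ∣ n + h i ↔ n ≡ p j * h i - h i [MOD p j] := by
      intro n
      have e : p j * h i - h i + h i = p j * h i := Nat.sub_add_cancel (Nat.le_mul_of_pos_left _ hpos)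
      constructor
      · intro hd
        refine Nat.ModEq.add_right_cancel' (h i) ?_
        rw [e]
        exact ((Nat.modEq_zero_iff_dvd).2 hd).trans ((Nat.modEq_zero_iff_dvd).2 ⟨_, rfl⟩).symm
      · intro hm
        have := hm.add_right (h i)
        rw [e] at this
        exact (Nat.modEq_zero_iff_dvd).1 (this.trans ((Nat.modEq_zero_iff_dvd).2 ⟨_, rfl⟩))
    have hco : (W * nm p A).Coprime (p j) := by
      refine Nat.Coprime.symm ((Nat.Prime.coprime_iff_not_dvd (hP.pr j)).2 fun hd => ?_)
      rcases (hP.pr j).dvd_mul.1 hd with h1 | h1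
      · exact hP.nd j h1
      · exact hj ((hP.dvd_nm A j).1 h1)
    obtain ⟨c, hc1, hc2⟩ := Nat.chineseRemainder hco a (p j * h i - h i)
    refine ⟨c, fun n => ?_⟩
    have e2 : W * nm p (insert j A) = W * nm p A * p j := by
      unfold nm; rw [Finset.prod_insert hj]; ring
    rw [e2, ← Nat.modEq_and_modEq_iff_modEq_mul hco]
    have e3 : n ≡ c [MOD W * nm p A] ↔ n ≡ a [MOD W * nm p A] := ⟨fun H => H.trans hc1, fun H => H.trans hc1.symm⟩
    have e4 : n ≡ c [MOD p j] ↔ n ≡ p j * h i - h i [MOD p j] := ⟨fun H => H.trans hc2, fun H => H.trans hc2.symm⟩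
    rw [e3, e4, ← ha, ← hb]
    constructor
    · rintro ⟨h1, h2⟩
      exact ⟨⟨h1, fun j' hj' => h2 j' (Finset.mem_insert_of_mem hj')⟩, h2 j (Finset.mem_insert_self _ _) i hi⟩
    · rintro ⟨⟨h1, h2⟩, h3⟩
      refine ⟨h1, fun j' hj' i' hi' => ?_⟩
      rcases Finset.mem_insert.1 hj' with rfl | h4
      · rw [hi] at hi'; cases hi'; exact h3
      · exact h2 j' h4 i' hi'

lemma crt (hP : PS W R p) (h : Fin k → ℕ) (t : Fin N → Option (Fin k)) (ν : ℕ) :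
    ∃ a, ∀ n, (n ≡ ν [MOD W] ∧ InT p h t n) ↔ n ≡ a [MOD W * nm p (supp t)] := by
  obtain ⟨a, ha⟩ := crt_aux hP h t ν (supp t) (fun j hj => by unfold supp at hj; exact (Finset.mem_filter.1 hj).2)
  refine ⟨a, fun n => ?_⟩
  rw [← ha]
  refine and_congr_right fun _ => ⟨fun H j _ => H j, fun H j i hi => H j ?_ i hi⟩
  unfold supp
  simp [hi]

lemma class_sum (g : ℕ → ℝ) (Q : ℕ) [NeZero Q] (a : ℕ) :
    ∑' n, (if n ≡ a [MOD Q] then g n else 0) = ∑' m, g (a % Q + Q * m) := by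
  have hQ : 0 < Q := Nat.pos_of_ne_zero (NeZero.ne Q)
  have hinj : Function.Injective fun m => a % Q + Q * m := by
    intro m m' hm
    have : Q * m = Q * m' := Nat.add_left_cancel hm
    exact Nat.eq_of_mul_eq_mul_left hQ this
  rw [← hinj.tsum_eq (f := fun n => if n ≡ a [MOD Q] then g n else 0)]
  · refine tsum_congr fun m => ?_
    rw [if_pos]
    unfold Nat.ModEq
    simp
  · intro n hn
    have h1 : n ≡ a [MOD Q] := by
      by_contra h2
      simp [h2] at hn
    refine ⟨n / Q, ?_⟩
    have h3 : n % Q = a % Q := h1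
    show a % Q + Q * (n / Q) = n
    rw [← h3]; exact Nat.mod_add_div n Q

/-- sum over t of a function of the support -/
lemma sum_supp (F : Finset (Fin N) → ℝ) :
    ∑ t : Fin N → Option (Fin k), F (supp t) = ∑ A : Finset (Fin N), (k:ℝ) ^ A.card * F A := by
  classical
  have h1 : ∑ t : Fin N → Option (Fin k), F (supp t) = ∑ A : Finset (Fin N), ∑ t : Fin N → Option (Fin k), if supp t = A then F A else 0 := by
    rw [Finset.sum_comm]
    refine Finset.sum_congr rfl fun t _ => ?_
    rw [Finset.sum_ite_eq]; simp
  rw [h1]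
  refine Finset.sum_congr rfl fun A _ => ?_
  rw [← Finset.sum_filter, Finset.sum_const, nsmul_eq_mul]
  congr 1
  have h2 : (univ.filter fun t : Fin N → Option (Fin k) => supp t = A) =
      Fintype.piFinset fun j => if j ∈ A then (univ : Finset (Option (Fin k))).erase none else {none} := by
    ext t
    simp only [mem_filter, mem_univ, true_and, Fintype.mem_piFinset]
    constructor
    · rintro rfl j
      by_cases hj : t j = none <;> simp [supp, hj]
    · intro H
      ext j
      have := H j
      by_cases hj : j ∈ A <;> simp [supp, hj] at this ⊢ <;> exact this
  rw [h2, Fintype.card_piFinset]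
  have h3 : ∀ j, ((if j ∈ A then (univ : Finset (Option (Fin k))).erase none else {none}).card) = if j ∈ A then k else 1 := by
    intro j; split_ifs <;> simp
  rw [Finset.prod_congr rfl fun j _ => h3 j, Finset.prod_ite_mem]
  simp

end PG

namespace PG
open Finset

variable {N k : ℕ} {W : ℕ} {R : ℝ} {p : Fin N → ℕ}

lemma summable_class {g : ℕ → ℝ} (hg : Summable g) (P : ℕ → Prop) [DecidablePred P] :
    Summable fun n => if P n then g n else 0 := by
  refine Summable.of_norm_bounded hg.norm fun n => ?_
  split_ifs
  · exact le_rfl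
  · simp

lemma expand {h : Fin k → ℕ} (hu : ∀ j i i' n, p j ∣ n + h i → p j ∣ n + h i' → i = i')
    (c : (Fin N → Option (Fin k)) → ℝ) (ν : ℕ) (a : (Fin N → Option (Fin k)) → ℕ)
    (ha : ∀ t n, (n ≡ ν [MOD W] ∧ InT p h t n) ↔ n ≡ a t [MOD W * nm p (supp t)])
    {g : ℕ → ℝ} (hg : Summable g) :
    ∑' n, (if n ≡ ν [MOD W] then Xs p c (sg p h n) ^ 2 * g n else 0) =
      ∑ t, mu p c t * ∑' n, (if n ≡ a t [MOD W * nm p (supp t)] then g n else 0) := by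
  classical
  have e : ∀ n, (if n ≡ ν [MOD W] then Xs p c (sg p h n) ^ 2 * g n else 0) =
      ∑ t, mu p c t * (if n ≡ a t [MOD W * nm p (supp t)] then g n else 0) := by
    intro n
    split_ifs with h1
    · rw [Xs_sq, Finset.sum_mul]
      refine Finset.sum_congr rfl fun t _ => ?_
      rw [ind_sg hu, mul_assoc]
      congr 1
      by_cases h2 : InT p h t n
      · rw [if_pos h2, if_pos ((ha t n).1 ⟨h1, h2⟩), one_mul]
      · rw [if_neg h2, if_neg (fun H => h2 ((ha t n).2 H).2), zero_mul]
    · symm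
      refine Finset.sum_eq_zero fun t _ => ?_
      rw [if_neg (fun H => h1 ((ha t n).2 H).1), mul_zero]
  rw [tsum_congr e, Summable.tsum_finsetSum]
  · exact Finset.sum_congr rfl fun t _ => tsum_mul_left
  · exact fun t _ => (summable_class hg _).mul_left _

lemma S1_le (hP : PS W R p) (hW : W ≠ 0) {h : Fin k → ℕ} (hu : ∀ j i i' n, p j ∣ n + h i → p j ∣ n + h i' → i = i')
    (c : (Fin N → Option (Fin k)) → ℝ) (ν : ℕ) {y T : ℝ} (hy : 1 ≤ y) (hT : TV (fun m : ℕ => om y m) ≤ T) :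
    ∑' n, (if n ≡ ν [MOD W] then Xs p c (sg p h n) ^ 2 * om y n else 0) ≤
      (∑' n : ℕ, om y n) / W * (∑ t, mu p c t * (1 / (nm p (supp t) : ℝ))) + (∑ t, |mu p c t|) * T := by
  choose a ha using fun t => crt hP h t ν
  rw [expand hu c ν a ha (summable_om hy), Finset.mul_sum, Finset.sum_mul, ← Finset.sum_add_distrib]
  refine Finset.sum_le_sum fun t _ => ?_
  have hn := hP.nm_pos (supp t)
  have : NeZero (W * nm p (supp t)) := ⟨by positivity⟩
  rw [class_sum]
  have h1 := (ap_real (g := fun m : ℕ => om y m) (summable_om hy).norm (W * nm p (supp t)) (a t % (W * nm p (supp t)))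
    (Nat.mod_lt _ (by positivity))).trans hT
  set U := ∑' m : ℕ, (fun m : ℕ => om y m) (a t % (W * nm p (supp t)) + W * nm p (supp t) * m) with hU
  have h2 : mu p c t * (U - (∑' n : ℕ, om y n) / ((W * nm p (supp t) : ℕ):ℝ)) ≤ |mu p c t| * T := by
    refine (le_abs_self _).trans ?_
    rw [abs_mul]
    exact mul_le_mul_of_nonneg_left h1 (abs_nonneg _)
  have h3 : (∑' n : ℕ, om y n) / ((W * nm p (supp t) : ℕ):ℝ) = (∑' n : ℕ, om y n) / W * (1 / (nm p (supp t) : ℝ)) := by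
    push_cast
    rw [div_mul_div_comm, mul_one]
  rw [h3] at h2
  linarith

lemma totient_nm (hP : PS W R p) (A : Finset (Fin N)) : (((nm p A).totient : ℕ):ℝ) = ∏ j ∈ A, ((p j : ℝ) - 1) := by
  rw [totient_sqf (hP.nm_sqf A), hP.nm_pf, Finset.prod_image fun x _ y _ hxy => hP.inj hxy]
  push_cast
  refine Finset.prod_congr rfl fun j _ => ?_
  rw [Nat.cast_sub (hP.pr j).one_le]; simp

lemma T2_est (hP : PS W R p) (hW : W ≠ 0) {h : Fin k → ℕ} (hu : ∀ j i i' n, p j ∣ n + h i → p j ∣ n + h i' → i = i')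
    {ν : ℕ} (hν : ∀ i, (ν + h i).Coprime W) {t : Fin N → Option (Fin k)} {a : ℕ}
    (ha : ∀ n, (n ≡ ν [MOD W] ∧ InT p h t n) ↔ n ≡ a [MOD W * nm p (supp t)]) {y : ℝ} (hy : 1 ≤ y) {X : ℕ}
    (hQ : W * nm p (supp t) ≤ X) (m : Fin k) (hm : h m ≤ X) :
    |∑' n, (if n ≡ a [MOD W * nm p (supp t)] then lamP X (n + h m) * om y ((n + h m : ℕ):ℝ) else 0) -
      Th y X / W.totient * ∏ j ∈ supp t, w2 m (p j) (t j)| ≤ Es y X (W * nm p (supp t)) / (W * nm p (supp t)).totient := by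
  have hn := hP.nm_pos (supp t)
  set Q := W * nm p (supp t) with hQd
  have hQ1 : 1 ≤ Q := Nat.one_le_iff_ne_zero.2 (by positivity)
  by_cases hc : ∃ j, t j = some m
  · obtain ⟨j, hj⟩ := hc
    have hjs : j ∈ supp t := by simp [supp, hj]
    have e1 : ∏ j ∈ supp t, w2 m (p j) (t j) = 0 := by
      refine Finset.prod_eq_zero hjs ?_
      rw [hj]; simp [w2]
    have e2 : ∀ n, (if n ≡ a [MOD Q] then lamP X (n + h m) * om y ((n + h m : ℕ):ℝ) else 0) = 0 := by
      intro n
      split_ifs with h1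
      · have h2 := ((ha n).2 h1).2 j m hj
        by_cases h3 : lamP X (n + h m) = 0
        · rw [h3, zero_mul]
        · have h4 := lamP_coprime hQ1 hQ h3
          have h5 : p j ∣ Q := Dvd.dvd.mul_left ((hP.dvd_nm _ j).2 hjs) _
          exact absurd (Nat.eq_one_of_dvd_coprimes h4 h2 h5) (hP.pr j).ne_one
      · rfl
    rw [tsum_congr e2, e1, tsum_zero]
    simp only [mul_zero, sub_zero, abs_zero]
    exact div_nonneg (Es_nonneg _ _ _) (Nat.cast_nonneg _)
  · push Not at hc
    have hb : (a + h m).Coprime Q := by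
      have h0 := (ha a).2 rfl
      refine Nat.Coprime.mul_right ?_ ?_
      · have h1 : a + h m ≡ ν + h m [MOD W] := h0.1.add_right _
        unfold Nat.Coprime
        rw [h1.gcd_eq]
        exact hν m
      · refine Nat.Coprime.prod_right fun j hj => ?_
        refine ((Nat.Prime.coprime_iff_not_dvd (hP.pr j)).2 fun hd => ?_).symm
        have hjn : t j ≠ none := by unfold supp at hj; exact (Finset.mem_filter.1 hj).2
        obtain ⟨i, hi⟩ := Option.ne_none_iff_exists'.1 hjn
        have := hu j i m a (h0.2 j i hi) hd
        subst this
        exact hc j hi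
    have h1 := ap_prime hy hQ1 hQ hb
    have e1 : ∑' n, (if n ≡ a [MOD Q] then lamP X (n + h m) * om y ((n + h m : ℕ):ℝ) else 0) =
        ∑' n : ℕ, (if (n : ZMod Q) = ((a + h m : ℕ) : ZMod Q) then lamP X n * om y n else 0) := by
      rw [← (add_left_injective (h m)).tsum_eq (f := fun n : ℕ => if (n : ZMod Q) = ((a + h m : ℕ) : ZMod Q) then lamP X n * om y n else 0)]
      · refine tsum_congr fun n => ?_
        have : n ≡ a [MOD Q] ↔ (((n + h m : ℕ)) : ZMod Q) = ((a + h m : ℕ) : ZMod Q) := by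
          rw [ZMod.natCast_eq_natCast_iff]
          exact ⟨fun H => H.add_right _, fun H => H.add_right_cancel' _⟩
        simp only [this]
      · intro n hn
        by_cases h2 : h m ≤ n
        · exact ⟨n - h m, Nat.sub_add_cancel h2⟩
        · exfalso
          apply hn
          have : lamP X n = 0 := by
            unfold lamP
            rw [if_neg]
            rintro ⟨_, h3⟩
            have : X < n := by exact_mod_cast h3
            omega
          simp [this]
    have e2 : Th y X / Q.totient = Th y X / W.totient * ∏ j ∈ supp t, w2 m (p j) (t j) := by
      rw [hQd, Nat.totient_mul (hP.nm_coprime _).symm]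
      push_cast
      rw [totient_nm hP, ← div_div, div_eq_mul_inv (_ / _), ← Finset.prod_inv_distrib]
      congr 1
      refine Finset.prod_congr rfl fun j hj => ?_
      have hjn : t j ≠ none := by unfold supp at hj; exact (Finset.mem_filter.1 hj).2
      simp [w2, hjn, hc j]
    rw [e1, ← e2]
    exact h1

lemma S2_ge (hP : PS W R p) (hW : W ≠ 0) {h : Fin k → ℕ} (hu : ∀ j i i' n, p j ∣ n + h i → p j ∣ n + h i' → i = i')
    {ν : ℕ} (hν : ∀ i, (ν + h i).Coprime W) (c : (Fin N → Option (Fin k)) → ℝ)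
    (hc : ∀ t, mu p c t ≠ 0 → (nm p (supp t) : ℝ) ≤ R ^ 2)
    {y : ℝ} (hy : 1 ≤ y) {X : ℕ} (hX : W * R ^ 2 ≤ X) (m : Fin k) (hm : h m ≤ X) :
    Th y X / W.totient * (∑ t, mu p c t * ∏ j ∈ supp t, w2 m (p j) (t j)) -
      ∑ t, |mu p c t| * (Es y X (W * nm p (supp t)) / (W * nm p (supp t)).totient) ≤
    ∑' n, (if n ≡ ν [MOD W] then Xs p c (sg p h n) ^ 2 * (lamP X (n + h m) * om y ((n + h m : ℕ):ℝ)) else 0) := by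
  choose a ha using fun t => crt hP h t ν
  have hs : Summable fun n : ℕ => lamP X (n + h m) * om y ((n + h m : ℕ):ℝ) :=
    (summable_lamP_om hy X).comp_injective (add_left_injective (h m))
  rw [expand hu c ν a ha hs, Finset.mul_sum, ← Finset.sum_sub_distrib]
  refine Finset.sum_le_sum fun t _ => ?_
  by_cases h0 : mu p c t = 0
  · simp [h0]
  have hQ : W * nm p (supp t) ≤ X := by
    have h1 := hc t h0
    have : ((W * nm p (supp t) : ℕ):ℝ) ≤ X := by
      push_cast
      exact (mul_le_mul_of_nonneg_left h1 (Nat.cast_nonneg _)).trans hX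
    exact_mod_cast this
  have h1 := T2_est hP hW hu hν (ha t) hy hQ m hm
  set U := ∑' n, (if n ≡ a t [MOD W * nm p (supp t)] then lamP X (n + h m) * om y ((n + h m : ℕ):ℝ) else 0) with hU
  set V := Th y X / W.totient
  set P := ∏ j ∈ supp t, w2 m (p j) (t j)
  have h2 : |mu p c t| * |U - V * P| ≤ |mu p c t| * (Es y X (W * nm p (supp t)) / (W * nm p (supp t)).totient) :=
    mul_le_mul_of_nonneg_left h1 (abs_nonneg _)
  have h3 := neg_abs_le (mu p c t * (U - V * P))
  rw [abs_mul] at h3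
  nlinarith [h2, h3]

/-- general majorant for sums over t -/
lemma sum_t_le (hP : PS W R p) (c : (Fin N → Option (Fin k)) → ℝ) {B : ℝ} (hB : 0 ≤ B)
    (hc : ∀ t, mu p c t ≠ 0 → (nm p (supp t) : ℝ) ≤ R ^ 2) (hmu : ∀ t, |mu p c t| ≤ B * 8 ^ (supp t).card)
    (G : ℕ → ℝ) (hG : ∀ q, 0 ≤ G q) :
    ∑ t, |mu p c t| * G (nm p (supp t)) ≤
      B * ∑ q ∈ ((Finset.Icc 1 ⌊R ^ 2⌋₊).filter Squarefree).filter (fun q => q.Coprime W), ((8 * k : ℕ) : ℝ) ^ q.primeFactors.card * G q := by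
  classical
  set F : Finset (Fin N) → ℝ := fun A => if nm p A ≤ ⌊R ^ 2⌋₊ then B * 8 ^ A.card * G (nm p A) else 0 with hF
  have h1 : ∑ t, |mu p c t| * G (nm p (supp t)) ≤ ∑ t : Fin N → Option (Fin k), F (supp t) := by
    refine Finset.sum_le_sum fun t _ => ?_
    by_cases h0 : mu p c t = 0
    · rw [h0, abs_zero, zero_mul, hF]
      dsimp only
      split_ifs
      · exact mul_nonneg (by positivity) (hG _)
      · exact le_rfl
    · rw [hF]
      dsimp only
      rw [if_pos (Nat.le_floor (hc t h0))]
      exact mul_le_mul_of_nonneg_right (hmu t) (hG _)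
  refine h1.trans ?_
  rw [sum_supp, Finset.mul_sum]
  have h2 : ∀ A : Finset (Fin N), (k:ℝ) ^ A.card * F A = if nm p A ≤ ⌊R ^ 2⌋₊ then
      (fun q : ℕ => B * (((8 * k : ℕ) : ℝ) ^ q.primeFactors.card * G q)) (nm p A) else 0 := by
    intro A
    rw [hF]
    dsimp only
    split_ifs
    · rw [hP.nm_card]; push_cast; rw [mul_pow]; ring
    · simp
  rw [Finset.sum_congr rfl fun A _ => h2 A, ← Finset.sum_filter,
    ← Finset.sum_image (f := fun q : ℕ => B * (((8 * k : ℕ) : ℝ) ^ q.primeFactors.card * G q)) (g := nm p) (fun x _ y _ hxy => hP.nm_inj hxy)]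
  refine Finset.sum_le_sum_of_subset_of_nonneg ?_ ?_
  · intro q hq
    obtain ⟨A, hA, rfl⟩ := Finset.mem_image.1 hq
    simp only [mem_filter, mem_Icc]
    exact ⟨⟨⟨hP.nm_pos A, (Finset.mem_filter.1 hA).2⟩, hP.nm_sqf A⟩, hP.nm_coprime A⟩
  · intro q _ _
    exact mul_nonneg hB (mul_nonneg (by positivity) (hG _))

lemma M1_le (hP : PS W R p) (hR : 1 < R) (c : (Fin N → Option (Fin k)) → ℝ) {B : ℝ} (hB : 0 ≤ B)
    (hc : ∀ t, mu p c t ≠ 0 → (nm p (supp t) : ℝ) ≤ R ^ 2) (hmu : ∀ t, |mu p c t| ≤ B * 8 ^ (supp t).card) :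
    ∑ t, |mu p c t| ≤ B * (R ^ 2 * (1 + 2 * Real.log R) ^ (8 * k)) := by
  have h1 := sum_t_le hP c hB hc hmu (fun _ => 1) (fun _ => zero_le_one)
  simp only [mul_one] at h1
  refine h1.trans (mul_le_mul_of_nonneg_left ?_ hB)
  have hR2 : 1 ≤ R ^ 2 := by nlinarith
  have hf1 : 1 ≤ ⌊R ^ 2⌋₊ := Nat.le_floor (by simpa using hR2)
  have hf2 : (⌊R ^ 2⌋₊ : ℝ) ≤ R ^ 2 := Nat.floor_le (by positivity)
  have hl : Real.log (⌊R ^ 2⌋₊ : ℝ) ≤ 2 * Real.log R := by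
    have := Real.log_le_log (by exact_mod_cast hf1) hf2
    rwa [Real.log_pow, Nat.cast_ofNat] at this
  calc ∑ q ∈ ((Finset.Icc 1 ⌊R ^ 2⌋₊).filter Squarefree).filter (fun q => q.Coprime W), ((8 * k : ℕ) : ℝ) ^ q.primeFactors.card
      ≤ ∑ q ∈ (Finset.Icc 1 ⌊R ^ 2⌋₊).filter Squarefree, ((8 * k : ℕ) : ℝ) ^ q.primeFactors.card :=
        Finset.sum_le_sum_of_subset_of_nonneg (Finset.filter_subset _ _) fun _ _ _ => by positivity
    _ ≤ ∑ q ∈ (Finset.Icc 1 ⌊R ^ 2⌋₊).filter Squarefree, R ^ 2 * (((8 * k : ℕ) : ℝ) ^ q.primeFactors.card / q) := by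
        refine Finset.sum_le_sum fun q hq => ?_
        simp only [mem_filter, mem_Icc] at hq
        have hq0 : (0:ℝ) < q := by exact_mod_cast hq.1.1
        have hq1 : (q:ℝ) ≤ R ^ 2 := le_trans (by exact_mod_cast hq.1.2) hf2
        rw [mul_div_assoc', le_div_iff₀ hq0, mul_comm]
        exact mul_le_mul_of_nonneg_right hq1 (by positivity)
    _ ≤ R ^ 2 * (1 + Real.log (⌊R ^ 2⌋₊ : ℝ)) ^ (8 * k) := by
        rw [← Finset.mul_sum]
        exact mul_le_mul_of_nonneg_left (sum_tau_div _ _) (by positivity)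
    _ ≤ _ := by
        have : 0 ≤ Real.log (⌊R ^ 2⌋₊ : ℝ) := Real.log_natCast_nonneg _
        gcongr

lemma err2_le (hP : PS W R p) (hW : Squarefree W) (c : (Fin N → Option (Fin k)) → ℝ) {B : ℝ} (hB : 0 ≤ B) (hk : 1 ≤ k)
    (hc : ∀ t, mu p c t ≠ 0 → (nm p (supp t) : ℝ) ≤ R ^ 2) (hmu : ∀ t, |mu p c t| ≤ B * 8 ^ (supp t).card)
    (y : ℝ) {X : ℕ} (hX : W * R ^ 2 ≤ X) :
    ∑ t, |mu p c t| * (Es y X (W * nm p (supp t)) / (W * nm p (supp t)).totient) ≤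
      B * ∑ q ∈ (Finset.Icc 1 X).filter Squarefree, aw (8 * k) q * Es y X q := by
  classical
  have hW0 : W ≠ 0 := hW.ne_zero
  have h1 := sum_t_le hP c hB hc hmu (fun q => Es y X (W * q) / (W * q).totient)
    (fun q => div_nonneg (Es_nonneg _ _ _) (Nat.cast_nonneg _))
  refine h1.trans (mul_le_mul_of_nonneg_left ?_ hB)
  set S := ((Finset.Icc 1 ⌊R ^ 2⌋₊).filter Squarefree).filter (fun q => q.Coprime W)
  calc ∑ q ∈ S, ((8 * k : ℕ) : ℝ) ^ q.primeFactors.card * (Es y X (W * q) / (W * q).totient)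
      ≤ ∑ q ∈ S, (fun q => aw (8 * k) q * Es y X q) (W * q) := by
        refine Finset.sum_le_sum fun q hq => ?_
        simp only [S, mem_filter, mem_Icc] at hq
        dsimp only [aw]
        rw [mul_div_assoc', div_mul_eq_mul_div]
        have hq0 : q ≠ 0 := by omega
        have hsub : q.primeFactors.card ≤ (W * q).primeFactors.card :=
          Finset.card_le_card (Nat.primeFactors_mono (Dvd.intro_left _ rfl) (by positivity))
        have h8 : (1:ℝ) ≤ ((8 * k : ℕ):ℝ) := by exact_mod_cast (by omega : 1 ≤ 8 * k)
        have hE := Es_nonneg y X (W * q)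
        gcongr
    _ = ∑ q ∈ S.image (fun q => W * q), aw (8 * k) q * Es y X q := by
        rw [Finset.sum_image]
        intro x _ x' _ hxx
        exact Nat.eq_of_mul_eq_mul_left (Nat.pos_of_ne_zero hW0) hxx
    _ ≤ _ := by
        refine Finset.sum_le_sum_of_subset_of_nonneg ?_ fun q _ _ => mul_nonneg (aw_nonneg _ _) (Es_nonneg _ _ _)
        intro q' hq'
        obtain ⟨q, hq, rfl⟩ := Finset.mem_image.1 hq'
        simp only [S, mem_filter, mem_Icc] at hq ⊢
        refine ⟨⟨Nat.one_le_iff_ne_zero.2 (mul_ne_zero hW0 (by omega)), ?_⟩, (Nat.squarefree_mul_iff.2 ⟨hq.2.symm, hW, hq.1.2⟩)⟩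
        have : ((W * q : ℕ):ℝ) ≤ X := by
          push_cast
          refine le_trans (mul_le_mul_of_nonneg_left ?_ (Nat.cast_nonneg _)) hX
          exact le_trans (by exact_mod_cast hq.1.1.2) (Nat.floor_le (by positivity))
        exact_mod_cast this

end PG

namespace PG
open Finset

variable {N k : ℕ} {W : ℕ} {R : ℝ} {p : Fin N → ℕ}

lemma Xs_sq_le (c : (Fin N → Option (Fin k)) → ℝ) (σ : Fin N → Option (Fin k)) :
    Xs p c σ ^ 2 ≤ ∑ t, |mu p c t| := by
  rw [Xs_sq]
  refine Finset.sum_le_sum fun t _ => ?_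
  have h0 : 0 ≤ ind t σ := Finset.prod_nonneg fun j _ => by split_ifs <;> norm_num
  have h1 : ind t σ ≤ 1 := Finset.prod_le_one (fun j _ => by split_ifs <;> norm_num) fun j _ => by split_ifs <;> norm_num
  calc mu p c t * ind t σ ≤ |mu p c t| * ind t σ := mul_le_mul_of_nonneg_right (le_abs_self _) h0
    _ ≤ |mu p c t| * 1 := mul_le_mul_of_nonneg_left h1 (abs_nonneg _)
    _ = _ := mul_one _

noncomputable def KE (y : ℝ) (H : ℕ) : ℝ := 8 * y * H * Real.exp (-(y / 4)) + Real.exp 8 * Real.exp (-y)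

lemma pt_one {y : ℝ} (hy : 1 ≤ y) {X H n d : ℕ} (hd : d ≤ H) (hHX : H ≤ X) (hl : lamP X (n + d) ≠ 0) :
    lamP X (n + d) * om y ((n + d : ℕ):ℝ) ≤ 2 * y * om y n + KE y H * (n:ℝ) ^ (-(3 / 2) : ℝ) := by
  have hn1 : 1 ≤ n := by
    unfold lamP at hl
    split_ifs at hl with h1
    · have : X < n + d := by exact_mod_cast h1.2
      omega
    · exact absurd rfl hl
  have hn : (1:ℝ) ≤ n := by exact_mod_cast hn1
  have hn0 : (0:ℝ) < n := by linarith
  have hNn : (n:ℝ) ≤ ((n + d : ℕ):ℝ) := by exact_mod_cast Nat.le_add_right n d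
  set v : ℝ := ((n + d : ℕ):ℝ) with hv
  have hv1 : 1 ≤ v := by linarith
  have hv0 : 0 < v := by linarith
  have hom := om_nonneg (y := y) (v := v) hv0.le
  have homn := om_nonneg (y := y) (v := n) hn0.le
  have hle : lamP X (n + d) ≤ Real.log v := lamP_le_log _ _
  have hlog0 : 0 ≤ Real.log v := Real.log_nonneg hv1
  have hp0 : 0 ≤ (n:ℝ) ^ (-(3 / 2) : ℝ) := by positivity
  refine (mul_le_mul_of_nonneg_right hle hom).trans ?_
  unfold KE
  by_cases hc : Real.log v ≤ 2 * y
  · have h1 := om_sub_le (y := y) (v := n) (h := d) hy hn (Nat.cast_nonneg _)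
    have h2 : om y v ≤ om y n + 4 * ((n:ℝ) ^ (-(7 / 4) : ℝ) * Real.exp (-(y / 4))) * d := by
      have e : v = (n:ℝ) + d := by rw [hv]; push_cast; rfl
      rw [e]
      linarith [le_abs_self (om y ((n:ℝ) + d) - om y n)]
    have h3 : (n:ℝ) ^ (-(7 / 4) : ℝ) ≤ (n:ℝ) ^ (-(3 / 2) : ℝ) := Real.rpow_le_rpow_of_exponent_le hn (by norm_num)
    have h4 : 4 * ((n:ℝ) ^ (-(7 / 4) : ℝ) * Real.exp (-(y / 4))) * d ≤ 4 * ((n:ℝ) ^ (-(3 / 2) : ℝ) * Real.exp (-(y / 4))) * H := by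
      have : (d:ℝ) ≤ H := by exact_mod_cast hd
      gcongr
    have h5 : Real.log v * om y v ≤ 2 * y * (om y n + 4 * ((n:ℝ) ^ (-(3 / 2) : ℝ) * Real.exp (-(y / 4))) * H) :=
      mul_le_mul hc (by linarith) hom (by linarith)
    have h6 : 0 ≤ Real.exp 8 * Real.exp (-y) * (n:ℝ) ^ (-(3 / 2) : ℝ) := by positivity
    nlinarith [h5, h6]
  · push Not at hc
    have h1 := om_le_gen hy hv1 (-4)
    have h2 : Real.log v ≤ v := (Real.log_le_sub_one_of_pos hv0).trans (by linarith)
    have e1 : Real.exp (-(-4 * y)) * Real.exp y ≤ v ^ ((5:ℝ) / 2) := by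
      rw [← Real.exp_add, Real.rpow_def_of_pos hv0]
      exact Real.exp_le_exp.2 (by nlinarith)
    have e2 : v ^ ((-4:ℝ) - 1) * v * v ^ ((5:ℝ) / 2) = v ^ (-(3 / 2) : ℝ) := by
      conv_lhs => rw [← Real.rpow_add_one hv0.ne', ← Real.rpow_add hv0]
      norm_num
    have e3 : v ^ (-(3 / 2) : ℝ) ≤ (n:ℝ) ^ (-(3 / 2) : ℝ) := Real.rpow_le_rpow_of_nonpos hn0 hNn (by norm_num)
    have h3 : Real.log v * om y v ≤ v * (Real.exp 8 * (v ^ ((-4:ℝ) - 1) * Real.exp (-(-4 * y)))) := by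
      refine mul_le_mul h2 (h1.trans (le_of_eq ?_)) hom hv0.le
      norm_num
    have h4 : Real.exp (-(-4 * y)) ≤ Real.exp (-y) * v ^ ((5:ℝ) / 2) := by
      rw [Real.exp_neg y, inv_mul_eq_div, le_div_iff₀ (Real.exp_pos _)]
      exact e1
    have h5 : v * (Real.exp 8 * (v ^ ((-4:ℝ) - 1) * Real.exp (-(-4 * y)))) ≤ Real.exp 8 * Real.exp (-y) * (n:ℝ) ^ (-(3 / 2) : ℝ) := by
      calc _ ≤ v * (Real.exp 8 * (v ^ ((-4:ℝ) - 1) * (Real.exp (-y) * v ^ ((5:ℝ) / 2)))) := by gcongr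
        _ = Real.exp 8 * Real.exp (-y) * (v ^ ((-4:ℝ) - 1) * v * v ^ ((5:ℝ) / 2)) := by ring
        _ ≤ _ := by rw [e2]; gcongr
    have h6 : 0 ≤ 2 * y * om y n := by positivity
    have h7 : 0 ≤ 8 * y * H * Real.exp (-(y / 4)) * (n:ℝ) ^ (-(3 / 2) : ℝ) := by positivity
    have h8 := h3.trans h5
    rw [add_mul]
    exact h8.trans ((le_add_of_nonneg_left h7).trans (le_add_of_nonneg_left h6))

lemma KE_nonneg {y : ℝ} (hy : 1 ≤ y) (H : ℕ) : 0 ≤ KE y H := by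
  unfold KE; positivity

lemma pt_sum {y : ℝ} (hy : 1 ≤ y) {X H n : ℕ} {h : Fin k → ℕ} (hd : ∀ i, h i ≤ H) (hHX : H ≤ X)
    (hf : ∀ i i', lamP X (n + h i) ≠ 0 → lamP X (n + h i') ≠ 0 → i = i') :
    ∑ m, lamP X (n + h m) * om y ((n + h m : ℕ):ℝ) ≤ 2 * y * om y n + KE y H * (n:ℝ) ^ (-(3 / 2) : ℝ) := by
  by_cases hc : ∃ m, lamP X (n + h m) ≠ 0
  · obtain ⟨m, hm⟩ := hc
    rw [Finset.sum_eq_single m]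
    · exact pt_one hy (hd m) hHX hm
    · intro i _ hi
      by_cases h0 : lamP X (n + h i) = 0
      · rw [h0, zero_mul]
      · exact absurd (hf _ _ h0 hm) hi
    · intro h1; exact absurd (Finset.mem_univ m) h1
  · push Not at hc
    rw [Finset.sum_eq_zero fun m _ => by rw [hc m, zero_mul]]
    have := KE_nonneg hy H
    have := om_nonneg (y := y) (v := (n:ℝ)) (Nat.cast_nonneg _)
    positivity

lemma S2_sum_le {y : ℝ} (hy : 1 ≤ y) {X H : ℕ} {h : Fin k → ℕ} (hd : ∀ i, h i ≤ H) (hHX : H ≤ X) (ν : ℕ)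
    (hf : ∀ n, n ≡ ν [MOD W] → ∀ i i', lamP X (n + h i) ≠ 0 → lamP X (n + h i') ≠ 0 → i = i')
    (c : (Fin N → Option (Fin k)) → ℝ) :
    ∑ m, ∑' n, (if n ≡ ν [MOD W] then Xs p c (sg p h n) ^ 2 * (lamP X (n + h m) * om y ((n + h m : ℕ):ℝ)) else 0) ≤
      2 * y * (∑' n : ℕ, (if n ≡ ν [MOD W] then Xs p c (sg p h n) ^ 2 * om y n else 0)) +
      (∑ t, |mu p c t|) * (KE y H * ∑' n : ℕ, (n:ℝ) ^ (-(3 / 2) : ℝ)) := by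
  set M := ∑ t, |mu p c t| with hM
  have hM0 : 0 ≤ M := Finset.sum_nonneg fun _ _ => abs_nonneg _
  have hbd : ∀ (g : ℕ → ℝ), (∀ n, 0 ≤ g n) → Summable g →
      Summable fun n => (if n ≡ ν [MOD W] then Xs p c (sg p h n) ^ 2 * g n else 0) := by
    intro g hg0 hg
    refine Summable.of_nonneg_of_le (fun n => ?_) (fun n => ?_) (hg.mul_left M)
    · split_ifs
      · exact mul_nonneg (sq_nonneg _) (hg0 n)
      · exact le_rfl
    · split_ifs
      · exact mul_le_mul_of_nonneg_right (Xs_sq_le c _) (hg0 n)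
      · exact mul_nonneg hM0 (hg0 n)
  have hs2 : ∀ m, Summable fun n => (if n ≡ ν [MOD W] then Xs p c (sg p h n) ^ 2 * (lamP X (n + h m) * om y ((n + h m : ℕ):ℝ)) else 0) := by
    intro m
    refine hbd (fun n => lamP X (n + h m) * om y ((n + h m : ℕ):ℝ)) (fun n => mul_nonneg (lamP_nonneg _ _) (om_nonneg (Nat.cast_nonneg _))) ?_
    exact (summable_lamP_om hy X).comp_injective (add_left_injective (h m))
  have hs1 := hbd (fun n : ℕ => om y n) (fun n => om_nonneg (Nat.cast_nonneg _)) (summable_om hy)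
  have hs3 := summable_rpow_neg (a := -(3 / 2)) (by norm_num)
  rw [← Summable.tsum_finsetSum fun m _ => hs2 m, ← tsum_mul_left, ← tsum_mul_left, ← tsum_mul_left,
    ← Summable.tsum_add (hs1.mul_left _) ((hs3.mul_left _).mul_left _)]
  refine Summable.tsum_le_tsum (fun n => ?_) (summable_sum fun m _ => hs2 m) ((hs1.mul_left _).add ((hs3.mul_left _).mul_left _))
  have hK := KE_nonneg hy H
  have hn0 : 0 ≤ (n:ℝ) ^ (-(3 / 2) : ℝ) := by positivity
  split_ifs with h1
  · rw [← Finset.mul_sum]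
    have h2 := pt_sum hy hd hHX (hf n h1)
    have h3 := Xs_sq_le (p := p) c (sg p h n)
    have h4 := sq_nonneg (Xs p c (sg p h n))
    calc _ ≤ Xs p c (sg p h n) ^ 2 * (2 * y * om y n + KE y H * (n:ℝ) ^ (-(3 / 2) : ℝ)) := mul_le_mul_of_nonneg_left h2 h4
      _ = 2 * y * (Xs p c (sg p h n) ^ 2 * om y n) + Xs p c (sg p h n) ^ 2 * (KE y H * (n:ℝ) ^ (-(3 / 2) : ℝ)) := by ring
      _ ≤ _ := by gcongr
  · simp only [Finset.sum_const_zero, mul_zero, zero_add]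
    positivity

end PG

namespace PG
open Finset

lemma num_core {k : ℕ} (hk : 1 ≤ k) {y W φ L Φ a c0 T I J1 s1 s2 e2 m1 m2 : ℝ} (hW : 0 < W) (hφ : 0 < φ) (hy : 0 < y)
    (hL : L * (120000 * k * J1) = y) (hJ : 0 < J1) (hΦ : Φ = φ / W * L) (hΦ4 : 4 ≤ Φ) (hc0 : 1920000 * 1921 ≤ c0 * J1) (hc : 0 < c0)
    (hT : c0 ≤ T) (hI0 : 0 ≤ I) (hI : I ≤ 10) (hs1 : s1 ≤ 2 * a ^ k) (ha : 1 ≤ a) (haΦ : a ≤ 48 * Φ)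
    (hs2 : 1 / 16 * J1 ^ 2 * Φ ^ 2 * a ^ (k - 1) ≤ s2)
    (main : k * (T / φ * s2 - e2) ≤ 2 * y * (I / W * s1 + m1) + m2) : 4 * y / W ≤ k * e2 + 2 * y * m1 + m2 := by
  have hk0 : (0:ℝ) < k := by exact_mod_cast hk
  set P := a ^ (k - 1) with hP
  have hP1 : 1 ≤ P := one_le_pow₀ ha
  have hak : a ^ k ≤ 48 * Φ * P := by
    have : a ^ k = a * P := by rw [hP, ← pow_succ']; congr 1; omega
    rw [this]
    exact mul_le_mul_of_nonneg_right haΦ (by linarith)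
  have h1 : I / W * s1 ≤ 10 / W * (96 * (Φ * P)) := by
    have hh : (0:ℝ) ≤ a ^ k := by positivity
    calc I / W * s1 ≤ I / W * (2 * a ^ k) := by gcongr
      _ ≤ 10 / W * (2 * a ^ k) := by gcongr
      _ ≤ _ := by
        have : 2 * a ^ k ≤ 96 * (Φ * P) := by linarith
        gcongr
  have h2 : c0 / φ * (1 / 16 * J1 ^ 2 * Φ ^ 2 * P) ≤ T / φ * s2 := by
    have : 0 ≤ 1 / 16 * J1 ^ 2 * Φ ^ 2 * P := by positivity
    calc c0 / φ * (1 / 16 * J1 ^ 2 * Φ ^ 2 * P) ≤ T / φ * (1 / 16 * J1 ^ 2 * Φ ^ 2 * P) := by gcongr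
      _ ≤ _ := by
        have : 0 ≤ T / φ := div_nonneg (by linarith) hφ.le
        gcongr
  have h3 : k * (c0 / φ * (1 / 16 * J1 ^ 2 * Φ ^ 2 * P)) = (c0 * J1) / 1920000 * (y / W * (Φ * P)) := by
    rw [← hL]
    have e : Φ ^ 2 = Φ * (φ / W * L) := by rw [sq]; nth_rewrite 2 [hΦ]; rfl
    rw [e]
    field_simp
    ring
  have h4 : 1921 * (y / W * (Φ * P)) ≤ (c0 * J1) / 1920000 * (y / W * (Φ * P)) := by
    refine mul_le_mul_of_nonneg_right (by linarith) ?_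
    have : 0 ≤ Φ * P := mul_nonneg (by linarith) (by linarith)
    positivity
  have h5 : 4 * y / W ≤ y / W * (Φ * P) := by
    have : 4 ≤ Φ * P := by nlinarith
    calc 4 * y / W = y / W * 4 := by ring
      _ ≤ _ := by gcongr
  have h6 : (k:ℝ) * (c0 / φ * (1 / 16 * J1 ^ 2 * Φ ^ 2 * P)) ≤ k * (T / φ * s2) := by gcongr
  have h7 : 2 * y * (I / W * s1) ≤ 1920 * (y / W * (Φ * P)) := by
    calc 2 * y * (I / W * s1) ≤ 2 * y * (10 / W * (96 * (Φ * P))) := by gcongr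
      _ = _ := by ring
  have h8 : k * (T / φ * s2) - k * e2 ≤ 2 * y * (I / W * s1) + 2 * y * m1 + m2 := by linarith [main]
  linarith

/-- everything at a fixed scale `y` -/
lemma fixed_y {k J : ℕ} (hk : k = 2 ^ J) {W : ℕ} (hWs : Squarefree W) {h : Fin k → ℕ} {H ν : ℕ} (hH : ∀ i, h i ≤ H)
    (hinj : Function.Injective h) (hWp : ∀ q : ℕ, q.Prime → q ≤ 5 + 4 * (k + 3) ^ 2 + H → q ∣ W)
    (hν : ∀ i, (ν + h i).Coprime W) {c0 y C : ℝ} (hc0 : 0 < c0) (hJ : 1920000 * 1921 ≤ c0 * ((J:ℝ) + 1)) (hy : 2 ≤ y)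
    (hC : 0 ≤ C) (hTV : TV (fun m : ℕ => om y m) ≤ C * Real.exp (-(y / 4)))
    (hTh : c0 ≤ Th y (Xy y)) (hWX : W * Real.exp (y / 300) ^ 2 ≤ Xy y) (hHX : H ≤ Xy y)
    (hf : ∀ n, n ≡ ν [MOD W] → ∀ i i', lamP (Xy y) (n + h i) ≠ 0 → lamP (Xy y) (n + h i') ≠ 0 → i = i')
    (hz3 : 3 ≤ Real.exp (y / (120000 * k * ((J:ℝ) + 1)))) (hzW : (W:ℝ) ≤ Real.exp (y / (120000 * k * ((J:ℝ) + 1))))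
    (hΦ4 : 4 ≤ (W.totient : ℝ) / W * (y / (120000 * k * ((J:ℝ) + 1))))
    (hbv : ∑ q ∈ (Finset.Icc 1 (Xy y)).filter Squarefree, aw (8 * k) q * Es y (Xy y) q ≤ 1 / y ^ (12 * k + 1)) :
    4 * y / W ≤ k * (4 ^ k / y) + (4 ^ k * y ^ (20 * k) * Real.exp (y / 150)) *
      (2 * y * (C * Real.exp (-(y / 4))) + KE y H * ∑' n : ℕ, (n:ℝ) ^ (-(3 / 2) : ℝ)) := by
  have hk1 : 1 ≤ k := by rw [hk]; exact Nat.one_le_two_pow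
  have hk0 : (0:ℝ) < k := by exact_mod_cast hk1
  have hy1 : 1 ≤ y := by linarith
  set R := Real.exp (y / 300) with hRd
  set z := Real.exp (y / (120000 * k * ((J:ℝ) + 1))) with hzd
  have hR1 : 1 < R := by rw [hRd]; exact Real.one_lt_exp_iff.2 (by linarith)
  have hlR : Real.log R = y / 300 := Real.log_exp _
  have hlz : Real.log z = y / (120000 * k * ((J:ℝ) + 1)) := Real.log_exp _
  have hW0 : W ≠ 0 := hWs.ne_zero
  have hWpos : (0:ℝ) < W := by exact_mod_cast Nat.pos_of_ne_zero hW0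
  have hφpos : (0:ℝ) < W.totient := by exact_mod_cast Nat.totient_pos.2 (Nat.pos_of_ne_zero hW0)
  obtain ⟨N, p, hP⟩ := exists_PS W R (by linarith)
  have hpw : ∀ j, 5 + 4 * (k + 3) ^ 2 + H < p j := by
    intro j
    by_contra hcon
    push Not at hcon
    exact hP.nd j (hWp _ (hP.pr j) hcon)
  have hu : ∀ j i i' n, p j ∣ n + h i → p j ∣ n + h i' → i = i' := by
    intro j i i' n h1 h2
    apply hinj
    have h3 := hpw j
    have h4 := hH i
    have h5 := hH i'
    have h6 : h i ≡ h i' [MOD p j] := by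
      refine Nat.ModEq.add_left_cancel' n ?_
      exact ((Nat.modEq_zero_iff_dvd).2 h1).trans ((Nat.modEq_zero_iff_dvd).2 h2).symm
    exact Nat.ModEq.eq_of_lt_of_lt h6 (by omega) (by omega)
  obtain ⟨a, ha1, ha2, hs1, hs2⟩ := sieve_model hP hWs k J hk hz3 hzW (by rw [hlz, hlR]; apply le_of_eq; field_simp; ring) hR1
    (by omega : 5 + 4 * (k + 3) ^ 2 ≤ 5 + 4 * (k + 3) ^ 2 + H) hpw
  set c := cs k p J z R with hcd
  set B : ℝ := 4 ^ k * (1 + Real.log R) ^ (12 * k) with hB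
  have hlR0 : 0 ≤ Real.log R := by rw [hlR]; positivity
  have hB0 : 0 ≤ B := by positivity
  have hmu := mu_cs_le hP k J z hR1
  have hsupp := mu_cs_supp hP k J z hR1
  set M := ∑ t, |mu p c t| with hM
  have hM0 : 0 ≤ M := Finset.sum_nonneg fun _ _ => abs_nonneg _
  have hS1 := S1_le hP hW0 hu c ν hy1 hTV
  have hS2 := fun m => S2_ge hP hW0 hu hν c hsupp hy1 hWX m ((hH m).trans hHX)
  have hS3 := S2_sum_le (p := p) hy1 hH hHX ν hf c
  have hE := err2_le hP hWs c hB0 hk1 hsupp hmu y hWX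
  have hM1 := M1_le hP hR1 c hB0 hsupp hmu
  set e2 := ∑ t, |mu p c t| * (Es y (Xy y) (W * nm p (supp t)) / (W * nm p (supp t)).totient) with he2
  set s1 := ∑ t, mu p c t * (1 / (nm p (supp t) : ℝ)) with hs1d
  set Φ := (W.totient : ℝ) / W * Real.log z with hΦ
  set s2 := 1 / 16 * ((J:ℝ) + 1) ^ 2 * Φ ^ 2 * a ^ (k - 1) with hs2d
  have hTφ : 0 ≤ Th y (Xy y) / W.totient := div_nonneg (by linarith) hφpos.le
  have hsum : k * (Th y (Xy y) / W.totient * s2 - e2) ≤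
      ∑ m, ∑' n, (if n ≡ ν [MOD W] then Xs p c (sg p h n) ^ 2 * (lamP (Xy y) (n + h m) * om y ((n + h m : ℕ):ℝ)) else 0) := by
    have : (k:ℝ) * (Th y (Xy y) / W.totient * s2 - e2) = ∑ m : Fin k, (Th y (Xy y) / W.totient * s2 - e2) := by
      rw [Finset.sum_const, Finset.card_univ, Fintype.card_fin, nsmul_eq_mul]
    rw [this]
    refine Finset.sum_le_sum fun m _ => le_trans ?_ (hS2 m)
    have := mul_le_mul_of_nonneg_left (hs2 m) hTφ
    linarith
  have hmain : k * (Th y (Xy y) / W.totient * s2 - e2) ≤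
      2 * y * ((∑' n : ℕ, om y n) / W * s1 + M * (C * Real.exp (-(y / 4)))) + M * (KE y H * ∑' n : ℕ, (n:ℝ) ^ (-(3 / 2) : ℝ)) := by
    refine hsum.trans (hS3.trans ?_)
    have := mul_le_mul_of_nonneg_left hS1 (by linarith : 0 ≤ 2 * y)
    linarith
  have hΦ4' : 4 ≤ Φ := by rw [hΦ, hlz]; exact hΦ4
  have hfin := num_core hk1 hWpos hφpos (by linarith) (by rw [hlz]; field_simp : Real.log z * (120000 * k * ((J:ℝ) + 1)) = y)
    (by positivity) hΦ hΦ4' hJ hc0 hTh (tsum_nonneg fun n => om_nonneg (Nat.cast_nonneg _)) (sum_om_le hy1) hs1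
    (by linarith) ha2 le_rfl hmain
  refine hfin.trans ?_
  have hlRy : 1 + Real.log R ≤ y := by rw [hlR]; linarith
  have hlRy2 : 1 + 2 * Real.log R ≤ y := by rw [hlR]; linarith
  have hBy : B ≤ 4 ^ k * y ^ (12 * k) := by rw [hB]; gcongr
  have hR2 : R ^ 2 = Real.exp (y / 150) := by rw [hRd, ← Real.exp_nat_mul]; congr 1; push_cast; ring
  have hMy : M ≤ 4 ^ k * y ^ (20 * k) * Real.exp (y / 150) := by
    refine hM1.trans ?_
    rw [hR2]
    calc B * (Real.exp (y / 150) * (1 + 2 * Real.log R) ^ (8 * k)) ≤ (4 ^ k * y ^ (12 * k)) * (Real.exp (y / 150) * y ^ (8 * k)) := by gcongr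
      _ = _ := by rw [show 20 * k = 12 * k + 8 * k by ring, pow_add]; ring
  have he2y : e2 ≤ 4 ^ k / y := by
    refine hE.trans ?_
    have hyp : (0:ℝ) < y ^ (12 * k) := by positivity
    calc _ ≤ B * (1 / y ^ (12 * k + 1)) := mul_le_mul_of_nonneg_left hbv hB0
      _ ≤ (4 ^ k * y ^ (12 * k)) * (1 / y ^ (12 * k + 1)) := by gcongr
      _ = _ := by rw [pow_succ]; field_simp
  have hK := KE_nonneg hy1 H
  have hZ : 0 ≤ ∑' n : ℕ, (n:ℝ) ^ (-(3 / 2) : ℝ) := tsum_nonneg fun n => by positivity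
  set Z := ∑' n : ℕ, (n:ℝ) ^ (-(3 / 2) : ℝ) with hZd
  have h1 : M * (2 * y * (C * Real.exp (-(y / 4))) + KE y H * Z) ≤ (4 ^ k * y ^ (20 * k) * Real.exp (y / 150)) *
      (2 * y * (C * Real.exp (-(y / 4))) + KE y H * Z) := by
    refine mul_le_mul_of_nonneg_right hMy ?_
    positivity
  have h2 : k * e2 ≤ k * (4 ^ k / y) := by gcongr
  have h3 : 2 * y * (M * (C * Real.exp (-(y / 4)))) + M * (KE y H * Z) = M * (2 * y * (C * Real.exp (-(y / 4))) + KE y H * Z) := by ring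
  linarith

end PG

namespace PG
open Finset

lemma err_small (k H : ℕ) (C Z : ℝ) (hC : 0 ≤ C) (hZ : 0 ≤ Z) : ∀ᶠ y : ℝ in Filter.atTop,
    (4 ^ k * y ^ (20 * k) * Real.exp (y / 150)) * (2 * y * (C * Real.exp (-(y / 4))) + KE y H * Z) ≤ 1 := by
  have h1 := tendsto_rpow_mul_exp_neg_mul_atTop_nhds_zero ((20 * k + 1 : ℕ):ℝ) (1 / 5) (by norm_num)
  have h2 := h1.const_mul (4 ^ k * (2 * C + 8 * H * Z + Real.exp 8 * Z))
  rw [mul_zero] at h2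
  filter_upwards [h2.eventually (gt_mem_nhds zero_lt_one), Filter.eventually_ge_atTop 1] with y hy1 hy
  refine le_trans ?_ hy1.le
  rw [Real.rpow_natCast]
  have e1 : Real.exp (-y) ≤ Real.exp (-(y / 4)) := Real.exp_le_exp.2 (by linarith)
  have e2 : Real.exp (y / 150) * Real.exp (-(y / 4)) ≤ Real.exp (-(1 / 5) * y) := by
    rw [← Real.exp_add]; exact Real.exp_le_exp.2 (by linarith)
  have e3 : KE y H ≤ y * (8 * H + Real.exp 8) * Real.exp (-(y / 4)) := by
    unfold KE
    have : Real.exp 8 * Real.exp (-y) ≤ y * Real.exp 8 * Real.exp (-(y / 4)) := by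
      have : Real.exp 8 ≤ y * Real.exp 8 := le_mul_of_one_le_left (Real.exp_pos _).le hy
      gcongr
    linarith
  calc _ ≤ (4 ^ k * y ^ (20 * k) * Real.exp (y / 150)) * (2 * y * (C * Real.exp (-(y / 4))) + (y * (8 * H + Real.exp 8) * Real.exp (-(y / 4))) * Z) := by
        gcongr
    _ = (4 ^ k * (2 * C + 8 * H * Z + Real.exp 8 * Z)) * (y ^ (20 * k + 1) * (Real.exp (y / 150) * Real.exp (-(y / 4)))) := by
        rw [pow_succ]; ring
    _ ≤ _ := by gcongr

set_option maxHeartbeats 1000000 in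
theorem maynard_tao : ∃ k : ℕ, 1 ≤ k ∧ ∀ h : Fin k → ℕ, Function.Injective h → ∃ w0 : ℕ, ∀ W : ℕ, Squarefree W →
    (∀ q : ℕ, q.Prime → q ≤ w0 → q ∣ W) → ∀ ν : ℕ, (∀ i, (ν + h i).Coprime W) →
    {n : ℕ | n ≡ ν [MOD W] ∧ ∃ i i', i ≠ i' ∧ (n + h i).Prime ∧ (n + h i').Prime}.Infinite := by
  obtain ⟨c0, hc0, yc, hcheb⟩ := cheb_lower
  obtain ⟨C, hC, hTV⟩ := tv_om_mul
  set J := ⌈1920000 * 1921 / c0⌉₊ with hJd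
  have hJ : 1920000 * 1921 ≤ c0 * ((J:ℝ) + 1) := by
    have := Nat.le_ceil (1920000 * 1921 / c0)
    rw [div_le_iff₀ hc0, ← hJd] at this
    nlinarith
  refine ⟨2 ^ J, Nat.one_le_two_pow, ?_⟩
  generalize hk : 2 ^ J = k
  intro h hinj
  have hk1 : 1 ≤ k := by rw [← hk]; exact Nat.one_le_two_pow
  have hk0 : (0:ℝ) < k := by exact_mod_cast hk1
  set H := ∑ i, h i with hHd
  have hH : ∀ i, h i ≤ H := fun i => Finset.single_le_sum (fun _ _ => Nat.zero_le _) (Finset.mem_univ i)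
  refine ⟨5 + 4 * (k + 3) ^ 2 + H, fun W hWs hWp ν hν => ?_⟩
  by_contra hfin
  rw [Set.not_infinite] at hfin
  obtain ⟨n0, hn0⟩ := hfin.bddAbove
  have hW0 : W ≠ 0 := hWs.ne_zero
  have hWpos : (0:ℝ) < W := by exact_mod_cast Nat.pos_of_ne_zero hW0
  have hφpos : (0:ℝ) < W.totient := by exact_mod_cast Nat.totient_pos.2 (Nat.pos_of_ne_zero hW0)
  set Z := ∑' n : ℕ, (n:ℝ) ^ (-(3 / 2) : ℝ) with hZd
  have hZ : 0 ≤ Z := tsum_nonneg fun n => by positivity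
  have texp : ∀ b : ℝ, 0 < b → ∀ A : ℝ, ∀ᶠ y : ℝ in Filter.atTop, A ≤ Real.exp (y / b) := by
    intro b hb A
    exact (Real.tendsto_exp_atTop.comp (Filter.tendsto_id.atTop_div_const hb)).eventually_ge_atTop A
  set b : ℝ := 120000 * k * ((J:ℝ) + 1) with hb
  have hb0 : 0 < b := by positivity
  have ev : ∀ᶠ y : ℝ in Filter.atTop, 4 ≤ y ∧ yc ≤ y ∧ (W:ℝ) + 1 ≤ Real.exp (y / 300) ∧ (n0:ℝ) + H + 1 ≤ Real.exp (y / 100) ∧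
      3 ≤ Real.exp (y / b) ∧ (W:ℝ) ≤ Real.exp (y / b) ∧ 4 ≤ (W.totient : ℝ) / W * (y / b) ∧ (W:ℝ) * (k * 4 ^ k + 1) / 4 < y ∧
      (4 ^ k * y ^ (20 * k) * Real.exp (y / 150)) * (2 * y * (C * Real.exp (-(y / 4))) + KE y H * Z) ≤ 1 := by
    filter_upwards [Filter.eventually_ge_atTop 4, Filter.eventually_ge_atTop yc, texp 300 (by norm_num) (W + 1),
      texp 100 (by norm_num) (n0 + H + 1), texp b hb0 3, texp b hb0 W,
      Filter.eventually_ge_atTop (4 * b * (W / W.totient)), Filter.eventually_gt_atTop ((W:ℝ) * (k * 4 ^ k + 1) / 4),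
      err_small k H C Z hC.le hZ] with y h1 h2 h3 h4 h5 h6 h7 h8 h9
    refine ⟨h1, h2, h3, h4, h5, h6, ?_, h8, h9⟩
    calc (4:ℝ) = (W.totient : ℝ) / W * ((4 * b * (W / W.totient)) / b) := by field_simp
      _ ≤ _ := by gcongr
  obtain ⟨y0, hy0⟩ := Filter.eventually_atTop.1 ev
  obtain ⟨y, hyy0, hy1, hbv⟩ := bv (8 * k) (12 * k + 1) (by omega) y0
  obtain ⟨h1, h2, h3, h4, h5, h6, h7, h8, h9⟩ := hy0 y hyy0
  have hXle : (Xy y : ℝ) ≤ Real.exp (y / 100) := Nat.floor_le (Real.exp_pos _).le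
  have hXge : Real.exp (y / 100) - 1 ≤ (Xy y : ℝ) := (Nat.sub_one_lt_floor _).le
  have hHn : n0 + H ≤ Xy y := by
    have : ((n0 + H : ℕ):ℝ) ≤ (Xy y : ℝ) := by push_cast; linarith
    exact_mod_cast this
  have hWX : W * Real.exp (y / 300) ^ 2 ≤ Xy y := by
    refine le_trans ?_ hXge
    have e : Real.exp (y / 100) = Real.exp (y / 300) * Real.exp (y / 300) ^ 2 := by
      rw [← Real.exp_nat_mul, ← Real.exp_add]; congr 1; push_cast; ring
    rw [e]
    have h10 : 1 ≤ Real.exp (y / 300) := Real.one_le_exp (by linarith)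
    nlinarith [one_le_pow₀ (n := 2) h10]
  have hf : ∀ n, n ≡ ν [MOD W] → ∀ i i', lamP (Xy y) (n + h i) ≠ 0 → lamP (Xy y) (n + h i') ≠ 0 → i = i' := by
    intro n hn i i' hi hi'
    by_contra hne
    have key : ∀ i, lamP (Xy y) (n + h i) ≠ 0 → (n + h i).Prime ∧ Xy y < n + h i := by
      intro i hi
      unfold lamP at hi
      split_ifs at hi with hh
      · exact ⟨hh.1, by exact_mod_cast hh.2⟩
      · exact absurd rfl hi
    have h11 := hn0 (show n ∈ {n : ℕ | n ≡ ν [MOD W] ∧ ∃ i i', i ≠ i' ∧ (n + h i).Prime ∧ (n + h i').Prime} from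
      ⟨hn, i, i', hne, (key i hi).1, (key i' hi').1⟩)
    have h12 := (key i hi).2
    have h13 := hH i
    omega
  have hfinal := fixed_y hk.symm hWs hH hinj hWp hν hc0 hJ (by linarith) hC.le (by simpa using hTV y hy1 1 le_rfl)
    (hcheb y h2 hy1 (Xy y) (hXle.trans (Real.exp_le_exp.2 (by linarith)))) hWX (by omega) hf h5 h6 h7 hbv
  rw [← hZd] at hfinal
  have h14 : (k:ℝ) * (4 ^ k / y) ≤ k * 4 ^ k := by
    gcongr
    exact div_le_self (by positivity) hy1
  have h15 : (k * 4 ^ k + 1 : ℝ) < 4 * y / W := by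
    rw [lt_div_iff₀ hWpos]
    linarith
  linarith

end PG

namespace PG
open Finset

def rep2 : ℕ → ℕ
  | 0 => 0
  | n + 1 => 10 * rep2 n + 2

lemma rep2_add (a b : ℕ) : rep2 (a + b) = 10 ^ a * rep2 b + rep2 a := by
  induction a with
  | zero => simp [rep2]
  | succ a ih =>
    rw [show a + 1 + b = (a + b) + 1 by ring, rep2, ih, rep2]; ring

lemma rep2_pos {n : ℕ} (hn : 1 ≤ n) : 1 ≤ rep2 n := by
  obtain ⟨m, rfl⟩ : ∃ m, n = m + 1 := ⟨n - 1, by omega⟩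
  rw [rep2]; omega

lemma rep2_strictMono : StrictMono rep2 := strictMono_nat_of_lt_succ fun n => by rw [rep2]; omega

lemma dig_mul {m : ℕ} (hm : ∀ d ∈ Nat.digits 10 m, d = 0 ∨ d = 2) {x : ℕ} (hx : x = 0 ∨ x = 2) :
    ∀ d ∈ Nat.digits 10 (x + 10 * m), d = 0 ∨ d = 2 := by
  by_cases h : x ≠ 0 ∨ m ≠ 0
  · rw [Nat.digits_add 10 (by norm_num) x m (by omega) h]
    intro d hd
    rcases List.mem_cons.1 hd with rfl | h1
    · exact hx
    · exact hm d h1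
  · push Not at h
    rw [h.1, h.2]; simp

lemma dig_rep2 (n : ℕ) : ∀ d ∈ Nat.digits 10 (rep2 n), d = 0 ∨ d = 2 := by
  induction n with
  | zero => simp [rep2]
  | succ n ih => rw [rep2, add_comm]; exact dig_mul ih (Or.inr rfl)

lemma dig_pow_rep2 (a b : ℕ) : ∀ d ∈ Nat.digits 10 (10 ^ a * rep2 b), d = 0 ∨ d = 2 := by
  induction a with
  | zero => rw [pow_zero, one_mul]; exact dig_rep2 b
  | succ a ih =>
    have e : 10 ^ (a + 1) * rep2 b = 0 + 10 * (10 ^ a * rep2 b) := by rw [pow_succ]; ring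
    rw [e]; exact dig_mul ih (Or.inl rfl)

lemma exists_exps (k B M : ℕ) (hM : M ≠ 0) : ∃ e : Fin k → ℕ, StrictMono e ∧ (∀ i, B ≤ e i) ∧
    ∀ i i', rep2 (e i) ≡ rep2 (e i') [MOD M] := by
  classical
  have : NeZero M := ⟨hM⟩
  obtain ⟨x, hx⟩ := Finite.exists_infinite_fiber (fun n : ℕ => (rep2 n : ZMod M))
  set s := (fun n : ℕ => (rep2 n : ZMod M)) ⁻¹' {x} with hs
  set f := Nat.orderEmbeddingOfSet s with hf
  have hmem : ∀ n, ((rep2 (f n) : ℕ) : ZMod M) = x := by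
    intro n
    have : f n ∈ s := by
      rw [← Nat.orderEmbeddingOfSet_range s]; exact ⟨n, rfl⟩
    exact this
  refine ⟨fun i => f (B + i), fun i i' hi => ?_, fun i => ?_, fun i i' => ?_⟩
  · exact f.strictMono (Nat.add_lt_add_left hi B)
  · exact (Nat.le_add_right B i).trans f.strictMono.le_apply
  · rw [← ZMod.natCast_eq_natCast_iff, hmem, hmem]

lemma admissible {k : ℕ} {h : Fin k → ℕ} (hh : ∀ i i', h i ≡ h i' [MOD k.factorial]) {q : ℕ} (hq : q.Prime) :
    ∃ r, ∀ i, ¬ q ∣ r + h i := by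
  have : NeZero q := ⟨hq.ne_zero⟩
  have : Fact q.Prime := ⟨hq⟩
  suffices H : ∃ x : ZMod q, ∀ i, x + (h i : ZMod q) ≠ 0 by
    obtain ⟨x, hx⟩ := H
    refine ⟨x.val, fun i hd => hx i ?_⟩
    rw [← ZMod.natCast_eq_zero_iff] at hd
    push_cast at hd
    rwa [ZMod.natCast_zmod_val] at hd
  by_cases hqk : q ≤ k
  · have i0 : Fin k := ⟨0, by have := hq.pos; omega⟩
    refine ⟨1 - (h i0 : ZMod q), fun i => ?_⟩
    have h1 : h i ≡ h i0 [MOD q] := (hh i i0).of_dvd ((Nat.Prime.dvd_factorial hq).2 hqk)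
    rw [← ZMod.natCast_eq_natCast_iff] at h1
    rw [h1]; simp
  · have hns : ¬ Function.Surjective fun i : Fin k => -(h i : ZMod q) := by
      intro hs
      have := Fintype.card_le_of_surjective _ hs
      rw [ZMod.card, Fintype.card_fin] at this
      omega
    rw [Function.Surjective] at hns
    push Not at hns
    obtain ⟨x, hx⟩ := hns
    exact ⟨x, fun i h0 => hx i (eq_neg_of_add_eq_zero_left h0).symm⟩

/-- choice of the modulus and residue -/
lemma exists_W {k : ℕ} {h : Fin k → ℕ} (hh : ∀ i i', h i ≡ h i' [MOD k.factorial]) {H : ℕ} (hH : ∀ i, h i ≤ H) (w0 : ℕ) :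
    ∃ W ν n1 : ℕ, Squarefree W ∧ (∀ q : ℕ, q.Prime → q ≤ w0 → q ∣ W) ∧ (∀ i, (ν + h i).Coprime W) ∧
      ∀ n, n1 < n → n ≡ ν [MOD W] → ∀ j ≤ H, (n + j).Prime → ∃ i, h i = j := by
  classical
  set T := w0 + H + 1 with hT
  set qf : ℕ → ℕ := fun j => Nat.nth Nat.Prime (T + j) with hqf
  have hqfp : ∀ j, (qf j).Prime := fun j => Nat.prime_nth_prime _
  have hqfT : ∀ j, T < qf j := fun j => by
    have := Nat.add_two_le_nth_prime (T + j)
    show T < Nat.nth Nat.Prime (T + j)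
    omega
  have hqfi : Function.Injective qf := fun j j' hj => by
    have := Nat.nth_injective Nat.infinite_setOfPred_prime hj
    omega
  set D := (Finset.range (H + 1)).filter fun j => ∀ i, h i ≠ j with hD
  set S := ((Finset.range (T + 1)).filter Nat.Prime) ∪ D.image qf with hS
  have hSp : ∀ q ∈ S, q.Prime := by
    intro q hq
    rw [hS, mem_union] at hq
    rcases hq with hq | hq
    · exact (mem_filter.1 hq).2
    · obtain ⟨j, _, rfl⟩ := mem_image.1 hq
      exact hqfp j
  have hr : ∀ q, ∃ r, q ∈ S → (∀ i, ¬ q ∣ r + h i) ∧ ∀ j ∈ D, q = qf j → q ∣ r + j := by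
    intro q
    by_cases hq : q ∈ S
    · have hqp := hSp q hq
      by_cases hex : ∃ j ∈ D, q = qf j
      · obtain ⟨j, hj, rfl⟩ := hex
        have h1 := hqfT j
        have hjD := mem_filter.1 hj
        have hjH : j ≤ H := Nat.lt_succ_iff.1 (mem_range.1 hjD.1)
        have e : (qf j - 1) * j + j = qf j * j := by
          obtain ⟨m, hm⟩ : ∃ m, qf j = m + 1 := ⟨qf j - 1, by omega⟩
          rw [hm]; simp; ring
        refine ⟨(qf j - 1) * j, fun _ => ⟨fun i hd => ?_, fun j' _ hj' => ?_⟩⟩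
        · have h2 : h i ≡ j [MOD qf j] := by
            refine Nat.ModEq.add_left_cancel' ((qf j - 1) * j) ?_
            rw [e]
            exact ((Nat.modEq_zero_iff_dvd).2 hd).trans ((Nat.modEq_zero_iff_dvd).2 ⟨_, rfl⟩).symm
          have h3 := hH i
          exact hjD.2 i (Nat.ModEq.eq_of_lt_of_lt h2 (by omega) (by omega))
        · rw [← hqfi hj', e]; exact ⟨_, rfl⟩
      · obtain ⟨r, hr⟩ := admissible hh hqp
        exact ⟨r, fun _ => ⟨hr, fun j hj hqj => absurd ⟨j, hj, hqj⟩ hex⟩⟩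
    · exact ⟨0, fun h1 => absurd h1 hq⟩
  choose r hr using hr
  have hpair : (S : Set ℕ).Pairwise (Function.onFun Nat.Coprime fun q : ℕ => q) := by
    intro q hq q' hq' hne
    exact (Nat.coprime_primes (hSp q hq) (hSp q' hq')).2 hne
  obtain ⟨ν, hν⟩ := Nat.chineseRemainderOfFinset r (fun q => q) S (fun q hq => (hSp q hq).ne_zero) hpair
  refine ⟨∏ q ∈ S, q, ν, ∑ q ∈ S, q, ?_, ?_, ?_, ?_⟩
  · refine Finset.squarefree_prod_of_pairwise_isCoprime (fun q hq q' hq' hne => ?_) fun q hq => (hSp q hq).prime.squarefree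
    exact Nat.coprime_iff_isRelPrime.1 (hpair hq hq' hne)
  · intro q hq hqw
    refine Finset.dvd_prod_of_mem (fun q => q) ?_
    rw [hS, mem_union]
    left
    rw [mem_filter, mem_range]
    exact ⟨by omega, hq⟩
  · intro i
    refine Nat.Coprime.prod_right fun q hq => ?_
    refine ((Nat.Prime.coprime_iff_not_dvd (hSp q hq)).2 fun hd => ?_).symm
    have h1 := ((hν q hq).add_right (h i)).dvd_iff dvd_rfl
    exact (hr q hq).1 i (h1.1 hd)
  · intro n hn hnν j hj hp
    by_contra hne
    push Not at hne
    have hjD : j ∈ D := by rw [hD, mem_filter, mem_range]; exact ⟨by omega, hne⟩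
    have hqS : qf j ∈ S := by rw [hS, mem_union]; right; exact mem_image_of_mem _ hjD
    have h1 : n ≡ r (qf j) [MOD qf j] := (hnν.of_dvd (Finset.dvd_prod_of_mem (fun q => q) hqS)).trans (hν _ hqS)
    have h2 : qf j ∣ n + j := ((h1.add_right j).dvd_iff dvd_rfl).2 ((hr _ hqS).2 j hjD rfl)
    have h3 : qf j = n + j := (Nat.prime_dvd_prime_iff_eq (hqfp j) hp).1 h2
    have h4 : qf j ≤ ∑ q ∈ S, q := Finset.single_le_sum (f := fun q : ℕ => q) (fun _ _ => Nat.zero_le _) hqS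
    omega

lemma consecutive {k : ℕ} {h : Fin k → ℕ} {H n : ℕ} (hH : ∀ i, h i ≤ H)
    (hn : ∀ j ≤ H, (n + j).Prime → ∃ i, h i = j) {i i' : Fin k} (hi : h i < h i') (h1 : (n + h i).Prime) (h2 : (n + h i').Prime) :
    ∃ s i'', n ≤ Nat.nth Nat.Prime s ∧ h i < h i'' ∧ Nat.nth Nat.Prime (s + 1) - Nat.nth Nat.Prime s = h i'' - h i := by
  obtain ⟨s, _, hs⟩ := Nat.exists_lt_card_nth_eq h1
  obtain ⟨s', _, hs'⟩ := Nat.exists_lt_card_nth_eq h2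
  have hlt : s < s' := by
    rw [← Nat.nth_lt_nth Nat.infinite_setOfPred_prime, hs, hs']; omega
  have h3 : Nat.nth Nat.Prime s < Nat.nth Nat.Prime (s + 1) := (Nat.nth_lt_nth Nat.infinite_setOfPred_prime).2 (Nat.lt_succ_self s)
  have h4 : Nat.nth Nat.Prime (s + 1) ≤ Nat.nth Nat.Prime s' := (Nat.nth_strictMono Nat.infinite_setOfPred_prime).monotone hlt
  have h5 := hH i'
  obtain ⟨j, hj⟩ : ∃ j, Nat.nth Nat.Prime (s + 1) = n + j := ⟨Nat.nth Nat.Prime (s + 1) - n, by omega⟩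
  obtain ⟨i'', hi''⟩ := hn j (by omega) (by rw [← hj]; exact Nat.prime_nth_prime _)
  exact ⟨s, i'', by omega, by omega, by omega⟩

theorem main_gaps (B : ℕ) : ∃ m, B < m ∧ (∀ d ∈ Nat.digits 10 m, d = 0 ∨ d = 2) ∧
    {n : ℕ | Nat.nth Nat.Prime (n + 1) - Nat.nth Nat.Prime n = m}.Infinite := by
  classical
  obtain ⟨k, hk, hMT⟩ := maynard_tao
  obtain ⟨e, he, heB, hmod⟩ := exists_exps k B k.factorial (Nat.factorial_ne_zero k)
  set h : Fin k → ℕ := fun i => rep2 (e i) with hh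
  have hmono : StrictMono h := rep2_strictMono.comp he
  obtain ⟨w0, hw0⟩ := hMT h hmono.injective
  have hH : ∀ i, h i ≤ ∑ i, h i := fun i => Finset.single_le_sum (fun _ _ => Nat.zero_le _) (Finset.mem_univ i)
  obtain ⟨W, ν, n1, hWs, hWp, hν, hpr⟩ := exists_W hmod hH w0
  have hinf := hw0 W hWs hWp ν hν
  have hbig : {s : ℕ | ∃ x : Fin k × Fin k, h x.1 < h x.2 ∧ Nat.nth Nat.Prime (s + 1) - Nat.nth Nat.Prime s = h x.2 - h x.1}.Infinite := by
    refine Set.infinite_of_forall_exists_gt fun s0 => ?_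
    obtain ⟨n, ⟨hnν, i, i', hne, hp, hp'⟩, hn⟩ := hinf.exists_gt (n1 + Nat.nth Nat.Prime s0)
    have key : ∀ i i' : Fin k, h i < h i' → (n + h i).Prime → (n + h i').Prime → ∃ s ∈ {s : ℕ | ∃ x : Fin k × Fin k, h x.1 < h x.2 ∧
        Nat.nth Nat.Prime (s + 1) - Nat.nth Nat.Prime s = h x.2 - h x.1}, s0 < s := by
      intro i i' hlt hp hp'
      obtain ⟨s, i'', hs1, hs2, hs3⟩ := consecutive hH (hpr n (by omega) hnν) hlt hp hp'
      refine ⟨s, ⟨(i, i''), hs2, hs3⟩, ?_⟩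
      refine (Nat.nth_lt_nth Nat.infinite_setOfPred_prime).1 (lt_of_lt_of_le ?_ hs1)
      show Nat.nth Nat.Prime s0 < n
      omega
    rcases lt_or_gt_of_ne (fun H => hne (hmono.injective H)) with hlt | hlt
    · exact key i i' hlt hp hp'
    · exact key i' i hlt hp' hp
  have hex : ∃ x : Fin k × Fin k, {s : ℕ | h x.1 < h x.2 ∧ Nat.nth Nat.Prime (s + 1) - Nat.nth Nat.Prime s = h x.2 - h x.1}.Infinite := by
    by_contra hcon
    push Not at hcon
    apply hbig
    have h1 := Set.finite_iUnion fun x => hcon x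
    refine h1.subset ?_
    rintro s ⟨x, hx⟩
    exact Set.mem_iUnion.2 ⟨x, hx⟩
  obtain ⟨⟨i, i'⟩, hx⟩ := hex
  obtain ⟨s, hs, _⟩ := hx.nonempty
  have hlt : e i < e i' := he.lt_iff_lt.2 (hmono.lt_iff_lt.1 hs)
  obtain ⟨b, hb⟩ : ∃ b, e i' = e i + b := ⟨e i' - e i, by omega⟩
  have hm : h i' - h i = 10 ^ e i * rep2 b := by
    show rep2 (e i') - rep2 (e i) = _
    rw [hb, rep2_add]; omega
  refine ⟨h i' - h i, ?_, ?_, hx.mono fun s hs => hs.2⟩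
  · rw [hm]
    have h1 : e i < 10 ^ e i := Nat.lt_pow_self (by norm_num)
    have h2 : 1 ≤ rep2 b := rep2_pos (by omega)
    have h3 := heB i
    calc B < 10 ^ e i * 1 := by omega
      _ ≤ _ := Nat.mul_le_mul_left _ h2
  · rw [hm]; exact dig_pow_rep2 _ _

end PG

/-- There are infinitely many de Polignac numbers whose decimal expansion
contains only the digits `0` and `2`. -/
theorem de_polignac_numbers_with_digits_zero_two :
    {m : ℕ | (∀ d ∈ Nat.digits 10 m, d = 0 ∨ d = 2) ∧ DePolignac m}.Infinite := by
  refine Set.infinite_of_forall_exists_gt fun B => ?_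
  obtain ⟨m, h1, h2, h3⟩ := PG.main_gaps B
  exact ⟨m, ⟨h2, h3⟩, h1⟩
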